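/- Fix σ > 0, (i_0, j_0) ∈ (0,1)² with j_0 < i_0, a constant C > 0, and a sequence m = m(n) of positive integers with m(n) → ∞ and m(n)/n → 0. For each n, let X_n be a random Hermitian matrix such that X_n/√(σ² n) is an n×n GUE matrix, let λ_{i,j} denote the j-th largest eigenvalue of the top-left i×i principal minor of X_n, let P_n = {(i,j) : |i − ⌈i_0 n⌉| ≤ m, |j − ⌈j_0 n⌉| ≤ m}, and let G = (λ_{i,j} − λ_{i−1,j})_{(i,j) ∈ P_n} be the vector of interlacing gaps. Then there exist C'' > 0 and n_0 such that for all n > n_0 and every finite nonempty family 𝒜 of vectors a ∈ ℝ^{P_n} with ‖a‖_∞ ≤ 1, Var( max_{a ∈ 𝒜} ∑_{(i,j) ∈ P_n} a_{i,j} (λ_{i,j} − λ_{i−1,j}) ) ≤ C'' m⁴ / (log m)^C; the constants C'' and n_0 do not depend on the family 𝒜. (In particular this applies to the family of total lozenge weights ⟨∂g_m, ∂a_m⟩ over all height functions a_m within L^∞ distance mε of a fixed affine asymptotic height function, each such pairing being a linear combination of the interlacing gaps with bounded coefficients determined by the associated lozenge tiling.) -/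

import Mathlib

open MeasureTheory ProbabilityTheory

noncomputable section

instance matrixMeasurableSpace {n : ℕ} : MeasurableSpace (Matrix (Fin n) (Fin n) ℂ) :=
  (inferInstance : MeasurableSpace (Fin n → Fin n → ℂ))

/-- The distribution of an `n×n` GUE matrix. -/
def gueMeasure (n : ℕ) : Measure (Matrix (Fin n) (Fin n) ℂ) :=
  Measure.map
    (fun ω : (Fin n → ℝ) × (Fin n × Fin n → ℝ × ℝ) =>
      Matrix.of fun i j =>
        if i = j then (ω.1 i : ℂ)
        else if i < j then ((ω.2 (i, j)).1 : ℂ) + ((ω.2 (i, j)).2 : ℂ) * Complex.I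
        else ((ω.2 (j, i)).1 : ℂ) - ((ω.2 (j, i)).2 : ℂ) * Complex.I)
    ((Measure.pi fun _ : Fin n => gaussianReal 0 1).prod
      (Measure.pi fun _ : Fin n × Fin n =>
        (gaussianReal 0 (1 / 2)).prod (gaussianReal 0 (1 / 2))))

/-- The eigenvalues of a (Hermitian) matrix, in nonincreasing order. -/
def eigsDesc {n : ℕ} (M : Matrix (Fin n) (Fin n) ℂ) : Fin n → ℝ :=
  if h : M.IsHermitian then fun i => h.eigenvalues (Tuple.sort h.eigenvalues i.rev) else 0

/-- `λ_{i,j}(X_n)` for `X_n = √(σ² n) · M`: the `j`-th largest eigenvalue of the top-left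
`i × i` principal minor of `X_n` (for `1 ≤ j ≤ i ≤ n`; junk value `0` otherwise). -/
def minorEig {n : ℕ} (σ : ℝ) (M : Matrix (Fin n) (Fin n) ℂ) (i j : ℕ) : ℝ :=
  if h : 1 ≤ j ∧ j ≤ i ∧ i ≤ n then
    Real.sqrt (σ ^ 2 * n) *
      eigsDesc (Matrix.of fun a b : Fin i =>
        M ⟨a.val, by omega⟩ ⟨b.val, by omega⟩) ⟨j - 1, by omega⟩
  else 0

/-- The patch of indices `P_n`, encoded by `Fin (2m+1) × Fin (2m+1)`:
`(a, b) ↦ (⌈i₀n⌉ − m + a, ⌈j₀n⌉ − m + b)`. -/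
def patchIdx (i0 j0 : ℝ) (n m : ℕ) (p : Fin (2 * m + 1) × Fin (2 * m + 1)) : ℕ × ℕ :=
  ((⌈i0 * n⌉ - m + p.1.val).toNat, (⌈j0 * n⌉ - m + p.2.val).toNat)

/-- The interlacing gap `λ_{i,j} − λ_{i−1,j}` at the patch position `p`. -/
def patchGap {n : ℕ} (σ i0 j0 : ℝ) (m : ℕ) (p : Fin (2 * m + 1) × Fin (2 * m + 1))
    (M : Matrix (Fin n) (Fin n) ℂ) : ℝ :=
  minorEig σ M (patchIdx i0 j0 n m p).1 (patchIdx i0 j0 n m p).2 -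
    minorEig σ M ((patchIdx i0 j0 n m p).1 - 1) (patchIdx i0 j0 n m p).2

/-- The covariance matrix of the vector of interlacing gaps over the patch. -/
def covMatrix (σ i0 j0 : ℝ) (n m : ℕ) :
    Matrix (Fin (2 * m + 1) × Fin (2 * m + 1)) (Fin (2 * m + 1) × Fin (2 * m + 1)) ℝ :=
  Matrix.of fun p q =>
    (∫ M, patchGap σ i0 j0 m p M * patchGap σ i0 j0 m q M ∂gueMeasure n) -
      (∫ M, patchGap σ i0 j0 m p M ∂gueMeasure n) *
        (∫ M, patchGap σ i0 j0 m q M ∂gueMeasure n)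

open scoped ENNReal NNReal

/-- The midpoint form of the Prékopa–Leindler inequality on a measure space with a linear
structure. -/
def PrekopaLeindler (α : Type*) [MeasureSpace α] [AddCommGroup α] [Module ℝ α] : Prop :=
  ∀ f g h : α → ℝ≥0∞, Measurable f → Measurable g → Measurable h →
    (∀ x y, f x * g y ≤ h ((1 / 2 : ℝ) • (x + y)) ^ 2) →
    (∫⁻ x, f x) * (∫⁻ x, g x) ≤ (∫⁻ x, h x) ^ 2

theorem volume_add_volume_le_of_isCompact {A B D : Set ℝ} (hA : IsCompact A) (hB : IsCompact B)
    (hA0 : A.Nonempty) (hB0 : B.Nonempty) (hD : ∀ a ∈ A, ∀ b ∈ B, (1 / 2 : ℝ) * (a + b) ∈ D) :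
    volume A + volume B ≤ 2 * volume D := by
  obtain ⟨a, haA, ha⟩ := hA.exists_isGreatest hA0
  obtain ⟨b, hbB, hb⟩ := hB.exists_isLeast hB0
  set A' : Set ℝ := (fun x => x + b) '' A
  set B' : Set ℝ := (fun x => a + x) '' B
  have hA'v : volume A' = volume A := by
    have := measure_preimage_add_right volume (-b) A
    rw [← this]; congr 1; ext x; simp [A']
  have hB'v : volume B' = volume B := by
    have := measure_preimage_add volume (-a) B
    rw [← this]; congr 1; ext x; simp [B']
  have hcA' : IsCompact A' := hA.image (by fun_prop)
  have hcB' : IsCompact B' := hB.image (by fun_prop)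
  have hint : A' ∩ B' ⊆ {a + b} := by
    rintro _ ⟨⟨x, hx, rfl⟩, ⟨y, hy, hxy⟩⟩
    have := ha hx; have := hb hy
    simp only [Set.mem_singleton_iff] at *
    linarith
  have h0 : volume (A' ∩ B') = 0 := measure_mono_null hint (by simp)
  have hU : volume A + volume B = volume (A' ∪ B') := by
    have := measure_union_add_inter (μ := volume) A' hcB'.measurableSet
    rw [h0, add_zero, hA'v, hB'v] at this
    exact this.symm
  have hsub : A' ∪ B' ⊆ (fun x => (1 / 2 : ℝ) * x) ⁻¹' D := by
    rintro _ (⟨x, hx, rfl⟩ | ⟨x, hx, rfl⟩)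
    · exact hD x hx b hbB
    · exact hD a haA x hx
  rw [hU]
  refine (measure_mono hsub).trans ?_
  rw [Real.volume_preimage_mul_left (by norm_num)]
  norm_num

theorem volume_add_volume_le {A B D : Set ℝ} (hA : MeasurableSet A) (hB : MeasurableSet B)
    (hA0 : A.Nonempty) (hB0 : B.Nonempty) (hD : ∀ a ∈ A, ∀ b ∈ B, (1 / 2 : ℝ) * (a + b) ∈ D) :
    volume A + volume B ≤ 2 * volume D := by
  rw [hA.measure_eq_iSup_isCompact, hB.measure_eq_iSup_isCompact]
  obtain ⟨a, ha⟩ := hA0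
  obtain ⟨b, hb⟩ := hB0
  have key : ∀ K₁ ⊆ A, IsCompact K₁ → ∀ K₂ ⊆ B, IsCompact K₂ →
      volume K₁ + volume K₂ ≤ 2 * volume D := by
    intro K₁ h₁ c₁ K₂ h₂ c₂
    refine le_trans (add_le_add (measure_mono (Set.subset_insert a K₁))
      (measure_mono (Set.subset_insert b K₂))) ?_
    refine volume_add_volume_le_of_isCompact (c₁.insert a) (c₂.insert b) (by simp) (by simp) ?_
    exact fun x hx y hy => hD x (Set.insert_subset ha h₁ hx) y (Set.insert_subset hb h₂ hy)
  simp only [iSup_and']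
  exact ENNReal.biSup_add_biSup_le' (p := fun K => K ⊆ A ∧ IsCompact K)
    (q := fun K => K ⊆ B ∧ IsCompact K) ⟨∅, by simp⟩ ⟨∅, by simp⟩
    fun K₁ h₁ K₂ h₂ => key K₁ h₁.1 h₁.2 K₂ h₂.1 h₂.2

theorem ENNReal.mul_le_sq_of_add_le {a b c : ℝ≥0∞} (h : a + b ≤ 2 * c) : a * b ≤ c ^ 2 := by
  by_cases hc : c = ∞
  · simp [hc]
  have hab : a + b ≠ ∞ := ne_top_of_le_ne_top (ENNReal.mul_ne_top (by simp) hc) h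
  rw [ENNReal.add_ne_top] at hab
  lift a to ℝ≥0 using hab.1
  lift b to ℝ≥0 using hab.2
  lift c to ℝ≥0 using hc
  norm_cast at h ⊢
  have h' : (a : ℝ) + b ≤ 2 * c := by exact_mod_cast h
  have : (a : ℝ) * b ≤ c ^ 2 := by nlinarith [sq_nonneg ((a : ℝ) - b), a.2, b.2, c.2]
  exact_mod_cast this

theorem lintegral_eq_lintegral_Ioo_of_le_one {f : ℝ → ℝ≥0∞} (hf : Measurable f)
    (h1 : ∀ x, f x ≤ 1) :
    ∫⁻ x, f x = ∫⁻ t in Set.Ioo (0 : ℝ) 1, volume {x | ENNReal.ofReal t < f x} := by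
  have hfin : ∀ x, f x ≠ ∞ := fun x => ne_top_of_le_ne_top (by simp) (h1 x)
  have h := lintegral_eq_lintegral_meas_lt (volume : Measure ℝ) (f := fun x => (f x).toReal)
    (Filter.Eventually.of_forall fun x => ENNReal.toReal_nonneg) hf.ennreal_toReal.aemeasurable
  simp only [ENNReal.ofReal_toReal (hfin _)] at h
  rw [h, ← Set.Ioo_union_Ici_eq_Ioi (zero_lt_one' ℝ), lintegral_union measurableSet_Ici
    (Set.disjoint_left.2 fun x hx hx' => by simp at hx hx'; linarith [hx.2])]
  have hz : ∫⁻ t in Set.Ici (1 : ℝ), volume {x | t < (f x).toReal} = 0 := by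
    rw [setLIntegral_congr_fun (g := fun _ => 0) measurableSet_Ici]
    · simp
    · intro t ht
      have : {x | t < (f x).toReal} = ∅ := by
        ext x
        simp only [Set.mem_ofPred_eq, Set.mem_empty_iff_false, iff_false, not_lt]
        refine le_trans ?_ ht
        simpa using ENNReal.toReal_mono (by simp) (h1 x)
      simp [this]
  rw [hz, add_zero]
  refine setLIntegral_congr_fun measurableSet_Ioo fun t ht => ?_
  simp only [ENNReal.ofReal_lt_iff_lt_toReal ht.1.le (hfin _)]

theorem lintegral_mul_le_sq_of_iSup_eq_one {f g h : ℝ → ℝ≥0∞} (hf : Measurable f)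
    (hg : Measurable g) (hh : Measurable h) (hf1 : ⨆ x, f x = 1) (hg1 : ⨆ x, g x = 1)
    (H : ∀ x y, f x * g y ≤ h ((1 / 2 : ℝ) * (x + y)) ^ 2) :
    (∫⁻ x, f x) * (∫⁻ x, g x) ≤ (∫⁻ x, h x) ^ 2 := by
  apply ENNReal.mul_le_sq_of_add_le
  have hh' : ∫⁻ x, min (h x) 1 ≤ ∫⁻ x, h x := lintegral_mono fun x => min_le_left _ _
  refine le_trans ?_ (mul_le_mul_right hh' 2)
  have hfm : ∀ x, f x ≤ 1 := fun x => hf1 ▸ le_iSup f x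
  have hgm : ∀ x, g x ≤ 1 := fun x => hg1 ▸ le_iSup g x
  rw [lintegral_eq_lintegral_Ioo_of_le_one hf hfm, lintegral_eq_lintegral_Ioo_of_le_one hg hgm,
    lintegral_eq_lintegral_Ioo_of_le_one (hh.min measurable_const) (fun x => min_le_right _ _),
    ← lintegral_const_mul' _ _ (by simp)]
  have hanti : ∀ k : ℝ → ℝ≥0∞, Antitone fun t : ℝ => volume {x | ENNReal.ofReal t < k x} :=
    fun k s t hst => measure_mono fun x hx => lt_of_le_of_lt (ENNReal.ofReal_le_ofReal hst) hx
  rw [← lintegral_add_left (hanti f).measurable]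
  refine setLIntegral_mono' measurableSet_Ioo fun t ht => ?_
  have ht1 : ENNReal.ofReal t < 1 := by simpa using ht.2
  refine volume_add_volume_le (measurableSet_lt measurable_const hf)
    (measurableSet_lt measurable_const hg) ?_ ?_ ?_
  · rw [← hf1] at ht1; exact lt_iSup_iff.1 ht1
  · rw [← hg1] at ht1; exact lt_iSup_iff.1 ht1
  · intro a ha b hb
    simp only [Set.mem_ofPred_eq, lt_min_iff] at *
    refine ⟨?_, ht1⟩
    by_contra hcon
    push Not at hcon
    have h1 := H a b
    have h2 : h ((1 / 2 : ℝ) * (a + b)) ^ 2 ≤ ENNReal.ofReal t * ENNReal.ofReal t := by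
      rw [sq]; exact mul_le_mul' hcon hcon
    exact absurd (lt_of_lt_of_le (ENNReal.mul_lt_mul ha hb) (h1.trans h2)) (lt_irrefl _)

theorem prekopaLeindler_of_bounded {f g h : ℝ → ℝ≥0∞} (hf : Measurable f)
    (hg : Measurable g) (hh : Measurable h) (hf1 : ⨆ x, f x ≠ ∞) (hg1 : ⨆ x, g x ≠ ∞)
    (H : ∀ x y, f x * g y ≤ h ((1 / 2 : ℝ) * (x + y)) ^ 2) :
    (∫⁻ x, f x) * (∫⁻ x, g x) ≤ (∫⁻ x, h x) ^ 2 := by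
  by_cases hf0 : ⨆ x, f x = 0
  · have : f = 0 := by ext x; simpa using ENNReal.iSup_eq_zero.1 hf0 x
    simp [this]
  by_cases hg0 : ⨆ x, g x = 0
  · have : g = 0 := by ext x; simpa using ENNReal.iSup_eq_zero.1 hg0 x
    simp [this]
  set a := ⨆ x, f x with ha
  set b := ⨆ x, g x with hb
  set r : ℝ≥0∞ := (a * b) ^ (1 / 2 : ℝ)
  have hr2 : r ^ 2 = a * b := by
    rw [← ENNReal.rpow_natCast, ← ENNReal.rpow_mul]; norm_num
  have hab : a * b ≠ 0 := mul_ne_zero hf0 hg0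
  have hab' : a * b ≠ ∞ := ENNReal.mul_ne_top hf1 hg1
  have key := lintegral_mul_le_sq_of_iSup_eq_one (hf.const_mul a⁻¹) (hg.const_mul b⁻¹)
    (hh.const_mul r⁻¹) (by rw [← ENNReal.mul_iSup, ENNReal.inv_mul_cancel hf0 hf1])
    (by rw [← ENNReal.mul_iSup, ENNReal.inv_mul_cancel hg0 hg1]) (by
      intro x y
      rw [mul_pow, ← ENNReal.inv_pow, hr2, ENNReal.mul_inv (Or.inl hf0) (Or.inl hf1),
        mul_mul_mul_comm]
      exact mul_le_mul_right (H x y) _)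
  rw [lintegral_const_mul _ hf, lintegral_const_mul _ hg, lintegral_const_mul _ hh, mul_pow,
    ← ENNReal.inv_pow, hr2, mul_mul_mul_comm, ← ENNReal.mul_inv (Or.inl hf0) (Or.inl hf1)] at key
  exact (ENNReal.mul_le_mul_iff_right (ENNReal.inv_ne_zero.2 hab') (ENNReal.inv_ne_top.2 hab)).1 key

theorem prekopaLeindler_real : PrekopaLeindler ℝ := by
  intro f g h hf hg hh H
  have hmono : ∀ k : ℝ → ℝ≥0∞, Monotone fun (n : ℕ) x => min (k x) (n : ℝ≥0∞) := by
    intro k i j hij x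
    exact min_le_min le_rfl (by exact_mod_cast hij)
  have hsup : ∀ k : ℝ → ℝ≥0∞, ∀ x, ⨆ n : ℕ, min (k x) (n : ℝ≥0∞) = k x := by
    intro k x
    rw [← inf_iSup_eq, ENNReal.iSup_natCast, inf_top_eq]
  have hlim : ∀ k : ℝ → ℝ≥0∞, Measurable k →
      ∫⁻ x, k x = ⨆ n : ℕ, ∫⁻ x, min (k x) (n : ℝ≥0∞) := by
    intro k hk
    rw [← lintegral_iSup (fun n => hk.min measurable_const) (hmono k)]
    simp only [hsup]
  have key : ∀ n : ℕ, (∫⁻ x, min (f x) (n : ℝ≥0∞)) * (∫⁻ x, min (g x) (n : ℝ≥0∞)) ≤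
      (∫⁻ x, h x) ^ 2 := by
    intro n
    refine prekopaLeindler_of_bounded (hf.min measurable_const) (hg.min measurable_const) hh
      (ne_top_of_le_ne_top (ENNReal.natCast_ne_top n) (iSup_le fun x => min_le_right _ _))
      (ne_top_of_le_ne_top (ENNReal.natCast_ne_top n) (iSup_le fun x => min_le_right _ _)) ?_
    exact fun x y => (mul_le_mul' (min_le_left _ _) (min_le_left _ _)).trans (H x y)
  rw [hlim f hf, hlim g hg, ENNReal.iSup_mul]
  refine iSup_le fun i => ?_
  rw [ENNReal.mul_iSup]
  refine iSup_le fun j => le_trans ?_ (key (max i j))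
  exact mul_le_mul' (lintegral_mono (hmono f (le_max_left i j)))
    (lintegral_mono (hmono g (le_max_right i j)))

theorem PrekopaLeindler.prod {α β : Type*} [MeasureSpace α] [AddCommGroup α] [Module ℝ α]
    [MeasureSpace β] [AddCommGroup β] [Module ℝ β] [SFinite (volume : Measure β)]
    (hα : PrekopaLeindler α) (hβ : PrekopaLeindler β) : PrekopaLeindler (α × β) := by
  intro f g h hf hg hh H
  rw [Measure.volume_eq_prod, lintegral_prod _ hf.aemeasurable, lintegral_prod _ hg.aemeasurable,
    lintegral_prod _ hh.aemeasurable]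
  refine hα _ _ _ hf.lintegral_prod_right' hg.lintegral_prod_right' hh.lintegral_prod_right' ?_
  intro x y
  exact hβ _ _ _ (hf.comp measurable_prodMk_left) (hg.comp measurable_prodMk_left)
    (hh.comp measurable_prodMk_left) fun u v => H (x, u) (y, v)

theorem PrekopaLeindler.congr {α β : Type*} [MeasureSpace α] [AddCommGroup α] [Module ℝ α]
    [MeasureSpace β] [AddCommGroup β] [Module ℝ β] (hα : PrekopaLeindler α) (e : α ≃ᵐ β)
    (he : MeasurePreserving e)
    (hmid : ∀ x y, e ((1 / 2 : ℝ) • (x + y)) = (1 / 2 : ℝ) • (e x + e y)) :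
    PrekopaLeindler β := by
  intro f g h hf hg hh H
  rw [← he.lintegral_comp hf, ← he.lintegral_comp hg, ← he.lintegral_comp hh]
  refine hα _ _ _ (hf.comp e.measurable) (hg.comp e.measurable) (hh.comp e.measurable) ?_
  intro x y
  rw [hmid]
  exact H _ _

theorem prekopaLeindler_fin (n : ℕ) : PrekopaLeindler (Fin n → ℝ) := by
  induction n with
  | zero =>
    intro f g h _ _ _ H
    simp only [volume_pi, Measure.pi_of_empty (fun _ : Fin 0 => (volume : Measure ℝ)) 0]
    rw [lintegral_dirac, lintegral_dirac, lintegral_dirac]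
    have := H 0 0
    simpa using this
  | succ n ih =>
    refine (prekopaLeindler_real.prod ih).congr
      (MeasurableEquiv.piFinSuccAbove (fun _ : Fin (n + 1) => ℝ) 0).symm
      (volume_preserving_piFinSuccAbove (fun _ : Fin (n + 1) => ℝ) 0).symm ?_
    intro x y
    ext i
    refine Fin.cases ?_ (fun j => ?_) i <;> simp [MeasurableEquiv.piFinSuccAbove, mul_add]

/-- The Prékopa–Leindler inequality in `ℝ^ι`. -/
theorem prekopaLeindler_pi (ι : Type*) [Fintype ι] : PrekopaLeindler (ι → ℝ) := by
  refine (prekopaLeindler_fin (Fintype.card ι)).congr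
    (MeasurableEquiv.piCongrLeft (fun _ : ι => ℝ) (Fintype.equivFin ι).symm)
    (volume_measurePreserving_piCongrLeft (fun _ : ι => ℝ) (Fintype.equivFin ι).symm) ?_
  intro x y
  ext i
  obtain ⟨j, rfl⟩ := (Fintype.equivFin ι).symm.surjective i
  simp [MeasurableEquiv.piCongrLeft, Equiv.piCongrLeft_apply_apply, mul_add]

theorem eigsDesc_antitone {n : ℕ} (M : Matrix (Fin n) (Fin n) ℂ) : Antitone (eigsDesc M) := by
  unfold eigsDesc
  split_ifs with h
  · intro i j hij
    exact Tuple.monotone_sort h.eigenvalues (Fin.rev_le_rev.2 hij)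
  · exact fun _ _ _ => le_rfl

theorem Matrix.IsHermitian.det_sub_eq_prod_eigsDesc {n : ℕ} {M : Matrix (Fin n) (Fin n) ℂ}
    (hM : M.IsHermitian) (t : ℝ) :
    (Matrix.scalar (Fin n) (t : ℂ) - M).det = ∏ i, ((t : ℂ) - (eigsDesc M i : ℂ)) := by
  rw [← Matrix.eval_charpoly, hM.charpoly_eq, Polynomial.eval_prod]
  simp only [eigsDesc, hM, dif_pos, Polynomial.eval_sub, Polynomial.eval_X, Polynomial.eval_C]
  exact (Fintype.prod_equiv (Fin.revPerm.trans (Tuple.sort hM.eigenvalues)) _ _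
    (fun i => by simp)).symm

/-- An antitone vector is determined by the monic polynomial having its entries as roots. -/
theorem eq_of_antitone_of_prod_sub_eq {n : ℕ} {x y : Fin n → ℝ} (hx : Antitone x)
    (hy : Antitone y) (h : ∀ t : ℕ, ∏ i, ((t : ℝ) - x i) = ∏ i, ((t : ℝ) - y i)) : x = y := by
  have hpoly : ∀ z : Fin n → ℝ, (∏ i, (Polynomial.X - Polynomial.C (z i))).roots =
      ((List.ofFn z : List ℝ) : Multiset ℝ) := by
    intro z
    have := Polynomial.roots_multiset_prod_X_sub_C ((List.ofFn z : List ℝ) : Multiset ℝ)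
    rwa [Multiset.map_coe, Multiset.prod_coe, List.map_ofFn, List.prod_ofFn] at this
  have heq : (∏ i, (Polynomial.X - Polynomial.C (x i)) : Polynomial ℝ) =
      ∏ i, (Polynomial.X - Polynomial.C (y i)) := by
    apply Polynomial.eq_of_infinite_eval_eq
    refine Set.Infinite.mono ?_ (Set.infinite_range_of_injective (Nat.cast_injective (R := ℝ)))
    rintro _ ⟨t, rfl⟩
    simpa [Polynomial.eval_prod] using h t
  have hperm : (List.ofFn x).Perm (List.ofFn y) := by
    rw [← Multiset.coe_eq_coe, ← hpoly, ← hpoly, heq]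
  have := hperm.eq_of_pairwise (le := (· ≥ ·)) (fun _ _ _ _ h₁ h₂ => le_antisymm h₂ h₁)
    (List.pairwise_ofFn.2 fun i j hij => hx hij.le) (List.pairwise_ofFn.2 fun i j hij => hy hij.le)
  exact List.ofFn_injective this

theorem measurable_matrix_entry {n : ℕ} (i j : Fin n) :
    Measurable fun M : Matrix (Fin n) (Fin n) ℂ => M i j :=
  (measurable_pi_apply j).comp (measurable_pi_apply i)

theorem measurable_matrix_det {n : ℕ} {α : Type*} [MeasurableSpace α]
    {f : α → Matrix (Fin n) (Fin n) ℂ} (hf : ∀ i j, Measurable fun a => f a i j) :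
    Measurable fun a => (f a).det := by
  simp only [Matrix.det_apply]
  refine Finset.measurable_sum _ fun s _ => ?_
  exact (Finset.measurable_prod _ fun i _ => hf _ _).const_smul _

theorem measurableSet_isHermitian (n : ℕ) :
    MeasurableSet {M : Matrix (Fin n) (Fin n) ℂ | M.IsHermitian} := by
  have : {M : Matrix (Fin n) (Fin n) ℂ | M.IsHermitian} =
      ⋂ i, ⋂ j, {M | star (M j i) = M i j} := by
    ext M
    simp [Matrix.IsHermitian.ext_iff]
  rw [this]
  refine MeasurableSet.iInter fun i => MeasurableSet.iInter fun j => ?_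
  exact measurableSet_eq_fun (continuous_star.measurable.comp (measurable_matrix_entry j i))
    (measurable_matrix_entry i j)

theorem measurable_eigsDesc (n : ℕ) :
    Measurable (eigsDesc : Matrix (Fin n) (Fin n) ℂ → Fin n → ℝ) := by
  have : PolishSpace {x : Fin n → ℝ // Antitone x} :=
    (isClosed_antitone (β := Fin n) (α := ℝ)).polishSpace
  let E : {x : Fin n → ℝ // Antitone x} → ℕ → ℝ := fun x t => ∏ i, ((t : ℝ) - x.1 i)
  have hE : Measurable E := by
    refine measurable_pi_iff.2 fun t => Finset.measurable_prod _ fun i _ => ?_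
    exact measurable_const.sub ((measurable_pi_apply i).comp measurable_subtype_coe)
  have hEi : Function.Injective E := fun x y hxy =>
    Subtype.ext (eq_of_antitone_of_prod_sub_eq x.2 y.2 fun t => congrFun hxy t)
  have hemb := hE.measurableEmbedding hEi
  have hm : Measurable fun M : Matrix (Fin n) (Fin n) ℂ =>
      (⟨eigsDesc M, eigsDesc_antitone M⟩ : {x : Fin n → ℝ // Antitone x}) := by
    rw [← hemb.measurable_comp_iff]
    classical
    have : (E ∘ fun M : Matrix (Fin n) (Fin n) ℂ =>
        (⟨eigsDesc M, eigsDesc_antitone M⟩ : {x : Fin n → ℝ // Antitone x})) =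
        fun M => if M.IsHermitian then
          fun t : ℕ => (Matrix.scalar (Fin n) (((t : ℝ) : ℂ)) - M).det.re
          else fun t : ℕ => (t : ℝ) ^ n := by
      ext M t
      by_cases h : M.IsHermitian
      · simp only [E, h, Function.comp, if_true, h.det_sub_eq_prod_eigsDesc]
        rw [← Complex.ofReal_re (∏ i, _)]
        push_cast
        rfl
      · simp [E, h, eigsDesc]
    rw [this]
    refine Measurable.ite (measurableSet_isHermitian n) ?_ measurable_const
    refine measurable_pi_iff.2 fun t => Complex.measurable_re.comp (measurable_matrix_det ?_)
    intro i j
    exact measurable_const.sub (measurable_matrix_entry i j)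
  exact measurable_subtype_coe.comp hm

open scoped Matrix in
/-- The Hermitian matrix obtained from `B` by adding a last row and column. -/
def border {n : ℕ} (B : Matrix (Fin n) (Fin n) ℂ) (y : Fin n → ℂ) (d : ℝ) :
    Matrix (Fin (n + 1)) (Fin (n + 1)) ℂ :=
  Matrix.reindex finSumFinEquiv finSumFinEquiv
    (Matrix.fromBlocks B (Matrix.replicateCol (Fin 1) y) (Matrix.replicateRow (Fin 1) (star y))
      (Matrix.of fun _ _ => (d : ℂ)))

/-- The characteristic polynomial of an arrow matrix. -/
def secular {n : ℕ} (μ w : Fin n → ℝ) (d t : ℝ) : ℝ :=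
  (t - d) * ∏ l, (t - μ l) - ∑ l, w l * ∏ k ∈ Finset.univ.erase l, (t - μ k)

theorem border_isHermitian {n : ℕ} {B : Matrix (Fin n) (Fin n) ℂ} (hB : B.IsHermitian)
    (y : Fin n → ℂ) (d : ℝ) : (border B y d).IsHermitian := by
  unfold border
  rw [Matrix.reindex_apply]
  refine Matrix.IsHermitian.submatrix ?_ _
  refine Matrix.IsHermitian.fromBlocks hB ?_ ?_
  · ext i j; simp [Matrix.conjTranspose_apply]
  · ext i j; simp [Matrix.conjTranspose_apply]

/-- Spectral theorem with the eigenvalues in the order of `eigsDesc`. -/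
theorem Matrix.IsHermitian.exists_unitary_eigsDesc {n : ℕ} {B : Matrix (Fin n) (Fin n) ℂ}
    (hB : B.IsHermitian) : ∃ U : Matrix (Fin n) (Fin n) ℂ, U.conjTranspose * U = 1 ∧
      U * U.conjTranspose = 1 ∧
      B = U * Matrix.diagonal (fun i => (eigsDesc B i : ℂ)) * U.conjTranspose := by
  let e : Fin n ≃ Fin n := Fin.revPerm.trans (Tuple.sort hB.eigenvalues)
  let V : Matrix (Fin n) (Fin n) ℂ := hB.eigenvectorUnitary
  have hV1 : V.conjTranspose * V = 1 := Unitary.coe_star_mul_self hB.eigenvectorUnitary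
  have hV2 : V * V.conjTranspose = 1 := Unitary.coe_mul_star_self hB.eigenvectorUnitary
  have hVB : B = V * Matrix.diagonal (fun i => (hB.eigenvalues i : ℂ)) * V.conjTranspose := by
    have := hB.spectral_theorem
    rw [Unitary.conjStarAlgAut_apply] at this
    exact this
  have hd : Matrix.diagonal (fun i => (eigsDesc B i : ℂ)) =
      (Matrix.diagonal (fun i => (hB.eigenvalues i : ℂ))).submatrix e e := by
    rw [Matrix.submatrix_diagonal_equiv]
    congr 1
    ext i
    simp [eigsDesc, hB, e]
  refine ⟨V.submatrix id e, ?_, ?_, ?_⟩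
  · have := Matrix.submatrix_mul_equiv V.conjTranspose V e (Equiv.refl _) e
    rw [Equiv.coe_refl] at this
    rw [Matrix.conjTranspose_submatrix, this, hV1]
    simp
  · rw [Matrix.conjTranspose_submatrix, Matrix.submatrix_mul_equiv, hV2]
    simp
  · rw [hd, Matrix.conjTranspose_submatrix, Matrix.submatrix_mul_equiv,
      Matrix.submatrix_mul_equiv, ← hVB]
    simp

theorem sum_eigsDesc {n : ℕ} {B : Matrix (Fin n) (Fin n) ℂ} (hB : B.IsHermitian) :
    ((∑ i, eigsDesc B i : ℝ) : ℂ) = B.trace := by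
  obtain ⟨U, h1, -, h⟩ := hB.exists_unitary_eigsDesc
  conv_rhs => rw [h]
  rw [Matrix.trace_mul_comm, ← Matrix.mul_assoc, h1]
  simp

theorem sum_sq_eigsDesc {n : ℕ} {B : Matrix (Fin n) (Fin n) ℂ} (hB : B.IsHermitian) :
    ((∑ i, eigsDesc B i ^ 2 : ℝ) : ℂ) = (B * B).trace := by
  obtain ⟨U, h1, -, h⟩ := hB.exists_unitary_eigsDesc
  set D := Matrix.diagonal (fun i => (eigsDesc B i : ℂ)) with hD
  have : B * B = U * (D * D) * U.conjTranspose := by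
    calc B * B = U * D * (U.conjTranspose * U) * D * U.conjTranspose := by
          conv_lhs => rw [h]
          simp only [Matrix.mul_assoc]
      _ = _ := by rw [h1, Matrix.mul_one, Matrix.mul_assoc U D D]
  rw [this, Matrix.trace_mul_comm, ← Matrix.mul_assoc, h1]
  simp [hD, Matrix.diagonal_mul_diagonal, pow_two]

theorem Matrix.trace_submatrix_symm {m n R : Type*} [Fintype m] [Fintype n] [AddCommMonoid R]
    (A : Matrix m m R) (e : m ≃ n) : (A.submatrix e.symm e.symm).trace = A.trace := by
  simp only [Matrix.trace, Matrix.diag, Matrix.submatrix_apply]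
  exact Equiv.sum_comp e.symm fun i => A i i

theorem Matrix.trace_fromBlocks_eq {m n R : Type*} [Fintype m] [Fintype n] [AddCommMonoid R]
    (A : Matrix m m R) (B : Matrix m n R) (C : Matrix n m R) (D : Matrix n n R) :
    (Matrix.fromBlocks A B C D).trace = A.trace + D.trace := by
  simp [Matrix.trace]

theorem trace_border {n : ℕ} (B : Matrix (Fin n) (Fin n) ℂ) (y : Fin n → ℂ) (d : ℝ) :
    (border B y d).trace = B.trace + d := by
  unfold border
  rw [Matrix.reindex_apply, Matrix.trace_submatrix_symm, Matrix.trace_fromBlocks_eq]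
  simp [Matrix.trace]

theorem trace_border_sq {n : ℕ} (B : Matrix (Fin n) (Fin n) ℂ) (y : Fin n → ℂ) (d : ℝ) :
    (border B y d * border B y d).trace =
      (B * B).trace + 2 * ∑ i, y i * star (y i) + (d : ℂ) ^ 2 := by
  unfold border
  rw [Matrix.reindex_apply, Matrix.submatrix_mul_equiv, Matrix.trace_submatrix_symm,
    Matrix.fromBlocks_multiply, Matrix.trace_fromBlocks_eq, Matrix.trace_add, Matrix.trace_add]
  simp [Matrix.trace, Matrix.mul_apply, mul_comm, pow_two]
  ring

theorem det_sub_border_diagonal {n : ℕ} (μ : Fin n → ℝ) (v : Fin n → ℂ) (d t : ℝ) :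
    (Matrix.scalar (Fin (n + 1)) (t : ℂ) -
      border (Matrix.diagonal fun i => (μ i : ℂ)) v d).det =
      (secular μ (fun l => Complex.normSq (v l)) d t : ℂ) := by
  have hblk : ∀ t : ℝ, (Matrix.scalar (Fin (n + 1)) (t : ℂ) -
      border (Matrix.diagonal fun i => (μ i : ℂ)) v d).det =
      (Matrix.fromBlocks (Matrix.diagonal fun i => ((t - μ i : ℝ) : ℂ))
        (-Matrix.replicateCol (Fin 1) v) (-Matrix.replicateRow (Fin 1) (star v))
        (Matrix.of fun _ _ => ((t - d : ℝ) : ℂ))).det := by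
    intro t
    rw [← Matrix.det_reindex_self finSumFinEquiv (Matrix.fromBlocks _ _ _ _)]
    congr 1
    unfold border
    ext i j
    obtain ⟨i, rfl⟩ := finSumFinEquiv.surjective i
    obtain ⟨j, rfl⟩ := finSumFinEquiv.surjective j
    rcases i with i | i <;> rcases j with j | j <;>
      simp [Matrix.diagonal_apply, Matrix.scalar_apply, Fin.ext_iff]
    · split_ifs <;> simp
    · omega
    · omega
  have hcl : Continuous fun t : ℝ => (Matrix.scalar (Fin (n + 1)) (t : ℂ) -
      border (Matrix.diagonal fun i => (μ i : ℂ)) v d).det := by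
    refine Continuous.matrix_det (Continuous.sub ?_ continuous_const)
    simp only [Matrix.scalar_apply]
    exact Continuous.matrix_diagonal (by fun_prop)
  have hcr : Continuous fun t : ℝ => (secular μ (fun l => Complex.normSq (v l)) d t : ℂ) := by
    unfold secular
    fun_prop
  have hd : Dense (Set.range μ)ᶜ := (Set.finite_range μ).countable.dense_compl ℝ
  refine congrFun (hcl.ext_on hd hcr ?_) t
  intro t ht
  have hne : ∀ i, t - μ i ≠ 0 := fun i h => ht ⟨i, by linarith⟩
  have hinv : Invertible (Matrix.diagonal fun i => ((t - μ i : ℝ) : ℂ)) := by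
    refine Matrix.invertibleOfIsUnitDet _ ?_
    rw [Matrix.det_diagonal, isUnit_iff_ne_zero]
    exact Finset.prod_ne_zero_iff.2 fun i _ => by exact_mod_cast hne i
  simp only []
  rw [hblk, Matrix.det_fromBlocks₁₁, Matrix.det_diagonal, Matrix.det_fin_one]
  have hi : ⅟(Matrix.diagonal fun i => ((t - μ i : ℝ) : ℂ)) =
      Matrix.diagonal fun i => ((t - μ i : ℝ) : ℂ)⁻¹ := by
    refine invOf_eq_right_inv ?_
    rw [Matrix.diagonal_mul_diagonal, ← Matrix.diagonal_one]
    congr 1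
    ext i
    exact mul_inv_cancel₀ (by exact_mod_cast hne i)
  rw [hi]
  have hs : ∀ l, ∏ k ∈ Finset.univ.erase l, (t - μ k) = (∏ k, (t - μ k)) * (t - μ l)⁻¹ := by
    intro l
    rw [← Finset.mul_prod_erase Finset.univ _ (Finset.mem_univ l)]
    field_simp [hne l]
  simp only [secular, hs, Matrix.mul_apply, Matrix.sub_apply, Matrix.of_apply, Matrix.neg_apply,
    Matrix.replicateCol_apply, Matrix.replicateRow_apply, Matrix.diagonal_apply, Pi.star_apply,
    mul_ite, mul_zero,
    Finset.sum_ite_eq', Finset.mem_univ, if_true]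
  push_cast
  rw [mul_sub, mul_comm (∏ i, _)]
  congr 1
  rw [Finset.mul_sum]
  refine Finset.sum_congr rfl fun l _ => ?_
  rw [Complex.normSq_eq_conj_mul_self]
  simp only [RCLike.star_def]
  ring

theorem det_sub_border {n : ℕ} {B U : Matrix (Fin n) (Fin n) ℂ} {μ : Fin n → ℝ}
    (hU' : U * U.conjTranspose = 1)
    (hB : B = U * Matrix.diagonal (fun i => (μ i : ℂ)) * U.conjTranspose)
    (y : Fin n → ℂ) (d t : ℝ) :
    (Matrix.scalar (Fin (n + 1)) (t : ℂ) - border B y d).det =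
      (secular μ (fun l => Complex.normSq ((U.conjTranspose.mulVec y) l)) d t : ℂ) := by
  rw [← det_sub_border_diagonal]
  let W : Matrix (Fin (n + 1)) (Fin (n + 1)) ℂ :=
    Matrix.reindex finSumFinEquiv finSumFinEquiv (Matrix.fromBlocks U 0 0 1)
  have hW : W * W.conjTranspose = 1 := by
    simp only [W, Matrix.reindex_apply, Matrix.conjTranspose_submatrix, Matrix.submatrix_mul_equiv,
      Matrix.fromBlocks_conjTranspose, Matrix.fromBlocks_multiply]
    simp [hU']
  have hWb : border B y d = W * border (Matrix.diagonal fun i => (μ i : ℂ))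
      (U.conjTranspose.mulVec y) d * W.conjTranspose := by
    simp only [W, border, Matrix.reindex_apply, Matrix.conjTranspose_submatrix,
      Matrix.submatrix_mul_equiv, Matrix.fromBlocks_conjTranspose, Matrix.fromBlocks_multiply]
    congr 2
    · simp [hB]
    · ext i j
      have : (U * U.conjTranspose).mulVec y i = y i := by rw [hU', Matrix.one_mulVec]
      rw [← Matrix.mulVec_mulVec] at this
      simpa [Matrix.mul_apply, Matrix.mulVec, dotProduct] using this.symm
    · ext i j
      have : star ((U * U.conjTranspose).mulVec y) j = star (y j) := by
        rw [hU', Matrix.one_mulVec]; rfl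
      rw [← Matrix.mulVec_mulVec, Matrix.star_mulVec] at this
      simpa [Matrix.mul_apply, Matrix.vecMul, dotProduct] using this.symm
    · simp
  have : Matrix.scalar (Fin (n + 1)) (t : ℂ) - border B y d = W * (Matrix.scalar (Fin (n + 1))
      (t : ℂ) - border (Matrix.diagonal fun i => (μ i : ℂ))
      (U.conjTranspose.mulVec y) d) * W.conjTranspose := by
    rw [hWb, mul_sub, sub_mul]
    congr 1
    have hc := Matrix.scalar_commute (n := Fin (n + 1)) (t : ℂ) (fun _ => mul_comm _ _) W
    rw [← hc.eq, mul_assoc, hW, mul_one]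
  rw [this, Matrix.det_mul, Matrix.det_mul, mul_comm, ← mul_assoc, ← Matrix.det_mul]
  rw [mul_eq_one_comm.1 hW, Matrix.det_one, one_mul]

/-- Strict interlacing of two rows. -/
def Interlaces {n : ℕ} (μ : Fin n → ℝ) (ν : Fin (n + 1) → ℝ) : Prop :=
  ∀ l, ν l.succ < μ l ∧ μ l < ν l.castSucc

theorem Interlaces.strictAnti {n : ℕ} {μ : Fin n → ℝ} {ν : Fin (n + 1) → ℝ}
    (h : Interlaces μ ν) : StrictAnti ν :=
  Fin.strictAnti_iff_succ_lt.2 fun l => (h l).1.trans (h l).2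

theorem Interlaces.strictAnti_left {n : ℕ} {μ : Fin n → ℝ} {ν : Fin (n + 1) → ℝ}
    (h : Interlaces μ ν) : StrictAnti μ := by
  intro i j hij
  refine (h j).2.trans_le (le_trans ?_ (h i).1.le)
  exact h.strictAnti.antitone (by rw [Fin.le_def]; simpa using hij)

theorem neg_one_pow_card_mul_prod_pos {ι : Type*} (s : Finset ι) (x : ι → ℝ)
    (hx : ∀ i ∈ s, x i ≠ 0) : 0 < (-1) ^ (s.filter fun i => x i < 0).card * ∏ i ∈ s, x i := by
  classical
  induction s using Finset.induction_on with
  | empty => simp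
  | insert a s ha ih =>
    have ih := ih fun i hi => hx i (Finset.mem_insert_of_mem hi)
    rw [Finset.filter_insert, Finset.prod_insert ha]
    rcases lt_or_gt_of_ne (hx a (Finset.mem_insert_self a s)) with h | h
    · rw [if_pos h, Finset.card_insert_of_notMem (by simp [ha]), pow_succ]
      nlinarith
    · rw [if_neg (by linarith)]
      nlinarith

theorem StrictAnti.prod_erase_sub_sign {n : ℕ} {μ : Fin n → ℝ} (hμ : StrictAnti μ) (l : Fin n) :
    0 < (-1) ^ (l : ℕ) * ∏ k ∈ Finset.univ.erase l, (μ l - μ k) := by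
  have h := neg_one_pow_card_mul_prod_pos (Finset.univ.erase l) (fun k => μ l - μ k)
    fun k hk => sub_ne_zero.2 fun h => (Finset.ne_of_mem_erase hk) (hμ.injective h).symm
  convert h using 3
  rw [← Fin.card_Iio l]
  congr 1
  ext k
  simp only [Finset.mem_Iio, Finset.mem_filter, Finset.mem_erase, Finset.mem_univ, sub_neg,
    hμ.lt_iff_gt, ne_eq, and_true]
  exact ⟨fun h => ⟨h.ne, h⟩, fun h => h.2⟩

theorem secular_apply {n : ℕ} (μ w : Fin n → ℝ) (d : ℝ) (l : Fin n) :
    secular μ w d (μ l) = -(w l * ∏ k ∈ Finset.univ.erase l, (μ l - μ k)) := by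
  unfold secular
  rw [Finset.prod_eq_zero (Finset.mem_univ l) (sub_self _), mul_zero, zero_sub,
    Finset.sum_eq_single l]
  · intro k _ hk
    rw [Finset.prod_eq_zero (Finset.mem_erase.2 ⟨hk.symm, Finset.mem_univ _⟩) (sub_self _),
      mul_zero]
  · simp

theorem interlaces_of_secular {n : ℕ} {μ w : Fin n → ℝ} {d : ℝ} {ν : Fin (n + 1) → ℝ}
    (hμ : StrictAnti μ) (hν : Antitone ν) (hw : ∀ l, 0 < w l)
    (h : ∀ t, ∏ j, (t - ν j) = secular μ w d t) : Interlaces μ ν := by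
  let N : Fin n → ℕ := fun l => (Finset.univ.filter fun j => μ l - ν j < 0).card
  have hprod : ∀ l, ∏ j, (μ l - ν j) = -(w l * ∏ k ∈ Finset.univ.erase l, (μ l - μ k)) :=
    fun l => by rw [h, secular_apply]
  have hne : ∀ l j, μ l - ν j ≠ 0 := by
    intro l j hz
    have h1 := hprod l
    rw [Finset.prod_eq_zero (Finset.mem_univ j) hz] at h1
    have h2 := hμ.prod_erase_sub_sign l
    have h3 : ∏ k ∈ Finset.univ.erase l, (μ l - μ k) = 0 := by
      have := (hw l).ne'
      simpa [this] using h1.symm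
    rw [h3] at h2
    simp at h2
  have hodd : ∀ l : Fin n, Odd (N l + l) := by
    intro l
    have h1 := neg_one_pow_card_mul_prod_pos Finset.univ (fun j => μ l - ν j) fun j _ => hne l j
    have h2 := hμ.prod_erase_sub_sign l
    rw [hprod] at h1
    by_contra hcon
    rw [Nat.not_odd_iff_even] at hcon
    have h3 : (-1 : ℝ) ^ N l * (-1) ^ (l : ℕ) = 1 := by rw [← pow_add, hcon.neg_one_pow]
    have h4 := mul_pos h1 h2
    have h5 : (-1 : ℝ) ^ N l * -(w l * ∏ k ∈ Finset.univ.erase l, (μ l - μ k)) *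
        ((-1) ^ (l : ℕ) * ∏ k ∈ Finset.univ.erase l, (μ l - μ k)) =
        -((-1 : ℝ) ^ N l * (-1) ^ (l : ℕ)) *
          (w l * (∏ k ∈ Finset.univ.erase l, (μ l - μ k)) ^ 2) := by ring
    rw [h5, h3] at h4
    nlinarith [hw l, mul_nonneg (hw l).le (sq_nonneg (∏ k ∈ Finset.univ.erase l, (μ l - μ k)))]
  have hmono : ∀ i j : Fin n, i ≤ j → N i ≤ N j := by
    intro i j hij
    refine Finset.card_le_card fun k hk => ?_
    simp only [Finset.mem_filter, Finset.mem_univ, true_and, sub_neg] at hk ⊢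
    exact (hμ.antitone hij).trans_lt hk
  have hlow : ∀ (k : ℕ) (hk : k < n), k + 1 ≤ N ⟨k, hk⟩ := by
    intro k
    induction k with
    | zero =>
      intro hk
      have : 0 < N ⟨0, hk⟩ := by simpa using (hodd ⟨0, hk⟩).pos
      omega
    | succ k ih =>
      intro hk
      have h1 := ih (by omega)
      have h2 := hmono ⟨k, by omega⟩ ⟨k + 1, hk⟩ (by simp)
      have h3 := hodd ⟨k + 1, hk⟩
      rw [Nat.odd_iff] at h3
      simp only at h3
      omega
  have hup : ∀ (k : ℕ) (hk : k < n), N ⟨n - 1 - k, by omega⟩ ≤ n - k := by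
    intro k
    induction k with
    | zero =>
      intro hk
      have h1 : N ⟨n - 1 - 0, by omega⟩ ≤ n + 1 := (Finset.card_filter_le _ _).trans (by simp)
      have h3 := hodd ⟨n - 1 - 0, by omega⟩
      rw [Nat.odd_iff] at h3
      simp only at h3
      omega
    | succ k ih =>
      intro hk
      have h1 := ih (by omega)
      have h2 := hmono ⟨n - 1 - (k + 1), by omega⟩ ⟨n - 1 - k, by omega⟩ (by simp; omega)
      have h3 := hodd ⟨n - 1 - (k + 1), by omega⟩
      rw [Nat.odd_iff] at h3
      simp only at h3
      omega
  have hN : ∀ l : Fin n, N l = l + 1 := by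
    intro l
    have h1 := hlow l l.2
    have h2 := hup (n - 1 - l) (by omega)
    have : (⟨n - 1 - (n - 1 - l), by omega⟩ : Fin n) = l := by ext; simp; omega
    rw [this] at h2
    simp only [Fin.eta] at h1
    omega
  intro l
  constructor
  · rcases lt_or_gt_of_ne (sub_ne_zero.1 (hne l l.succ)) with h1 | h1
    · exfalso
      have : Finset.Iic l.succ ⊆ Finset.univ.filter fun j => μ l - ν j < 0 := by
        intro j hj
        simp only [Finset.mem_filter, Finset.mem_univ, true_and, sub_neg, Finset.mem_Iic] at hj ⊢
        exact h1.trans_le (hν hj)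
      have := Finset.card_le_card this
      have hNl := hN l
      rw [Fin.card_Iic, Fin.val_succ] at this
      simp only [N] at hNl
      omega
    · exact h1
  · by_contra hcon
    push Not at hcon
    have : (Finset.univ.filter fun j => μ l - ν j < 0) ⊆ Finset.Iio l.castSucc := by
      intro j hj
      simp only [Finset.mem_filter, Finset.mem_univ, true_and, sub_neg, Finset.mem_Iio] at hj ⊢
      by_contra hj'
      exact absurd (hj.trans_le (hν (not_lt.1 hj'))) (not_lt.2 hcon)
    have := Finset.card_le_card this
    have hNl := hN l
    rw [Fin.card_Iio, Fin.val_castSucc] at this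
    simp only [N] at hNl
    omega

/-- The residues and the corner entry of the arrow matrix with diagonal `μ` and spectrum `ν`. -/
def arrowInv {n : ℕ} (μ : Fin n → ℝ) (ν : Fin (n + 1) → ℝ) : Fin (n + 1) → ℝ :=
  Fin.snoc (α := fun _ => ℝ)
    (fun l => -(∏ j, (μ l - ν j)) / ∏ k ∈ Finset.univ.erase l, (μ l - μ k))
    (∑ j, ν j - ∑ l, μ l)

theorem arrowInv_castSucc {n : ℕ} (μ : Fin n → ℝ) (ν : Fin (n + 1) → ℝ) (l : Fin n) :
    arrowInv μ ν l.castSucc =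
      -(∏ j, (μ l - ν j)) / ∏ k ∈ Finset.univ.erase l, (μ l - μ k) := by
  simp [arrowInv]

theorem arrowInv_last {n : ℕ} (μ : Fin n → ℝ) (ν : Fin (n + 1) → ℝ) :
    arrowInv μ ν (Fin.last n) = ∑ j, ν j - ∑ l, μ l := by
  simp [arrowInv]

theorem Interlaces.arrowInv_pos {n : ℕ} {μ : Fin n → ℝ} {ν : Fin (n + 1) → ℝ}
    (h : Interlaces μ ν) (l : Fin n) : 0 < arrowInv μ ν l.castSucc := by
  rw [arrowInv_castSucc]
  have hlt : ∀ j, μ l - ν j < 0 ↔ j ≤ l.castSucc := by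
    intro j
    constructor
    · intro hj
      by_contra hcon
      rw [not_le, Fin.castSucc_lt_iff_succ_le] at hcon
      linarith [(h l).1, h.strictAnti.antitone hcon]
    · intro hj
      linarith [(h l).2, h.strictAnti.antitone hj]
  have hne : ∀ j, μ l - ν j ≠ 0 := by
    intro j hz
    have h1 : ¬ j ≤ l.castSucc := fun hj => absurd ((hlt j).2 hj) (by simp [hz])
    rw [not_le, Fin.castSucc_lt_iff_succ_le] at h1
    linarith [(h l).1, h.strictAnti.antitone h1]
  have h1 := neg_one_pow_card_mul_prod_pos Finset.univ (fun j => μ l - ν j) fun j _ => hne j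
  have hc : (Finset.univ.filter fun j => μ l - ν j < 0).card = l + 1 := by
    have : (Finset.univ.filter fun j => μ l - ν j < 0) = Finset.Iic l.castSucc := by
      ext j; simp [hlt]
    rw [this, Fin.card_Iic, Fin.val_castSucc]
  rw [hc] at h1
  have h2 := h.strictAnti_left.prod_erase_sub_sign l
  have h3 : ∀ a b s : ℝ, s ≠ 0 → -a / b = -(s * a) / (s * b) := by
    intro a b s hs
    rw [← mul_neg, mul_div_mul_left _ _ hs]
  rw [h3 _ _ ((-1 : ℝ) ^ (l : ℕ)) (by positivity)]
  rw [pow_succ] at h1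
  exact div_pos (by linarith) h2

theorem StrictAnti.prod_erase_sub_ne {n : ℕ} {μ : Fin n → ℝ} (hμ : StrictAnti μ) (l : Fin n) :
    ∏ k ∈ Finset.univ.erase l, (μ l - μ k) ≠ 0 :=
  fun h => by have := hμ.prod_erase_sub_sign l; simp [h] at this

theorem arrowInv_injective {n : ℕ} {μ : Fin n → ℝ} {ν ν' : Fin (n + 1) → ℝ} (hμ : StrictAnti μ)
    (hν : Antitone ν) (hν' : Antitone ν') (h : arrowInv μ ν = arrowInv μ ν') : ν = ν' := by
  let P : (Fin (n + 1) → ℝ) → Polynomial ℝ := fun ν => ∏ j, (Polynomial.X - Polynomial.C (ν j))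
  have hm : ∀ ν, (P ν).Monic := fun ν => Polynomial.monic_prod_X_sub_C ν Finset.univ
  have hd : ∀ ν, (P ν).natDegree = n + 1 := fun ν => by
    simp [P, Polynomial.natDegree_finsetProd_X_sub_C_eq_card]
  have hnext : ∀ ν, (P ν).coeff n = -∑ j, ν j := by
    intro ν
    have h1 := Polynomial.prod_X_sub_C_nextCoeff (s := Finset.univ) ν
    rwa [Polynomial.nextCoeff_of_natDegree_pos (by rw [hd]; omega), hd] at h1
  have key : P ν = P ν' := by
    refine Polynomial.eq_of_degree_sub_lt_of_eval_finset_eq (Finset.univ.image μ) ?_ ?_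
    · rw [Finset.card_image_of_injective _ hμ.injective, Finset.card_univ, Fintype.card_fin,
        Polynomial.degree_lt_iff_coeff_zero]
      intro m hmn
      rw [Polynomial.coeff_sub]
      rcases Nat.lt_trichotomy m (n + 1) with h1 | h1 | h1
      · obtain rfl : m = n := by omega
        rw [hnext, hnext]
        have := congrFun h (Fin.last m)
        rw [arrowInv_last, arrowInv_last] at this
        linarith
      · have h2 := (hm ν).coeff_natDegree
        have h3 := (hm ν').coeff_natDegree
        rw [hd, ← h1] at h2 h3
        rw [h2, h3, sub_self]
      · rw [Polynomial.coeff_eq_zero_of_natDegree_lt (by rw [hd]; exact h1),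
          Polynomial.coeff_eq_zero_of_natDegree_lt (by rw [hd]; exact h1), sub_self]
    · intro t ht
      obtain ⟨l, -, rfl⟩ := Finset.mem_image.1 ht
      have := congrFun h l.castSucc
      rw [arrowInv_castSucc, arrowInv_castSucc, div_left_inj' (hμ.prod_erase_sub_ne l),
        neg_inj] at this
      simpa [P, Polynomial.eval_prod] using this
  refine eq_of_antitone_of_prod_sub_eq hν hν' fun t => ?_
  have := congrArg (Polynomial.eval (t : ℝ)) key
  simpa [P, Polynomial.eval_prod] using this

/-- The spectrum of the arrow matrix with diagonal `μ`, squared border entries `w` and corner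
`d`. -/
def arrowEigs {n : ℕ} (μ w : Fin n → ℝ) (d : ℝ) : Fin (n + 1) → ℝ :=
  eigsDesc (border (Matrix.diagonal fun i => (μ i : ℂ)) (fun l => (Real.sqrt (w l) : ℂ)) d)

theorem isHermitian_diagonal_ofReal {n : ℕ} (μ : Fin n → ℝ) :
    (Matrix.diagonal fun i => (μ i : ℂ)).IsHermitian := by
  rw [Matrix.isHermitian_diagonal_iff]
  intro i
  simp [IsSelfAdjoint]

theorem prod_sub_eigsDesc_border {n : ℕ} {B U : Matrix (Fin n) (Fin n) ℂ} {μ : Fin n → ℝ}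
    (hH : B.IsHermitian) (hU' : U * U.conjTranspose = 1)
    (hB : B = U * Matrix.diagonal (fun i => (μ i : ℂ)) * U.conjTranspose)
    (y : Fin n → ℂ) (d t : ℝ) :
    ∏ j, (t - eigsDesc (border B y d) j) =
      secular μ (fun l => Complex.normSq ((U.conjTranspose.mulVec y) l)) d t := by
  have h1 := (border_isHermitian hH y d).det_sub_eq_prod_eigsDesc t
  rw [det_sub_border hU' hB] at h1
  exact_mod_cast h1.symm

theorem prod_sub_arrowEigs {n : ℕ} (μ : Fin n → ℝ) {w : Fin n → ℝ} (hw : ∀ l, 0 ≤ w l)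
    (d t : ℝ) : ∏ j, (t - arrowEigs μ w d j) = secular μ w d t := by
  have := prod_sub_eigsDesc_border (U := 1) (μ := μ) (isHermitian_diagonal_ofReal μ) (by simp)
    (by simp) (fun l => (Real.sqrt (w l) : ℂ)) d t
  simpa [arrowEigs, Complex.normSq_ofReal, Real.mul_self_sqrt (hw _)] using this

theorem eigsDesc_border_eq {n : ℕ} {B U : Matrix (Fin n) (Fin n) ℂ} {μ : Fin n → ℝ}
    (hH : B.IsHermitian) (hU' : U * U.conjTranspose = 1)
    (hB : B = U * Matrix.diagonal (fun i => (μ i : ℂ)) * U.conjTranspose)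
    (y : Fin n → ℂ) (d : ℝ) : eigsDesc (border B y d) =
      arrowEigs μ (fun l => Complex.normSq ((U.conjTranspose.mulVec y) l)) d := by
  refine eq_of_antitone_of_prod_sub_eq (eigsDesc_antitone _) (eigsDesc_antitone _) fun t => ?_
  rw [prod_sub_eigsDesc_border hH hU' hB]
  exact (prod_sub_arrowEigs _ (fun l => Complex.normSq_nonneg _) _ _).symm

theorem interlaces_arrowEigs {n : ℕ} {μ w : Fin n → ℝ} (hμ : StrictAnti μ) (hw : ∀ l, 0 < w l)
    (d : ℝ) : Interlaces μ (arrowEigs μ w d) :=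
  interlaces_of_secular hμ (eigsDesc_antitone _) hw (prod_sub_arrowEigs μ (fun l => (hw l).le) d)

theorem sum_arrowEigs {n : ℕ} (μ w : Fin n → ℝ) (d : ℝ) :
    ∑ j, arrowEigs μ w d j = ∑ l, μ l + d := by
  have := sum_eigsDesc (border_isHermitian (isHermitian_diagonal_ofReal μ)
    (fun l => (Real.sqrt (w l) : ℂ)) d)
  rw [trace_border, Matrix.trace_diagonal] at this
  exact_mod_cast this

theorem sum_sq_arrowEigs {n : ℕ} (μ : Fin n → ℝ) {w : Fin n → ℝ} (hw : ∀ l, 0 ≤ w l) (d : ℝ) :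
    ∑ j, arrowEigs μ w d j ^ 2 = ∑ l, μ l ^ 2 + 2 * ∑ l, w l + d ^ 2 := by
  have := sum_sq_eigsDesc (border_isHermitian (isHermitian_diagonal_ofReal μ)
    (fun l => (Real.sqrt (w l) : ℂ)) d)
  rw [trace_border_sq, Matrix.diagonal_mul_diagonal, Matrix.trace_diagonal] at this
  have h2 : ∀ l, (Real.sqrt (w l) : ℂ) * star (Real.sqrt (w l) : ℂ) = (w l : ℂ) := by
    intro l
    rw [RCLike.star_def, Complex.conj_ofReal, ← Complex.ofReal_mul, Real.mul_self_sqrt (hw l)]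
  simp only [h2, ← pow_two] at this
  exact_mod_cast this

theorem arrowInv_arrowEigs {n : ℕ} {μ w : Fin n → ℝ} (hμ : StrictAnti μ) (hw : ∀ l, 0 ≤ w l)
    (d : ℝ) : arrowInv μ (arrowEigs μ w d) = Fin.snoc (α := fun _ => ℝ) w d := by
  ext j
  refine Fin.lastCases ?_ (fun l => ?_) j
  · rw [arrowInv_last, sum_arrowEigs, Fin.snoc_last]; ring
  · rw [arrowInv_castSucc, prod_sub_arrowEigs μ hw, secular_apply, neg_neg, Fin.snoc_castSucc,
      mul_div_cancel_right₀ _ (hμ.prod_erase_sub_ne l)]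

theorem Interlaces.arrowEigs_arrowInv {n : ℕ} {μ : Fin n → ℝ} {ν : Fin (n + 1) → ℝ}
    (h : Interlaces μ ν) :
    arrowEigs μ (fun l => arrowInv μ ν l.castSucc) (arrowInv μ ν (Fin.last n)) = ν := by
  refine arrowInv_injective h.strictAnti_left (eigsDesc_antitone _) h.strictAnti.antitone ?_
  rw [arrowInv_arrowEigs h.strictAnti_left fun l => (h.arrowInv_pos l).le]
  ext j
  refine Fin.lastCases ?_ (fun l => ?_) j <;> simp

theorem Interlaces.energy {n : ℕ} {μ : Fin n → ℝ} {ν : Fin (n + 1) → ℝ} (h : Interlaces μ ν) :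
    2 * ∑ l, arrowInv μ ν (Fin.castSucc l) + arrowInv μ ν (Fin.last n) ^ 2 =
      ∑ j, ν j ^ 2 - ∑ l, μ l ^ 2 := by
  have := sum_sq_arrowEigs μ (fun l => (h.arrowInv_pos l).le) (arrowInv μ ν (Fin.last n))
  rw [h.arrowEigs_arrowInv] at this
  linarith

theorem arrowInv_image {n : ℕ} {μ : Fin n → ℝ} (hμ : StrictAnti μ) :
    arrowInv μ '' {ν | Interlaces μ ν} = {z | ∀ l : Fin n, 0 < z l.castSucc} := by
  ext z
  constructor
  · rintro ⟨ν, hν, rfl⟩ l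
    exact hν.arrowInv_pos l
  · intro hz
    refine ⟨_, interlaces_arrowEigs hμ hz (z (Fin.last n)), ?_⟩
    rw [arrowInv_arrowEigs hμ fun l => (hz l).le]
    ext j
    refine Fin.lastCases ?_ (fun l => ?_) j <;> simp

theorem measurable_arrowEigs {n : ℕ} :
    Measurable fun p : (Fin n → ℝ) × (Fin n → ℝ) × ℝ => arrowEigs p.1 p.2.1 p.2.2 := by
  refine (measurable_eigsDesc (n + 1)).comp ?_
  refine measurable_pi_iff.2 fun i => measurable_pi_iff.2 fun j => ?_
  obtain ⟨i, rfl⟩ := finSumFinEquiv.surjective i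
  obtain ⟨j, rfl⟩ := finSumFinEquiv.surjective j
  rcases i with i | i <;> rcases j with j | j <;> simp [border, Matrix.diagonal_apply]
  · split_ifs <;> fun_prop
  all_goals fun_prop

/-- The Vandermonde product `∏_{i<j} (x_i - x_j)`. -/
def vand {n : ℕ} (x : Fin n → ℝ) : ℝ := ∏ i, ∏ j ∈ Finset.Ioi i, (x i - x j)

theorem vand_eq_det {n : ℕ} (x : Fin n → ℝ) : vand x = (Matrix.vandermonde (-x)).det := by
  rw [Matrix.det_vandermonde]
  refine Finset.prod_congr rfl fun i _ => Finset.prod_congr rfl fun j _ => ?_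
  simp only [Pi.neg_apply]; ring

theorem abs_det_vandermonde {n : ℕ} (x : Fin n → ℝ) :
    |(Matrix.vandermonde x).det| = |vand x| := by
  rw [Matrix.det_vandermonde, vand]
  simp only [Finset.abs_prod, abs_sub_comm]

theorem StrictAnti.vand_pos {n : ℕ} {x : Fin n → ℝ} (hx : StrictAnti x) : 0 < vand x :=
  Finset.prod_pos fun _ _ => Finset.prod_pos fun _ hj => sub_pos.2 (hx (Finset.mem_Ioi.1 hj))

theorem continuous_vand (n : ℕ) : Continuous (vand : (Fin n → ℝ) → ℝ) := by
  unfold vand; fun_prop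

theorem prod_abs_prod_erase_sub {n : ℕ} (x : Fin n → ℝ) :
    ∏ j, |∏ k ∈ Finset.univ.erase j, (x j - x k)| = vand x ^ 2 := by
  have h1 : ∀ j : Fin n, |∏ k ∈ Finset.univ.erase j, (x j - x k)| =
      (∏ k ∈ Finset.Ioi j, |x j - x k|) * ∏ k ∈ Finset.Iio j, |x j - x k| := by
    intro j
    have : Finset.univ.erase j = (Finset.Ioi j).disjUnion (Finset.Iio j)
        (Finset.disjoint_left.2 fun a h1 h2 => by simp at h1 h2; omega) := by
      ext k
      simp only [Finset.mem_erase, Finset.mem_univ, and_true, Finset.mem_disjUnion,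
        Finset.mem_Ioi, Finset.mem_Iio]
      omega
    rw [this, Finset.abs_prod, Finset.prod_disjUnion]
  simp only [h1, Finset.prod_mul_distrib]
  have h2 : ∏ j : Fin n, ∏ k ∈ Finset.Iio j, |x j - x k| =
      ∏ k : Fin n, ∏ j ∈ Finset.Ioi k, |x k - x j| := by
    rw [Finset.prod_comm' (t' := Finset.univ) (s' := fun k => Finset.Ioi k) (by simp)]
    simp only [abs_sub_comm]
  rw [h2, ← sq_abs (vand x), vand]
  simp only [Finset.abs_prod]
  ring

/-- The Jacobian matrix of `arrowInv μ`. -/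
def arrowJac {n : ℕ} (μ : Fin n → ℝ) (ν : Fin (n + 1) → ℝ) :
    Matrix (Fin (n + 1)) (Fin (n + 1)) ℝ :=
  Matrix.of fun i j => Fin.snoc (α := fun _ => ℝ)
    (fun l => -(∏ k ∈ Finset.univ.erase l, (μ l - μ k))⁻¹) 1 i *
    Fin.snoc (α := fun _ => ℝ) (fun l => -∏ k ∈ Finset.univ.erase j, (μ l - ν k)) 1 i

theorem hasFDerivAt_arrowInv {n : ℕ} (μ : Fin n → ℝ) (ν : Fin (n + 1) → ℝ) :
    HasFDerivAt (arrowInv μ)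
      (LinearMap.toContinuousLinearMap (Matrix.toLin' (arrowJac μ ν))) ν := by
  rw [hasFDerivAt_pi']
  intro i
  refine Fin.lastCases ?_ (fun l => ?_) i
  · simp only [arrowInv_last]
    have h : HasFDerivAt (fun x : Fin (n + 1) → ℝ => ∑ j, x j - ∑ l, μ l)
        (∑ j : Fin (n + 1), ContinuousLinearMap.proj (R := ℝ) (φ := fun _ : Fin (n + 1) => ℝ) j)
        ν :=
      (HasFDerivAt.fun_sum fun j _ => hasFDerivAt_apply j ν).sub_const _
    refine h.congr_fderiv ?_
    ext v
    simp [arrowJac, Matrix.mulVec, dotProduct, _root_.sum_apply]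
  · simp only [arrowInv_castSucc]
    have h : HasFDerivAt (fun x : Fin (n + 1) → ℝ =>
        -(∏ j, (μ l - x j)) / ∏ k ∈ Finset.univ.erase l, (μ l - μ k)) _ ν :=
      ((HasFDerivAt.finsetProd (u := Finset.univ) fun j _ =>
        (hasFDerivAt_apply (𝕜 := ℝ) j ν).const_sub (μ l)).neg).mul_const
          (∏ k ∈ Finset.univ.erase l, (μ l - μ k))⁻¹
    refine h.congr_fderiv ?_
    ext v
    simp only [arrowJac, ContinuousLinearMap.comp_apply, Matrix.mulVec, dotProduct,
      ContinuousLinearMap.proj_apply, LinearMap.coe_toContinuousLinearMap', Matrix.toLin'_apply,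
      Matrix.of_apply, Fin.snoc_castSucc, _root_.smul_apply,
      _root_.neg_apply, _root_.sum_apply, smul_eq_mul, Finset.mul_sum,
      ← Finset.sum_neg_distrib]
    refine Finset.sum_congr rfl fun j _ => by ring

theorem abs_det_arrowJac {n : ℕ} {μ : Fin n → ℝ} {ν : Fin (n + 1) → ℝ} (hμ : StrictAnti μ)
    (hν : StrictAnti ν) : |(arrowJac μ ν).det| = vand ν / vand μ := by
  let a : Matrix (Fin (n + 1)) (Fin (n + 1)) ℝ := Matrix.of fun i j =>
    Fin.snoc (α := fun _ => ℝ) (fun l => -∏ k ∈ Finset.univ.erase j, (μ l - ν k)) 1 i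
  let b : Matrix (Fin (n + 1)) (Fin (n + 1)) ℝ := Matrix.of fun i j =>
    Fin.snoc (α := fun _ => ℝ) (fun l => ∏ k ∈ Finset.univ.erase j, (μ l - ν k)) 1 i
  have hab : |a.det| = |b.det| := by
    have : a = Matrix.of fun i j => (Fin.snoc (α := fun _ => ℝ) (fun _ : Fin n => (-1 : ℝ)) 1 i) *
        b i j := by
      ext i j
      refine Fin.lastCases ?_ (fun l => ?_) i <;> simp [a, b]
    rw [this, Matrix.det_mul_column, abs_mul, Finset.abs_prod, Fin.prod_univ_castSucc]
    simp
  let Q : Fin (n + 1) → Polynomial ℝ := fun j =>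
    ∏ k ∈ Finset.univ.erase j, (Polynomial.X - Polynomial.C (ν k))
  have hQd : ∀ j, (Q j).natDegree = n := fun j => by
    simp only [Q, Polynomial.natDegree_finsetProd_X_sub_C_eq_card]
    simp
  have hQm : ∀ j, (Q j).Monic := fun j => Polynomial.monic_prod_X_sub_C _ _
  have hQe : ∀ j t, (Q j).eval t = ∏ k ∈ Finset.univ.erase j, (t - ν k) := fun j t => by
    simp [Q, Polynomial.eval_prod]
  let Cf : Matrix (Fin (n + 1)) (Fin (n + 1)) ℝ := Matrix.of fun p j => (Q j).coeff p
  have heval : ∀ j t, ∑ p : Fin (n + 1), t ^ (p : ℕ) * (Q j).coeff p = (Q j).eval t := by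
    intro j t
    rw [Polynomial.eval_eq_sum_range, hQd, Finset.sum_range]
    exact Finset.sum_congr rfl fun p _ => mul_comm _ _
  let V' : Matrix (Fin (n + 1)) (Fin (n + 1)) ℝ :=
    Matrix.projVandermonde (Fin.snoc (α := fun _ => ℝ) μ 1) (Fin.snoc (α := fun _ => ℝ) 1 0)
  have hV'l : ∀ l p, V' (Fin.castSucc l) p = μ l ^ (p : ℕ) := by
    intro l p
    simp [V', Matrix.projVandermonde_apply]
  have hV'n : ∀ p, V' (Fin.last n) p = if p = Fin.last n then 1 else 0 := by
    intro p
    simp only [V', Matrix.projVandermonde_apply, Fin.snoc_last, one_pow, one_mul]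
    split_ifs with hp
    · simp [hp]
    · rw [zero_pow]
      rw [Fin.val_rev]
      have : (p : ℕ) ≠ n := fun h => hp (Fin.ext h)
      omega
  have hb : b = V' * Cf := by
    ext i j
    refine Fin.lastCases ?_ (fun l => ?_) i
    · simp only [b, Matrix.of_apply, Fin.snoc_last, Matrix.mul_apply, hV'n, Cf, ite_mul, one_mul,
        zero_mul, Finset.sum_ite_eq', Finset.mem_univ, if_true, Fin.val_last]
      have := (hQm j).coeff_natDegree
      rw [hQd] at this
      exact this.symm
    · simp only [b, Matrix.of_apply, Fin.snoc_castSucc, Matrix.mul_apply, hV'l, Cf]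
      rw [heval, hQe]
  have hVC : Matrix.vandermonde ν * Cf =
      Matrix.diagonal fun j => ∏ k ∈ Finset.univ.erase j, (ν j - ν k) := by
    ext i j
    simp only [Matrix.mul_apply, Matrix.vandermonde_apply, Cf, Matrix.of_apply]
    rw [heval, hQe, Matrix.diagonal_apply]
    split_ifs with h
    · rw [h]
    · exact Finset.prod_eq_zero (Finset.mem_erase.2 ⟨h, Finset.mem_univ i⟩) (sub_self _)
  have hdV : |V'.det| = vand μ := by
    rw [Matrix.det_succ_row V' (Fin.last n), Finset.sum_eq_single (Fin.last n)]
    · have : V'.submatrix (Fin.last n).succAbove (Fin.last n).succAbove =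
          Matrix.vandermonde μ := by
        ext l p
        simp [hV'l, Matrix.vandermonde_apply]
      rw [this, hV'n, if_pos rfl, abs_mul, abs_mul, abs_det_vandermonde, abs_pow]
      simp [abs_of_pos hμ.vand_pos]
    · intro p _ hp
      simp [hV'n, hp]
    · simp
  have hvν := hν.vand_pos
  have hvμ := hμ.vand_pos
  have hCf : |Cf.det| = vand ν := by
    have := congrArg (fun M => |Matrix.det M|) hVC
    simp only [Matrix.det_mul, abs_mul, Matrix.det_diagonal, abs_det_vandermonde,
      abs_of_pos hvν] at this
    rw [Finset.abs_prod, prod_abs_prod_erase_sub, pow_two] at this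
    exact mul_left_cancel₀ hvν.ne' this
  have hA : arrowJac μ ν = Matrix.of fun i j => Fin.snoc (α := fun _ => ℝ)
      (fun l => -(∏ k ∈ Finset.univ.erase l, (μ l - μ k))⁻¹) 1 i * a i j := rfl
  rw [hA, Matrix.det_mul_column, abs_mul, hab, hb, Matrix.det_mul, abs_mul, hdV, hCf,
    Fin.prod_univ_castSucc]
  simp only [Fin.snoc_castSucc, Fin.snoc_last, mul_one, Finset.abs_prod, abs_neg, abs_inv]
  have := prod_abs_prod_erase_sub μ
  simp only [Finset.abs_prod] at this
  rw [Finset.prod_inv_distrib, this]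
  field_simp

theorem measurePreserving_pi_comp_injective {ι κ X : Type*} [Fintype ι] [Fintype κ]
    [MeasurableSpace X] (μ : Measure X) [IsProbabilityMeasure μ] {e : ι → κ}
    (he : Function.Injective e) :
    MeasurePreserving (fun (x : κ → X) i => x (e i)) (Measure.pi fun _ => μ)
      (Measure.pi fun _ => μ) := by
  classical
  have hm : Measurable fun (x : κ → X) i => x (e i) :=
    measurable_pi_iff.2 fun i => measurable_pi_apply _
  refine ⟨hm, (Measure.pi_eq fun s hs => ?_).symm⟩
  rw [Measure.map_apply hm (MeasurableSet.univ_pi hs)]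
  have : (fun (x : κ → X) i => x (e i)) ⁻¹' Set.univ.pi s =
      Set.univ.pi fun k => ⋂ i, ⋂ (_ : e i = k), s i := by
    ext x
    simp only [Set.mem_preimage, Set.mem_pi, Set.mem_univ, true_imp_iff, Set.mem_iInter]
    exact ⟨fun h k i hi => hi ▸ h i, fun h i => h _ i rfl⟩
  rw [this, Measure.pi_pi, ← Finset.prod_subset (Finset.subset_univ (Finset.univ.image e)),
    Finset.prod_image fun i _ j _ h => he h]
  · refine Finset.prod_congr rfl fun i _ => ?_
    congr 1
    ext x
    simp only [Set.mem_iInter]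
    exact ⟨fun h => h i rfl, fun h j hj => he hj ▸ h⟩
  · intro k _ hk
    have : ⋂ i, ⋂ (_ : e i = k), s i = Set.univ := by
      refine Set.iInter_eq_univ.2 fun i => Set.iInter_eq_univ.2 fun hi => ?_
      exact absurd (Finset.mem_image.2 ⟨i, Finset.mem_univ _, hi⟩) hk
    rw [this, measure_univ]

theorem lintegral_pi_fin_prod {n : ℕ} {X : Type*} [MeasurableSpace X] (μ : Measure X)
    [SigmaFinite μ] {f : Fin n → X → ℝ≥0∞} (hf : ∀ i, Measurable (f i)) :
    ∫⁻ x, ∏ i, f i (x i) ∂Measure.pi (fun _ : Fin n => μ) = ∏ i, ∫⁻ x, f i x ∂μ := by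
  induction n with
  | zero => simp
  | succ n ih =>
    have hmp := (measurePreserving_piFinSuccAbove (fun _ : Fin (n + 1) => μ) 0).symm
    have hm : Measurable fun x : Fin (n + 1) → X => ∏ i, f i (x i) :=
      Finset.measurable_prod _ fun i _ => (hf i).comp (measurable_pi_apply i)
    rw [← hmp.lintegral_comp hm]
    refine (lintegral_prod _ (hm.comp hmp.measurable).aemeasurable).trans ?_
    simp only [Function.comp_apply, Fin.prod_univ_succ,
      MeasurableEquiv.piFinSuccAbove_symm_apply]
    simp only [Fin.insertNthEquiv_apply, Fin.insertNth_zero, Fin.cons_zero, Fin.cons_succ]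
    rw [← ih fun i => hf i.succ, ← lintegral_mul_const _ (hf 0)]
    refine lintegral_congr fun x => ?_
    exact lintegral_const_mul _ (Finset.measurable_prod _ fun i _ =>
      (hf i.succ).comp (measurable_pi_apply i))

theorem pi_withDensity_fin {n : ℕ} {X : Type*} [MeasurableSpace X] (μ : Measure X)
    [SigmaFinite μ] {f : X → ℝ≥0∞} (hf : Measurable f) [SigmaFinite (μ.withDensity f)] :
    Measure.pi (fun _ : Fin n => μ.withDensity f) =
      (Measure.pi fun _ : Fin n => μ).withDensity fun x => ∏ i, f (x i) := by
  refine Measure.pi_eq fun s hs => ?_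
  rw [withDensity_apply _ (MeasurableSet.univ_pi hs),
    ← lintegral_indicator (MeasurableSet.univ_pi hs)]
  have : ∀ x : Fin n → X, (Set.univ.pi s).indicator (fun x => ∏ i, f (x i)) x =
      ∏ i, (s i).indicator f (x i) := by
    intro x
    by_cases hx : x ∈ Set.univ.pi s
    · rw [Set.indicator_of_mem hx]
      exact Finset.prod_congr rfl fun i _ => (Set.indicator_of_mem (hx i trivial) _).symm
    · rw [Set.indicator_of_notMem hx]
      simp only [Set.mem_pi, Set.mem_univ, true_imp_iff, not_forall] at hx
      obtain ⟨i, hi⟩ := hx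
      exact (Finset.prod_eq_zero (Finset.mem_univ i) (Set.indicator_of_notMem hi _)).symm
  simp only [this]
  rw [lintegral_pi_fin_prod μ fun i => hf.indicator (hs i)]
  exact Finset.prod_congr rfl fun i _ => by
    rw [lintegral_indicator (hs i), withDensity_apply _ (hs i)]

/-- The complex vector with given real and imaginary parts. -/
def toComplexVec {n : ℕ} (y : Fin n → ℝ × ℝ) : Fin n → ℂ := fun l => (y l).1 + (y l).2 * Complex.I

/-- The standard complex Gaussian measure, as a measure on `ℝ × ℝ`. -/
def complexGaussian : Measure (ℝ × ℝ) := (gaussianReal 0 (1 / 2)).prod (gaussianReal 0 (1 / 2))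

instance : IsProbabilityMeasure complexGaussian := by unfold complexGaussian; infer_instance

/-- The law of the last row of a GUE matrix of size `n + 1`. -/
def borderNoise (n : ℕ) : Measure ((Fin n → ℝ × ℝ) × ℝ) :=
  (Measure.pi fun _ => complexGaussian).prod (gaussianReal 0 1)

instance (n : ℕ) : IsProbabilityMeasure (borderNoise n) := by unfold borderNoise; infer_instance

/-- The Hermitian matrix built from its diagonal and upper triangular entries. -/
def hermitianOf {n : ℕ} (ω : (Fin n → ℝ) × (Fin n × Fin n → ℝ × ℝ)) :
    Matrix (Fin n) (Fin n) ℂ :=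
  Matrix.of fun i j =>
    if i = j then (ω.1 i : ℂ)
    else if i < j then ((ω.2 (i, j)).1 : ℂ) + ((ω.2 (i, j)).2 : ℂ) * Complex.I
    else ((ω.2 (j, i)).1 : ℂ) - ((ω.2 (j, i)).2 : ℂ) * Complex.I

theorem gueMeasure_eq (n : ℕ) : gueMeasure n = Measure.map hermitianOf
    ((Measure.pi fun _ : Fin n => gaussianReal 0 1).prod
      (Measure.pi fun _ : Fin n × Fin n => complexGaussian)) := rfl

theorem measurable_hermitianOf (n : ℕ) : Measurable (hermitianOf (n := n)) := by
  refine measurable_pi_iff.2 fun i => measurable_pi_iff.2 fun j => ?_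
  unfold hermitianOf
  simp only [Matrix.of_apply]
  split_ifs <;> fun_prop

instance (n : ℕ) : IsProbabilityMeasure (gueMeasure n) := by
  rw [gueMeasure_eq]
  exact Measure.isProbabilityMeasure_map (measurable_hermitianOf n).aemeasurable

theorem hermitianOf_isHermitian {n : ℕ} (ω : (Fin n → ℝ) × (Fin n × Fin n → ℝ × ℝ)) :
    (hermitianOf ω).IsHermitian := by
  refine Matrix.IsHermitian.ext fun i j => ?_
  simp only [hermitianOf, Matrix.of_apply]
  rcases lt_trichotomy i j with h | h | h
  · simp [h, h.ne, h.ne', h.not_gt]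
  · simp [h]
  · simp [h, h.ne, h.ne', h.not_gt, sub_eq_add_neg]

theorem ae_isHermitian_gueMeasure (n : ℕ) : ∀ᵐ M ∂gueMeasure n, M.IsHermitian := by
  rw [gueMeasure_eq, ae_map_iff (measurable_hermitianOf n).aemeasurable
    (measurableSet_isHermitian n)]
  exact Filter.Eventually.of_forall hermitianOf_isHermitian

theorem measurable_border (n : ℕ) :
    Measurable fun p : Matrix (Fin n) (Fin n) ℂ × ((Fin n → ℝ × ℝ) × ℝ) =>
      border p.1 (toComplexVec p.2.1) p.2.2 := by
  refine measurable_pi_iff.2 fun i => measurable_pi_iff.2 fun j => ?_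
  have hc : ∀ l : Fin n, Measurable fun p : Matrix (Fin n) (Fin n) ℂ × ((Fin n → ℝ × ℝ) × ℝ) =>
      toComplexVec p.2.1 l := by
    intro l; unfold toComplexVec; fun_prop
  simp only [border, Matrix.reindex_apply, Matrix.submatrix_apply]
  rcases finSumFinEquiv.symm i with a | a <;> rcases finSumFinEquiv.symm j with b | b
  · exact (measurable_matrix_entry a b).comp measurable_fst
  · simpa using hc a
  · exact (continuous_star (R := ℂ)).measurable.comp (hc b)
  · exact Complex.measurable_ofReal.comp (measurable_snd.comp measurable_snd)

theorem measurePreserving_prod_shuffle {α β γ δ : Type*} [MeasurableSpace α] [MeasurableSpace β]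
    [MeasurableSpace γ] [MeasurableSpace δ] (μa : Measure α) (μb : Measure β) (μc : Measure γ)
    (μd : Measure δ) [SFinite μa] [SFinite μb] [SFinite μc] [SFinite μd] :
    MeasurePreserving (fun p : (α × β) × (γ × δ) => ((p.1.1, p.2.1), (p.2.2, p.1.2)))
      ((μa.prod μb).prod (μc.prod μd)) ((μa.prod μc).prod (μd.prod μb)) := by
  have hm : Measurable (fun p : (α × β) × (γ × δ) => ((p.1.1, p.2.1), (p.2.2, p.1.2))) := by
    fun_prop
  refine ⟨hm, Measure.ext_of_lintegral _ fun f hf => ?_⟩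
  rw [lintegral_map hf hm, lintegral_prod _ (by fun_prop), lintegral_prod _ (by fun_prop),
    lintegral_prod _ (by fun_prop), lintegral_prod _ (by fun_prop)]
  refine lintegral_congr fun a => ?_
  have h1 : ∀ b, ∫⁻ y, f ((a, y.1), (y.2, b)) ∂μc.prod μd =
      ∫⁻ c, ∫⁻ d, f ((a, c), (d, b)) ∂μd ∂μc := fun b => lintegral_prod _ (by fun_prop)
  simp only [h1]
  rw [lintegral_lintegral_swap (by
    refine Measurable.aemeasurable ?_
    refine Measurable.lintegral_prod_right
      (f := fun (x : β × γ) d => f ((a, x.2), (d, x.1))) ?_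
    fun_prop)]
  refine lintegral_congr fun c => ?_
  rw [lintegral_prod _ (by fun_prop), lintegral_lintegral_swap (by fun_prop)]

/-- Splitting the entries of a Hermitian matrix of size `n + 1` into those of its principal
minor and those of its last column. -/
def splitEntries {n : ℕ} (ω : (Fin (n + 1) → ℝ) × (Fin (n + 1) × Fin (n + 1) → ℝ × ℝ)) :
    ((Fin n → ℝ) × (Fin n × Fin n → ℝ × ℝ)) × ((Fin n → ℝ × ℝ) × ℝ) :=
  ((fun l => ω.1 l.castSucc, fun p => ω.2 (p.1.castSucc, p.2.castSucc)),
    (fun l => ω.2 (l.castSucc, Fin.last n), ω.1 (Fin.last n)))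

theorem measurePreserving_splitEntries (n : ℕ) :
    MeasurePreserving (splitEntries (n := n))
      ((Measure.pi fun _ : Fin (n + 1) => gaussianReal 0 1).prod
        (Measure.pi fun _ : Fin (n + 1) × Fin (n + 1) => complexGaussian))
      (((Measure.pi fun _ : Fin n => gaussianReal 0 1).prod
        (Measure.pi fun _ : Fin n × Fin n => complexGaussian)).prod (borderNoise n)) := by
  have h1 : MeasurePreserving (fun x : Fin (n + 1) → ℝ => (fun l => x (Fin.castSucc l),
      x (Fin.last n))) (Measure.pi fun _ : Fin (n + 1) => gaussianReal 0 1)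
      ((Measure.pi fun _ : Fin n => gaussianReal 0 1).prod (gaussianReal 0 1)) := by
    have := Measure.measurePreserving_swap.comp
      (measurePreserving_piFinSuccAbove (fun _ : Fin (n + 1) => gaussianReal 0 1) (Fin.last n))
    convert this using 1
    ext x <;> simp [MeasurableEquiv.piFinSuccAbove, Fin.insertNthEquiv, Fin.init]
  let e : (Fin n × Fin n) ⊕ Fin n → Fin (n + 1) × Fin (n + 1) :=
    Sum.elim (fun p => (p.1.castSucc, p.2.castSucc)) fun l => (l.castSucc, Fin.last n)
  have he : Function.Injective e := by
    rintro (⟨a, b⟩ | a) (⟨c, d⟩ | c) h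
    · simpa [e] using h
    · exact absurd (congrArg Prod.snd h) (Fin.castSucc_lt_last b).ne
    · exact absurd (congrArg Prod.snd h) (Fin.castSucc_lt_last d).ne'
    · simpa [e] using h
  have h2 := (measurePreserving_sumPiEquivProdPi (X := fun _ : (Fin n × Fin n) ⊕ Fin n => ℝ × ℝ)
    fun _ => complexGaussian).comp (measurePreserving_pi_comp_injective complexGaussian he)
  exact (measurePreserving_prod_shuffle _ _ _ _).comp (h1.prod h2)

theorem hermitianOf_eq_border {n : ℕ}
    (ω : (Fin (n + 1) → ℝ) × (Fin (n + 1) × Fin (n + 1) → ℝ × ℝ)) :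
    hermitianOf ω = border (hermitianOf (splitEntries ω).1) (toComplexVec (splitEntries ω).2.1)
      (splitEntries ω).2.2 := by
  ext i j
  refine Fin.lastCases ?_ (fun a => ?_) i <;> refine Fin.lastCases ?_ (fun b => ?_) j
  · simp [border, hermitianOf, splitEntries]
  · simp [border, hermitianOf, splitEntries, toComplexVec, (Fin.castSucc_lt_last b).ne',
      (Fin.castSucc_lt_last b).not_gt, sub_eq_add_neg]
  · simp [border, hermitianOf, splitEntries, toComplexVec, (Fin.castSucc_lt_last a).ne,
      (Fin.castSucc_lt_last a)]
  · simp [border, hermitianOf, splitEntries]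

theorem map_border_gueMeasure (n : ℕ) :
    Measure.map (fun p : Matrix (Fin n) (Fin n) ℂ × ((Fin n → ℝ × ℝ) × ℝ) =>
      border p.1 (toComplexVec p.2.1) p.2.2) ((gueMeasure n).prod (borderNoise n)) =
      gueMeasure (n + 1) := by
  have h := measurePreserving_splitEntries n
  have hp : (gueMeasure n).prod (borderNoise n) = Measure.map (Prod.map hermitianOf id)
      (((Measure.pi fun _ : Fin n => gaussianReal 0 1).prod
        (Measure.pi fun _ : Fin n × Fin n => complexGaussian)).prod (borderNoise n)) := by
    rw [gueMeasure_eq, ← Measure.map_prod_map _ _ (measurable_hermitianOf n) measurable_id,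
      Measure.map_id]
  rw [hp, ← h.map_eq, Measure.map_map ((measurable_hermitianOf n).prodMap measurable_id)
    h.measurable, Measure.map_map (measurable_border n)
      (((measurable_hermitianOf n).prodMap measurable_id).comp h.measurable), gueMeasure_eq]
  congr 1
  ext1 ω
  exact (hermitianOf_eq_border ω).symm

theorem lintegral_withDensity_mul {α : Type*} [MeasurableSpace α] (μ : Measure α)
    {ρ f : α → ℝ≥0∞} (hρ : Measurable ρ) (hf : Measurable f) :
    ∫⁻ a, f a ∂μ.withDensity ρ = ∫⁻ a, ρ a * f a ∂μ :=
  lintegral_withDensity_eq_lintegral_mul _ hρ hf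

theorem complexGaussian_eq_withDensity : complexGaussian = (volume : Measure (ℝ × ℝ)).withDensity
    fun p => ENNReal.ofReal (Real.pi⁻¹ * Real.exp (-(p.1 ^ 2 + p.2 ^ 2))) := by
  rw [complexGaussian, gaussianReal_of_var_ne_zero _ (by norm_num),
    prod_withDensity (measurable_gaussianPDF _ _) (measurable_gaussianPDF _ _),
    Measure.volume_eq_prod]
  congr 1
  ext p
  rw [gaussianPDF, gaussianPDF, ← ENNReal.ofReal_mul (gaussianPDFReal_nonneg _ _ _)]
  congr 1
  simp only [gaussianPDFReal_def]
  rw [mul_mul_mul_comm, ← Real.exp_add, ← mul_inv, Real.mul_self_sqrt (by positivity)]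
  congr 1
  · push_cast; ring_nf
  · congr 1; push_cast; ring

theorem pi_complexGaussian_eq_withDensity (n : ℕ) :
    Measure.pi (fun _ : Fin n => complexGaussian) =
      (volume : Measure (Fin n → ℝ × ℝ)).withDensity fun y =>
        ENNReal.ofReal (Real.pi⁻¹ ^ n * Real.exp (-∑ l, ((y l).1 ^ 2 + (y l).2 ^ 2))) := by
  have : SigmaFinite ((volume : Measure (ℝ × ℝ)).withDensity
    fun p => ENNReal.ofReal (Real.pi⁻¹ * Real.exp (-(p.1 ^ 2 + p.2 ^ 2)))) := by
    rw [← complexGaussian_eq_withDensity]; infer_instance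
  rw [complexGaussian_eq_withDensity, pi_withDensity_fin _ (by fun_prop), volume_pi]
  congr 1
  ext y
  rw [← ENNReal.ofReal_prod_of_nonneg fun l _ => by positivity, Finset.prod_mul_distrib,
    ← Real.exp_sum, Finset.sum_neg_distrib]
  simp

/-- The real linear identification of `ℝ × ℝ`-valued vectors with complex vectors. -/
def complexVecEquiv (n : ℕ) : (Fin n → ℝ × ℝ) ≃ₗ[ℝ] (Fin n → ℂ) :=
  LinearEquiv.piCongrRight fun _ => Complex.equivRealProdLm.symm

theorem complexVecEquiv_apply {n : ℕ} (y : Fin n → ℝ × ℝ) :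
    complexVecEquiv n y = toComplexVec y := by
  ext l
  simp [complexVecEquiv, toComplexVec, Complex.equivRealProdLm, Complex.ext_iff]

/-- The action of a complex matrix on `ℝ × ℝ`-valued vectors. -/
def realAction {n : ℕ} (U : Matrix (Fin n) (Fin n) ℂ) : (Fin n → ℝ × ℝ) →ₗ[ℝ] (Fin n → ℝ × ℝ) :=
  (complexVecEquiv n).symm.toLinearMap ∘ₗ (U.mulVecLin.restrictScalars ℝ) ∘ₗ
    (complexVecEquiv n).toLinearMap

theorem toComplexVec_realAction {n : ℕ} (U : Matrix (Fin n) (Fin n) ℂ) (y : Fin n → ℝ × ℝ) :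
    toComplexVec (realAction U y) = U.mulVec (toComplexVec y) := by
  rw [← complexVecEquiv_apply, realAction]
  simp [complexVecEquiv_apply]

theorem realAction_comp {n : ℕ} (U V : Matrix (Fin n) (Fin n) ℂ) :
    realAction U ∘ₗ realAction V = realAction (U * V) := by
  refine LinearMap.ext fun y => ?_
  apply (complexVecEquiv n).injective
  simp [complexVecEquiv_apply, toComplexVec_realAction, Matrix.mulVec_mulVec]

theorem realAction_one (n : ℕ) : realAction (1 : Matrix (Fin n) (Fin n) ℂ) = LinearMap.id := by
  refine LinearMap.ext fun y => ?_
  apply (complexVecEquiv n).injective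
  simp [complexVecEquiv_apply, toComplexVec_realAction]

theorem normSq_toComplexVec {n : ℕ} (y : Fin n → ℝ × ℝ) (l : Fin n) :
    Complex.normSq (toComplexVec y l) = (y l).1 ^ 2 + (y l).2 ^ 2 := by
  simp [toComplexVec, Complex.normSq_add_mul_I]

theorem sum_normSq_mulVec {n : ℕ} {U : Matrix (Fin n) (Fin n) ℂ} (hU : U.conjTranspose * U = 1)
    (z : Fin n → ℂ) : ∑ l, Complex.normSq (U.mulVec z l) = ∑ l, Complex.normSq (z l) := by
  have h : ∀ z : Fin n → ℂ, ((∑ l, Complex.normSq (z l) : ℝ) : ℂ) = star z ⬝ᵥ z := by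
    intro z
    push_cast
    exact Finset.sum_congr rfl fun l _ => by
      rw [Complex.normSq_eq_conj_mul_self]; rfl
  have : ((∑ l, Complex.normSq (U.mulVec z l) : ℝ) : ℂ) =
      ((∑ l, Complex.normSq (z l) : ℝ) : ℂ) := by
    rw [h, h, Matrix.star_mulVec, ← Matrix.dotProduct_mulVec, Matrix.mulVec_mulVec, hU,
      Matrix.one_mulVec]
  exact_mod_cast this

theorem measurePreserving_realAction {n : ℕ} {U : Matrix (Fin n) (Fin n) ℂ}
    (hU : U.conjTranspose * U = 1) :
    MeasurePreserving (realAction U) (Measure.pi fun _ : Fin n => complexGaussian)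
      (Measure.pi fun _ : Fin n => complexGaussian) := by
  have hm : Measurable (realAction U) :=
    (LinearMap.continuous_of_finiteDimensional _).measurable
  have hdet : LinearMap.det (realAction U) ≠ 0 := by
    intro h0
    have := congrArg LinearMap.det (realAction_comp U.conjTranspose U)
    rw [LinearMap.det_comp, h0, hU, realAction_one, LinearMap.det_id, mul_zero] at this
    exact zero_ne_one this
  have hmap := Measure.map_linearMap_addHaar_eq_smul_addHaar
    (volume : Measure (Fin n → ℝ × ℝ)) hdet
  set c := ENNReal.ofReal |(LinearMap.det (realAction U))⁻¹|
  set ρ : (Fin n → ℝ × ℝ) → ℝ≥0∞ := fun y =>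
    ENNReal.ofReal (Real.pi⁻¹ ^ n * Real.exp (-∑ l, ((y l).1 ^ 2 + (y l).2 ^ 2))) with hρ
  have hρm : Measurable ρ := by fun_prop
  have hρU : ∀ y, ρ (realAction U y) = ρ y := by
    intro y
    simp only [hρ, ← normSq_toComplexVec, toComplexVec_realAction, sum_normSq_mulVec hU]
  have key : Measure.map (realAction U) (Measure.pi fun _ : Fin n => complexGaussian) =
      c • Measure.pi fun _ : Fin n => complexGaussian := by
    refine Measure.ext_of_lintegral _ fun f hf => ?_
    rw [lintegral_map hf hm, lintegral_smul_measure, pi_complexGaussian_eq_withDensity,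
      lintegral_withDensity_mul _ hρm (f := fun y => f (realAction U y)) (hf.comp hm),
      lintegral_withDensity_mul _ hρm hf, ← lintegral_smul_measure, ← hmap,
      lintegral_map (f := fun y => ρ y * f y) (hρm.mul hf) hm]
    simp only [hρU]
  refine ⟨hm, ?_⟩
  have h1 : c = 1 := by
    have := congrArg (fun ν : Measure (Fin n → ℝ × ℝ) => ν Set.univ) key
    simpa [Measure.map_apply hm MeasurableSet.univ] using this.symm
  rw [key, h1, one_smul]

instance : IsProbabilityMeasure (expMeasure 1) := isProbabilityMeasure_expMeasure one_pos

theorem lintegral_expMeasure_one {f : ℝ → ℝ≥0∞} (hf : Measurable f) :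
    ∫⁻ w, f w ∂expMeasure 1 = ∫⁻ w in Set.Ioi 0, ENNReal.ofReal (Real.exp (-w)) * f w := by
  have : expMeasure 1 = volume.withDensity (exponentialPDF 1) := rfl
  rw [this, lintegral_withDensity_mul _ (ρ := exponentialPDF 1)
    (measurable_exponentialPDFReal 1).ennreal_ofReal hf, restrict_Ioi_eq_restrict_Ici,
    ← lintegral_indicator measurableSet_Ici]
  refine lintegral_congr fun w => ?_
  by_cases hw : 0 ≤ w
  · simp [hw, exponentialPDF_eq]
  · simp [hw, exponentialPDF_eq]

theorem lintegral_expMeasure_one_eq_sq {f : ℝ → ℝ≥0∞} (hf : Measurable f) :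
    ∫⁻ w, f w ∂expMeasure 1 =
      ∫⁻ r in Set.Ioi 0,
        ENNReal.ofReal (2 * r) * (ENNReal.ofReal (Real.exp (-r ^ 2)) * f (r ^ 2)) := by
  have himg : (fun r : ℝ => r ^ 2) '' Set.Ioi 0 = Set.Ioi 0 := by
    ext w
    simp only [Set.mem_image, Set.mem_Ioi]
    exact ⟨fun ⟨r, hr, h⟩ => h ▸ pow_pos hr 2, fun hw => ⟨√w, Real.sqrt_pos.2 hw,
      Real.sq_sqrt hw.le⟩⟩
  have hinj : Set.InjOn (fun r : ℝ => r ^ 2) (Set.Ioi 0) := fun x hx y hy h =>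
    (sq_eq_sq₀ (le_of_lt hx) (le_of_lt hy)).1 h
  rw [lintegral_expMeasure_one hf]
  conv_lhs => rw [← himg]
  rw [lintegral_image_eq_lintegral_abs_deriv_mul (f' := fun r => 2 * r) measurableSet_Ioi
    (fun r _ => by simpa using (hasDerivAt_pow 2 r).hasDerivWithinAt) hinj]
  refine setLIntegral_congr_fun measurableSet_Ioi fun r hr => ?_
  simp only [abs_of_pos (mul_pos two_pos (Set.mem_Ioi.1 hr))]

theorem measurePreserving_normSq_complexGaussian :
    MeasurePreserving (fun p : ℝ × ℝ => p.1 ^ 2 + p.2 ^ 2) complexGaussian (expMeasure 1) := by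
  have hm : Measurable fun p : ℝ × ℝ => p.1 ^ 2 + p.2 ^ 2 := by fun_prop
  refine ⟨hm, Measure.ext_of_lintegral _ fun f hf => ?_⟩
  rw [lintegral_map hf hm, complexGaussian_eq_withDensity,
    lintegral_withDensity_mul _ (by fun_prop) (f := fun p : ℝ × ℝ => f (p.1 ^ 2 + p.2 ^ 2))
      (hf.comp hm),
    ← lintegral_comp_polarCoord_symm, lintegral_expMeasure_one_eq_sq hf, polarCoord_target,
    Measure.volume_eq_prod, ← Measure.prod_restrict]
  have hsq : ∀ p : ℝ × ℝ, (polarCoord.symm p).1 ^ 2 + (polarCoord.symm p).2 ^ 2 = p.1 ^ 2 := by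
    intro p
    simp only [polarCoord_symm_apply]
    linear_combination p.1 ^ 2 * Real.cos_sq_add_sin_sq p.2
  simp only [hsq]
  rw [lintegral_prod _ (by fun_prop)]
  refine setLIntegral_congr_fun measurableSet_Ioi fun r hr => ?_
  have hr : 0 < r := hr
  simp only [lintegral_const, Measure.restrict_apply_univ, Real.volume_Ioo, smul_eq_mul]
  have h0 : ENNReal.ofReal r * ENNReal.ofReal (Real.pi⁻¹ * Real.exp (-r ^ 2)) *
      ENNReal.ofReal (Real.pi - -Real.pi) =
        ENNReal.ofReal (2 * r) * ENNReal.ofReal (Real.exp (-r ^ 2)) := by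
    rw [← ENNReal.ofReal_mul hr.le, ← ENNReal.ofReal_mul (by positivity),
      ← ENNReal.ofReal_mul (by positivity)]
    congr 1
    field_simp
    ring
  rw [← mul_assoc, ← mul_assoc, ← h0]
  ring

theorem measurePreserving_normSq_pi (n : ℕ) :
    MeasurePreserving (fun (y : Fin n → ℝ × ℝ) l => Complex.normSq (toComplexVec y l))
      (Measure.pi fun _ => complexGaussian) (Measure.pi fun _ => expMeasure 1) := by
  simp only [normSq_toComplexVec]
  exact measurePreserving_pi _ _ fun _ => measurePreserving_normSq_complexGaussian

/-- The law of the squared moduli and the corner entry of a Gaussian border. -/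
def arrowNoise (n : ℕ) : Measure ((Fin n → ℝ) × ℝ) :=
  (Measure.pi fun _ => expMeasure 1).prod (gaussianReal 0 1)

instance (n : ℕ) : IsProbabilityMeasure (arrowNoise n) := by unfold arrowNoise; infer_instance

/-- The eigenvalues of a bordered Hermitian matrix with Gaussian border, in terms of independent
exponential weights. -/
theorem lintegral_eigsDesc_border {n : ℕ} {B : Matrix (Fin n) (Fin n) ℂ} (hB : B.IsHermitian)
    {f : (Fin (n + 1) → ℝ) → ℝ≥0∞} (hf : Measurable f) :
    ∫⁻ p, f (eigsDesc (border B (toComplexVec p.1) p.2)) ∂borderNoise n =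
      ∫⁻ q, f (arrowEigs (eigsDesc B) q.1 q.2) ∂arrowNoise n := by
  obtain ⟨U, hU, hU', hBU⟩ := hB.exists_unitary_eigsDesc
  have hV : U.conjTranspose.conjTranspose * U.conjTranspose = 1 := by
    rwa [Matrix.conjTranspose_conjTranspose]
  have h := ((measurePreserving_normSq_pi n).comp (measurePreserving_realAction hV)).prod
    (MeasurePreserving.id (gaussianReal 0 1))
  have hm : Measurable fun q : (Fin n → ℝ) × ℝ => arrowEigs (eigsDesc B) q.1 q.2 :=
    measurable_arrowEigs.comp
      (f := fun q : (Fin n → ℝ) × ℝ => ((eigsDesc B, q) : (Fin n → ℝ) × (Fin n → ℝ) × ℝ))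
      (measurable_const.prodMk measurable_id)
  refine Eq.trans ?_ (h.lintegral_comp (hf.comp hm))
  refine lintegral_congr fun p => ?_
  rw [eigsDesc_border_eq hB hU' hBU]
  simp [toComplexVec_realAction]

theorem lintegral_arrowNoise {n : ℕ} {f : (Fin n → ℝ) × ℝ → ℝ≥0∞} (hf : Measurable f) :
    ∫⁻ q, f q ∂arrowNoise n =
      ∫⁻ z in {z : Fin (n + 1) → ℝ | ∀ l : Fin n, 0 < z l.castSucc},
        ENNReal.ofReal ((√(2 * Real.pi))⁻¹ *
          Real.exp (-((∑ l : Fin n, z l.castSucc) + z (Fin.last n) ^ 2 / 2))) *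
        f (fun l => z l.castSucc, z (Fin.last n)) := by
  have hexp : expMeasure 1 = volume.withDensity (exponentialPDF 1) := rfl
  have hpdf : Measurable (exponentialPDF 1) := (measurable_exponentialPDFReal 1).ennreal_ofReal
  have : SigmaFinite ((volume : Measure ℝ).withDensity (exponentialPDF 1)) := by
    rw [← hexp]; infer_instance
  have hS : MeasurableSet {z : Fin (n + 1) → ℝ | ∀ l : Fin n, 0 < z l.castSucc} := by
    simp only [Set.ofPred_forall]
    exact MeasurableSet.iInter fun l => measurableSet_lt measurable_const (measurable_pi_apply _)
  have hmp := (Measure.measurePreserving_swap (μ := (volume : Measure ℝ))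
    (ν := (volume : Measure (Fin n → ℝ)))).comp
      (volume_preserving_piFinSuccAbove (fun _ : Fin (n + 1) => ℝ) (Fin.last n))
  have hprod : Measurable fun q : Fin n → ℝ => ∏ l, exponentialPDF 1 (q l) :=
    Finset.measurable_prod _ fun l _ => hpdf.comp (measurable_pi_apply l)
  rw [arrowNoise, hexp, pi_withDensity_fin _ hpdf,
    gaussianReal_of_var_ne_zero _ one_ne_zero, prod_withDensity hprod (measurable_gaussianPDF _ _),
    lintegral_withDensity_mul _ (ρ := fun q : (Fin n → ℝ) × ℝ =>
      (∏ l, exponentialPDF 1 (q.1 l)) * gaussianPDF 0 1 q.2) (by fun_prop) hf]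
  rw [← lintegral_indicator hS]
  refine (hmp.lintegral_comp (f := fun q => (∏ l, exponentialPDF 1 (q.1 l)) *
    gaussianPDF 0 1 q.2 * f q) (by fun_prop)).symm.trans ?_
  have hne : ∀ᵐ z : Fin (n + 1) → ℝ, ∀ l : Fin n, z l.castSucc ≠ 0 :=
    ae_all_iff.2 fun l => Measure.ae_eval_ne _ _ _
  refine lintegral_congr_ae ?_
  filter_upwards [hne] with z hz0
  have hz : (Prod.swap ∘ MeasurableEquiv.piFinSuccAbove (fun _ : Fin (n + 1) => ℝ) (Fin.last n)) z =
      (fun l => z l.castSucc, z (Fin.last n)) := by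
    refine Prod.ext (funext fun l => ?_) rfl
    show z ((Fin.last n).succAbove l) = _
    rw [Fin.succAbove_last]
  rw [hz]
  by_cases h : ∀ l : Fin n, 0 < z l.castSucc
  · rw [Set.indicator_of_mem (by exact h)]
    congr 1
    simp only [exponentialPDF_eq, (h _).le, if_true, gaussianPDF, one_mul]
    rw [← ENNReal.ofReal_prod_of_nonneg fun l _ => (Real.exp_pos _).le,
      ← ENNReal.ofReal_mul (Finset.prod_nonneg fun l _ => (Real.exp_pos _).le), ← Real.exp_sum]
    congr 1
    rw [gaussianPDFReal_def]
    simp only [Finset.sum_neg_distrib, NNReal.coe_one, mul_one, sub_zero]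
    rw [mul_left_comm, ← Real.exp_add]
    congr 2
    ring
  · rw [Set.indicator_of_notMem (by exact h)]
    push Not at h
    obtain ⟨l, hl⟩ := h
    have h0 : exponentialPDF 1 (z l.castSucc) = 0 := by
      simp [exponentialPDF_eq, not_le.2 (lt_of_le_of_ne hl (hz0 l))]
    rw [Finset.prod_eq_zero (Finset.mem_univ l) h0, zero_mul, zero_mul]

/-- The transition density from the eigenvalues of a GUE minor to those of the next one. -/
def gtKernel {n : ℕ} (μ : Fin n → ℝ) (ν : Fin (n + 1) → ℝ) : ℝ :=
  vand ν / vand μ * (√(2 * Real.pi))⁻¹ * Real.exp (-(∑ l, ν l ^ 2 - ∑ l, μ l ^ 2) / 2)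

theorem measurableSet_interlaces {n : ℕ} (μ : Fin n → ℝ) :
    MeasurableSet {ν : Fin (n + 1) → ℝ | Interlaces μ ν} := by
  simp only [Interlaces, Set.ofPred_forall]
  exact MeasurableSet.iInter fun l =>
    (measurableSet_lt (measurable_pi_apply _) measurable_const).inter
      (measurableSet_lt measurable_const (measurable_pi_apply _))

theorem lintegral_arrowEigs {n : ℕ} {μ : Fin n → ℝ} (hμ : StrictAnti μ)
    {f : (Fin (n + 1) → ℝ) → ℝ≥0∞} (hf : Measurable f) :
    ∫⁻ q, f (arrowEigs μ q.1 q.2) ∂arrowNoise n =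
      ∫⁻ ν in {ν | Interlaces μ ν}, ENNReal.ofReal (gtKernel μ ν) * f ν := by
  have hm : Measurable fun q : (Fin n → ℝ) × ℝ => arrowEigs μ q.1 q.2 :=
    measurable_arrowEigs.comp
      (f := fun q : (Fin n → ℝ) × ℝ => ((μ, q) : (Fin n → ℝ) × (Fin n → ℝ) × ℝ))
      (measurable_const.prodMk measurable_id)
  rw [lintegral_arrowNoise (f := fun q => f (arrowEigs μ q.1 q.2)) (hf.comp hm),
    ← arrowInv_image hμ,
    lintegral_image_eq_lintegral_abs_det_fderiv_mul _ (measurableSet_interlaces μ)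
      (fun ν _ => (hasFDerivAt_arrowInv μ ν).hasFDerivWithinAt)
      (fun ν hν ν' hν' h => arrowInv_injective hμ
        (Interlaces.strictAnti hν).antitone (Interlaces.strictAnti hν').antitone h)]
  refine setLIntegral_congr_fun (measurableSet_interlaces μ) fun ν hν => ?_
  have hν : Interlaces μ ν := hν
  have hE : (∑ l : Fin n, arrowInv μ ν l.castSucc) + arrowInv μ ν (Fin.last n) ^ 2 / 2 =
      (∑ l, ν l ^ 2 - ∑ l, μ l ^ 2) / 2 := by
    linarith [hν.energy]
  simp only [hν.arrowEigs_arrowInv]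
  rw [LinearMap.det_toContinuousLinearMap, LinearMap.det_toLin', abs_det_arrowJac hμ hν.strictAnti,
    ← mul_assoc, ← ENNReal.ofReal_mul (div_nonneg hν.strictAnti.vand_pos.le hμ.vand_pos.le), hE,
    gtKernel, neg_div, mul_assoc]

/-- The top-left `i × i` minor. -/
def topMinor {n i : ℕ} (M : Matrix (Fin n) (Fin n) ℂ) (h : i ≤ n) : Matrix (Fin i) (Fin i) ℂ :=
  Matrix.of fun a b => M (Fin.castLE h a) (Fin.castLE h b)

/-- The eigenvalues of all top-left minors, extended by zero: `pattern M i j` is the `j`-th largest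
eigenvalue of the `i × i` minor, counting from `j = 0`. -/
def pattern {n : ℕ} (M : Matrix (Fin n) (Fin n) ℂ) (i j : ℕ) : ℝ :=
  if h : j < i ∧ i ≤ n then eigsDesc (topMinor M h.2) ⟨j, h.1⟩ else 0

/-- The `i`-th row of a triangular array. -/
def patternRow (x : ℕ → ℕ → ℝ) (i : ℕ) (j : Fin i) : ℝ := x i j

/-- Replaces the row of length `n + 1`. -/
def appendRow (n : ℕ) (x : ℕ → ℕ → ℝ) (ν : Fin (n + 1) → ℝ) (i j : ℕ) : ℝ :=
  if i = n + 1 then (if h : j < n + 1 then ν ⟨j, h⟩ else 0) else x i j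

theorem topMinor_self {n : ℕ} (M : Matrix (Fin n) (Fin n) ℂ) : topMinor M le_rfl = M := rfl

theorem topMinor_border {n i : ℕ} (B : Matrix (Fin n) (Fin n) ℂ) (y : Fin n → ℂ) (d : ℝ)
    (h : i ≤ n) : topMinor (border B y d) (Nat.le_succ_of_le h) = topMinor B h := by
  ext a b
  have ha : ∀ a : Fin i, Fin.castLE (Nat.le_succ_of_le h) a =
      finSumFinEquiv (Sum.inl (Fin.castLE h a) : Fin n ⊕ Fin 1) := fun a => by
    ext; simp
  simp only [topMinor, border, Matrix.of_apply, Matrix.reindex_apply, Matrix.submatrix_apply, ha,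
    Equiv.symm_apply_apply, Matrix.fromBlocks_apply₁₁]

theorem pattern_border {n : ℕ} (B : Matrix (Fin n) (Fin n) ℂ) (y : Fin n → ℂ) (d : ℝ) :
    pattern (border B y d) = appendRow n (pattern B) (eigsDesc (border B y d)) := by
  funext i j
  unfold appendRow
  split_ifs with hi hj
  · subst hi
    rw [pattern, dif_pos ⟨hj, le_rfl⟩, topMinor_self]
  · subst hi
    rw [pattern, dif_neg (fun h => hj h.1)]
  · unfold pattern
    by_cases h : j < i ∧ i ≤ n
    · rw [dif_pos h, dif_pos ⟨h.1, Nat.le_succ_of_le h.2⟩, topMinor_border B y d h.2]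
    · rw [dif_neg h, dif_neg fun h' => h ⟨h'.1, by omega⟩]

theorem patternRow_pattern {n i : ℕ} (M : Matrix (Fin n) (Fin n) ℂ) (h : i ≤ n) :
    patternRow (pattern M) i = eigsDesc (topMinor M h) := by
  funext j
  rw [patternRow, pattern, dif_pos ⟨j.2, h⟩]

theorem measurable_topMinor {n i : ℕ} (h : i ≤ n) :
    Measurable fun M : Matrix (Fin n) (Fin n) ℂ => topMinor M h :=
  measurable_pi_iff.2 fun a => measurable_pi_iff.2 fun b =>
    measurable_matrix_entry (Fin.castLE h a) (Fin.castLE h b)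

theorem measurable_pattern (n : ℕ) :
    Measurable (pattern : Matrix (Fin n) (Fin n) ℂ → ℕ → ℕ → ℝ) := by
  refine measurable_pi_iff.2 fun i => measurable_pi_iff.2 fun j => ?_
  by_cases h : j < i ∧ i ≤ n
  · simp only [pattern, dif_pos h]
    exact (measurable_pi_apply _).comp ((measurable_eigsDesc i).comp (measurable_topMinor h.2))
  · simp only [pattern, dif_neg h]
    exact measurable_const

theorem measurable_appendRow (n : ℕ) :
    Measurable fun p : (ℕ → ℕ → ℝ) × (Fin (n + 1) → ℝ) => appendRow n p.1 p.2 := by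
  refine measurable_pi_iff.2 fun i => measurable_pi_iff.2 fun j => ?_
  unfold appendRow
  split_ifs <;> fun_prop

theorem measurable_patternRow (i : ℕ) : Measurable fun x : ℕ → ℕ → ℝ => patternRow x i := by
  unfold patternRow; fun_prop

theorem measurableSet_setOf_interlaces (n : ℕ) :
    MeasurableSet {p : (Fin n → ℝ) × (Fin (n + 1) → ℝ) | Interlaces p.1 p.2} := by
  simp only [Interlaces, Set.ofPred_forall]
  exact MeasurableSet.iInter fun l =>
    (measurableSet_lt (f := fun p : (Fin n → ℝ) × (Fin (n + 1) → ℝ) => p.2 l.succ)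
      (g := fun p => p.1 l) (by fun_prop) (by fun_prop)).inter
      (measurableSet_lt (f := fun p : (Fin n → ℝ) × (Fin (n + 1) → ℝ) => p.1 l)
        (g := fun p => p.2 l.castSucc) (by fun_prop) (by fun_prop))

theorem measurable_gtKernel (n : ℕ) :
    Measurable fun p : (Fin n → ℝ) × (Fin (n + 1) → ℝ) => gtKernel p.1 p.2 := by
  have h1 := (continuous_vand n).measurable
  have h2 := (continuous_vand (n + 1)).measurable
  unfold gtKernel
  fun_prop

theorem measurable_setLIntegral_interlaces {α : Type*} [MeasurableSpace α] {n : ℕ}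
    {μ : α → Fin n → ℝ} (hμ : Measurable μ) {f : α × (Fin (n + 1) → ℝ) → ℝ≥0∞}
    (hf : Measurable f) :
    Measurable fun x => ∫⁻ ν in {ν | Interlaces (μ x) ν}, f (x, ν) := by
  have : ∀ x, ∫⁻ ν in {ν | Interlaces (μ x) ν}, f (x, ν) =
      ∫⁻ ν, Set.indicator {p : α × (Fin (n + 1) → ℝ) | Interlaces (μ p.1) p.2} f (x, ν) := by
    intro x
    rw [← lintegral_indicator (measurableSet_interlaces _)]
    rfl
  simp only [this]
  refine Measurable.lintegral_prod_right' (hf.indicator ?_)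
  exact (measurableSet_setOf_interlaces n).preimage
    ((hμ.comp measurable_fst).prodMk measurable_snd)

theorem lintegral_gueMeasure_succ_of_ae_strictAnti {n : ℕ}
    (h : ∀ᵐ M ∂gueMeasure n, StrictAnti (eigsDesc M)) {f : (ℕ → ℕ → ℝ) → ℝ≥0∞}
    (hf : Measurable f) :
    ∫⁻ M, f (pattern M) ∂gueMeasure (n + 1) =
      ∫⁻ B, (∫⁻ ν in {ν | Interlaces (eigsDesc B) ν},
        ENNReal.ofReal (gtKernel (eigsDesc B) ν) * f (appendRow n (pattern B) ν))
          ∂gueMeasure n := by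
  have hg : Measurable fun M : Matrix (Fin (n + 1)) (Fin (n + 1)) ℂ => f (pattern M) :=
    hf.comp (measurable_pattern _)
  rw [← map_border_gueMeasure, lintegral_map hg (measurable_border n),
    lintegral_prod (fun p : Matrix (Fin n) (Fin n) ℂ × ((Fin n → ℝ × ℝ) × ℝ) =>
      f (pattern (border p.1 (toComplexVec p.2.1) p.2.2)))
      (hg.comp (measurable_border n)).aemeasurable]
  refine lintegral_congr_ae ?_
  filter_upwards [ae_isHermitian_gueMeasure n, h] with B hB hs
  simp only [pattern_border]
  have hF : Measurable fun ν => f (appendRow n (pattern B) ν) :=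
    hf.comp ((measurable_appendRow n).comp (measurable_const.prodMk measurable_id))
  rw [lintegral_eigsDesc_border hB hF, lintegral_arrowEigs hs hF]

theorem patternRow_appendRow {n : ℕ} (x : ℕ → ℕ → ℝ) (ν : Fin (n + 1) → ℝ) :
    patternRow (appendRow n x ν) (n + 1) = ν := by
  funext j
  rw [patternRow, appendRow, if_pos rfl, dif_pos j.2]

theorem patternRow_pattern_self {n : ℕ} (M : Matrix (Fin n) (Fin n) ℂ) :
    patternRow (pattern M) n = eigsDesc M := patternRow_pattern M le_rfl

theorem measurableSet_strictAnti (n : ℕ) : MeasurableSet {x : Fin n → ℝ | StrictAnti x} := by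
  have : {x : Fin n → ℝ | StrictAnti x} = ⋂ i, ⋂ j, ⋂ _ : i < j, {x | x j < x i} := by
    ext x
    simp only [Set.mem_iInter, StrictAnti]
    exact Iff.rfl
  rw [this]
  exact MeasurableSet.iInter fun i => MeasurableSet.iInter fun j => MeasurableSet.iInter fun _ =>
    measurableSet_lt (by fun_prop) (by fun_prop)

theorem ae_strictAnti_eigsDesc (n : ℕ) : ∀ᵐ M ∂gueMeasure n, StrictAnti (eigsDesc M) := by
  induction n with
  | zero => exact Filter.Eventually.of_forall fun M i => i.elim0
  | succ n ih =>
    have hS : MeasurableSet {x : ℕ → ℕ → ℝ | ¬ StrictAnti (patternRow x (n + 1))} :=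
      ((measurableSet_strictAnti (n + 1)).preimage (measurable_patternRow (n + 1))).compl
    have h := lintegral_gueMeasure_succ_of_ae_strictAnti ih (f := Set.indicator _ fun _ => 1)
      (measurable_const.indicator hS)
    have h0 : ∫⁻ M, Set.indicator {x : ℕ → ℕ → ℝ | ¬ StrictAnti (patternRow x (n + 1))}
        (fun _ => 1) (pattern M) ∂gueMeasure (n + 1) = 0 := by
      rw [h]
      refine (lintegral_congr fun B => ?_).trans lintegral_zero
      refine (setLIntegral_congr_fun (measurableSet_interlaces _) (g := fun _ => 0)
        fun ν hν => ?_).trans (by simp)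
      have : appendRow n (pattern B) ν ∉
          {x : ℕ → ℕ → ℝ | ¬ StrictAnti (patternRow x (n + 1))} := by
        simp only [Set.mem_ofPred_eq, patternRow_appendRow, not_not]
        exact Interlaces.strictAnti hν
      simp [this]
    filter_upwards [(lintegral_eq_zero_iff
      ((measurable_const.indicator hS).comp (measurable_pattern _))).1 h0] with M hM
    by_contra hcon
    rw [← patternRow_pattern_self] at hcon
    simp [Set.indicator_of_mem (show pattern M ∈ {x : ℕ → ℕ → ℝ |
      ¬ StrictAnti (patternRow x (n + 1))} from hcon)] at hM

theorem lintegral_gueMeasure_succ {n : ℕ} {f : (ℕ → ℕ → ℝ) → ℝ≥0∞} (hf : Measurable f) :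
    ∫⁻ M, f (pattern M) ∂gueMeasure (n + 1) =
      ∫⁻ B, (∫⁻ ν in {ν | Interlaces (eigsDesc B) ν},
        ENNReal.ofReal (gtKernel (eigsDesc B) ν) * f (appendRow n (pattern B) ν))
          ∂gueMeasure n :=
  lintegral_gueMeasure_succ_of_ae_strictAnti (ae_strictAnti_eigsDesc n) hf

/-- The first `n` rows of the array interlace strictly. -/
def GTPattern (n : ℕ) (x : ℕ → ℕ → ℝ) : Prop :=
  ∀ i < n, Interlaces (patternRow x i) (patternRow x (i + 1))

theorem measurableSet_gtPattern (n : ℕ) : MeasurableSet {x | GTPattern n x} := by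
  simp only [GTPattern, Set.ofPred_forall]
  exact MeasurableSet.iInter fun i => MeasurableSet.iInter fun _ =>
    (measurableSet_setOf_interlaces i).preimage
      ((measurable_patternRow i).prodMk (measurable_patternRow (i + 1)))

theorem patternRow_appendRow_of_le {n i : ℕ} (hi : i ≤ n) (x : ℕ → ℕ → ℝ)
    (ν : Fin (n + 1) → ℝ) : patternRow (appendRow n x ν) i = patternRow x i := by
  funext j
  rw [patternRow, appendRow, if_neg (by omega), patternRow]

theorem gtPattern_appendRow {n : ℕ} {x : ℕ → ℕ → ℝ} {ν : Fin (n + 1) → ℝ} (hx : GTPattern n x)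
    (hν : Interlaces (patternRow x n) ν) : GTPattern (n + 1) (appendRow n x ν) := by
  intro i hi
  rcases Nat.lt_succ_iff_lt_or_eq.1 hi with h | rfl
  · rw [patternRow_appendRow_of_le h.le, patternRow_appendRow_of_le h]
    exact hx i h
  · rw [patternRow_appendRow_of_le le_rfl, patternRow_appendRow]
    exact hν

theorem ae_gtPattern (n : ℕ) : ∀ᵐ M ∂gueMeasure n, GTPattern n (pattern M) := by
  induction n with
  | zero => exact Filter.Eventually.of_forall fun M i hi => absurd hi (Nat.not_lt_zero i)
  | succ n ih =>
    have hS : MeasurableSet {x : ℕ → ℕ → ℝ | ¬ GTPattern (n + 1) x} :=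
      (measurableSet_gtPattern (n + 1)).compl
    have h := lintegral_gueMeasure_succ (n := n) (f := Set.indicator _ fun _ => 1)
      (measurable_const.indicator hS)
    have h0 : ∫⁻ M, Set.indicator {x : ℕ → ℕ → ℝ | ¬ GTPattern (n + 1) x}
        (fun _ => 1) (pattern M) ∂gueMeasure (n + 1) = 0 := by
      rw [h]
      refine (lintegral_congr_ae ?_).trans lintegral_zero
      filter_upwards [ih] with B hB
      refine (setLIntegral_congr_fun (measurableSet_interlaces _) (g := fun _ => 0)
        fun ν hν => ?_).trans (by simp)
      have : appendRow n (pattern B) ν ∉ {x : ℕ → ℕ → ℝ | ¬ GTPattern (n + 1) x} := by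
        simp only [Set.mem_ofPred_eq, not_not]
        exact gtPattern_appendRow hB (by rw [patternRow_pattern_self]; exact hν)
      simp [this]
    filter_upwards [(lintegral_eq_zero_iff
      ((measurable_const.indicator hS).comp (measurable_pattern _))).1 h0] with M hM
    by_contra hcon
    simp [Set.indicator_of_mem (show pattern M ∈ {x : ℕ → ℕ → ℝ |
      ¬ GTPattern (n + 1) x} from hcon)] at hM

theorem Interlaces.midpoint {n : ℕ} {μ μ' : Fin n → ℝ} {ν ν' : Fin (n + 1) → ℝ}
    (hν : Interlaces μ ν) (hν' : Interlaces μ' ν') :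
    Interlaces ((1 / 2 : ℝ) • (μ + μ')) ((1 / 2 : ℝ) • (ν + ν')) := by
  intro l
  simp only [Pi.smul_apply, Pi.add_apply, smul_eq_mul]
  constructor
  · linarith [(hν l).1, (hν' l).1]
  · linarith [(hν l).2, (hν' l).2]

/-- The unnormalised log-concave weight `vand x * exp (-|x|² / 2)`. -/
def rowWeight {n : ℕ} (x : Fin n → ℝ) : ℝ := vand x * Real.exp (-(∑ l, x l ^ 2) / 2)

theorem StrictAnti.rowWeight_pos {n : ℕ} {x : Fin n → ℝ} (h : StrictAnti x) : 0 < rowWeight x :=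
  mul_pos h.vand_pos (Real.exp_pos _)

theorem gtKernel_eq {n : ℕ} (μ : Fin n → ℝ) (ν : Fin (n + 1) → ℝ) :
    gtKernel μ ν = rowWeight ν * (rowWeight μ)⁻¹ * (√(2 * Real.pi))⁻¹ := by
  have : -(∑ l, ν l ^ 2 - ∑ l, μ l ^ 2) / 2 = -(∑ l, ν l ^ 2) / 2 - -(∑ l, μ l ^ 2) / 2 := by ring
  rw [gtKernel, rowWeight, rowWeight, this, Real.exp_sub, mul_inv, div_eq_mul_inv, div_eq_mul_inv]
  ring

theorem mul_le_sq_midpoint (a b : ℝ) : a * b ≤ ((1 / 2 : ℝ) * (a + b)) ^ 2 := by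
  nlinarith [sq_nonneg (a - b)]

theorem StrictAnti.midpoint {n : ℕ} {x y : Fin n → ℝ} (hx : StrictAnti x) (hy : StrictAnti y) :
    StrictAnti ((1 / 2 : ℝ) • (x + y)) := fun i j hij => by
  simp only [Pi.smul_apply, Pi.add_apply, smul_eq_mul]
  linarith [hx hij, hy hij]

theorem StrictAnti.vand_mul_le {n : ℕ} {x y : Fin n → ℝ} (hx : StrictAnti x) (hy : StrictAnti y) :
    vand x * vand y ≤ vand ((1 / 2 : ℝ) • (x + y)) ^ 2 := by
  unfold vand
  rw [← Finset.prod_mul_distrib, ← Finset.prod_pow]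
  refine Finset.prod_le_prod (fun i _ => mul_nonneg ?_ ?_) fun i _ => ?_
  · exact Finset.prod_nonneg fun j hj => (sub_pos.2 (hx (Finset.mem_Ioi.1 hj))).le
  · exact Finset.prod_nonneg fun j hj => (sub_pos.2 (hy (Finset.mem_Ioi.1 hj))).le
  · rw [← Finset.prod_mul_distrib, ← Finset.prod_pow]
    refine Finset.prod_le_prod (fun j hj => mul_nonneg ?_ ?_) fun j _ => ?_
    · exact (sub_pos.2 (hx (Finset.mem_Ioi.1 hj))).le
    · exact (sub_pos.2 (hy (Finset.mem_Ioi.1 hj))).le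
    · refine (mul_le_sq_midpoint _ _).trans_eq ?_
      simp only [Pi.smul_apply, Pi.add_apply, smul_eq_mul]
      ring

theorem exp_neg_sum_sq_mul_le {n : ℕ} (x y : Fin n → ℝ) :
    Real.exp (-(∑ l, x l ^ 2) / 2) * Real.exp (-(∑ l, y l ^ 2) / 2) ≤
      Real.exp (-(∑ l, ((1 / 2 : ℝ) • (x + y)) l ^ 2) / 2) ^ 2 := by
  rw [← Real.exp_add, ← Real.exp_nat_mul, Real.exp_le_exp]
  have : ∑ l, ((1 / 2 : ℝ) • (x + y)) l ^ 2 ≤ ∑ l, (x l ^ 2 / 2 + y l ^ 2 / 2) :=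
    Finset.sum_le_sum fun l _ => by
      simp only [Pi.smul_apply, Pi.add_apply, smul_eq_mul]
      nlinarith [sq_nonneg (x l - y l)]
  rw [Finset.sum_add_distrib, ← Finset.sum_div, ← Finset.sum_div] at this
  push_cast
  linarith

theorem StrictAnti.rowWeight_mul_le {n : ℕ} {x y : Fin n → ℝ} (hx : StrictAnti x)
    (hy : StrictAnti y) : rowWeight x * rowWeight y ≤ rowWeight ((1 / 2 : ℝ) • (x + y)) ^ 2 := by
  unfold rowWeight
  rw [mul_mul_mul_comm, mul_pow]
  exact mul_le_mul (hx.vand_mul_le hy) (exp_neg_sum_sq_mul_le x y) (by positivity) (sq_nonneg _)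

theorem measurable_rowWeight (n : ℕ) : Measurable (rowWeight : (Fin n → ℝ) → ℝ) := by
  have := (continuous_vand n).measurable
  unfold rowWeight
  fun_prop

theorem patternRow_midpoint (x y : ℕ → ℕ → ℝ) (i : ℕ) :
    patternRow ((1 / 2 : ℝ) • (x + y)) i = (1 / 2 : ℝ) • (patternRow x i + patternRow y i) := rfl

theorem appendRow_midpoint {n : ℕ} (x y : ℕ → ℕ → ℝ) (ν ν' : Fin (n + 1) → ℝ) :
    appendRow n ((1 / 2 : ℝ) • (x + y)) ((1 / 2 : ℝ) • (ν + ν')) =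
      (1 / 2 : ℝ) • (appendRow n x ν + appendRow n y ν') := by
  funext i j
  simp only [appendRow, Pi.smul_apply, Pi.add_apply]
  split_ifs <;> simp

/-- The function obtained by integrating out the last row against Lebesgue measure. -/
def integrateRow (n : ℕ) (f : (ℕ → ℕ → ℝ) → ℝ≥0∞) (x : ℕ → ℕ → ℝ) : ℝ≥0∞ :=
  ∫⁻ ν in {ν | Interlaces (patternRow x n) ν}, f (appendRow n x ν)

theorem measurable_integrateRow (n : ℕ) {f : (ℕ → ℕ → ℝ) → ℝ≥0∞} (hf : Measurable f) :
    Measurable (integrateRow n f) :=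
  measurable_setLIntegral_interlaces (f := fun p => f (appendRow n p.1 p.2))
    (measurable_patternRow n) (hf.comp (measurable_appendRow n))

theorem lintegral_gue_succ_div_rowWeight {n : ℕ} {f : (ℕ → ℕ → ℝ) → ℝ≥0∞} (hf : Measurable f) :
    ∫⁻ M, f (pattern M) * (ENNReal.ofReal (rowWeight (eigsDesc M)))⁻¹ ∂gueMeasure (n + 1) =
      ENNReal.ofReal (√(2 * Real.pi))⁻¹ * ∫⁻ B, integrateRow n f (pattern B) *
        (ENNReal.ofReal (rowWeight (eigsDesc B)))⁻¹ ∂gueMeasure n := by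
  have hW : ∀ n, Measurable fun x : ℕ → ℕ → ℝ =>
      (ENNReal.ofReal (rowWeight (patternRow x n)))⁻¹ := fun n =>
    ((measurable_rowWeight n).comp (measurable_patternRow n)).ennreal_ofReal.inv
  have hmeas : Measurable fun B : Matrix (Fin n) (Fin n) ℂ => integrateRow n f (pattern B) *
      (ENNReal.ofReal (rowWeight (eigsDesc B)))⁻¹ :=
    ((measurable_integrateRow n hf).comp (measurable_pattern n)).mul
      ((measurable_rowWeight n).comp (measurable_eigsDesc n)).ennreal_ofReal.inv
  have h := lintegral_gueMeasure_succ (n := n)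
    (f := fun x => f x * (ENNReal.ofReal (rowWeight (patternRow x (n + 1))))⁻¹) (hf.mul (hW _))
  simp only [patternRow_pattern_self, patternRow_appendRow] at h
  rw [h, ← lintegral_const_mul _ hmeas]
  refine lintegral_congr_ae ?_
  filter_upwards [ae_strictAnti_eigsDesc n] with B hB
  have hmν : Measurable fun ν => f (appendRow n (pattern B) ν) :=
    hf.comp ((measurable_appendRow n).comp (measurable_const.prodMk measurable_id))
  rw [integrateRow, patternRow_pattern_self, mul_comm (∫⁻ ν in _, _), ← mul_assoc,
    ← lintegral_const_mul _ hmν]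
  refine setLIntegral_congr_fun (measurableSet_interlaces _) fun ν hν => ?_
  have hν : Interlaces (eigsDesc B) ν := hν
  have hp := hν.strictAnti.rowWeight_pos
  rw [gtKernel_eq, mul_assoc, ENNReal.ofReal_mul hp.le,
    ENNReal.ofReal_mul (inv_nonneg.2 hB.rowWeight_pos.le),
    ENNReal.ofReal_inv_of_pos hB.rowWeight_pos]
  have h1 : ENNReal.ofReal (rowWeight ν) * (ENNReal.ofReal (rowWeight ν))⁻¹ = 1 :=
    ENNReal.mul_inv_cancel (ENNReal.ofReal_pos.2 hp).ne' ENNReal.ofReal_ne_top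
  calc _ = (ENNReal.ofReal (rowWeight ν) * (ENNReal.ofReal (rowWeight ν))⁻¹) *
        (ENNReal.ofReal (√(2 * Real.pi))⁻¹ * (ENNReal.ofReal (rowWeight (eigsDesc B)))⁻¹ *
          f (appendRow n (pattern B) ν)) := by ring
    _ = _ := by rw [h1, one_mul]

theorem prekopaLeindler_pattern_div (n : ℕ) : ∀ f g h : (ℕ → ℕ → ℝ) → ℝ≥0∞,
    Measurable f → Measurable g → Measurable h →
    (∀ x y, GTPattern n x → GTPattern n y → f x * g y ≤ h ((1 / 2 : ℝ) • (x + y)) ^ 2) →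
    (∫⁻ M, f (pattern M) * (ENNReal.ofReal (rowWeight (eigsDesc M)))⁻¹ ∂gueMeasure n) *
      (∫⁻ M, g (pattern M) * (ENNReal.ofReal (rowWeight (eigsDesc M)))⁻¹ ∂gueMeasure n) ≤
      (∫⁻ M, h (pattern M) * (ENNReal.ofReal (rowWeight (eigsDesc M)))⁻¹ ∂gueMeasure n) ^ 2 := by
  induction n with
  | zero =>
    intro f g h hf hg hh H
    have hx : ∀ M : Matrix (Fin 0) (Fin 0) ℂ, pattern M = 0 := fun M => by
      funext i j
      rw [pattern, dif_neg (by omega)]; rfl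
    have hw : ∀ M : Matrix (Fin 0) (Fin 0) ℂ, rowWeight (eigsDesc M) = 1 := fun M => by
      simp [rowWeight, vand]
    simp only [hx, hw, lintegral_const, measure_univ, mul_one, ENNReal.ofReal_one, inv_one]
    have := H 0 0 (fun i hi => absurd hi (Nat.not_lt_zero i))
      (fun i hi => absurd hi (Nat.not_lt_zero i))
    simpa using this
  | succ n ih =>
    intro f g h hf hg hh H
    simp only [lintegral_gue_succ_div_rowWeight hf, lintegral_gue_succ_div_rowWeight hg,
      lintegral_gue_succ_div_rowWeight hh]
    rw [mul_mul_mul_comm, mul_pow, ← sq]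
    refine mul_le_mul_right (ih _ _ _ (measurable_integrateRow n hf) (measurable_integrateRow n hg)
      (measurable_integrateRow n hh) fun x y hx hy => ?_) _
    simp only [integrateRow]
    rw [← lintegral_indicator (measurableSet_interlaces _),
      ← lintegral_indicator (measurableSet_interlaces _),
      ← lintegral_indicator (measurableSet_interlaces _)]
    have hm : ∀ (f : (ℕ → ℕ → ℝ) → ℝ≥0∞) (x : ℕ → ℕ → ℝ), Measurable f →
        Measurable fun ν => f (appendRow n x ν) := fun f x hf =>
      hf.comp ((measurable_appendRow n).comp (measurable_const.prodMk measurable_id))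
    refine prekopaLeindler_pi (Fin (n + 1)) _ _ _
      ((hm f x hf).indicator (measurableSet_interlaces _))
      ((hm g y hg).indicator (measurableSet_interlaces _))
      ((hm h _ hh).indicator (measurableSet_interlaces _)) fun ν ν' => ?_
    by_cases h1 : Interlaces (patternRow x n) ν
    · by_cases h2 : Interlaces (patternRow y n) ν'
      · rw [Set.indicator_of_mem (by exact h1), Set.indicator_of_mem (by exact h2),
          Set.indicator_of_mem (by exact h1.midpoint h2), appendRow_midpoint]
        exact H _ _ (gtPattern_appendRow hx h1) (gtPattern_appendRow hy h2)
      · rw [Set.indicator_of_notMem (s := {ν | Interlaces (patternRow y n) ν}) (by exact h2)]; simp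
    · rw [Set.indicator_of_notMem (s := {ν | Interlaces (patternRow x n) ν}) (by exact h1)]; simp

/-- The Prékopa–Leindler inequality for the joint law of the eigenvalues of all minors. -/
theorem prekopaLeindler_pattern {n : ℕ} {f g h : (ℕ → ℕ → ℝ) → ℝ≥0∞}
    (hf : Measurable f) (hg : Measurable g) (hh : Measurable h)
    (H : ∀ x y, GTPattern n x → GTPattern n y → f x * g y ≤ h ((1 / 2 : ℝ) • (x + y)) ^ 2) :
    (∫⁻ M, f (pattern M) ∂gueMeasure n) * (∫⁻ M, g (pattern M) ∂gueMeasure n) ≤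
      (∫⁻ M, h (pattern M) ∂gueMeasure n) ^ 2 := by
  have hW : Measurable fun x : ℕ → ℕ → ℝ => ENNReal.ofReal (rowWeight (patternRow x n)) :=
    ((measurable_rowWeight n).comp (measurable_patternRow n)).ennreal_ofReal
  have key : ∀ f : (ℕ → ℕ → ℝ) → ℝ≥0∞, ∫⁻ M, f (pattern M) ∂gueMeasure n =
      ∫⁻ M, f (pattern M) * ENNReal.ofReal (rowWeight (patternRow (pattern M) n)) *
        (ENNReal.ofReal (rowWeight (eigsDesc M)))⁻¹ ∂gueMeasure n := by
    intro f
    refine lintegral_congr_ae ?_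
    filter_upwards [ae_strictAnti_eigsDesc n] with M hM
    rw [patternRow_pattern_self, mul_assoc, ENNReal.mul_inv_cancel
      (ENNReal.ofReal_pos.2 hM.rowWeight_pos).ne' ENNReal.ofReal_ne_top, mul_one]
  rw [key f, key g, key h]
  refine prekopaLeindler_pattern_div n (fun x => f x * ENNReal.ofReal (rowWeight (patternRow x n)))
    (fun x => g x * ENNReal.ofReal (rowWeight (patternRow x n)))
    (fun x => h x * ENNReal.ofReal (rowWeight (patternRow x n))) (hf.mul hW) (hg.mul hW)
    (hh.mul hW) fun x y hx hy => ?_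
  rw [mul_mul_mul_comm, mul_pow]
  have hanti : ∀ x, GTPattern n x → StrictAnti (patternRow x n) := by
    intro x hx
    rcases n with _ | n
    · exact fun i => i.elim0
    · exact (hx n n.lt_succ_self).strictAnti
  refine mul_le_mul' (H x y hx hy) ?_
  rw [← ENNReal.ofReal_mul (hanti x hx).rowWeight_pos.le, patternRow_midpoint]
  refine (ENNReal.ofReal_le_ofReal ((hanti x hx).rowWeight_mul_le (hanti y hy))).trans_eq ?_
  rw [ENNReal.ofReal_pow ((hanti x hx).midpoint (hanti y hy)).rowWeight_pos.le]

theorem measurePreserving_topMinor {n i : ℕ} (h : i ≤ n) :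
    MeasurePreserving (fun M : Matrix (Fin n) (Fin n) ℂ => topMinor M h) (gueMeasure n)
      (gueMeasure i) := by
  induction n, h using Nat.le_induction with
  | base => exact MeasurePreserving.id _
  | succ n h ih =>
    refine ⟨measurable_topMinor _, ?_⟩
    rw [← map_border_gueMeasure, Measure.map_map (measurable_topMinor _) (measurable_border n)]
    have : (fun M => topMinor M (Nat.le_succ_of_le h)) ∘
        (fun p : Matrix (Fin n) (Fin n) ℂ × ((Fin n → ℝ × ℝ) × ℝ) =>
          border p.1 (toComplexVec p.2.1) p.2.2) = (fun M => topMinor M h) ∘ Prod.fst := by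
      funext p
      exact topMinor_border _ _ _ h
    rw [this]
    exact (ih.comp (measurePreserving_fst (ν := borderNoise n))).map_eq

theorem pattern_topMinor {n i k : ℕ} (M : Matrix (Fin n) (Fin n) ℂ) (h : i ≤ n) (hk : k ≤ i) :
    pattern (topMinor M h) k = pattern M k := by
  funext j
  unfold pattern
  by_cases hj : j < k
  · rw [dif_pos ⟨hj, hk⟩, dif_pos ⟨hj, hk.trans h⟩]
    rfl
  · rw [dif_neg (fun h => hj h.1), dif_neg (fun h => hj h.1)]

theorem integral_pi_det {n : ℕ} (m : Fin n → Measure ℝ) [∀ i, SigmaFinite (m i)]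
    (φ : Fin n → ℝ → ℝ) (hφ : ∀ i k, Integrable (φ k) (m i)) :
    ∫ x, (Matrix.of fun i k => φ k (x i)).det ∂Measure.pi m =
      (Matrix.of fun i k => ∫ t, φ k t ∂m i).det := by
  have hdet : ∀ A : Matrix (Fin n) (Fin n) ℝ,
      A.det = ∑ σ : Equiv.Perm (Fin n), (Equiv.Perm.sign σ : ℝ) * ∏ i, A i (σ i) := fun A => by
    rw [← Matrix.det_transpose, Matrix.det_apply']
    rfl
  simp only [hdet, Matrix.of_apply]
  rw [integral_finsetSum _ fun σ _ =>
    (Integrable.fintype_prod (f := fun i => φ (σ i)) fun i => hφ i (σ i)).const_mul _]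
  refine Finset.sum_congr rfl fun σ _ => ?_
  rw [integral_const_mul, integral_fintype_prod_eq_prod fun i => φ (σ i)]

theorem det_sub_pow_succ {n : ℕ} (v : Fin (n + 1) → ℝ) :
    (Matrix.of fun l k : Fin n => v l.succ ^ ((k : ℕ) + 1) - v l.castSucc ^ ((k : ℕ) + 1)).det =
      (Matrix.vandermonde v).det := by
  let B : Matrix (Fin (n + 1)) (Fin (n + 1)) ℝ := Matrix.of fun i k =>
    Fin.cases (motive := fun _ => ℝ) (v 0 ^ (k : ℕ))
      (fun l => v l.succ ^ (k : ℕ) - v l.castSucc ^ (k : ℕ)) i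
  have h := Matrix.det_eq_of_forall_row_eq_smul_add_pred (A := Matrix.vandermonde v) (B := B)
    (fun _ => 1) (fun j => by simp [B, Matrix.vandermonde_apply])
    (fun i j => by simp [B, Matrix.vandermonde_apply])
  rw [h, Matrix.det_succ_column_zero, Fin.sum_univ_succ, Finset.sum_eq_zero]
  · simp only [B, Matrix.of_apply, Fin.cases_zero, Fin.val_zero, pow_zero, one_mul, add_zero]
    congr 1
  · intro l _
    simp [B]

theorem setOf_interlaces_eq_pi {n : ℕ} (ν : Fin (n + 1) → ℝ) :
    {μ : Fin n → ℝ | Interlaces μ ν} =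
      Set.univ.pi fun l => Set.Ioo (ν l.succ) (ν l.castSucc) := by
  ext μ
  simp [Interlaces, Set.mem_pi]

theorem setIntegral_vand_interlaces {n : ℕ} {ν : Fin (n + 1) → ℝ} (hν : StrictAnti ν) :
    ∫ μ in {μ | Interlaces μ ν}, vand μ = (∏ k : Fin n, ((k : ℝ) + 1))⁻¹ * vand ν := by
  have hle : ∀ l : Fin n, ν l.succ ≤ ν l.castSucc := fun l => (hν Fin.castSucc_lt_succ).le
  have hv : ∀ x : Fin n → ℝ, vand x =
      (Matrix.of fun i k : Fin n => (fun t : ℝ => (-t) ^ (k : ℕ)) (x i)).det := fun x => by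
    rw [vand_eq_det]; rfl
  have hint : ∀ (l k : Fin n), ∫ t in Set.Ioo (ν l.succ) (ν l.castSucc), (-t) ^ (k : ℕ) =
      ((k : ℝ) + 1)⁻¹ * ((-ν) l.succ ^ ((k : ℕ) + 1) - (-ν) l.castSucc ^ ((k : ℕ) + 1)) := by
    intro l k
    rw [← integral_Ioc_eq_integral_Ioo, ← intervalIntegral.integral_of_le (hle l),
      intervalIntegral.integral_comp_neg (fun t => t ^ (k : ℕ)), integral_pow, Pi.neg_apply,
      Pi.neg_apply, div_eq_inv_mul]
  rw [setOf_interlaces_eq_pi, volume_pi, Measure.restrict_pi_pi]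
  rw [integral_congr_ae (Filter.Eventually.of_forall hv)]
  rw [integral_pi_det _ (fun (k : Fin n) t => (-t) ^ (k : ℕ)) fun i k => ?_]
  · simp only [hint]
    rw [vand_eq_det, ← det_sub_pow_succ, ← Finset.prod_inv_distrib, ← Matrix.det_mul_row]
    rfl
  · exact (Continuous.integrableOn_Icc (by fun_prop)).mono_set Set.Ioo_subset_Icc_self

theorem measurableSet_setOf_interlaces_left {n : ℕ} (ν : Fin (n + 1) → ℝ) :
    MeasurableSet {μ : Fin n → ℝ | Interlaces μ ν} := by
  rw [setOf_interlaces_eq_pi]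
  exact MeasurableSet.univ_pi fun _ => measurableSet_Ioo

theorem setLIntegral_vand_interlaces {n : ℕ} {ν : Fin (n + 1) → ℝ} (hν : StrictAnti ν) :
    ∫⁻ μ in {μ | Interlaces μ ν}, ENNReal.ofReal (vand μ) =
      ENNReal.ofReal ((∏ k : Fin n, ((k : ℝ) + 1))⁻¹ * vand ν) := by
  rw [← setIntegral_vand_interlaces hν, ofReal_integral_eq_lintegral_ofReal]
  · have hc : IntegrableOn (vand : (Fin n → ℝ) → ℝ)
        (Set.univ.pi fun l => Set.Icc (ν l.succ) (ν l.castSucc)) :=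
      (continuous_vand n).continuousOn.integrableOn_compact
        (isCompact_univ_pi fun _ => isCompact_Icc)
    rw [setOf_interlaces_eq_pi]
    exact hc.mono_set (Set.pi_mono fun _ _ => Set.Ioo_subset_Icc_self)
  · exact (ae_restrict_iff' (measurableSet_setOf_interlaces_left ν)).2
      (Filter.Eventually.of_forall fun μ hμ => (Interlaces.strictAnti_left hμ).vand_pos.le)

/-- The unnormalised density of the eigenvalues of a GUE matrix. -/
def rowDensity {n : ℕ} (x : Fin n → ℝ) : ℝ := vand x ^ 2 * Real.exp (-(∑ l, x l ^ 2) / 2)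

theorem measurable_rowDensity (n : ℕ) : Measurable (rowDensity : (Fin n → ℝ) → ℝ) := by
  have := (continuous_vand n).measurable
  unfold rowDensity
  fun_prop

theorem rowDensity_nonneg {n : ℕ} (x : Fin n → ℝ) : 0 ≤ rowDensity x := by
  unfold rowDensity; positivity

theorem measurable_gtKernel_right {n : ℕ} (μ : Fin n → ℝ) :
    Measurable fun ν : Fin (n + 1) → ℝ => gtKernel μ ν := by
  have h2 := (continuous_vand (n + 1)).measurable
  unfold gtKernel
  fun_prop

theorem exists_lintegral_eigsDesc_gueMeasure (n : ℕ) : ∃ c : ℝ, 0 < c ∧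
    ∀ f : (Fin n → ℝ) → ℝ≥0∞, Measurable f →
      ∫⁻ M, f (eigsDesc M) ∂gueMeasure n =
        ENNReal.ofReal c * ∫⁻ x in {x | StrictAnti x}, ENNReal.ofReal (rowDensity x) * f x := by
  induction n with
  | zero =>
    refine ⟨1, one_pos, fun f hf => ?_⟩
    have hs : {x : Fin 0 → ℝ | StrictAnti x} = Set.univ :=
      Set.eq_univ_of_forall fun x i => i.elim0
    have hx : ∀ x : Fin 0 → ℝ, x = default := fun x => Subsingleton.elim _ _
    have h1 : ∀ x : Fin 0 → ℝ, rowDensity x = 1 := fun x => by simp [rowDensity, vand]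
    have h2 : ∀ x : Fin 0 → ℝ, f x = f default := fun x => by rw [hx x]
    simp only [hs, h1, h2]
    simp [volume_pi]
  | succ n ih =>
    obtain ⟨c, hc, ih⟩ := ih
    set p : ℝ := (∏ k : Fin n, ((k : ℝ) + 1))⁻¹ with hp
    have hp0 : 0 < p := by positivity
    set s : ℝ := (√(2 * Real.pi))⁻¹ with hs
    have hs0 : 0 < s := by positivity
    refine ⟨c * (p * s), by positivity, fun f hf => ?_⟩
    have h := lintegral_gueMeasure_succ (n := n) (f := fun x => f (patternRow x (n + 1)))
      (hf.comp (measurable_patternRow _))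
    simp only [patternRow_pattern_self, patternRow_appendRow] at h
    have hK : Measurable fun q : (Fin n → ℝ) × (Fin (n + 1) → ℝ) =>
        ENNReal.ofReal (gtKernel q.1 q.2) * f q.2 :=
      (measurable_gtKernel n).ennreal_ofReal.mul (hf.comp measurable_snd)
    have hK' : ∀ μ : Fin n → ℝ, Measurable fun ν => ENNReal.ofReal (gtKernel μ ν) * f ν :=
      fun μ => (measurable_gtKernel_right μ).ennreal_ofReal.mul hf
    rw [h, ih (fun μ => ∫⁻ ν in {ν | Interlaces μ ν}, ENNReal.ofReal (gtKernel μ ν) * f ν)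
      (measurable_setLIntegral_interlaces (μ := fun μ => μ) measurable_id hK),
      ENNReal.ofReal_mul hc.le, mul_assoc]
    congr 1
    let J : (Fin n → ℝ) → (Fin (n + 1) → ℝ) → ℝ≥0∞ := fun μ ν =>
      Set.indicator {q : (Fin n → ℝ) × (Fin (n + 1) → ℝ) | Interlaces q.1 q.2}
        (fun q => ENNReal.ofReal (vand q.1) *
          (ENNReal.ofReal s * ENNReal.ofReal (rowWeight q.2) * f q.2)) (μ, ν)
    have hJ : Measurable (Function.uncurry J) := by
      refine Measurable.indicator ?_ (measurableSet_setOf_interlaces n)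
      exact ((continuous_vand n).measurable.comp measurable_fst).ennreal_ofReal.mul
        ((measurable_const.mul ((measurable_rowWeight _).comp measurable_snd).ennreal_ofReal).mul
          (hf.comp measurable_snd))
    calc ∫⁻ μ in {x | StrictAnti x}, ENNReal.ofReal (rowDensity μ) *
          ∫⁻ ν in {ν | Interlaces μ ν}, ENNReal.ofReal (gtKernel μ ν) * f ν
        = ∫⁻ μ, ∫⁻ ν, J μ ν := by
          rw [← lintegral_indicator (measurableSet_strictAnti n)]
          refine lintegral_congr fun μ => ?_
          by_cases hμ : StrictAnti μ
          · rw [Set.indicator_of_mem (by exact hμ), ← lintegral_const_mul _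
              (f := fun ν => ENNReal.ofReal (gtKernel μ ν) * f ν)
              (hK' μ),
              ← lintegral_indicator (measurableSet_interlaces μ)]
            refine lintegral_congr fun ν => ?_
            by_cases hν : Interlaces μ ν
            · rw [Set.indicator_of_mem (by exact hν)]
              simp only [J]
              rw [Set.indicator_of_mem (by exact hν)]
              have hw := hμ.rowWeight_pos
              have hd : rowDensity μ * gtKernel μ ν = vand μ * (s * rowWeight ν) := by
                have : rowDensity μ = vand μ * rowWeight μ := by
                  rw [rowDensity, rowWeight]; ring
                rw [gtKernel_eq, this, ← hs]
                field_simp [hw.ne']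
              rw [← mul_assoc, ← ENNReal.ofReal_mul (rowDensity_nonneg μ), hd,
                ENNReal.ofReal_mul hμ.vand_pos.le, ENNReal.ofReal_mul hs0.le, mul_assoc]
            · rw [Set.indicator_of_notMem (by exact hν)]
              simp only [J]
              rw [Set.indicator_of_notMem (by exact hν)]
          · rw [Set.indicator_of_notMem (by exact hμ)]
            refine (lintegral_eq_zero_of_ae_eq_zero (Filter.Eventually.of_forall fun ν => ?_)).symm
            exact Set.indicator_of_notMem (fun h => hμ (Interlaces.strictAnti_left h)) _
      _ = ∫⁻ ν, ∫⁻ μ, J μ ν := lintegral_lintegral_swap hJ.aemeasurable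
      _ = ∫⁻ ν in {x | StrictAnti x}, ENNReal.ofReal (p * s) * 
          (ENNReal.ofReal (rowDensity ν) * f ν) := by
          rw [← lintegral_indicator (measurableSet_strictAnti _)]
          refine lintegral_congr fun ν => ?_
          by_cases hν : StrictAnti ν
          · rw [Set.indicator_of_mem (by exact hν)]
            have : ∫⁻ μ, J μ ν = ∫⁻ μ in {μ | Interlaces μ ν}, ENNReal.ofReal (vand μ) *
                (ENNReal.ofReal s * ENNReal.ofReal (rowWeight ν) * f ν) := by
              rw [← lintegral_indicator (measurableSet_setOf_interlaces_left ν)]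
              rfl
            rw [this, lintegral_mul_const _ (continuous_vand n).measurable.ennreal_ofReal,
              setLIntegral_vand_interlaces hν, ← mul_assoc, ← mul_assoc,
              ← ENNReal.ofReal_mul (by have := hν.vand_pos; positivity), ← mul_assoc,
              ← ENNReal.ofReal_mul (by have := hν.vand_pos; positivity),
              ← ENNReal.ofReal_mul (by positivity)]
            congr 2
            rw [rowDensity, rowWeight]
            ring
          · rw [Set.indicator_of_notMem (by exact hν)]
            refine lintegral_eq_zero_of_ae_eq_zero (Filter.Eventually.of_forall fun μ => ?_)
            exact Set.indicator_of_notMem (fun h => hν (Interlaces.strictAnti h)) _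
      _ = _ := lintegral_const_mul _ ((measurable_rowDensity _).ennreal_ofReal.mul hf)

/-- The law of the ordered eigenvalues of a GUE matrix. -/
def rowLaw (n : ℕ) : Measure (Fin n → ℝ) := (gueMeasure n).map eigsDesc

instance (n : ℕ) : IsProbabilityMeasure (rowLaw n) :=
  Measure.isProbabilityMeasure_map (measurable_eigsDesc n).aemeasurable

theorem ae_strictAnti_rowLaw (n : ℕ) : ∀ᵐ x ∂rowLaw n, StrictAnti x :=
  (ae_map_iff (measurable_eigsDesc n).aemeasurable (measurableSet_strictAnti n)).2
    (ae_strictAnti_eigsDesc n)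

/-- The Gaussian weight times the squared Vandermonde product, supported on the Weyl chamber. -/
def chamberDensity {n : ℕ} (x : Fin n → ℝ) : ℝ :=
  (∏ i, ∏ j ∈ Finset.Ioi i, max (x i - x j) 0 ^ 2) * Real.exp (-(∑ l, x l ^ 2) / 2)

theorem chamberDensity_of_strictAnti {n : ℕ} {x : Fin n → ℝ} (h : StrictAnti x) :
    chamberDensity x = rowDensity x := by
  rw [chamberDensity, rowDensity, vand, ← Finset.prod_pow]
  congr 1
  refine Finset.prod_congr rfl fun i _ => ?_
  rw [← Finset.prod_pow]
  refine Finset.prod_congr rfl fun j hj => ?_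
  rw [max_eq_left (sub_pos.2 (h (Finset.mem_Ioi.1 hj))).le]

theorem chamberDensity_of_not_strictAnti {n : ℕ} {x : Fin n → ℝ} (h : ¬ StrictAnti x) :
    chamberDensity x = 0 := by
  have : ∃ i j, i < j ∧ x i ≤ x j := by
    by_contra hcon
    push Not at hcon
    exact h fun i j hij => hcon i j hij
  obtain ⟨i, j, hij, hx⟩ := this
  rw [chamberDensity, Finset.prod_eq_zero (Finset.mem_univ i)
    (Finset.prod_eq_zero (Finset.mem_Ioi.2 hij)
      (by rw [max_eq_right (sub_nonpos.2 hx), zero_pow two_ne_zero])), zero_mul]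

theorem chamberDensity_nonneg {n : ℕ} (x : Fin n → ℝ) : 0 ≤ chamberDensity x :=
  mul_nonneg (Finset.prod_nonneg fun _ _ => Finset.prod_nonneg fun _ _ => sq_nonneg _)
    (Real.exp_pos _).le

theorem measurable_chamberDensity (n : ℕ) : Measurable (chamberDensity : (Fin n → ℝ) → ℝ) := by
  unfold chamberDensity
  refine Measurable.mul ?_ (by fun_prop)
  exact Finset.measurable_fun_prod _ fun i _ => Finset.measurable_fun_prod _ fun j _ => by fun_prop

theorem measurable_ofReal_mul_chamberDensity (n : ℕ) (c : ℝ) :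
    Measurable fun x : Fin n → ℝ => ENNReal.ofReal (c * chamberDensity x) :=
  ((measurable_chamberDensity n).const_mul c).ennreal_ofReal

theorem exists_rowLaw_eq_withDensity (n : ℕ) : ∃ c : ℝ, 0 < c ∧
    rowLaw n = volume.withDensity fun x => ENNReal.ofReal (c * chamberDensity x) := by
  obtain ⟨c, hc, h⟩ := exists_lintegral_eigsDesc_gueMeasure n
  refine ⟨c, hc, Measure.ext_of_lintegral _ fun f hf => ?_⟩
  rw [rowLaw, lintegral_map hf (measurable_eigsDesc n), h f hf, lintegral_withDensity_mul _
    (measurable_ofReal_mul_chamberDensity n c) hf,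
    ← lintegral_const_mul (f := fun x => ENNReal.ofReal (rowDensity x) * f x) _
      ((measurable_rowDensity n).ennreal_ofReal.mul hf),
    ← lintegral_indicator (measurableSet_strictAnti n)]
  refine lintegral_congr fun x => ?_
  by_cases hx : StrictAnti x
  · rw [Set.indicator_of_mem (by exact hx), chamberDensity_of_strictAnti hx,
      ENNReal.ofReal_mul hc.le,
      mul_assoc]
  · rw [Set.indicator_of_notMem (by exact hx), chamberDensity_of_not_strictAnti hx]
    simp

theorem integrable_rowLaw_iff {n : ℕ} {φ : (Fin n → ℝ) → ℝ} :
    Integrable φ (rowLaw n) ↔ Integrable fun x => chamberDensity x * φ x := by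
  obtain ⟨c, hc, h⟩ := exists_rowLaw_eq_withDensity n
  rw [h, integrable_withDensity_iff_integrable_smul₀'
    (measurable_ofReal_mul_chamberDensity n c).aemeasurable
    (Filter.Eventually.of_forall fun _ => ENNReal.ofReal_lt_top)]
  have : ∀ x, (ENNReal.ofReal (c * chamberDensity x)).toReal • φ x =
      c * (chamberDensity x * φ x) := fun x => by
    rw [ENNReal.toReal_ofReal (mul_nonneg hc.le (chamberDensity_nonneg x)), smul_eq_mul, mul_assoc]
  simp only [this]
  exact integrable_const_mul_iff (IsUnit.mk0 c hc.ne') _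

theorem integral_rowLaw_eq_zero_iff {n : ℕ} {φ : (Fin n → ℝ) → ℝ} :
    ∫ x, φ x ∂rowLaw n = 0 ↔ ∫ x, chamberDensity x * φ x = 0 := by
  obtain ⟨c, hc, h⟩ := exists_rowLaw_eq_withDensity n
  rw [h, integral_withDensity_eq_integral_toReal_smul₀
    (measurable_ofReal_mul_chamberDensity n c).aemeasurable
    (Filter.Eventually.of_forall fun _ => ENNReal.ofReal_lt_top)]
  have : ∀ x, (ENNReal.ofReal (c * chamberDensity x)).toReal • φ x =
      c * (chamberDensity x * φ x) := fun x => by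
    rw [ENNReal.toReal_ofReal (mul_nonneg hc.le (chamberDensity_nonneg x)), smul_eq_mul, mul_assoc]
  simp only [this]
  rw [integral_const_mul, mul_eq_zero, or_iff_right hc.ne']

theorem hasDerivAt_max_zero_sq (t : ℝ) : HasDerivAt (fun t : ℝ => max t 0 ^ 2) (2 * max t 0) t := by
  rcases lt_trichotomy t 0 with ht | rfl | ht
  · rw [max_eq_right ht.le, mul_zero]
    refine (hasDerivAt_const t (0 : ℝ)).congr_of_eventuallyEq ?_
    filter_upwards [gt_mem_nhds ht] with s hs
    simp [max_eq_right hs.le]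
  · rw [max_self, mul_zero, hasDerivAt_iff_isLittleO_nhds_zero]
    simp only [zero_add, max_self, smul_zero, sub_zero]
    refine (Asymptotics.IsBigO.of_bound 1 ?_).trans_isLittleO
      (Asymptotics.isLittleO_pow_id (one_lt_two : 1 < 2))
    refine Filter.Eventually.of_forall fun h => ?_
    rcases le_total h 0 with hh | hh <;> (simp [hh]; try positivity)
  · rw [max_eq_left ht.le]
    refine HasDerivAt.congr_of_eventuallyEq (by simpa using hasDerivAt_pow 2 t) ?_
    filter_upwards [lt_mem_nhds ht] with s hs
    simp [max_eq_left hs.le]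

/-- The repulsion felt by the `k`-th point; the diagonal term vanishes by convention. -/
def repulsion {n : ℕ} (k : Fin n) (x : Fin n → ℝ) : ℝ := ∑ l, (x k - x l)⁻¹

theorem sum_pairs_single_div {n : ℕ} (k : Fin n) (x : Fin n → ℝ) :
    ∑ i, ∑ j ∈ Finset.Ioi i, ((Pi.single k 1 : Fin n → ℝ) i - (Pi.single k 1 : Fin n → ℝ) j) *
      (x i - x j)⁻¹ = repulsion k x := by
  have h1 : ∀ i, ∑ j ∈ Finset.Ioi i, ((Pi.single k 1 : Fin n → ℝ) i -
      (Pi.single k 1 : Fin n → ℝ) j) * (x i - x j)⁻¹ =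
      (if i = k then ∑ j, (if i < j then (x i - x j)⁻¹ else 0) else 0) +
        (if i < k then (x k - x i)⁻¹ else 0) := by
    intro i
    rw [← Finset.filter_lt_eq_Ioi, Finset.sum_filter]
    simp only [Pi.single_apply, sub_mul, ite_mul, one_mul, zero_mul]
    rw [show (∑ a, if i < a then ((if i = k then (x i - x a)⁻¹ else 0) -
        (if a = k then (x i - x a)⁻¹ else 0)) else 0) =
      (∑ a, if i = k then (if i < a then (x i - x a)⁻¹ else 0) else 0) +
        ∑ a, if a = k then (if i < a then (x a - x i)⁻¹ else 0) else 0 by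
      rw [← Finset.sum_add_distrib]
      refine Finset.sum_congr rfl fun a _ => ?_
      have : (x a - x i)⁻¹ = -(x i - x a)⁻¹ := by rw [← neg_sub, inv_neg]
      split_ifs <;> simp [this]]
    congr 1
    · split_ifs <;> simp
    · rw [Finset.sum_ite_eq' Finset.univ k]
      simp
  rw [Finset.sum_congr rfl fun i _ => h1 i, Finset.sum_add_distrib,
    Finset.sum_ite_eq' Finset.univ k,
    if_pos (Finset.mem_univ k), ← Finset.sum_add_distrib]
  refine Finset.sum_congr rfl fun l _ => ?_
  rcases lt_trichotomy k l with h | rfl | h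
  · simp [h, not_lt.2 h.le]
  · simp
  · simp [h, not_lt.2 h.le]

theorem hasLineDerivAt_chamberDensity {n : ℕ} (k : Fin n) (x : Fin n → ℝ) :
    HasLineDerivAt ℝ chamberDensity (chamberDensity x * (2 * repulsion k x - x k)) x
      (Pi.single k 1) := by
  unfold HasLineDerivAt
  have hc : ∀ l, HasDerivAt (fun t : ℝ => (x + t • (Pi.single k 1 : Fin n → ℝ)) l)
      ((Pi.single k 1 : Fin n → ℝ) l) 0 := fun l => by
    simpa using ((hasDerivAt_id (0 : ℝ)).mul_const ((Pi.single k 1 : Fin n → ℝ) l)).const_add (x l)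
  have hp : ∀ i j, HasDerivAt (fun t : ℝ => max ((x + t • (Pi.single k 1 : Fin n → ℝ)) i -
      (x + t • (Pi.single k 1 : Fin n → ℝ)) j) 0 ^ 2)
      (2 * max (x i - x j) 0 * ((Pi.single k 1 : Fin n → ℝ) i - (Pi.single k 1 : Fin n → ℝ) j))
      0 := fun i j => by
    have := HasDerivAt.comp (0 : ℝ) (hasDerivAt_max_zero_sq _) ((hc i).sub (hc j))
    simpa [Function.comp_def] using this
  have he : HasDerivAt (fun t : ℝ =>
      Real.exp (-(∑ l, (x + t • (Pi.single k 1 : Fin n → ℝ)) l ^ 2) / 2))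
      (Real.exp (-(∑ l, x l ^ 2) / 2) * (-x k)) 0 := by
    have := ((HasDerivAt.fun_sum fun l (_ : l ∈ Finset.univ) => (hc l).fun_pow 2).fun_neg.div_const
      2).exp
    convert this using 1
    simp only [zero_smul, add_zero, Nat.cast_ofNat, Pi.single_apply, mul_ite, mul_one, mul_zero,
      Finset.sum_ite_eq', Finset.mem_univ, if_true]
    ring_nf
  have hprod := (HasDerivAt.fun_finsetProd (u := Finset.univ.sigma Finset.Ioi)
    (fun p (_ : p ∈ (Finset.univ : Finset (Fin n)).sigma Finset.Ioi) => hp p.1 p.2))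
  have := hprod.fun_mul he
  simp only [Finset.prod_sigma] at this
  refine this.congr_deriv ?_
  have hx : x + (0 : ℝ) • (Pi.single k 1 : Fin n → ℝ) = x := by simp
  have key : ∑ p ∈ (Finset.univ : Finset (Fin n)).sigma Finset.Ioi,
      (∏ q ∈ ((Finset.univ : Finset (Fin n)).sigma Finset.Ioi).erase p,
        max (x q.1 - x q.2) 0 ^ 2) • (2 * max (x p.1 - x p.2) 0 *
          ((Pi.single k 1 : Fin n → ℝ) p.1 - (Pi.single k 1 : Fin n → ℝ) p.2)) =
      (∏ i, ∏ j ∈ Finset.Ioi i, max (x i - x j) 0 ^ 2) * (2 * repulsion k x) := by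
    rw [← sum_pairs_single_div, Finset.sum_sigma' Finset.univ Finset.Ioi,
      Finset.prod_sigma' Finset.univ Finset.Ioi, Finset.mul_sum, Finset.mul_sum]
    refine Finset.sum_congr rfl fun p hp => ?_
    rw [← Finset.mul_prod_erase _ _ hp, smul_eq_mul]
    rcases le_or_gt (x p.1 - x p.2) 0 with h | h
    · simp [max_eq_right h]
    · rw [max_eq_left h.le]
      field_simp
  rw [hx, key, chamberDensity]
  ring

/-- A majorant for polynomials. -/
def polyWeight {n : ℕ} (x : Fin n → ℝ) : ℝ := ∏ l, (1 + x l ^ 2)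

/-- A majorant for inverse distances between points. -/
def invWeight {n : ℕ} (x : Fin n → ℝ) : ℝ := 1 + ∑ a, ∑ b, |x a - x b|⁻¹

theorem one_le_polyWeight {n : ℕ} (x : Fin n → ℝ) : 1 ≤ polyWeight x :=
  Finset.one_le_prod fun l _ => by nlinarith [sq_nonneg (x l)]

theorem one_le_invWeight {n : ℕ} (x : Fin n → ℝ) : 1 ≤ invWeight x :=
  le_add_of_nonneg_right (Finset.sum_nonneg fun _ _ => Finset.sum_nonneg fun _ _ =>
    inv_nonneg.2 (abs_nonneg _))

theorem one_add_sq_le_polyWeight {n : ℕ} (x : Fin n → ℝ) (l : Fin n) :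
    1 + x l ^ 2 ≤ polyWeight x := by
  rw [polyWeight, ← Finset.mul_prod_erase _ _ (Finset.mem_univ l)]
  exact le_mul_of_one_le_right (by positivity)
    (Finset.one_le_prod fun i _ => by nlinarith [sq_nonneg (x i)])

/-- Functions of moderate growth with singularities of order `d` on the collision set. -/
def Tame {n : ℕ} (d : ℕ) (φ : (Fin n → ℝ) → ℝ) : Prop :=
  Measurable φ ∧ ∃ K : ℝ, ∃ m : ℕ, 0 ≤ K ∧
    ∀ x, StrictAnti x → |φ x| ≤ K * polyWeight x ^ m * invWeight x ^ d

namespace Tame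

variable {n d e : ℕ} {φ ψ : (Fin n → ℝ) → ℝ}

theorem mono (h : Tame d φ) (hde : d ≤ e) : Tame e φ := by
  obtain ⟨hm, K, m, hK, h⟩ := h
  refine ⟨hm, K, m, hK, fun x hx => (h x hx).trans ?_⟩
  have := one_le_polyWeight x
  exact mul_le_mul_of_nonneg_left (pow_le_pow_right₀ (one_le_invWeight x) hde) (by positivity)

theorem mul (h : Tame d φ) (h' : Tame e ψ) : Tame (d + e) fun x => φ x * ψ x := by
  obtain ⟨hm, K, m, hK, h⟩ := h
  obtain ⟨hm', K', m', hK', h'⟩ := h'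
  refine ⟨hm.mul hm', K * K', m + m', mul_nonneg hK hK', fun x hx => ?_⟩
  rw [abs_mul]
  refine (mul_le_mul (h x hx) (h' x hx) (abs_nonneg _) ((abs_nonneg _).trans (h x hx))).trans_eq ?_
  ring

theorem add (h : Tame d φ) (h' : Tame d ψ) : Tame d fun x => φ x + ψ x := by
  obtain ⟨hm, K, m, hK, h⟩ := h
  obtain ⟨hm', K', m', hK', h'⟩ := h'
  refine ⟨hm.add hm', K + K', m + m', add_nonneg hK hK', fun x hx => ?_⟩
  have hp := one_le_polyWeight x
  have hi : 0 ≤ invWeight x ^ d := pow_nonneg (zero_le_one.trans (one_le_invWeight x)) _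
  have h1 := pow_le_pow_right₀ hp (Nat.le_add_right m m')
  have h2 := pow_le_pow_right₀ hp (Nat.le_add_left m' m)
  calc |φ x + ψ x| ≤ |φ x| + |ψ x| := abs_add_le _ _
    _ ≤ K * polyWeight x ^ m * invWeight x ^ d + K' * polyWeight x ^ m' * invWeight x ^ d :=
      add_le_add (h x hx) (h' x hx)
    _ ≤ K * polyWeight x ^ (m + m') * invWeight x ^ d +
        K' * polyWeight x ^ (m + m') * invWeight x ^ d := by gcongr
    _ = _ := by ring

theorem const (c : ℝ) : Tame (n := n) 0 fun _ => c :=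
  ⟨measurable_const, |c|, 0, abs_nonneg c, fun x _ => by simp⟩

theorem const_mul (c : ℝ) (h : Tame d φ) : Tame d fun x => c * φ x := by
  simpa using (const c).mul h

theorem neg (h : Tame d φ) : Tame d fun x => -φ x := by
  simpa using h.const_mul (-1)

theorem sub (h : Tame d φ) (h' : Tame d ψ) : Tame d fun x => φ x - ψ x := by
  simpa [sub_eq_add_neg] using h.add h'.neg

theorem pow (h : Tame d φ) (p : ℕ) : Tame (p * d) fun x => φ x ^ p := by
  induction p with
  | zero => simpa using const 1
  | succ p ih => simpa only [pow_succ, Nat.succ_mul] using ih.mul h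

theorem sum {ι : Type*} (s : Finset ι) {φ : ι → (Fin n → ℝ) → ℝ} (h : ∀ i ∈ s, Tame d (φ i)) :
    Tame d fun x => ∑ i ∈ s, φ i x := by
  classical
  induction s using Finset.induction_on with
  | empty => simpa using (const 0).mono (Nat.zero_le d)
  | insert a s ha ih =>
    simp only [Finset.sum_insert ha]
    exact (h a (Finset.mem_insert_self _ _)).add
      (ih fun i hi => h i (Finset.mem_insert_of_mem hi))

theorem coord (k : Fin n) : Tame 0 fun x : Fin n → ℝ => x k := by
  refine ⟨measurable_pi_apply k, 1, 1, zero_le_one, fun x _ => ?_⟩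
  rw [pow_zero, mul_one, one_mul, pow_one]
  refine le_trans ?_ (one_add_sq_le_polyWeight x k)
  nlinarith [sq_nonneg (|x k| - 1), sq_abs (x k)]

theorem inv_of_le {ℓ : (Fin n → ℝ) → ℝ} (hℓ : Measurable ℓ) {a b : Fin n} (hab : a ≠ b)
    {c : ℝ} (hc : 0 ≤ c) (h : ∀ x, StrictAnti x → |x a - x b| ≤ c * |ℓ x|) :
    Tame 1 fun x => (ℓ x)⁻¹ := by
  refine ⟨hℓ.inv, c, 0, hc, fun x hx => ?_⟩
  have h1 : 0 < |x a - x b| := abs_pos.2 (sub_ne_zero.2 (hx.injective.ne hab))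
  have h2 := h x hx
  have h3 : 0 < |ℓ x| := by
    by_contra hcon
    rw [le_antisymm (not_lt.1 hcon) (abs_nonneg _), mul_zero] at h2
    exact absurd h1 h2.not_gt
  have h4 : |x a - x b|⁻¹ ≤ invWeight x := by
    have h0 : ∀ i j, 0 ≤ |x i - x j|⁻¹ := fun i j => inv_nonneg.2 (abs_nonneg _)
    have : |x a - x b|⁻¹ ≤ ∑ i, ∑ j, |x i - x j|⁻¹ :=
      (Finset.single_le_sum (f := fun j => |x a - x j|⁻¹) (fun j _ => h0 a j)
        (Finset.mem_univ b)).trans (Finset.single_le_sum (f := fun i => ∑ j, |x i - x j|⁻¹)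
          (fun i _ => Finset.sum_nonneg fun j _ => h0 i j) (Finset.mem_univ a))
    rw [invWeight]; linarith
  rw [abs_inv, pow_zero, mul_one, pow_one]
  refine le_trans ?_ (mul_le_mul_of_nonneg_left h4 hc)
  rw [inv_le_iff_one_le_mul₀ h3, mul_assoc, mul_comm, ← div_eq_inv_mul, div_mul_eq_mul_div,
    one_le_div h1, mul_comm]
  exact h2

theorem inv_sub (a b : Fin n) : Tame 1 fun x : Fin n → ℝ => (x a - x b)⁻¹ := by
  rcases eq_or_ne a b with rfl | hab
  · simpa using (const 0).mono zero_le_one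
  · exact inv_of_le (by fun_prop) hab zero_le_one fun x _ => by rw [one_mul]

theorem repulsion (k : Fin n) : Tame 1 (repulsion k) :=
  sum _ fun l _ => inv_sub k l

end Tame

theorem integrable_one_add_sq_pow_mul_exp (m : ℕ) :
    Integrable fun x : ℝ => (1 + x ^ 2) ^ m * Real.exp (-x ^ 2 / 2) := by
  have h : ∀ k : ℕ, Integrable fun x : ℝ => x ^ k * Real.exp (-x ^ 2 / 2) := fun k => by
    have := integrable_rpow_mul_exp_neg_mul_sq (b := 1 / 2) (by norm_num) (s := k)
      (by have : (0 : ℝ) ≤ k := k.cast_nonneg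
          linarith)
    refine this.congr (Filter.Eventually.of_forall fun x => ?_)
    simp only [Real.rpow_natCast]
    ring_nf
  have hs : Integrable fun x : ℝ => ∑ k ∈ Finset.range (m + 1),
      (m.choose k : ℝ) * (x ^ (2 * (m - k)) * Real.exp (-x ^ 2 / 2)) :=
    integrable_finsetSum _ fun k _ => (h (2 * (m - k))).const_mul _
  refine hs.congr (Filter.Eventually.of_forall fun x => ?_)
  simp only
  rw [add_pow, Finset.sum_mul]
  refine Finset.sum_congr rfl fun k _ => ?_
  rw [one_pow, one_mul, pow_mul]
  ring

theorem integrable_polyWeight_pow_mul_exp (n m : ℕ) :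
    Integrable fun x : Fin n → ℝ => polyWeight x ^ m * Real.exp (-(∑ l, x l ^ 2) / 2) := by
  have := Integrable.fintype_prod (ι := Fin n) (fun _ => integrable_one_add_sq_pow_mul_exp m)
  refine this.congr (Filter.Eventually.of_forall fun x => ?_)
  simp only
  rw [Finset.prod_mul_distrib, polyWeight, ← Finset.prod_pow, ← Real.exp_sum, ← Finset.sum_div,
    Finset.sum_neg_distrib]

theorem sub_sq_le_polyWeight {n : ℕ} (x : Fin n → ℝ) {i j : Fin n} (hij : i ≠ j) :
    (x i - x j) ^ 2 ≤ 2 * polyWeight x := by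
  have h : (1 + x i ^ 2) * (1 + x j ^ 2) ≤ polyWeight x := by
    rw [polyWeight, ← Finset.mul_prod_erase _ _ (Finset.mem_univ i),
      ← Finset.mul_prod_erase _ _ (Finset.mem_erase.2 ⟨hij.symm, Finset.mem_univ j⟩), ← mul_assoc]
    exact le_mul_of_one_le_right (by positivity)
      (Finset.one_le_prod fun i _ => by nlinarith [sq_nonneg (x i)])
  nlinarith [sq_nonneg (x i + x j), sq_nonneg (x i * x j)]

theorem chamberDensity_mul_inv_sq_le {n : ℕ} {x : Fin n → ℝ} (hx : StrictAnti x) {a b : Fin n}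
    (hab : a ≠ b) : chamberDensity x * |x a - x b|⁻¹ ^ 2 ≤
      (2 * polyWeight x) ^ (n * n) * Real.exp (-(∑ l, x l ^ 2) / 2) := by
  wlog h : a < b generalizing a b
  · rw [abs_sub_comm]
    exact this hab.symm (lt_of_le_of_ne (not_lt.1 h) hab.symm)
  have hp : (⟨a, b⟩ : Σ _ : Fin n, Fin n) ∈
      (Finset.univ : Finset (Fin n)).sigma Finset.Ioi := by simpa using h
  have hpos : 0 < x a - x b := sub_pos.2 (hx h)
  have h1 : 1 ≤ 2 * polyWeight x := by linarith [one_le_polyWeight x]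
  rw [chamberDensity, Finset.prod_sigma' Finset.univ Finset.Ioi, ← Finset.mul_prod_erase _ _ hp,
    max_eq_left hpos.le, abs_of_pos hpos, mul_right_comm]
  refine mul_le_mul_of_nonneg_right ?_ (Real.exp_pos _).le
  rw [mul_right_comm, inv_pow, mul_inv_cancel₀ (by positivity), one_mul]
  calc _ ≤ ∏ _p ∈ ((Finset.univ : Finset (Fin n)).sigma Finset.Ioi).erase ⟨a, b⟩,
        (2 * polyWeight x) := by
        refine Finset.prod_le_prod (fun _ _ => sq_nonneg _) fun p hp => ?_
        have hlt : p.1 < p.2 := by simpa using (Finset.mem_of_mem_erase hp)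
        rw [max_eq_left (sub_pos.2 (hx hlt)).le]
        exact sub_sq_le_polyWeight x hlt.ne
    _ ≤ _ := by
        rw [Finset.prod_const]
        refine pow_le_pow_right₀ h1 ((Finset.card_le_univ _).trans ?_)
        simp [Fintype.card_sigma]

theorem chamberDensity_le {n : ℕ} {x : Fin n → ℝ} (hx : StrictAnti x) : chamberDensity x ≤
      (2 * polyWeight x) ^ (n * n) * Real.exp (-(∑ l, x l ^ 2) / 2) := by
  have h1 : 1 ≤ 2 * polyWeight x := by linarith [one_le_polyWeight x]
  rw [chamberDensity, Finset.prod_sigma' Finset.univ Finset.Ioi]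
  refine mul_le_mul_of_nonneg_right ?_ (Real.exp_pos _).le
  calc _ ≤ ∏ _p ∈ (Finset.univ : Finset (Fin n)).sigma Finset.Ioi, (2 * polyWeight x) := by
        refine Finset.prod_le_prod (fun _ _ => sq_nonneg _) fun p hp => ?_
        have hlt : p.1 < p.2 := by simpa using hp
        rw [max_eq_left (sub_pos.2 (hx hlt)).le]
        exact sub_sq_le_polyWeight x hlt.ne
    _ ≤ _ := by
        rw [Finset.prod_const]
        refine pow_le_pow_right₀ h1 ((Finset.card_le_univ _).trans ?_)
        simp [Fintype.card_sigma]

theorem chamberDensity_mul_invWeight_sq_le {n : ℕ} {x : Fin n → ℝ} (hx : StrictAnti x) :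
    chamberDensity x * invWeight x ^ 2 ≤
      (n * n + 1) ^ 2 * ((2 * polyWeight x) ^ (n * n) * Real.exp (-(∑ l, x l ^ 2) / 2)) := by
  set R := (2 * polyWeight x) ^ (n * n) * Real.exp (-(∑ l, x l ^ 2) / 2) with hR
  have hR0 : 0 ≤ R := (chamberDensity_nonneg x).trans (chamberDensity_le hx)
  have hterm : ∀ p : Option (Fin n × Fin n),
      chamberDensity x * (p.elim 1 fun p => |x p.1 - x p.2|⁻¹) ^ 2 ≤ R := by
    rintro (_ | ⟨a, b⟩)
    · simpa using chamberDensity_le hx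
    · rcases eq_or_ne a b with rfl | hab
      · simpa using hR0
      · exact chamberDensity_mul_inv_sq_le hx hab
  have hsum : invWeight x = ∑ p : Option (Fin n × Fin n),
      (p.elim 1 fun p => |x p.1 - x p.2|⁻¹) := by
    rw [Fintype.sum_option, Fintype.sum_prod_type]
    rfl
  have hcs := sq_sum_le_card_mul_sum_sq (s := (Finset.univ : Finset (Option (Fin n × Fin n))))
    (f := fun p => p.elim 1 fun p => |x p.1 - x p.2|⁻¹)
  rw [← hsum] at hcs
  have hcard : ((Finset.univ : Finset (Option (Fin n × Fin n))).card : ℝ) = n * n + 1 := by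
    simp
  rw [hcard] at hcs
  calc _ ≤ chamberDensity x * ((n * n + 1) * ∑ p : Option (Fin n × Fin n),
      (p.elim 1 fun p => |x p.1 - x p.2|⁻¹) ^ 2) :=
        mul_le_mul_of_nonneg_left hcs (chamberDensity_nonneg x)
    _ = (n * n + 1) * ∑ p : Option (Fin n × Fin n), chamberDensity x *
      (p.elim 1 fun p => |x p.1 - x p.2|⁻¹) ^ 2 := by rw [← Finset.mul_sum]; ring
    _ ≤ (n * n + 1) * ∑ _p : Option (Fin n × Fin n), R := by
        gcongr with p
        exact hterm p
    _ = _ := by rw [Finset.sum_const, nsmul_eq_mul, hcard]; ring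

theorem Tame.integrable {n : ℕ} {φ : (Fin n → ℝ) → ℝ} (h : Tame 2 φ) :
    Integrable φ (rowLaw n) := by
  obtain ⟨hm, K, m, hK, h⟩ := h
  rw [integrable_rowLaw_iff]
  refine ((integrable_polyWeight_pow_mul_exp n (m + n * n)).const_mul
    (K * ((n * n + 1) ^ 2 * 2 ^ (n * n)))).mono'
    ((measurable_chamberDensity n).mul hm).aestronglyMeasurable
    (Filter.Eventually.of_forall fun x => ?_)
  have hp := zero_le_one.trans (one_le_polyWeight x)
  by_cases hx : StrictAnti x
  · rw [norm_mul, Real.norm_of_nonneg (chamberDensity_nonneg x), Real.norm_eq_abs]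
    calc _ ≤ chamberDensity x * (K * polyWeight x ^ m * invWeight x ^ 2) :=
          mul_le_mul_of_nonneg_left (h x hx) (chamberDensity_nonneg x)
      _ = K * polyWeight x ^ m * (chamberDensity x * invWeight x ^ 2) := by ring
      _ ≤ K * polyWeight x ^ m * ((n * n + 1) ^ 2 *
          ((2 * polyWeight x) ^ (n * n) * Real.exp (-(∑ l, x l ^ 2) / 2))) :=
          mul_le_mul_of_nonneg_left (chamberDensity_mul_invWeight_sq_le hx) (by positivity)
      _ = _ := by rw [pow_add, mul_pow]; ring
  · rw [chamberDensity_of_not_strictAnti hx, zero_mul, norm_zero]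
    positivity

theorem Tame.integrable_of_le {n d : ℕ} {φ : (Fin n → ℝ) → ℝ} (h : Tame d φ) (hd : d ≤ 2) :
    Integrable φ (rowLaw n) := (h.mono hd).integrable

/-- Integration by parts for smooth test functions. -/
theorem integral_rowLaw_deriv_add {n : ℕ} (k : Fin n) {φ φ' : (Fin n → ℝ) → ℝ}
    (hφ : Tame 1 φ) (hφ' : Tame 2 φ') (h : ∀ x, HasLineDerivAt ℝ φ (φ' x) x (Pi.single k 1)) :
    ∫ x, φ' x + φ x * (2 * repulsion k x - x k) ∂rowLaw n = 0 := by
  have hr : Tame 1 fun x : Fin n → ℝ => 2 * repulsion k x - x k :=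
    ((Tame.repulsion k).const_mul 2).sub ((Tame.coord k).mono zero_le_one)
  have h1 := integrable_rowLaw_iff.1 (hφ.mul hr).integrable
  have h2 := integrable_rowLaw_iff.1 hφ'.integrable
  have h3 := integrable_rowLaw_iff.1 (hφ.integrable_of_le one_le_two)
  have h1' : Integrable fun x => chamberDensity x * (2 * repulsion k x - x k) * φ x := by
    refine h1.congr (Filter.Eventually.of_forall fun x => ?_)
    simp only
    ring
  have := integral_bilinear_hasLineDerivAt_right_eq_neg_left_of_integrable (μ := volume)
    (B := ContinuousLinearMap.mul ℝ ℝ) (f := chamberDensity) (g := φ) (v := Pi.single k 1)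
    h1' h2 h3 (fun x _ => hasLineDerivAt_chamberDensity k x) fun x _ => h x
  rw [integral_rowLaw_eq_zero_iff]
  simp only [ContinuousLinearMap.mul_apply'] at this
  have e : ∀ x, chamberDensity x * (φ' x + φ x * (2 * repulsion k x - x k)) =
      chamberDensity x * φ' x + chamberDensity x * (2 * repulsion k x - x k) * φ x := fun x => by
    ring
  simp only [e]
  rw [integral_add h2 h1', this, neg_add_cancel]

theorem Tame.of_abs_le {n d : ℕ} {φ ψ : (Fin n → ℝ) → ℝ} (hφ : Tame d φ) (hψ : Measurable ψ)
    (h : ∀ x, StrictAnti x → |ψ x| ≤ |φ x|) : Tame d ψ := by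
  obtain ⟨-, K, m, hK, hb⟩ := hφ
  exact ⟨hψ, K, m, hK, fun x hx => (h x hx).trans (hb x hx)⟩

/-- Integration by parts for the inverse of a linear form not vanishing on the chamber. -/
theorem integral_rowLaw_inv {n : ℕ} (k : Fin n) (ℓ : (Fin n → ℝ) →L[ℝ] ℝ) {a b : Fin n}
    (hab : a ≠ b) {c : ℝ} (hc : 0 ≤ c) (hℓ : ∀ x, StrictAnti x → |x a - x b| ≤ c * |ℓ x|) :
    ∫ x, -(ℓ (Pi.single k 1)) * (ℓ x)⁻¹ ^ 2 + (ℓ x)⁻¹ * (2 * repulsion k x - x k) ∂rowLaw n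
      = 0 := by
  have hmeas : Measurable fun x => ℓ x := ℓ.continuous.measurable
  have htame := Tame.inv_of_le hmeas hab hc hℓ
  have hne : ∀ x, StrictAnti x → ℓ x ≠ 0 := fun x hx h0 => by
    have := hℓ x hx
    rw [h0, abs_zero, mul_zero] at this
    exact absurd this (abs_pos.2 (sub_ne_zero.2 (hx.injective.ne hab))).not_ge
  have hr : Tame 1 fun x : Fin n → ℝ => 2 * repulsion k x - x k :=
    ((Tame.repulsion k).const_mul 2).sub ((Tame.coord k).mono zero_le_one)
  set e := ℓ (Pi.single k 1) with he
  set δ : ℕ → ℝ := fun i => 1 / ((i : ℝ) + 1) with hδ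
  have hδ0 : ∀ i, 0 < δ i := fun i => by positivity
  set φ : ℕ → (Fin n → ℝ) → ℝ := fun i x => ℓ x / (ℓ x ^ 2 + δ i ^ 2) with hφ
  set φ' : ℕ → (Fin n → ℝ) → ℝ := fun i x =>
    e * ((δ i ^ 2 - ℓ x ^ 2) / (ℓ x ^ 2 + δ i ^ 2) ^ 2) with hφ'
  have hden : ∀ i x, 0 < ℓ x ^ 2 + δ i ^ 2 := fun i x => by have := hδ0 i; positivity
  have hφle : ∀ i x, StrictAnti x → |φ i x| ≤ |(ℓ x)⁻¹| := fun i x hx => by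
    have h0 := abs_pos.2 (hne x hx)
    rw [hφ, abs_div, abs_of_pos (hden i x), abs_inv, div_le_iff₀ (hden i x), ← sq_abs (ℓ x),
      le_inv_mul_iff₀ h0]
    nlinarith [sq_nonneg (δ i)]
  have hφ'le : ∀ i x, StrictAnti x → |φ' i x| ≤ |e * (ℓ x)⁻¹ ^ 2| := fun i x hx => by
    have h0 : 0 < ℓ x ^ 2 := by have := hne x hx; positivity
    rw [hφ', abs_mul, abs_mul, inv_pow, abs_inv, abs_of_pos h0, abs_div,
      abs_of_pos (pow_pos (hden i x) 2)]
    refine mul_le_mul_of_nonneg_left ?_ (abs_nonneg e)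
    rw [div_le_iff₀ (pow_pos (hden i x) 2), le_inv_mul_iff₀ h0]
    have h1 : |δ i ^ 2 - ℓ x ^ 2| ≤ ℓ x ^ 2 + δ i ^ 2 := by
      rw [abs_le]; constructor <;> nlinarith [sq_nonneg (δ i)]
    nlinarith [sq_nonneg (δ i), hden i x]
  have hφm : ∀ i, Measurable (φ i) := fun i => by
    simp only [hφ]; exact hmeas.div ((hmeas.pow_const 2).add_const _)
  have hφ'm : ∀ i, Measurable (φ' i) := fun i => by
    simp only [hφ']
    exact (((hmeas.pow_const 2).const_sub _).div
      (((hmeas.pow_const 2).add_const _).pow_const 2)).const_mul e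
  have htφ : ∀ i, Tame 1 (φ i) := fun i => htame.of_abs_le (hφm i) (hφle i)
  have htφ' : ∀ i, Tame 2 (φ' i) := fun i =>
    ((htame.pow 2).const_mul e).of_abs_le (hφ'm i) (hφ'le i)
  have hderiv : ∀ i x, HasLineDerivAt ℝ (φ i) (φ' i x) x (Pi.single k 1) := fun i x => by
    unfold HasLineDerivAt
    have h1 : HasDerivAt (fun t : ℝ => ℓ (x + t • Pi.single k 1)) e 0 := by
      simp only [map_add, map_smul, smul_eq_mul, ← he]
      simpa using ((hasDerivAt_id (0 : ℝ)).mul_const e).const_add (ℓ x)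
    have h2 := h1.fun_div ((h1.fun_pow 2).add_const (δ i ^ 2)) (by simpa using (hden i x).ne')
    refine h2.congr_deriv ?_
    simp only [zero_smul, add_zero, hφ']
    have := (hden i x).ne'
    field_simp
    push_cast
    ring
  have hzero : ∀ i, ∫ x, φ' i x + φ i x * (2 * repulsion k x - x k) ∂rowLaw n = 0 := fun i =>
    integral_rowLaw_deriv_add k (htφ i) (htφ' i) (hderiv i)
  have hlim := tendsto_integral_of_dominated_convergence (μ := rowLaw n)
    (F := fun i x => φ' i x + φ i x * (2 * repulsion k x - x k))
    (f := fun x => -e * (ℓ x)⁻¹ ^ 2 + (ℓ x)⁻¹ * (2 * repulsion k x - x k))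
    (fun x => |e * (ℓ x)⁻¹ ^ 2| + |(ℓ x)⁻¹ * (2 * repulsion k x - x k)|)
    (fun i => (((htφ' i).add ((htφ i).mul hr)).1).aestronglyMeasurable)
    ((((htame.pow 2).const_mul e).integrable.abs).add (htame.mul hr).integrable.abs)
    (fun i => by
      filter_upwards [ae_strictAnti_rowLaw n] with x hx
      rw [Real.norm_eq_abs]
      refine (abs_add_le _ _).trans (add_le_add (hφ'le i x hx) ?_)
      rw [abs_mul, abs_mul]
      exact mul_le_mul_of_nonneg_right (hφle i x hx) (abs_nonneg _))
    (by
      filter_upwards [ae_strictAnti_rowLaw n] with x hx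
      have h0 := hne x hx
      have hδl : Filter.Tendsto δ Filter.atTop (nhds 0) := tendsto_one_div_add_atTop_nhds_zero_nat
      have hd : Filter.Tendsto (fun i => ℓ x ^ 2 + δ i ^ 2) Filter.atTop (nhds (ℓ x ^ 2)) := by
        simpa using (hδl.pow 2).const_add (ℓ x ^ 2)
      have h1 : Filter.Tendsto (fun i => φ i x) Filter.atTop (nhds (ℓ x)⁻¹) := by
        have := (tendsto_const_nhds (x := ℓ x)).div hd (by positivity)
        rwa [show ℓ x / ℓ x ^ 2 = (ℓ x)⁻¹ by field_simp] at this
      have h2 : Filter.Tendsto (fun i => φ' i x) Filter.atTop (nhds (-e * (ℓ x)⁻¹ ^ 2)) := by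
        have := (((hδl.pow 2).sub_const (ℓ x ^ 2)).div (hd.pow 2) (by positivity)).const_mul e
        rwa [show e * ((0 ^ 2 - ℓ x ^ 2) / (ℓ x ^ 2) ^ 2) = -e * (ℓ x)⁻¹ ^ 2 by
          field_simp; ring] at this
      exact h2.add (h1.mul_const _))
  simp only [hzero] at hlim
  exact (tendsto_nhds_unique hlim tendsto_const_nhds)

/-- The sum of the inverse squared distances to the `k`-th point. -/
def repulsionSq {n : ℕ} (k : Fin n) (x : Fin n → ℝ) : ℝ := ∑ l, (x k - x l)⁻¹ ^ 2

theorem Tame.repulsionSq {n : ℕ} (k : Fin n) : Tame 2 (repulsionSq k) :=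
  Tame.sum _ fun l _ => (Tame.inv_sub k l).pow 2

theorem sum_mul_repulsion {n : ℕ} (x ψ : Fin n → ℝ) :
    2 * ∑ k, ψ k * repulsion k x = ∑ k, ∑ l, (x k - x l)⁻¹ * (ψ k - ψ l) := by
  have h1 : ∑ k, ψ k * repulsion k x = ∑ k, ∑ l, (x k - x l)⁻¹ * ψ k :=
    Finset.sum_congr rfl fun k _ => by
      rw [repulsion, Finset.mul_sum]
      exact Finset.sum_congr rfl fun l _ => mul_comm _ _
  have h2 : ∑ k, ψ k * repulsion k x = ∑ k, ∑ l, -((x k - x l)⁻¹ * ψ l) := by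
    rw [h1, Finset.sum_comm]
    refine Finset.sum_congr rfl fun k _ => Finset.sum_congr rfl fun l _ => ?_
    rw [← neg_sub, inv_neg]
    ring
  rw [two_mul]
  nth_rewrite 1 [h1]
  rw [h2, ← Finset.sum_add_distrib]
  refine Finset.sum_congr rfl fun k _ => ?_
  rw [← Finset.sum_add_distrib]
  exact Finset.sum_congr rfl fun l _ => by ring

theorem sum_inv_sub_mul_repulsion {n : ℕ} {x : Fin n → ℝ} (hx : Function.Injective x) (j : Fin n) :
    2 * ∑ l, (x j - x l)⁻¹ * repulsion l x = repulsion j x ^ 2 - 3 * repulsionSq j x := by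
  rw [sum_mul_repulsion]
  have h : ∀ k l, (x k - x l)⁻¹ * ((x j - x k)⁻¹ - (x j - x l)⁻¹) =
      (x j - x k)⁻¹ * (x j - x l)⁻¹ - (if k = l then (x j - x k)⁻¹ ^ 2 else 0) -
        (if l = j then (x j - x k)⁻¹ ^ 2 else 0) - (if k = j then (x j - x l)⁻¹ ^ 2 else 0) := by
    intro k l
    rcases eq_or_ne k l with rfl | hkl
    · by_cases hk : k = j
      · subst hk; simp
      · simp only [sub_self, inv_zero, zero_mul, if_true, if_neg hk]; ring
    · have h1 : x k - x l ≠ 0 := sub_ne_zero.2 (hx.ne hkl)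
      rcases eq_or_ne l j with rfl | hl
      · simp only [sub_self, inv_zero, mul_zero, if_neg hkl, if_true]
        rw [← neg_sub (x k) (x l), inv_neg]
        ring
      · have h2 : x j - x l ≠ 0 := sub_ne_zero.2 (hx.ne hl.symm)
        rcases eq_or_ne k j with rfl | hk
        · simp only [sub_self, inv_zero, zero_mul, if_neg hkl, if_neg hl, if_true]
          ring
        · have h3 : x j - x k ≠ 0 := sub_ne_zero.2 (hx.ne hk.symm)
          rw [if_neg hkl, if_neg hl, if_neg hk]
          field_simp
          ring
  simp only [h, Finset.sum_sub_distrib, Finset.sum_ite_eq, Finset.sum_ite_eq', Finset.mem_univ,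
    if_true]
  rw [show (∑ k, ∑ l, if k = j then (x j - x l)⁻¹ ^ 2 else 0) = repulsionSq j x by
    rw [Finset.sum_comm]; simp [repulsionSq]]
  simp only [← Finset.mul_sum, ← Finset.sum_mul]
  rw [repulsion, repulsionSq]
  ring

theorem sum_inv_sub_mul_self {n : ℕ} {x : Fin n → ℝ} (hx : Function.Injective x) (j : Fin n) :
    ∑ l, (x j - x l)⁻¹ * x l = x j * repulsion j x - (n - 1) := by
  have h : ∀ l, (x j - x l)⁻¹ * x l = x j * (x j - x l)⁻¹ - (1 - if l = j then 1 else 0) := by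
    intro l
    by_cases hl : l = j
    · subst hl; simp
    · have : x j - x l ≠ 0 := sub_ne_zero.2 (hx.ne (Ne.symm hl))
      rw [if_neg hl]
      field_simp
      ring
  simp only [h, Finset.sum_sub_distrib, ← Finset.mul_sum]
  simp [repulsion]

/-- The linear form `x ↦ x a - x b`. -/
def subForm {n : ℕ} (a b : Fin n) : (Fin n → ℝ) →L[ℝ] ℝ :=
  ContinuousLinearMap.proj (R := ℝ) (φ := fun _ : Fin n => ℝ) a -
    ContinuousLinearMap.proj (R := ℝ) (φ := fun _ : Fin n => ℝ) b

theorem integral_rowLaw_inv_sub {n : ℕ} (k : Fin n) {a b : Fin n} (hab : a ≠ b) :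
    ∫ x, -((Pi.single k 1 : Fin n → ℝ) a - (Pi.single k 1 : Fin n → ℝ) b) * (x a - x b)⁻¹ ^ 2 +
      (x a - x b)⁻¹ * (2 * repulsion k x - x k) ∂rowLaw n = 0 :=
  integral_rowLaw_inv k (subForm a b) hab zero_le_one fun x _ => by rw [one_mul]; rfl

theorem Tame.force {n : ℕ} (k : Fin n) :
    Tame 1 fun x : Fin n → ℝ => 2 * _root_.repulsion k x - x k :=
  ((Tame.repulsion k).const_mul 2).sub ((Tame.coord k).mono zero_le_one)

theorem Tame.integral_add {n : ℕ} {φ ψ : (Fin n → ℝ) → ℝ} (h : Tame 2 φ) (h' : Tame 2 ψ) :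
    ∫ x, φ x + ψ x ∂rowLaw n = (∫ x, φ x ∂rowLaw n) + ∫ x, ψ x ∂rowLaw n :=
  MeasureTheory.integral_add h.integrable h'.integrable

theorem Tame.integral_sub {n : ℕ} {φ ψ : (Fin n → ℝ) → ℝ} (h : Tame 2 φ) (h' : Tame 2 ψ) :
    ∫ x, φ x - ψ x ∂rowLaw n = (∫ x, φ x ∂rowLaw n) - ∫ x, ψ x ∂rowLaw n :=
  MeasureTheory.integral_sub h.integrable h'.integrable

section Identities

variable {n : ℕ} (j : Fin n)

theorem tame_coord_sq : Tame 2 (fun x : Fin n → ℝ => x j ^ 2) :=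
  ((Tame.coord j).pow 2).mono (by simp)

theorem tame_coord_mul_repulsion : Tame 2 fun x : Fin n → ℝ => x j * repulsion j x :=
  ((Tame.coord j).mul (Tame.repulsion j)).mono (by simp)

theorem tame_repulsion_sq : Tame 2 fun x : Fin n → ℝ => repulsion j x ^ 2 :=
  (Tame.repulsion j).pow 2

theorem integrable_coord_sq : Integrable (fun x => x j ^ 2) (rowLaw n) :=
  ((Tame.coord j).pow 2).integrable_of_le (by simp)

theorem integrable_coord : Integrable (fun x => x j) (rowLaw n) :=
  (Tame.coord j).integrable_of_le (by simp)

theorem hasLineDerivAt_coord (k : Fin n) (x : Fin n → ℝ) :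
    HasLineDerivAt ℝ (fun x : Fin n → ℝ => x j) ((Pi.single k 1 : Fin n → ℝ) j) x
      (Pi.single k 1) := by
  unfold HasLineDerivAt
  simpa using ((hasDerivAt_id (0 : ℝ)).mul_const ((Pi.single k 1 : Fin n → ℝ) j)).const_add (x j)

theorem integral_coord_sq_eq :
    ∫ x, x j ^ 2 ∂rowLaw n = 1 + 2 * ∫ x, x j * repulsion j x ∂rowLaw n := by
  have h := integral_rowLaw_deriv_add j ((Tame.coord j).mono zero_le_one)
    ((Tame.const ((Pi.single j 1 : Fin n → ℝ) j)).mono (Nat.zero_le 2))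
    fun x => hasLineDerivAt_coord j j x
  have e : ∀ x : Fin n → ℝ, (Pi.single j 1 : Fin n → ℝ) j + x j * (2 * repulsion j x - x j) =
      1 + (2 * (x j * repulsion j x) - x j ^ 2) := fun x => by
    rw [Pi.single_eq_same]; ring
  simp only [e] at h
  rw [Tame.integral_add ((Tame.const 1).mono (Nat.zero_le 2))
    (((tame_coord_mul_repulsion j).const_mul 2).sub (tame_coord_sq j)),
    Tame.integral_sub ((tame_coord_mul_repulsion j).const_mul 2) (tame_coord_sq j),
    integral_const_mul] at h
  simp at h
  linarith

theorem integral_repulsionSq_eq : ∫ x, repulsionSq j x ∂rowLaw n =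
    2 * (∫ x, repulsion j x ^ 2 ∂rowLaw n) - ∫ x, x j * repulsion j x ∂rowLaw n := by
  have h : ∀ l, ∫ x, -(x j - x l)⁻¹ ^ 2 + (x j - x l)⁻¹ * (2 * repulsion j x - x j)
      ∂rowLaw n = 0 := fun l => by
    rcases eq_or_ne j l with rfl | hl
    · simp
    · simpa [Pi.single_eq_of_ne hl.symm] using integral_rowLaw_inv_sub j hl
  have hs := integral_finsetSum (μ := rowLaw n) Finset.univ (f := fun l x =>
      -(x j - x l)⁻¹ ^ 2 + (x j - x l)⁻¹ * (2 * repulsion j x - x j))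
    fun l _ => (((Tame.inv_sub j l).pow 2).neg.add ((Tame.inv_sub j l).mul
      (Tame.force j))).integrable
  simp only [h, Finset.sum_const_zero] at hs
  have e : ∀ x, ∑ l, (-(x j - x l)⁻¹ ^ 2 + (x j - x l)⁻¹ * (2 * repulsion j x - x j)) =
      2 * repulsion j x ^ 2 - x j * repulsion j x - repulsionSq j x := fun x => by
    rw [Finset.sum_add_distrib, Finset.sum_neg_distrib, ← Finset.sum_mul]
    change -repulsionSq j x + repulsion j x * _ = _
    ring
  simp only [e] at hs
  rw [Tame.integral_sub (((tame_repulsion_sq j).const_mul 2).sub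
    (tame_coord_mul_repulsion j)) (Tame.repulsionSq j),
    Tame.integral_sub ((tame_repulsion_sq j).const_mul 2) (tame_coord_mul_repulsion j),
    integral_const_mul] at hs
  linarith

theorem two_mul_integral_repulsionSq_eq : 2 * ∫ x, repulsionSq j x ∂rowLaw n =
    (∫ x, repulsion j x ^ 2 ∂rowLaw n) - (∫ x, x j * repulsion j x ∂rowLaw n) + (n - 1) := by
  have h : ∀ l, ∫ x, (x j - x l)⁻¹ ^ 2 + (x j - x l)⁻¹ * (2 * repulsion l x - x l)
      ∂rowLaw n = 0 := fun l => by
    rcases eq_or_ne j l with rfl | hl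
    · simp
    · simpa [Pi.single_eq_of_ne hl] using integral_rowLaw_inv_sub l hl
  have hs := integral_finsetSum (μ := rowLaw n) Finset.univ (f := fun l x =>
      (x j - x l)⁻¹ ^ 2 + (x j - x l)⁻¹ * (2 * repulsion l x - x l))
    fun l _ => (((Tame.inv_sub j l).pow 2).add ((Tame.inv_sub j l).mul (Tame.force l))).integrable
  simp only [h, Finset.sum_const_zero] at hs
  have e : (fun x => ∑ l, ((x j - x l)⁻¹ ^ 2 + (x j - x l)⁻¹ * (2 * repulsion l x - x l)))
      =ᵐ[rowLaw n]
      fun x => (repulsion j x ^ 2 - x j * repulsion j x + (n - 1)) - 2 * repulsionSq j x := by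
    filter_upwards [ae_strictAnti_rowLaw n] with x hx
    have h1 := sum_inv_sub_mul_repulsion hx.injective j
    have h2 := sum_inv_sub_mul_self hx.injective j
    have h3 : ∀ l, (x j - x l)⁻¹ ^ 2 + (x j - x l)⁻¹ * (2 * repulsion l x - x l) =
      (x j - x l)⁻¹ ^ 2 + 2 * ((x j - x l)⁻¹ * repulsion l x) - (x j - x l)⁻¹ * x l := fun l => by
        ring
    simp only [h3, Finset.sum_sub_distrib, Finset.sum_add_distrib, ← Finset.mul_sum]
    rw [h1, h2]
    change repulsionSq j x + _ - _ = _
    ring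
  rw [integral_congr_ae e, Tame.integral_sub (((tame_repulsion_sq j).sub
    (tame_coord_mul_repulsion j)).add ((Tame.const _).mono (Nat.zero_le 2)))
    ((Tame.repulsionSq j).const_mul 2), Tame.integral_add ((tame_repulsion_sq j).sub
    (tame_coord_mul_repulsion j)) ((Tame.const _).mono (Nat.zero_le 2)),
    Tame.integral_sub (tame_repulsion_sq j) (tame_coord_mul_repulsion j), integral_const_mul] at hs
  simp at hs
  linarith

theorem integral_repulsionSq_nonneg : 0 ≤ ∫ x, repulsionSq j x ∂rowLaw n :=
  integral_nonneg fun _ => Finset.sum_nonneg fun _ _ => sq_nonneg _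

theorem integral_repulsion_sq_le : ∫ x, repulsion j x ^ 2 ∂rowLaw n ≤ n := by
  linarith [integral_repulsionSq_eq j, two_mul_integral_repulsionSq_eq j,
    integral_repulsionSq_nonneg j]

theorem integral_repulsionSq_le : ∫ x, repulsionSq j x ∂rowLaw n ≤ n := by
  have : 0 ≤ ∫ x, repulsion j x ^ 2 ∂rowLaw n := integral_nonneg fun _ => sq_nonneg _
  linarith [integral_repulsionSq_eq j, two_mul_integral_repulsionSq_eq j]

theorem integral_coord_sq_le : ∫ x, x j ^ 2 ∂rowLaw n ≤ 4 * n := by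
  linarith [integral_repulsionSq_eq j, two_mul_integral_repulsionSq_eq j,
    integral_repulsionSq_nonneg j, integral_coord_sq_eq j]

end Identities

theorem vand_eq_prod_pairs {n : ℕ} (x : Fin n → ℝ) :
    vand x = ∏ p : Fin n × Fin n with p.1 < p.2, (x p.1 - x p.2) := by
  rw [vand, Finset.prod_filter, Fintype.prod_prod_type]
  refine Finset.prod_congr rfl fun i _ => ?_
  rw [← Finset.filter_lt_eq_Ioi, Finset.prod_filter]

/-- Quantitative midpoint log-concavity of the eigenvalue density. -/
theorem rowDensity_mul_le {n : ℕ} {x y : Fin n → ℝ} (hx : StrictAnti x) (hy : StrictAnti y)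
    (W : Finset (Fin n × Fin n)) (hW : ∀ p ∈ W, p.1 < p.2) :
    rowDensity x * rowDensity y * ((∏ p ∈ W, ((x p.1 - x p.2 + (y p.1 - y p.2)) / 2) ^ 2 /
      ((x p.1 - x p.2) * (y p.1 - y p.2))) ^ 2 * Real.exp (∑ l, (x l - y l) ^ 2 / 4)) ≤
      rowDensity ((1 / 2 : ℝ) • (x + y)) ^ 2 := by
  have hgap : ∀ {x : Fin n → ℝ}, StrictAnti x → ∀ p : Fin n × Fin n, p.1 < p.2 →
      0 < x p.1 - x p.2 := fun h p hp => sub_pos.2 (h hp)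
  have hmid : ∀ p : Fin n × Fin n, ((1 / 2 : ℝ) • (x + y)) p.1 - ((1 / 2 : ℝ) • (x + y)) p.2 =
      (x p.1 - x p.2 + (y p.1 - y p.2)) / 2 := fun p => by
    simp only [Pi.smul_apply, Pi.add_apply, smul_eq_mul]; ring
  have hvand : vand x * vand y * (∏ p ∈ W, ((x p.1 - x p.2 + (y p.1 - y p.2)) / 2) ^ 2 /
      ((x p.1 - x p.2) * (y p.1 - y p.2))) ≤ vand ((1 / 2 : ℝ) • (x + y)) ^ 2 := by
    have hsub : W ⊆ Finset.univ.filter fun p : Fin n × Fin n => p.1 < p.2 := fun p hp => by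
      simpa using hW p hp
    rw [vand_eq_prod_pairs, vand_eq_prod_pairs, vand_eq_prod_pairs, ← Finset.prod_mul_distrib,
      ← Finset.prod_pow, ← Finset.prod_sdiff hsub, mul_assoc, ← Finset.prod_mul_distrib,
      ← Finset.prod_sdiff hsub]
    have h1 : ∏ p ∈ W, (x p.1 - x p.2) * (y p.1 - y p.2) *
        (((x p.1 - x p.2 + (y p.1 - y p.2)) / 2) ^ 2 / ((x p.1 - x p.2) * (y p.1 - y p.2))) =
        ∏ p ∈ W, (((1 / 2 : ℝ) • (x + y)) p.1 - ((1 / 2 : ℝ) • (x + y)) p.2) ^ 2 :=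
      Finset.prod_congr rfl fun p hp => by
        rw [hmid, mul_div_cancel₀]
        exact (mul_pos (hgap hx p (hW p hp)) (hgap hy p (hW p hp))).ne'
    rw [h1]
    refine mul_le_mul_of_nonneg_right (Finset.prod_le_prod (fun p hp => ?_) fun p hp => ?_)
      (Finset.prod_nonneg fun _ _ => sq_nonneg _)
    · have hlt : p.1 < p.2 := by simpa using (Finset.mem_sdiff.1 hp).1
      exact (mul_pos (hgap hx p hlt) (hgap hy p hlt)).le
    · rw [hmid]
      nlinarith [sq_nonneg (x p.1 - x p.2 - (y p.1 - y p.2))]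
  have hexp : Real.exp (-(∑ l, x l ^ 2) / 2) * Real.exp (-(∑ l, y l ^ 2) / 2) *
      Real.exp (∑ l, (x l - y l) ^ 2 / 4) =
      Real.exp (-(∑ l, ((1 / 2 : ℝ) • (x + y)) l ^ 2) / 2) ^ 2 := by
    rw [← Real.exp_add, ← Real.exp_add, ← Real.exp_nat_mul]
    congr 1
    rw [← Finset.sum_neg_distrib, ← Finset.sum_neg_distrib, ← Finset.sum_neg_distrib,
      Finset.sum_div, Finset.sum_div, Finset.sum_div, Finset.mul_sum, ← Finset.sum_add_distrib,
      ← Finset.sum_add_distrib]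
    refine Finset.sum_congr rfl fun l _ => ?_
    simp only [Pi.smul_apply, Pi.add_apply, smul_eq_mul]
    push_cast
    ring
  have hpos : 0 ≤ vand x * vand y * (∏ p ∈ W, ((x p.1 - x p.2 + (y p.1 - y p.2)) / 2) ^ 2 /
      ((x p.1 - x p.2) * (y p.1 - y p.2))) :=
    mul_nonneg (mul_pos hx.vand_pos hy.vand_pos).le (Finset.prod_nonneg fun p hp =>
      div_nonneg (sq_nonneg _) (mul_pos (hgap hx p (hW p hp)) (hgap hy p (hW p hp))).le)
  rw [rowDensity, rowDensity, rowDensity]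
  calc _ = (vand x * vand y * (∏ p ∈ W, ((x p.1 - x p.2 + (y p.1 - y p.2)) / 2) ^ 2 /
      ((x p.1 - x p.2) * (y p.1 - y p.2)))) ^ 2 * (Real.exp (-(∑ l, x l ^ 2) / 2) *
      Real.exp (-(∑ l, y l ^ 2) / 2) * Real.exp (∑ l, (x l - y l) ^ 2 / 4)) := by ring
    _ ≤ (vand ((1 / 2 : ℝ) • (x + y)) ^ 2) ^ 2 *
      Real.exp (-(∑ l, ((1 / 2 : ℝ) • (x + y)) l ^ 2) / 2) ^ 2 := by
        rw [hexp]
        gcongr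
    _ = _ := by ring

/-- The Prékopa–Leindler inequality for the eigenvalue law, with a transport cost. -/
theorem prekopaLeindler_rowLaw {n : ℕ} {f g h : (Fin n → ℝ) → ℝ≥0∞} (hf : Measurable f)
    (hg : Measurable g) (hh : Measurable h) (R : (Fin n → ℝ) → (Fin n → ℝ) → ℝ)
    (hR : ∀ x y, StrictAnti x → StrictAnti y →
      rowDensity x * rowDensity y * R x y ≤ rowDensity ((1 / 2 : ℝ) • (x + y)) ^ 2)
    (H : ∀ x y, StrictAnti x → StrictAnti y →
      f x * g y ≤ ENNReal.ofReal (R x y) * h ((1 / 2 : ℝ) • (x + y)) ^ 2) :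
    (∫⁻ x, f x ∂rowLaw n) * (∫⁻ x, g x ∂rowLaw n) ≤ (∫⁻ x, h x ∂rowLaw n) ^ 2 := by
  obtain ⟨c, hc, hlaw⟩ := exists_rowLaw_eq_withDensity n
  have hm := measurable_ofReal_mul_chamberDensity n c
  rw [hlaw, lintegral_withDensity_mul _ hm hf, lintegral_withDensity_mul _ hm hg,
    lintegral_withDensity_mul _ hm hh]
  refine prekopaLeindler_pi (Fin n) _ _ _ (hm.mul hf) (hm.mul hg) (hm.mul hh) fun x y => ?_
  by_cases hx : StrictAnti x
  swap; · simp [chamberDensity_of_not_strictAnti hx]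
  by_cases hy : StrictAnti y
  swap; · simp [chamberDensity_of_not_strictAnti hy]
  have hxy : StrictAnti ((1 / 2 : ℝ) • (x + y)) := hx.midpoint hy
  rw [chamberDensity_of_strictAnti hx, chamberDensity_of_strictAnti hy,
    chamberDensity_of_strictAnti hxy]
  have hx0 := rowDensity_nonneg x
  have hy0 := rowDensity_nonneg y
  calc _ = ENNReal.ofReal (c * rowDensity x) * ENNReal.ofReal (c * rowDensity y) *
        (f x * g y) := by ring
    _ ≤ ENNReal.ofReal (c * rowDensity x) * ENNReal.ofReal (c * rowDensity y) *
        (ENNReal.ofReal (R x y) * h ((1 / 2 : ℝ) • (x + y)) ^ 2) := by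
        exact mul_le_mul_right (H x y hx hy) _
    _ = ENNReal.ofReal (c ^ 2 * (rowDensity x * rowDensity y * R x y)) *
        h ((1 / 2 : ℝ) • (x + y)) ^ 2 := by
        rw [← mul_assoc, ← ENNReal.ofReal_mul (by positivity), ← ENNReal.ofReal_mul (by positivity)]
        congr 2
        ring
    _ ≤ ENNReal.ofReal (c ^ 2 * rowDensity ((1 / 2 : ℝ) • (x + y)) ^ 2) *
        h ((1 / 2 : ℝ) • (x + y)) ^ 2 := by
        gcongr; exact hR x y hx hy
    _ = _ := by
        rw [mul_pow, ← mul_pow c, ENNReal.ofReal_pow (mul_nonneg hc.le (rowDensity_nonneg _))]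

/-- A function whose two-sided exponential moments are balanced concentrates around a constant. -/
theorem exists_lintegral_sub_sq_le {α : Type*} [MeasurableSpace α] {μ : Measure α} {F : α → ℝ}
    (hF : Measurable F) {s K : ℝ} (hs : 0 < s) (hK : 0 ≤ K)
    (h : (∫⁻ a, ENNReal.ofReal (Real.exp (s * F a)) ∂μ) *
      (∫⁻ a, ENNReal.ofReal (Real.exp (-(s * F a))) ∂μ) ≤ ENNReal.ofReal (K ^ 2)) :
    ∃ c : ℝ, ∫⁻ a, ENNReal.ofReal ((F a - c) ^ 2) ∂μ ≤ ENNReal.ofReal (4 * K / s ^ 2) := by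
  have hm1 : Measurable fun a => ENNReal.ofReal (Real.exp (s * F a)) :=
    (hF.const_mul s).exp.ennreal_ofReal
  have hm2 : Measurable fun a => ENNReal.ofReal (Real.exp (-(s * F a))) :=
    (hF.const_mul s).neg.exp.ennreal_ofReal
  rcases eq_or_ne μ 0 with rfl | hμ
  · exact ⟨0, by simp⟩
  have hpos : ∀ {G : α → ℝ}, (Measurable fun a => ENNReal.ofReal (Real.exp (G a))) →
      ∫⁻ a, ENNReal.ofReal (Real.exp (G a)) ∂μ ≠ 0 := fun hG h0 => by
    rw [lintegral_eq_zero_iff hG] at h0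
    refine hμ (ae_eq_bot.1 (Filter.eventually_false_iff_eq_bot.1 ?_))
    filter_upwards [h0] with a ha
    simp [not_le.2 (Real.exp_pos _)] at ha
  have hP0 := hpos hm1
  have hQ0 := hpos hm2
  have hlt := h.trans_lt ENNReal.ofReal_lt_top
  set P := ∫⁻ a, ENNReal.ofReal (Real.exp (s * F a)) ∂μ with hP
  set Q := ∫⁻ a, ENNReal.ofReal (Real.exp (-(s * F a))) ∂μ with hQ
  have hPt : P ≠ ∞ := fun ht => by rw [ht, ENNReal.top_mul hQ0] at hlt; exact lt_irrefl _ hlt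
  have hQt : Q ≠ ∞ := fun ht => by rw [ht, ENNReal.mul_top hP0] at hlt; exact lt_irrefl _ hlt
  set p := P.toReal
  set q := Q.toReal
  have hp : 0 < p := ENNReal.toReal_pos hP0 hPt
  have hq : 0 < q := ENNReal.toReal_pos hQ0 hQt
  have hpq : p * q ≤ K ^ 2 := by
    have := ENNReal.toReal_mono ENNReal.ofReal_ne_top h
    rwa [ENNReal.toReal_mul, ENNReal.toReal_ofReal (sq_nonneg K)] at this
  have hr : √(p * q) ≤ K := Real.sqrt_le_iff.2 ⟨hK, hpq⟩
  set c := (Real.log p - Real.log q) / (2 * s) with hc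
  have hlog : Real.log √(p * q) = (Real.log p + Real.log q) / 2 := by
    rw [Real.log_sqrt (by positivity), Real.log_mul hp.ne' hq.ne']
  have hsc : s * c = (Real.log p - Real.log q) / 2 := by rw [hc]; field_simp
  have e1 : Real.exp (-(s * c)) * p = √(p * q) := by
    rw [← Real.exp_log (show 0 < √(p * q) by positivity), hlog]
    rw [show Real.exp (-(s * c)) * p = Real.exp (-(s * c)) * Real.exp (Real.log p) by
      rw [Real.exp_log hp], ← Real.exp_add, hsc]
    congr 1; ring
  have e2 : Real.exp (s * c) * q = √(p * q) := by
    rw [← Real.exp_log (show 0 < √(p * q) by positivity), hlog]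
    rw [show Real.exp (s * c) * q = Real.exp (s * c) * Real.exp (Real.log q) by
      rw [Real.exp_log hq], ← Real.exp_add, hsc]
    congr 1; ring
  refine ⟨c, ?_⟩
  have hbound : ∀ a, ENNReal.ofReal ((F a - c) ^ 2) ≤
      ENNReal.ofReal (Real.exp (-(s * c)) * 2 / s ^ 2) * ENNReal.ofReal (Real.exp (s * F a)) +
      ENNReal.ofReal (Real.exp (s * c) * 2 / s ^ 2) * ENNReal.ofReal (Real.exp (-(s * F a))) := by
    intro a
    rw [← ENNReal.ofReal_mul (by positivity), ← ENNReal.ofReal_mul (by positivity),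
      ← ENNReal.ofReal_add (by positivity) (by positivity)]
    refine ENNReal.ofReal_le_ofReal ?_
    rw [div_mul_eq_mul_div, div_mul_eq_mul_div, ← add_div, le_div_iff₀ (by positivity),
      mul_right_comm, mul_right_comm _ 2, ← Real.exp_add, ← Real.exp_add]
    set t := s * (F a - c) with ht
    have h1 : ∀ u : ℝ, 0 ≤ u → u ^ 2 / 2 ≤ Real.exp u := fun u hu => by
      linarith [Real.quadratic_le_exp_of_nonneg hu]
    have h2 : t ^ 2 ≤ (Real.exp t + Real.exp (-t)) * 2 := by
      have e1 := Real.exp_pos t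
      have e2 := Real.exp_pos (-t)
      rcases le_total 0 t with h0 | h0
      · linarith [h1 t h0]
      · have := h1 (-t) (neg_nonneg.2 h0)
        rw [neg_sq] at this
        linarith
    rw [show -(s * c) + s * F a = t by rw [ht]; ring, show s * c + -(s * F a) = -t by rw [ht]; ring]
    nlinarith
  calc _ ≤ ∫⁻ a, ENNReal.ofReal (Real.exp (-(s * c)) * 2 / s ^ 2) *
        ENNReal.ofReal (Real.exp (s * F a)) +
      ENNReal.ofReal (Real.exp (s * c) * 2 / s ^ 2) * ENNReal.ofReal (Real.exp (-(s * F a))) ∂μ :=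
        lintegral_mono hbound
    _ = ENNReal.ofReal (Real.exp (-(s * c)) * 2 / s ^ 2) * P +
        ENNReal.ofReal (Real.exp (s * c) * 2 / s ^ 2) * Q := by
        rw [lintegral_add_left (hm1.const_mul _), lintegral_const_mul _ hm1,
          lintegral_const_mul _ hm2]
    _ = ENNReal.ofReal (4 * √(p * q) / s ^ 2) := by
        rw [← ENNReal.ofReal_toReal hPt, ← ENNReal.ofReal_toReal hQt,
          ← ENNReal.ofReal_mul (by positivity), ← ENNReal.ofReal_mul (by positivity),
          ← ENNReal.ofReal_add (by positivity) (by positivity)]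
        congr 1
        rw [div_mul_eq_mul_div, div_mul_eq_mul_div, mul_right_comm, mul_right_comm _ 2, e1, e2]
        ring
    _ ≤ _ := by gcongr

theorem lintegral_exp_coord_mul_le {n : ℕ} (j : Fin n) :
    (∫⁻ x, ENNReal.ofReal (Real.exp (1 * x j)) ∂rowLaw n) *
      (∫⁻ x, ENNReal.ofReal (Real.exp (-(1 * x j))) ∂rowLaw n) ≤ ENNReal.ofReal (2 ^ 2) := by
  refine (prekopaLeindler_rowLaw (h := fun _ => 2) (by fun_prop) (by fun_prop) measurable_const
    (fun x y => Real.exp (∑ l, (x l - y l) ^ 2 / 4)) (fun x y hx hy => ?_)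
    fun x y hx hy => ?_).trans_eq (by
      rw [lintegral_const, measure_univ, mul_one, ENNReal.ofReal_pow two_pos.le]; norm_num)
  · simpa using rowDensity_mul_le hx hy ∅ (by simp)
  · have h1 : (x j - y j) ^ 2 / 4 ≤ ∑ l, (x l - y l) ^ 2 / 4 :=
      Finset.single_le_sum (f := fun l => (x l - y l) ^ 2 / 4) (fun _ _ => by positivity)
        (Finset.mem_univ j)
    have h2 : Real.exp 1 ≤ 4 := by linarith [Real.exp_one_lt_d9]
    rw [← ENNReal.ofReal_mul (by positivity), ← Real.exp_add,
      show ((2 : ℝ≥0∞) ^ 2) = ENNReal.ofReal 4 by norm_num, ← ENNReal.ofReal_mul (by positivity)]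
    refine ENNReal.ofReal_le_ofReal ?_
    calc Real.exp (1 * x j + -(1 * y j)) ≤
          Real.exp (∑ l, (x l - y l) ^ 2 / 4 + 1) :=
          Real.exp_le_exp.2 (by nlinarith [sq_nonneg (x j - y j - 2)])
      _ ≤ _ := by
          rw [Real.exp_add]
          gcongr

/-- Eigenvalues fluctuate on the scale one. -/
theorem integral_coord_sub_sq_le {n : ℕ} (j : Fin n) :
    ∫ x, (x j - ∫ z, z j ∂rowLaw n) ^ 2 ∂rowLaw n ≤ 8 := by
  obtain ⟨c, hc⟩ := exists_lintegral_sub_sq_le (measurable_pi_apply j) one_pos two_pos.le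
    (lintegral_exp_coord_mul_le j)
  have hm : Measurable fun x : Fin n → ℝ => x j - c := by fun_prop
  have h1 : ∫ x, (x j - c) ^ 2 ∂rowLaw n ≤ 8 := by
    rw [integral_eq_lintegral_of_nonneg_ae (Filter.Eventually.of_forall fun _ => sq_nonneg _)
      (hm.pow_const 2).aestronglyMeasurable]
    refine (ENNReal.toReal_mono ENNReal.ofReal_ne_top hc).trans_eq ?_
    rw [ENNReal.toReal_ofReal] <;> norm_num
  have hX : MemLp (fun x : Fin n → ℝ => x j) 2 (rowLaw n) :=
    (memLp_two_iff_integrable_sq (measurable_pi_apply j).aestronglyMeasurable).2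
      (integrable_coord_sq j)
  have h2 : variance (fun x : Fin n → ℝ => x j) (rowLaw n) ≤ ∫ x, (x j - c) ^ 2 ∂rowLaw n := by
    have := variance_sub_const (μ := rowLaw n) (X := fun x : Fin n → ℝ => x j)
      (measurable_pi_apply j).aestronglyMeasurable c
    rw [← this]
    exact variance_le_expectation_sq hm.aestronglyMeasurable
  rw [variance_eq_integral (measurable_pi_apply j).aemeasurable] at h2
  exact h2.trans h1

theorem integral_coord_sq_le_sq_add {n : ℕ} (j : Fin n) :
    ∫ x, x j ^ 2 ∂rowLaw n ≤ (∫ x, x j ∂rowLaw n) ^ 2 + 8 := by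
  have h := integral_coord_sub_sq_le j
  have hX : MemLp (fun x : Fin n → ℝ => x j) 2 (rowLaw n) :=
    (memLp_two_iff_integrable_sq (measurable_pi_apply j).aestronglyMeasurable).2
      (integrable_coord_sq j)
  have := variance_eq_sub hX
  rw [variance_eq_integral (measurable_pi_apply j).aemeasurable] at this
  simp only [Pi.pow_apply] at this
  linarith

theorem le_integral_coord_mul {n : ℕ} (j k : Fin n) :
    (∫ x, x j ∂rowLaw n) * (∫ x, x k ∂rowLaw n) - 8 ≤ ∫ x, x j * x k ∂rowLaw n := by
  set a := ∫ x, x j ∂rowLaw n with ha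
  set b := ∫ x, x k ∂rowLaw n with hb
  have hi : ∀ (l : Fin n) (c : ℝ), Tame 2 fun x : Fin n → ℝ => (x l - c) ^ 2 := fun l c =>
    (((Tame.coord l).sub (Tame.const c)).pow 2).mono (by simp)
  have h1 : ∫ x, a * x k + b * x j - a * b - x j * x k ∂rowLaw n ≤
      ∫ x, 1 / 2 * (x j - a) ^ 2 + 1 / 2 * (x k - b) ^ 2 ∂rowLaw n := by
    refine integral_mono ?_ (((hi j a).const_mul _).add ((hi k b).const_mul _)).integrable
      fun x => ?_
    · exact (((((Tame.coord k).const_mul a).add ((Tame.coord j).const_mul b)).sub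
        (Tame.const (a * b))).sub ((Tame.coord j).mul (Tame.coord k))).integrable_of_le (by simp)
    · simp only
      nlinarith [sq_nonneg (x j - a + (x k - b))]
  rw [Tame.integral_add ((hi j a).const_mul _) ((hi k b).const_mul _), integral_const_mul,
    integral_const_mul, Tame.integral_sub (((((Tame.coord k).const_mul a).add
    ((Tame.coord j).const_mul b)).sub (Tame.const (a * b))).mono (by simp))
    (((Tame.coord j).mul (Tame.coord k)).mono (by simp)), Tame.integral_sub
    ((((Tame.coord k).const_mul a).add ((Tame.coord j).const_mul b)).mono (by simp))
    ((Tame.const _).mono (by simp)), Tame.integral_add (((Tame.coord k).const_mul a).mono (by simp))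
    (((Tame.coord j).const_mul b).mono (by simp)), integral_const_mul, integral_const_mul] at h1
  have h2 := integral_coord_sub_sq_le j
  have h3 := integral_coord_sub_sq_le k
  simp only [← ha, ← hb, integral_const, probReal_univ, smul_eq_mul] at h1 h2 h3
  linarith

theorem le_sum_sub_mul_repulsion {n : ℕ} {x : Fin n → ℝ} (hx : Function.Injective x) (j : Fin n)
    (T : Finset (Fin n)) (hj : j ∉ T)
    (h : ∀ k ∈ T, ∀ m ∉ T, 0 ≤ (x k - x m)⁻¹ * (x k - x j)) :
    (T.card : ℝ) ^ 2 + T.card ≤ 2 * ∑ k ∈ T, (x k - x j) * repulsion k x := by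
  have h1 := sum_mul_repulsion x fun k => if k ∈ T then x k - x j else 0
  simp only [ite_mul, zero_mul, Finset.sum_ite_mem, Finset.univ_inter] at h1
  rw [h1]
  have hne : ∀ {k m}, k ≠ m → x k - x m ≠ 0 := fun hkm => sub_ne_zero.2 (hx.ne hkm)
  have h2 : ∀ k m, (if k ∈ T then (if m ∈ T then (1 : ℝ) else 0) else 0) -
      (if k = m then (if m ∈ T then 1 else 0) else 0) +
      (if m = j then (if k ∈ T then (1 : ℝ) else 0) else 0) +
      (if k = j then (if m ∈ T then (1 : ℝ) else 0) else 0) ≤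
      (x k - x m)⁻¹ * ((if k ∈ T then x k - x j else 0) - if m ∈ T then x m - x j else 0) := by
    intro k m
    by_cases hk : k ∈ T <;> by_cases hm : m ∈ T
    · have hkj : k ≠ j := fun e => hj (e ▸ hk)
      have hmj : m ≠ j := fun e => hj (e ▸ hm)
      rcases eq_or_ne k m with rfl | hkm
      · simp [hk, hkj]
      · simp only [hk, hm, hkj, hmj, hkm, if_true, if_false]
        rw [show x k - x j - (x m - x j) = x k - x m by ring, inv_mul_cancel₀ (hne hkm)]
        norm_num
    · have hkj : k ≠ j := fun e => hj (e ▸ hk)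
      have hkm : k ≠ m := fun e => hm (e ▸ hk)
      simp only [hk, hm, hkj, hkm, if_true, if_false, sub_zero, zero_add, add_zero]
      by_cases hmj : m = j
      · subst hmj
        rw [inv_mul_cancel₀ (hne hkm), if_pos rfl]
      · rw [if_neg hmj]; exact h k hk m hm
    · have hmj : m ≠ j := fun e => hj (e ▸ hm)
      have hkm : k ≠ m := fun e => hk (e ▸ hm)
      simp only [hk, hm, hmj, hkm, if_true, if_false, sub_zero, zero_add, zero_sub]
      rw [← neg_sub (x m), inv_neg, neg_mul_neg]
      by_cases hkj : k = j
      · subst hkj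
        rw [inv_mul_cancel₀ (hne hkm.symm), if_pos rfl]
      · rw [if_neg hkj]; exact h m hm k hk
    · simp [hk, hm]
  refine le_trans (le_of_eq ?_) (Finset.sum_le_sum fun k _ => Finset.sum_le_sum fun m _ => h2 k m)
  simp only [Finset.sum_add_distrib, Finset.sum_sub_distrib, Finset.sum_ite_eq, Finset.sum_ite_eq',
    Finset.mem_univ, if_true]
  have e1 : (∑ k, ∑ m, if k ∈ T then (if m ∈ T then (1 : ℝ) else 0) else 0) = T.card ^ 2 := by
    simp [sq]
  have e2 : (∑ k, if k ∈ T then (1 : ℝ) else 0) = T.card := by simp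
  have e3 : (∑ k, ∑ m, if k = j then (if m ∈ T then (1 : ℝ) else 0) else 0) = T.card := by
    rw [Finset.sum_comm]; simp
  rw [e1, e2, e3]
  ring

theorem card_sq_le_integral {n : ℕ} (j : Fin n) (T : Finset (Fin n)) (hj : j ∉ T)
    (h : ∀ x : Fin n → ℝ, StrictAnti x → ∀ k ∈ T, ∀ m ∉ T, 0 ≤ (x k - x m)⁻¹ * (x k - x j)) :
    (T.card : ℝ) ^ 2 ≤ ∑ k ∈ T, ((∫ x, x k ^ 2 ∂rowLaw n) - ∫ x, x j * x k ∂rowLaw n) := by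
  have hsub : ∀ k, Tame 0 fun x : Fin n → ℝ => x k - x j := fun k =>
    (Tame.coord k).sub (Tame.coord j)
  have hr : ∀ k, Tame 2 fun x : Fin n → ℝ => (x k - x j) * repulsion k x := fun k =>
    ((hsub k).mul (Tame.repulsion k)).mono (by simp)
  have hq : ∀ k, Tame 2 fun x : Fin n → ℝ => x k ^ 2 - x j * x k := fun k =>
    (tame_coord_sq k).sub (((Tame.coord j).mul (Tame.coord k)).mono (by simp))
  have h1 : ∀ k ∈ T, 1 + (2 * (∫ x, (x k - x j) * repulsion k x ∂rowLaw n)) =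
      (∫ x, x k ^ 2 ∂rowLaw n) - ∫ x, x j * x k ∂rowLaw n := fun k hk => by
    have hkj : j ≠ k := fun e => hj (e ▸ hk)
    have := integral_rowLaw_deriv_add k ((hsub k).mono zero_le_one)
      ((Tame.const 1).mono (Nat.zero_le 2)) fun x => by
        simpa [HasLineDerivAt, Pi.single_eq_of_ne hkj] using
          HasDerivAt.fun_sub (hasLineDerivAt_coord k k x) (hasLineDerivAt_coord j k x)
    have e : ∀ x : Fin n → ℝ, 1 + (x k - x j) * (2 * repulsion k x - x k) =
        1 + 2 * ((x k - x j) * repulsion k x) - (x k ^ 2 - x j * x k) := fun x => by ring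
    simp only [e] at this
    rw [Tame.integral_sub (((Tame.const 1).mono (Nat.zero_le 2)).add ((hr k).const_mul 2)) (hq k),
      Tame.integral_add ((Tame.const 1).mono (Nat.zero_le 2)) ((hr k).const_mul 2),
      integral_const_mul, Tame.integral_sub (tame_coord_sq k)
      (((Tame.coord j).mul (Tame.coord k)).mono (by simp))] at this
    simp only [integral_const, probReal_univ, smul_eq_mul] at this
    linarith
  rw [← Finset.sum_congr rfl h1, Finset.sum_add_distrib, ← Finset.mul_sum,
    ← integral_finsetSum T fun k _ => (hr k).integrable]
  have h2 : (T.card : ℝ) ^ 2 + T.card ≤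
      2 * ∫ x, ∑ k ∈ T, (x k - x j) * repulsion k x ∂rowLaw n := by
    rw [← integral_const_mul]
    have : ∫ _x, ((T.card : ℝ) ^ 2 + T.card) ∂rowLaw n = (T.card : ℝ) ^ 2 + T.card := by simp
    rw [← this]
    refine integral_mono_ae (integrable_const _)
      ((Tame.sum T fun k _ => hr k).const_mul 2).integrable ?_
    filter_upwards [ae_strictAnti_rowLaw n] with x hx
    exact le_sum_sub_mul_repulsion hx.injective j T hj (h x hx)
  have : (0 : ℝ) ≤ T.card := T.card.cast_nonneg
  simp only [Finset.sum_const, nsmul_eq_mul, mul_one]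
  linarith

/-- Eigenvalues of bulk index stay away from the edge in mean square. -/
theorem integral_coord_sq_add_min_le {n : ℕ} (j : Fin n) :
    (∫ x, x j ^ 2 ∂rowLaw n) + min (j : ℝ) (n - 1 - j) ≤ 4 * n + 16 := by
  have key : ∀ T : Finset (Fin n), j ∉ T → (∀ x : Fin n → ℝ, StrictAnti x → ∀ k ∈ T, ∀ m ∉ T,
      0 ≤ (x k - x m)⁻¹ * (x k - x j)) → (∀ k ∈ T, (∫ x, x j ∂rowLaw n) ^ 2 ≤
      (∫ x, x j ∂rowLaw n) * ∫ x, x k ∂rowLaw n) →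
      (∫ x, x j ^ 2 ∂rowLaw n) + (T.card : ℝ) ≤ 4 * n + 16 := by
    intro T hj h hmean
    have h1 := card_sq_le_integral j T hj h
    have h2 : ∑ k ∈ T, ((∫ x, x k ^ 2 ∂rowLaw n) - ∫ x, x j * x k ∂rowLaw n) ≤
        ∑ _k ∈ T, (4 * (n : ℝ) + 16 - ∫ x, x j ^ 2 ∂rowLaw n) := by
      refine Finset.sum_le_sum fun k hk => ?_
      linarith [integral_coord_sq_le k, le_integral_coord_mul j k, integral_coord_sq_le_sq_add j,
        hmean k hk]
    rw [Finset.sum_const, nsmul_eq_mul] at h2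
    rcases T.eq_empty_or_nonempty with rfl | hT
    · simp only [Finset.card_empty, Nat.cast_zero, add_zero]
      linarith [integral_coord_sq_le j]
    · have : (0 : ℝ) < T.card := by exact_mod_cast hT.card_pos
      nlinarith
  have hmono : ∀ {k m : Fin n}, k ≤ m → ∫ x, x m ∂rowLaw n ≤ ∫ x, x k ∂rowLaw n := fun hkm =>
    integral_mono_ae (integrable_coord _) (integrable_coord _) (by
      filter_upwards [ae_strictAnti_rowLaw n] with x hx using hx.antitone hkm)
  rcases le_total 0 (∫ x, x j ∂rowLaw n) with h0 | h0
  · have := key (Finset.Iio j) (by simp) (fun x hx k hk m hm => ?_) fun k hk => ?_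
    · rw [Fin.card_Iio] at this
      exact (add_le_add_right (min_le_left _ _) _).trans this
    · have h1 : k < j := by simpa using hk
      have h2 : j ≤ m := by simpa using hm
      exact mul_nonneg (inv_nonneg.2 (sub_nonneg.2 (hx (h1.trans_le h2)).le))
        (sub_nonneg.2 (hx h1).le)
    · have h1 : k < j := by simpa using hk
      nlinarith [hmono h1.le]
  · have := key (Finset.Ioi j) (by simp) (fun x hx k hk m hm => ?_) fun k hk => ?_
    · rw [Fin.card_Ioi] at this
      refine le_trans (add_le_add_right (min_le_right _ _) _) ?_
      rwa [Nat.sub_sub, Nat.cast_sub (by have := j.2; omega), Nat.cast_add, Nat.cast_one,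
        ← sub_sub] at this
    · have h1 : j < k := by simpa using hk
      have h2 : m ≤ j := by simpa using hm
      exact mul_nonneg_of_nonpos_of_nonpos (inv_nonpos.2 (sub_nonpos.2 (hx (h2.trans_lt h1)).le))
        (sub_nonpos.2 (hx h1).le)
    · have h1 : j < k := by simpa using hk
      nlinarith [hmono h1.le]

/-- The position of the `k`-th point relative to the midpoint of the `a`-th and `b`-th. -/
def centredForm {n : ℕ} (a b k : Fin n) : (Fin n → ℝ) →L[ℝ] ℝ :=
  ContinuousLinearMap.proj (R := ℝ) (φ := fun _ : Fin n => ℝ) k -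
    (1 / 2 : ℝ) • (ContinuousLinearMap.proj (R := ℝ) (φ := fun _ : Fin n => ℝ) a +
      ContinuousLinearMap.proj (R := ℝ) (φ := fun _ : Fin n => ℝ) b)

theorem centredForm_apply {n : ℕ} (a b k : Fin n) (x : Fin n → ℝ) :
    centredForm a b k x = x k - 1 / 2 * (x a + x b) := rfl

theorem StrictAnti.abs_sub_le_centredForm {n : ℕ} {x : Fin n → ℝ} (hx : StrictAnti x)
    {a b : Fin n} (hab : (b : ℕ) = a + 1) (k : Fin n) :
    |x a - x b| ≤ 2 * |centredForm a b k x| := by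
  have hlt : x b < x a := hx (Fin.lt_def.2 (by omega))
  rw [centredForm_apply, abs_of_pos (sub_pos.2 hlt)]
  rcases le_or_gt k a with hk | hk
  · have := hx.antitone hk
    linarith [le_abs_self (x k - 1 / 2 * (x a + x b))]
  · have : x k ≤ x b := hx.antitone (Fin.le_def.2 (by have := Fin.lt_def.1 hk; omega))
    linarith [neg_abs_le (x k - 1 / 2 * (x a + x b))]

theorem sum_centredForm_force_le {n : ℕ} {x : Fin n → ℝ} (hx : StrictAnti x) {a b : Fin n}
    (hab : (b : ℕ) = a + 1) :
    ∑ k, (-(centredForm a b k (Pi.single k 1)) * (centredForm a b k x)⁻¹ ^ 2 +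
      (centredForm a b k x)⁻¹ * (2 * repulsion k x - x k)) ≤
      4 * (x a - x b)⁻¹ ^ 2 - n + (x a ^ 2 + x b ^ 2) / 8 := by
  have hne : a ≠ b := fun e => by rw [e] at hab; omega
  have hg : x a - x b ≠ 0 := sub_ne_zero.2 (hx.injective.ne hne)
  set c := 1 / 2 * (x a + x b) with hc
  set φ : Fin n → ℝ := fun k => (centredForm a b k x)⁻¹ with hφ
  have hφ0 : ∀ k, x k - c ≠ 0 := fun k h0 => by
    have := hx.abs_sub_le_centredForm hab k
    rw [centredForm_apply, h0, abs_zero, mul_zero] at this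
    exact absurd this (abs_pos.2 hg).not_ge
  have hφk : ∀ k, φ k = (x k - c)⁻¹ := fun k => rfl
  have h1 : ∑ k, φ k * (2 * repulsion k x) = -((∑ k, φ k) ^ 2 - ∑ k, φ k ^ 2) := by
    have := sum_mul_repulsion x φ
    rw [Finset.mul_sum] at this
    have e : ∀ k, φ k * (2 * repulsion k x) = 2 * (φ k * repulsion k x) := fun k => by ring
    simp only [e]
    rw [this, sq (∑ k, φ k), Finset.sum_mul_sum, ← Finset.sum_sub_distrib, ← Finset.sum_neg_distrib]
    refine Finset.sum_congr rfl fun k _ => ?_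
    have e2 : φ k ^ 2 = ∑ l, if k = l then φ k * φ l else 0 := by simp [sq]
    rw [e2, ← Finset.sum_sub_distrib, ← Finset.sum_neg_distrib]
    refine Finset.sum_congr rfl fun l _ => ?_
    rcases eq_or_ne k l with rfl | hkl
    · simp
    · have h0 := sub_ne_zero.2 (hx.injective.ne hkl)
      have h1 := hφ0 k
      have h2 := hφ0 l
      rw [if_neg hkl, hφk, hφk]
      field_simp
      ring
  have h2 : ∑ k, φ k * x k = n + c * ∑ k, φ k := by
    have : ∀ k, φ k * x k = 1 + c * φ k := fun k => by
      rw [hφk]; have := hφ0 k; field_simp; ring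
    simp only [this, Finset.sum_add_distrib, Finset.mul_sum]
    simp
  have h3 : ∑ k, -(centredForm a b k (Pi.single k 1)) * φ k ^ 2 =
      4 * (x a - x b)⁻¹ ^ 2 - ∑ k, φ k ^ 2 := by
    have e : ∀ k, -(centredForm a b k (Pi.single k 1)) * φ k ^ 2 =
        -(φ k ^ 2) + (if a = k then 1 / 2 * φ k ^ 2 else 0) +
          (if b = k then 1 / 2 * φ k ^ 2 else 0) := fun k => by
      rw [centredForm_apply, Pi.single_eq_same]
      by_cases hak : a = k <;> by_cases hbk : b = k <;> simp [hak, hbk] <;> ring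
    simp only [e, Finset.sum_add_distrib, Finset.sum_neg_distrib, Finset.sum_ite_eq,
      Finset.mem_univ, if_true]
    rw [hφk a, hφk b, show x a - c = (x a - x b) / 2 by rw [hc]; ring,
      show x b - c = -((x a - x b) / 2) by rw [hc]; ring]
    field_simp
    ring
  have h4 : ∑ k, (-(centredForm a b k (Pi.single k 1)) * φ k ^ 2 +
      φ k * (2 * repulsion k x - x k)) = 4 * (x a - x b)⁻¹ ^ 2 - (∑ k, φ k) ^ 2 - n -
        c * ∑ k, φ k := by
    simp only [mul_sub, Finset.sum_add_distrib, Finset.sum_sub_distrib]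
    rw [h1, h2, h3]
    ring
  change ∑ k, (-(centredForm a b k (Pi.single k 1)) * φ k ^ 2 +
      φ k * (2 * repulsion k x - x k)) ≤ _
  rw [h4]
  have h5 : c ^ 2 ≤ (x a ^ 2 + x b ^ 2) / 2 := by rw [hc]; nlinarith [sq_nonneg (x a - x b)]
  nlinarith [sq_nonneg (∑ k, φ k + c / 2)]

theorem tame_inv_sub_sq {n : ℕ} (a b : Fin n) : Tame 2 fun x : Fin n → ℝ => (x a - x b)⁻¹ ^ 2 :=
  (Tame.inv_sub a b).pow 2

/-- Neighbouring bulk eigenvalues are close. -/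
theorem le_integral_inv_gap_sq {n : ℕ} {a b : Fin n} (hab : (b : ℕ) = a + 1) :
    (min (a : ℝ) (n - 1 - a) + min (b : ℝ) (n - 1 - b)) / 32 - 1 ≤
      ∫ x, (x a - x b)⁻¹ ^ 2 ∂rowLaw n := by
  have hne : a ≠ b := fun e => by rw [e] at hab; omega
  have hT : ∀ k, Tame 2 fun x : Fin n → ℝ =>
      -(centredForm a b k (Pi.single k 1)) * (centredForm a b k x)⁻¹ ^ 2 +
      (centredForm a b k x)⁻¹ * (2 * repulsion k x - x k) := fun k => by
    have h := Tame.inv_of_le (centredForm a b k).continuous.measurable hne two_pos.le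
      fun x hx => hx.abs_sub_le_centredForm hab k
    exact ((h.pow 2).const_mul _).add (h.mul (Tame.force k))
  have h1 : ∫ x, ∑ k, (-(centredForm a b k (Pi.single k 1)) * (centredForm a b k x)⁻¹ ^ 2 +
      (centredForm a b k x)⁻¹ * (2 * repulsion k x - x k)) ∂rowLaw n = 0 := by
    rw [integral_finsetSum _ fun k _ => (hT k).integrable]
    exact Finset.sum_eq_zero fun k _ => integral_rowLaw_inv k _ hne two_pos.le
      fun x hx => hx.abs_sub_le_centredForm hab k
  have t1 : Tame 2 fun x : Fin n → ℝ => 4 * (x a - x b)⁻¹ ^ 2 := (tame_inv_sub_sq a b).const_mul 4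
  have t2 : Tame 2 fun _ : Fin n → ℝ => (n : ℝ) := (Tame.const _).mono (Nat.zero_le 2)
  have t3 : Tame 2 fun x : Fin n → ℝ => 1 / 8 * (x a ^ 2 + x b ^ 2) :=
    ((tame_coord_sq a).add (tame_coord_sq b)).const_mul _
  have h2 : 0 ≤ ∫ x, 4 * (x a - x b)⁻¹ ^ 2 - n + 1 / 8 * (x a ^ 2 + x b ^ 2) ∂rowLaw n := by
    rw [← h1]
    refine integral_mono_ae (Tame.sum _ fun k _ => hT k).integrable
      ((t1.sub t2).add t3).integrable ?_
    filter_upwards [ae_strictAnti_rowLaw n] with x hx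
    refine (sum_centredForm_force_le hx hab).trans_eq (by ring)
  rw [Tame.integral_add (t1.sub t2) t3, Tame.integral_sub t1 t2, integral_const_mul,
    integral_const_mul, Tame.integral_add (tame_coord_sq a) (tame_coord_sq b)] at h2
  simp only [integral_const, probReal_univ, smul_eq_mul, one_mul] at h2
  linarith [integral_coord_sq_add_min_le a, integral_coord_sq_add_min_le b]

theorem summable_two_pow_mul_exp_neg (p : ℕ) :
    Summable fun k : ℕ => (2 : ℝ) ^ ((k + 1) * p) * Real.exp (-(2 : ℝ) ^ k) := by
  refine Summable.of_nonneg_of_le (fun k => by positivity) (fun k => ?_)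
    ((summable_geometric_of_lt_one (r := (1 / 2 : ℝ)) (by norm_num) (by norm_num)).mul_left
      ((2 : ℝ) ^ p * (p + 1).factorial))
  have h := Real.pow_div_factorial_le_exp ((2 : ℝ) ^ k) (by positivity) (p + 1)
  rw [Real.exp_neg, ← div_eq_mul_inv, div_le_iff₀ (Real.exp_pos _)]
  have hf : (0 : ℝ) < (p + 1).factorial := by exact_mod_cast Nat.factorial_pos _
  rw [div_le_iff₀ hf] at h
  calc (2 : ℝ) ^ ((k + 1) * p) = 2 ^ p * (1 / 2) ^ k * (2 ^ k) ^ (p + 1) := by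
        rw [one_div, inv_pow]
        field_simp
        ring
    _ ≤ 2 ^ p * (1 / 2) ^ k * (Real.exp (2 ^ k) * (p + 1).factorial) := by gcongr
    _ = _ := by ring

theorem pow_le_tsum_indicator {r x : ℝ} (hr : 0 < r) (hx : 0 ≤ x) (p : ℕ) :
    ENNReal.ofReal (x ^ p) ≤ ENNReal.ofReal (r ^ p) * (1 + ∑' k : ℕ,
      ENNReal.ofReal ((2 : ℝ) ^ ((k + 1) * p)) * (if 2 ^ k * r < x then 1 else 0)) := by
  rcases le_or_gt x r with hxr | hxr
  · refine le_trans (ENNReal.ofReal_le_ofReal (pow_le_pow_left₀ hx hxr p)) ?_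
    exact le_mul_of_one_le_right' le_self_add
  · have hex : ∃ k : ℕ, x ≤ 2 ^ (k + 1) * r := by
      obtain ⟨k, hk⟩ := pow_unbounded_of_one_lt (x / r) (one_lt_two (α := ℝ))
      refine ⟨k, ?_⟩
      rw [div_lt_iff₀ hr] at hk
      refine hk.le.trans (mul_le_mul_of_nonneg_right ?_ hr.le)
      exact pow_le_pow_right₀ one_le_two (Nat.le_succ k)
    classical
    obtain ⟨k, hk, hk'⟩ : ∃ k : ℕ, x ≤ 2 ^ (k + 1) * r ∧ 2 ^ k * r < x := by
      refine ⟨Nat.find hex, Nat.find_spec hex, ?_⟩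
      rcases hn : Nat.find hex with _ | k
      · simpa using hxr
      · exact not_le.1 (Nat.find_min hex (m := k) (by omega))
    calc ENNReal.ofReal (x ^ p) ≤ ENNReal.ofReal (r ^ p * 2 ^ ((k + 1) * p)) := by
          refine ENNReal.ofReal_le_ofReal ((pow_le_pow_left₀ hx hk p).trans_eq ?_)
          rw [mul_pow, ← pow_mul, mul_comm]
      _ = ENNReal.ofReal (r ^ p) * (ENNReal.ofReal ((2 : ℝ) ^ ((k + 1) * p)) *
          (if 2 ^ k * r < x then 1 else 0)) := by
          rw [if_pos hk', mul_one, ENNReal.ofReal_mul (by positivity)]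
      _ ≤ _ := by
          gcongr
          exact (ENNReal.le_tsum (f := fun k : ℕ => ENNReal.ofReal ((2 : ℝ) ^ ((k + 1) * p)) *
            (if 2 ^ k * r < x then 1 else 0)) k).trans le_add_self

/-- If the squared tail of `G` under `ν` dominates the tail at the doubled level, then all moments
of `G` are controlled by the level at which the tail drops to `ν univ / e`. -/
theorem exists_lintegral_pow_le_of_tail (p : ℕ) : ∃ C : ℝ, 0 < C ∧
    ∀ {α : Type} [MeasurableSpace α] (ν : Measure α) (G : α → ℝ) (_ : Measurable G)
      (_ : ∀ᵐ x ∂ν, 0 ≤ G x) (r : ℝ) (_ : 0 < r)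
      (_ : ∀ s, 0 < s → ν {x | 2 * s < G x} * ν Set.univ ≤ ν {x | s < G x} ^ 2)
      (_ : ν {x | r < G x} ≤ ENNReal.ofReal (Real.exp (-1)) * ν Set.univ)
      (_ : ν Set.univ ≠ ∞),
      ∫⁻ x, ENNReal.ofReal (G x ^ p) ∂ν ≤ ENNReal.ofReal (C * r ^ p) * ν Set.univ := by
  have hsum := summable_two_pow_mul_exp_neg p
  refine ⟨1 + ∑' k : ℕ, (2 : ℝ) ^ ((k + 1) * p) * Real.exp (-(2 : ℝ) ^ k), by positivity, ?_⟩
  intro α _ ν G hG hG0 r hr hdouble htail hfin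
  rcases eq_or_ne (ν Set.univ) 0 with h0 | h0
  · rw [Measure.measure_univ_eq_zero.1 h0]; simp
  have ht : ∀ k : ℕ, ν {x | 2 ^ k * r < G x} ≤
      ENNReal.ofReal (Real.exp (-(2 : ℝ) ^ k)) * ν Set.univ := by
    intro k
    induction k with
    | zero => simpa using htail
    | succ k ih =>
      have h1 := hdouble (2 ^ k * r) (by positivity)
      rw [← mul_assoc, ← pow_succ'] at h1
      have h2 := h1.trans (pow_le_pow_left' ih 2)
      rw [mul_pow, ← ENNReal.ofReal_pow (Real.exp_pos _).le, ← Real.exp_nat_mul, sq (ν Set.univ),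
        ← mul_assoc] at h2
      refine le_trans ((ENNReal.mul_le_mul_iff_left h0 hfin).1 h2) (le_of_eq ?_)
      congr 3
      push_cast
      ring
  have hm : ∀ k : ℕ, MeasurableSet {x | 2 ^ k * r < G x} := fun k =>
    measurableSet_lt measurable_const hG
  have hcoe : ∀ (k : ℕ) x, (if 2 ^ k * r < G x then (1 : ℝ≥0∞) else 0) =
      {x | 2 ^ k * r < G x}.indicator 1 x := fun k x => by
    rw [Set.indicator_apply]; rfl
  calc ∫⁻ x, ENNReal.ofReal (G x ^ p) ∂ν ≤ ∫⁻ x, ENNReal.ofReal (r ^ p) * (1 + ∑' k : ℕ,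
      ENNReal.ofReal ((2 : ℝ) ^ ((k + 1) * p)) * {x | 2 ^ k * r < G x}.indicator 1 x) ∂ν := by
        refine lintegral_mono_ae ?_
        filter_upwards [hG0] with x hx
        simpa only [hcoe] using pow_le_tsum_indicator hr hx p
    _ = ENNReal.ofReal (r ^ p) * (ν Set.univ + ∑' k : ℕ,
        ENNReal.ofReal ((2 : ℝ) ^ ((k + 1) * p)) * ν {x | 2 ^ k * r < G x}) := by
        have hmi : ∀ k : ℕ, Measurable fun x => ENNReal.ofReal ((2 : ℝ) ^ ((k + 1) * p)) *
            {x | 2 ^ k * r < G x}.indicator (1 : α → ℝ≥0∞) x := fun k =>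
          (measurable_one.indicator (hm k)).const_mul _
        have hms : Measurable fun x => (1 : ℝ≥0∞) + ∑' k : ℕ, ENNReal.ofReal ((2 : ℝ) ^
            ((k + 1) * p)) * {x | 2 ^ k * r < G x}.indicator (1 : α → ℝ≥0∞) x :=
          measurable_const.add (Measurable.tsum hmi)
        rw [lintegral_const_mul _ hms,
          lintegral_add_left measurable_const, lintegral_tsum fun k => (hmi k).aemeasurable]
        congr 3
        · simp
        · funext k
          rw [lintegral_const_mul _ (measurable_one.indicator (hm k)),
            lintegral_indicator_one (hm k)]
    _ ≤ ENNReal.ofReal (r ^ p) * (ν Set.univ + ∑' k : ℕ,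
        ENNReal.ofReal ((2 : ℝ) ^ ((k + 1) * p) * Real.exp (-(2 : ℝ) ^ k)) * ν Set.univ) := by
        refine mul_le_mul_right (add_le_add le_rfl (ENNReal.tsum_le_tsum fun k => ?_)) _
        rw [ENNReal.ofReal_mul (by positivity), mul_assoc]
        exact mul_le_mul_right (ht k) _
    _ = _ := by
        rw [ENNReal.tsum_mul_right, ← ENNReal.ofReal_tsum_of_nonneg (fun k => by positivity) hsum,
          mul_comm _ (r ^ p), ENNReal.ofReal_mul (by positivity), ENNReal.ofReal_add zero_le_one
          (tsum_nonneg fun k => by positivity), ENNReal.ofReal_one]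
        ring

/-- The measure `(x a - x b)⁻² d(rowLaw n)`. -/
def gapTilt {n : ℕ} (a b : Fin n) : Measure (Fin n → ℝ) :=
  (rowLaw n).withDensity fun x => ENNReal.ofReal ((x a - x b)⁻¹ ^ 2)

theorem measurable_ofReal_inv_gap_sq {n : ℕ} (a b : Fin n) :
    Measurable fun x : Fin n → ℝ => ENNReal.ofReal ((x a - x b)⁻¹ ^ 2) := by fun_prop

theorem measurableSet_lt_gap {n : ℕ} (a b : Fin n) (s : ℝ) :
    MeasurableSet {x : Fin n → ℝ | s < x a - x b} :=
  measurableSet_lt measurable_const (by fun_prop)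

theorem gapTilt_univ {n : ℕ} (a b : Fin n) :
    gapTilt a b Set.univ = ENNReal.ofReal (∫ x, (x a - x b)⁻¹ ^ 2 ∂rowLaw n) := by
  rw [gapTilt, withDensity_apply _ MeasurableSet.univ, setLIntegral_univ,
    ofReal_integral_eq_lintegral_ofReal (tame_inv_sub_sq a b).integrable
    (Filter.Eventually.of_forall fun x => sq_nonneg _)]

theorem gapTilt_double {n : ℕ} {a b : Fin n} (hab : a < b) (s : ℝ) :
    gapTilt a b {x | 2 * s < x a - x b} * gapTilt a b Set.univ ≤
      gapTilt a b {x | s < x a - x b} ^ 2 := by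
  have hpos : ∀ {x : Fin n → ℝ}, StrictAnti x → 0 < x a - x b := fun hx => sub_pos.2 (hx hab)
  have hm := measurable_ofReal_inv_gap_sq a b
  rw [gapTilt, withDensity_apply _ (measurableSet_lt_gap a b _), withDensity_apply _
    MeasurableSet.univ, withDensity_apply _ (measurableSet_lt_gap a b _), setLIntegral_univ,
    ← lintegral_indicator (measurableSet_lt_gap a b _),
    ← lintegral_indicator (measurableSet_lt_gap a b _)]
  refine prekopaLeindler_rowLaw (hm.indicator (measurableSet_lt_gap a b _)) hm
    (hm.indicator (measurableSet_lt_gap a b _)) _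
    (fun x y hx hy => rowDensity_mul_le hx hy {(a, b)} (by simpa using hab)) fun x y hx hy => ?_
  rcases le_or_gt (x a - x b) (2 * s) with h | h
  · rw [Set.indicator_of_notMem (by simpa using h), zero_mul]
    exact zero_le
  · have hx0 := hpos hx
    have hy0 := hpos hy
    have hmid : ((1 / 2 : ℝ) • (x + y)) a - ((1 / 2 : ℝ) • (x + y)) b =
        (x a - x b + (y a - y b)) / 2 := by
      simp only [Pi.smul_apply, Pi.add_apply, smul_eq_mul]; ring
    rw [Set.indicator_of_mem (by exact h), Set.indicator_of_mem (by
      change s < ((1 / 2 : ℝ) • (x + y)) a - ((1 / 2 : ℝ) • (x + y)) b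
      rw [hmid]; linarith), hmid, ← ENNReal.ofReal_mul (by positivity),
      ← ENNReal.ofReal_pow (by positivity), ← ENNReal.ofReal_mul (by positivity)]
    refine ENNReal.ofReal_le_ofReal ?_
    rw [Finset.prod_singleton]
    set g := x a - x b
    set g' := y a - y b
    have he : 1 ≤ Real.exp (∑ l, (x l - y l) ^ 2 / 4) :=
      Real.one_le_exp (Finset.sum_nonneg fun _ _ => by positivity)
    calc g⁻¹ ^ 2 * g'⁻¹ ^ 2 = ((((g + g') / 2) ^ 2 / (g * g')) ^ 2 * 1) *
          (((g + g') / 2)⁻¹ ^ 2) ^ 2 := by field_simp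
      _ ≤ _ := by gcongr

theorem gapTilt_le {n : ℕ} {a b : Fin n} {r : ℝ} (hr : 0 < r) :
    gapTilt a b {x | r < x a - x b} ≤ ENNReal.ofReal ((r ^ 2)⁻¹) := by
  rw [gapTilt, withDensity_apply _ (measurableSet_lt_gap a b _)]
  calc ∫⁻ x in {x | r < x a - x b}, ENNReal.ofReal ((x a - x b)⁻¹ ^ 2) ∂rowLaw n ≤
      ∫⁻ _x in {x | r < x a - x b}, ENNReal.ofReal ((r ^ 2)⁻¹) ∂rowLaw n := by
        refine setLIntegral_mono' (measurableSet_lt_gap a b _) fun x hx => ?_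
        refine ENNReal.ofReal_le_ofReal ?_
        have hx' : r < x a - x b := hx
        rw [← inv_pow]
        have hx0 : 0 < x a - x b := hr.trans hx'
        gcongr
    _ ≤ _ := by
        rw [setLIntegral_const]
        exact mul_le_of_le_one_right' prob_le_one

/-- Moments of a gap, in terms of the mean inverse square gap. -/
theorem exists_lintegral_gap_pow_le (p : ℕ) : ∃ C : ℝ, 0 < C ∧ ∀ (n : ℕ) (a b : Fin n), a < b →
    ∀ q : ℝ, 0 < q → q ≤ ∫ x, (x a - x b)⁻¹ ^ 2 ∂rowLaw n →
    ∫⁻ x, ENNReal.ofReal ((x a - x b) ^ p) ∂rowLaw n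
      ≤ ENNReal.ofReal (C * (Real.sqrt q)⁻¹ ^ p) := by
  obtain ⟨C, hC, h⟩ := exists_lintegral_pow_le_of_tail (p + 2)
  refine ⟨C * Real.sqrt (Real.exp 1) ^ (p + 2), by positivity, fun n a b hab q hq hqQ => ?_⟩
  set Q := ∫ x, (x a - x b)⁻¹ ^ 2 ∂rowLaw n with hQ
  have hQ0 : 0 < Q := hq.trans_le hqQ
  set r := Real.sqrt (Real.exp 1) * (Real.sqrt Q)⁻¹ with hr
  have hsQ : 0 < Real.sqrt Q := Real.sqrt_pos.2 hQ0
  have hse : 0 < Real.sqrt (Real.exp 1) := Real.sqrt_pos.2 (Real.exp_pos 1)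
  have hr0 : 0 < r := by positivity
  have hr2 : r ^ 2 = Real.exp 1 * Q⁻¹ := by
    rw [hr, mul_pow, inv_pow, Real.sq_sqrt (Real.exp_pos _).le, Real.sq_sqrt hQ0.le]
  have hchamber : ∀ᵐ x ∂rowLaw n, 0 < x a - x b := by
    filter_upwards [ae_strictAnti_rowLaw n] with x hx using sub_pos.2 (hx hab)
  have hmp : Measurable fun x : Fin n → ℝ => ENNReal.ofReal ((x a - x b) ^ (p + 2)) := by fun_prop
  have key := h (gapTilt a b) (fun x => x a - x b) (by fun_prop)
    ((withDensity_absolutelyContinuous _ _).ae_le (hchamber.mono fun x hx => hx.le)) r hr0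
    (fun s _ => gapTilt_double hab s)
    (by
      rw [gapTilt_univ, ← ENNReal.ofReal_mul (Real.exp_pos _).le]
      refine (gapTilt_le hr0).trans (ENNReal.ofReal_le_ofReal (le_of_eq ?_))
      rw [hr2, mul_inv, inv_inv, Real.exp_neg])
    (by rw [gapTilt_univ]; exact ENNReal.ofReal_ne_top)
  rw [gapTilt_univ, ← ENNReal.ofReal_mul (by positivity), gapTilt,
    lintegral_withDensity_eq_lintegral_mul _ (measurable_ofReal_inv_gap_sq a b) hmp] at key
  have e : ∫⁻ x, ENNReal.ofReal ((x a - x b) ^ p) ∂rowLaw n =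
      ∫⁻ x, ((fun x : Fin n → ℝ => ENNReal.ofReal ((x a - x b)⁻¹ ^ 2)) *
        fun x : Fin n → ℝ => ENNReal.ofReal ((x a - x b) ^ (p + 2))) x ∂rowLaw n := by
    refine lintegral_congr_ae ?_
    filter_upwards [hchamber] with x hx
    rw [Pi.mul_apply, ← ENNReal.ofReal_mul (by positivity)]
    congr 1
    field_simp
    ring
  rw [e]
  refine key.trans (ENNReal.ofReal_le_ofReal ?_)
  calc C * r ^ (p + 2) * Q = C * Real.sqrt (Real.exp 1) ^ (p + 2) * (Real.sqrt Q)⁻¹ ^ p := by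
        rw [hr, mul_pow, pow_add (Real.sqrt Q)⁻¹, inv_pow (Real.sqrt Q) 2, Real.sq_sqrt hQ0.le]
        field_simp
    _ ≤ _ := by gcongr

/-- Gaps in the bulk have size `1 / √n`. -/
theorem exists_lintegral_bulk_gap_pow_le {α : ℝ} (hα : 0 < α) (p : ℕ) : ∃ C : ℝ, 0 < C ∧
    ∀ (n : ℕ) (a b : Fin n), (b : ℕ) = a + 1 → 32 ≤ α * n → α * n ≤ a → α * n ≤ n - 1 - (b : ℝ) →
    ∫⁻ x, ENNReal.ofReal ((x a - x b) ^ p) ∂rowLaw n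
      ≤ ENNReal.ofReal (C * (Real.sqrt n)⁻¹ ^ p) := by
  obtain ⟨C, hC, h⟩ := exists_lintegral_gap_pow_le p
  refine ⟨C * (Real.sqrt (α / 32))⁻¹ ^ p, by positivity, fun n a b hab hn ha hb => ?_⟩
  have hn0 : (0 : ℝ) < n := by
    rcases (Nat.cast_nonneg (α := ℝ) n).eq_or_lt with h0 | h0
    · rw [← h0, mul_zero] at hn; norm_num at hn
    · exact h0
  have hbR : (b : ℝ) = a + 1 := by exact_mod_cast hab
  have hq : α / 32 * n ≤ ∫ x, (x a - x b)⁻¹ ^ 2 ∂rowLaw n := by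
    refine le_trans ?_ (le_integral_inv_gap_sq hab)
    have h1 : α * n ≤ min (a : ℝ) (n - 1 - a) := le_min ha (by linarith)
    have h2 : α * n ≤ min (b : ℝ) (n - 1 - b) := le_min (by linarith) hb
    linarith
  refine (h n a b (Fin.lt_def.2 (by omega)) _ (by positivity) hq).trans_eq ?_
  rw [Real.sqrt_mul (by positivity), mul_inv, mul_pow, mul_assoc]

/-- The inverse interlacing gap at `j` is bounded below by this quantity over the `j`-th weight. -/
def gapDrive {n : ℕ} (μ w : Fin n → ℝ) (d : ℝ) (j : Fin n) : ℝ :=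
  μ j - d - ∑ l ∈ Finset.univ.erase j, w l * (μ j - μ l)⁻¹

theorem measurable_gapDrive {n : ℕ} (j : Fin n) :
    Measurable fun p : (Fin n → ℝ) × (Fin n → ℝ) × ℝ => gapDrive p.1 p.2.1 p.2.2 j := by
  unfold gapDrive; fun_prop

theorem gapDrive_update {n : ℕ} (μ w : Fin n → ℝ) (d : ℝ) (j : Fin n) (t : ℝ) :
    gapDrive μ (Function.update w j t) d j = gapDrive μ w d j := by
  unfold gapDrive
  congr 1
  refine Finset.sum_congr rfl fun l hl => ?_
  rw [Function.update_of_ne (Finset.ne_of_mem_erase hl)]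

theorem gapDrive_mul_le {n : ℕ} {μ w : Fin n → ℝ} (hμ : StrictAnti μ) (hw : ∀ l, 0 < w l) (d : ℝ)
    (j : Fin n) : gapDrive μ w d j * (arrowEigs μ w d j.castSucc - μ j) ≤ w j := by
  have hI := interlaces_arrowEigs hμ hw d
  set x := arrowEigs μ w d j.castSucc with hx
  have hxj : 0 < x - μ j := sub_pos.2 (hI j).2
  have hlt : ∀ l, l < j → x < μ l := fun l hl => by
    have h1 : l.succ ≤ j.castSucc := Fin.le_def.2 (by simpa using Fin.lt_def.1 hl)
    exact (hI.strictAnti.antitone h1).trans_lt (hI l).1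
  have hne : ∀ l, x - μ l ≠ 0 := fun l => by
    rcases lt_or_ge l j with h | h
    · exact (sub_neg.2 (hlt l h)).ne
    · exact (sub_pos.2 ((hμ.antitone h).trans_lt (hI j).2)).ne'
  have hsec : secular μ w d x = 0 := by
    rw [← prod_sub_arrowEigs μ (fun l => (hw l).le) d x]
    exact Finset.prod_eq_zero (Finset.mem_univ j.castSucc) (sub_self _)
  have hP : ∏ k, (x - μ k) ≠ 0 := Finset.prod_ne_zero_iff.2 fun k _ => hne k
  have heq : x - d = ∑ l, w l * (x - μ l)⁻¹ := by
    unfold secular at hsec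
    have h1 : ∀ l, w l * ∏ k ∈ Finset.univ.erase l, (x - μ k) =
        (w l * (x - μ l)⁻¹) * ∏ k, (x - μ k) := fun l => by
      rw [← Finset.mul_prod_erase _ _ (Finset.mem_univ l)]
      have := hne l
      field_simp
    simp only [h1, ← Finset.sum_mul, ← sub_mul] at hsec
    exact sub_eq_zero.1 ((mul_eq_zero.1 hsec).resolve_right hP)
  rw [← Finset.add_sum_erase _ _ (Finset.mem_univ j)] at heq
  have hmono : ∑ l ∈ Finset.univ.erase j, w l * (x - μ l)⁻¹ ≤
      ∑ l ∈ Finset.univ.erase j, w l * (μ j - μ l)⁻¹ := by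
    refine Finset.sum_le_sum fun l hl => mul_le_mul_of_nonneg_left ?_ (hw l).le
    rcases lt_or_gt_of_ne (Finset.ne_of_mem_erase hl) with h | h
    · exact (inv_le_inv_of_neg (sub_neg.2 (hlt l h)) (sub_neg.2 (hμ h))).2 (by linarith)
    · exact inv_anti₀ (sub_pos.2 (hμ h)) (by linarith)
  have h2 : gapDrive μ w d j ≤ w j * (x - μ j)⁻¹ := by
    unfold gapDrive
    linarith
  calc _ ≤ w j * (x - μ j)⁻¹ * (x - μ j) := mul_le_mul_of_nonneg_right h2 hxj.le
    _ = w j := by rw [mul_assoc, inv_mul_cancel₀ hxj.ne', mul_one]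

/-- The joint law of two consecutive rows. -/
theorem lintegral_two_rows {n : ℕ} {f : (Fin n → ℝ) × (Fin (n + 1) → ℝ) → ℝ≥0∞}
    (hf : Measurable f) :
    ∫⁻ M, f (patternRow (pattern M) n, patternRow (pattern M) (n + 1)) ∂gueMeasure (n + 1) =
      ∫⁻ p, f (p.1, arrowEigs p.1 p.2.1 p.2.2) ∂(rowLaw n).prod (arrowNoise n) := by
  have hm : Measurable fun M : Matrix (Fin (n + 1)) (Fin (n + 1)) ℂ =>
      f (patternRow (pattern M) n, patternRow (pattern M) (n + 1)) :=
    hf.comp (((measurable_patternRow n).comp (measurable_pattern _)).prodMk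
      ((measurable_patternRow (n + 1)).comp (measurable_pattern _)))
  have hm2 : Measurable fun p : (Fin n → ℝ) × (Fin n → ℝ) × ℝ =>
      f (p.1, arrowEigs p.1 p.2.1 p.2.2) := hf.comp (measurable_fst.prodMk measurable_arrowEigs)
  have hm1 : Measurable fun a : Matrix (Fin n) (Fin n) ℂ × (Fin n → ℝ × ℝ) × ℝ =>
      f (patternRow (pattern (border a.1 (toComplexVec a.2.1) a.2.2)) n,
        patternRow (pattern (border a.1 (toComplexVec a.2.1) a.2.2)) (n + 1)) :=
    hm.comp (measurable_border n)
  rw [← map_border_gueMeasure, lintegral_map hm (measurable_border n),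
    lintegral_prod _ hm1.aemeasurable,
    lintegral_prod _ hm2.aemeasurable, rowLaw, lintegral_map hm2.lintegral_prod_right'
    (measurable_eigsDesc n)]
  refine lintegral_congr_ae ?_
  filter_upwards [ae_isHermitian_gueMeasure n] with B hB
  rw [← lintegral_eigsDesc_border hB (f := fun ν => f (eigsDesc B, ν))
    (hf.comp (measurable_const.prodMk measurable_id))]
  refine lintegral_congr fun q => ?_
  rw [patternRow_pattern _ (Nat.le_succ n), patternRow_pattern _ le_rfl, topMinor_self,
    topMinor_border B _ _ le_rfl, topMinor_self]

theorem lintegral_pi_mul_of_update {ι : Type*} [Fintype ι] {X : ι → Type*}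
    [∀ i, MeasurableSpace (X i)] (μ : ∀ i, Measure (X i)) [∀ i, IsProbabilityMeasure (μ i)] (j : ι)
    {f : X j → ℝ≥0∞} {h : (∀ i, X i) → ℝ≥0∞} (hf : Measurable f) (hh : Measurable h)
    [DecidableEq ι] (hupd : ∀ w t, h (Function.update w j t) = h w) :
    ∫⁻ w, f (w j) * h w ∂Measure.pi μ = (∫⁻ t, f t ∂μ j) * ∫⁻ w, h w ∂Measure.pi μ := by
  have w₀ : ∀ i, X i := fun i => (nonempty_of_isProbabilityMeasure (μ i)).some
  have hmf : Measurable fun w : ∀ i, X i => f (w j) * h w :=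
    (hf.comp (measurable_pi_apply j)).mul hh
  rw [lintegral_eq_lmarginal_univ w₀, lintegral_eq_lmarginal_univ w₀,
    lmarginal_erase' _ hmf (Finset.mem_univ j), lmarginal_erase' _ hh (Finset.mem_univ j)]
  simp only [Function.update_self, hupd, lintegral_const, measure_univ, mul_one]
  simp only [lmarginal]
  rw [← lintegral_const_mul]
  · refine lintegral_congr fun w => ?_
    rw [lintegral_mul_const _ hf]
  · exact hh.comp measurable_updateFinset

theorem lintegral_weight_mul {n : ℕ} (j : Fin n) {f : ℝ → ℝ≥0∞}
    {h : (Fin n → ℝ) × (Fin n → ℝ) × ℝ → ℝ≥0∞} (hf : Measurable f) (hh : Measurable h)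
    (hupd : ∀ μ w d t, h (μ, Function.update w j t, d) = h (μ, w, d)) :
    ∫⁻ p, f (p.2.1 j) * h p ∂(rowLaw n).prod (arrowNoise n) =
      (∫⁻ t, f t ∂expMeasure 1) * ∫⁻ p, h p ∂(rowLaw n).prod (arrowNoise n) := by
  have hfh : Measurable fun p : (Fin n → ℝ) × (Fin n → ℝ) × ℝ => f (p.2.1 j) * h p := by fun_prop
  rw [lintegral_prod _ hfh.aemeasurable, lintegral_prod _ hh.aemeasurable,
    ← lintegral_const_mul _ hh.lintegral_prod_right']
  refine lintegral_congr fun μ => ?_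
  have h1 : Measurable fun q : (Fin n → ℝ) × ℝ => h (μ, q) := by fun_prop
  have h2 : Measurable fun q : (Fin n → ℝ) × ℝ => f (q.1 j) * h (μ, q) := by fun_prop
  unfold arrowNoise
  rw [lintegral_prod_symm _ h2.aemeasurable, lintegral_prod_symm _ h1.aemeasurable,
    ← lintegral_const_mul _ h1.lintegral_prod_left']
  refine lintegral_congr fun d => ?_
  exact lintegral_pi_mul_of_update (fun _ => expMeasure 1) j hf (h := fun w => h (μ, w, d))
    (by fun_prop) fun w t => hupd μ w d t

theorem memLp_id_expMeasure_one : MemLp (fun w : ℝ => w) 2 (expMeasure 1) := by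
  refine (memLp_two_iff_integrable_sq measurable_id.aestronglyMeasurable).2 ?_
  have hG := Real.GammaIntegral_convergent (s := 3) (by norm_num)
  refine ⟨by fun_prop, ?_⟩
  simp only [id_eq]
  rw [hasFiniteIntegral_iff_ofReal (Filter.Eventually.of_forall fun w => sq_nonneg w),
    lintegral_expMeasure_one (f := fun w => ENNReal.ofReal (w ^ 2)) (by fun_prop)]
  have hf := hG.2
  rw [hasFiniteIntegral_iff_ofReal] at hf
  · refine lt_of_le_of_lt (lintegral_mono fun w => ?_) hf
    rw [← ENNReal.ofReal_mul (Real.exp_pos _).le]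
    refine ENNReal.ofReal_le_ofReal (mul_le_mul_of_nonneg_left (le_of_eq ?_) (Real.exp_pos _).le)
    rw [← Real.rpow_natCast]
    norm_num
  · filter_upwards [ae_restrict_mem measurableSet_Ioi] with w hw
    exact mul_nonneg (Real.exp_pos _).le (Real.rpow_nonneg (Set.mem_Ioi.1 hw).le _)

theorem lintegral_pi_expMeasure_sum_sq {n : ℕ} (a : Fin n → ℝ) :
    ∫⁻ w, ENNReal.ofReal ((∑ l, a l * w l - (∫ t, t ∂expMeasure 1) * ∑ l, a l) ^ 2)
        ∂Measure.pi (fun _ : Fin n => expMeasure 1) =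
      ENNReal.ofReal (variance (fun t => t) (expMeasure 1) * ∑ l, a l ^ 2) := by
  have hL : ∀ l : Fin n, MemLp (fun t : ℝ => a l * t) 2 (expMeasure 1) := fun l =>
    memLp_id_expMeasure_one.const_mul (a l)
  have hLs : ∀ l : Fin n, MemLp (fun w : Fin n → ℝ => a l * w l) 2
      (Measure.pi fun _ : Fin n => expMeasure 1) := fun l =>
    (hL l).comp_measurePreserving (measurePreserving_eval (fun _ : Fin n => expMeasure 1) l)
  have hv := variance_sum_pi (μ := fun _ : Fin n => expMeasure 1) (X := fun l t => a l * t) hL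
  have hm : ∫ w, ∑ l, a l * w l ∂Measure.pi (fun _ : Fin n => expMeasure 1) =
      (∫ t, t ∂expMeasure 1) * ∑ l, a l := by
    rw [integral_finsetSum _ fun l _ => (hLs l).integrable one_le_two, Finset.mul_sum]
    refine Finset.sum_congr rfl fun l _ => ?_
    rw [integral_const_mul, mul_comm]
    congr 1
    have hmp := measurePreserving_eval (fun _ : Fin n => expMeasure 1) l
    have h := integral_map (μ := Measure.pi fun _ : Fin n => expMeasure 1) (f := fun t : ℝ => t)
      hmp.measurable.aemeasurable (by fun_prop)
    rw [hmp.map_eq] at h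
    exact h.symm
  have hS : MemLp (∑ l, fun w : Fin n → ℝ => a l * w l) 2
      (Measure.pi fun _ : Fin n => expMeasure 1) := memLp_finsetSum' _ fun l _ => hLs l
  have h2 := ofReal_variance hS
  rw [evariance_eq_lintegral_ofReal, hv] at h2
  simp only [Finset.sum_apply, hm] at h2
  rw [← h2, Finset.mul_sum]
  congr 1
  refine Finset.sum_congr rfl fun l _ => ?_
  rw [variance_const_mul, mul_comm]

/-- The part of `gapDrive` not involving the weight `k`. -/
def gapRest {n : ℕ} (μ w : Fin n → ℝ) (d : ℝ) (j k : Fin n) : ℝ :=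
  μ j - d - ∑ l ∈ (Finset.univ.erase j).erase k, w l * (μ j - μ l)⁻¹

theorem measurable_gapRest {n : ℕ} (j k : Fin n) :
    Measurable fun p : (Fin n → ℝ) × (Fin n → ℝ) × ℝ => gapRest p.1 p.2.1 p.2.2 j k := by
  unfold gapRest; fun_prop

theorem gapRest_update {n : ℕ} (μ w : Fin n → ℝ) (d : ℝ) (j k : Fin n) (t : ℝ) :
    gapRest μ (Function.update w k t) d j k = gapRest μ w d j k := by
  unfold gapRest
  congr 1
  refine Finset.sum_congr rfl fun l hl => ?_
  rw [Function.update_of_ne (Finset.ne_of_mem_erase hl)]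

theorem gapDrive_eq {n : ℕ} (μ w : Fin n → ℝ) (d : ℝ) {j k : Fin n} (h : k ≠ j) :
    gapDrive μ w d j = gapRest μ w d j k + w k * (μ k - μ j)⁻¹ := by
  unfold gapDrive gapRest
  rw [← Finset.add_sum_erase _ _ (Finset.mem_erase.2 ⟨h, Finset.mem_univ k⟩),
    ← neg_sub (μ k) (μ j), inv_neg]
  ring

theorem exists_lintegral_gapRest_sq_le : ∃ K : ℝ, 0 < K ∧ ∀ (n : ℕ) (j k : Fin n), k ≠ j →
    ∫⁻ p, ENNReal.ofReal (gapRest p.1 p.2.1 p.2.2 j k ^ 2) ∂(rowLaw n).prod (arrowNoise n) ≤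
      ENNReal.ofReal (K * n) := by
  set m := ∫ t, t ∂expMeasure 1 with hm
  set V := variance (fun t : ℝ => t) (expMeasure 1) with hV
  have hV0 : 0 ≤ V := variance_nonneg _ _
  refine ⟨4 * (4 + 1 + V + m ^ 2 * 4), by positivity, fun n j k hkj => ?_⟩
  have hn : (1 : ℝ) ≤ n := by exact_mod_cast (Nat.succ_le_of_lt (Fin.pos j))
  set s := (Finset.univ.erase j).erase k with hs
  set a : (Fin n → ℝ) → Fin n → ℝ := fun μ l => if l ∈ s then (μ j - μ l)⁻¹ else 0 with ha
  have ham : ∀ l, Measurable fun μ : Fin n → ℝ => a μ l := fun l => by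
    by_cases h : l ∈ s
    · simp only [ha, h, if_true]; fun_prop
    · simp only [ha, h, if_false]; fun_prop
  have hsum : ∀ μ w : Fin n → ℝ, ∑ l ∈ s, w l * (μ j - μ l)⁻¹ = ∑ l, a μ l * w l := fun μ w => by
    rw [← Finset.sum_subset (Finset.subset_univ s)
      (f := fun l => a μ l * w l) fun l _ h => by simp [ha, h]]
    exact Finset.sum_congr rfl fun l hl => by simp only [ha, hl, if_true]; ring
  have hA : ∀ μ : Fin n → ℝ, (∑ l, a μ l) ^ 2 ≤ 2 * repulsion j μ ^ 2 + 2 * repulsionSq j μ := by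
    intro μ
    have h1 : ∑ l, a μ l = repulsion j μ - (μ j - μ k)⁻¹ := by
      rw [← Finset.sum_subset (Finset.subset_univ s) fun l _ h => by simp [ha, h],
        Finset.sum_congr rfl (g := fun l => (μ j - μ l)⁻¹) fun l hl => by
          simp only [ha, hl, if_true], repulsion,
        ← Finset.add_sum_erase _ _ (Finset.mem_univ j),
        ← Finset.add_sum_erase _ _ (Finset.mem_erase.2 ⟨hkj, Finset.mem_univ k⟩)]
      simp [hs]
    have h2 : (μ j - μ k)⁻¹ ^ 2 ≤ repulsionSq j μ :=
      Finset.single_le_sum (f := fun l => (μ j - μ l)⁻¹ ^ 2) (fun l _ => sq_nonneg _)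
        (Finset.mem_univ k)
    rw [h1]
    nlinarith [sq_nonneg (repulsion j μ + (μ j - μ k)⁻¹)]
  have hQ : ∀ μ : Fin n → ℝ, ∑ l, a μ l ^ 2 ≤ repulsionSq j μ := fun μ => by
    refine Finset.sum_le_sum fun l _ => ?_
    by_cases h : l ∈ s
    · simp only [ha, h, if_true]; exact le_rfl
    · simp only [ha, h, if_false]; simpa using sq_nonneg (μ j - μ l)⁻¹
  have hpt : ∀ μ w : Fin n → ℝ, ∀ d : ℝ, gapRest μ w d j k ^ 2 ≤
      4 * (μ j ^ 2 + d ^ 2 + (∑ l, a μ l * w l - m * ∑ l, a μ l) ^ 2 +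
        m ^ 2 * (2 * repulsion j μ ^ 2 + 2 * repulsionSq j μ)) := by
    intro μ w d
    have h0 : gapRest μ w d j k = μ j - d - ∑ l, a μ l * w l := by rw [← hsum, gapRest]
    have h1 := mul_le_mul_of_nonneg_left (hA μ) (sq_nonneg m)
    rw [h0]
    set Y := ∑ l, a μ l * w l
    set A := ∑ l, a μ l
    have h2 : (μ j - d - Y) ^ 2 ≤ 4 * (μ j ^ 2 + d ^ 2 + (Y - m * A) ^ 2 + (m * A) ^ 2) := by
      nlinarith [sq_nonneg (μ j + d), sq_nonneg (μ j + (Y - m * A)), sq_nonneg (μ j + m * A),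
        sq_nonneg (d - (Y - m * A)), sq_nonneg (d - m * A), sq_nonneg (Y - m * A - m * A)]
    nlinarith
  have hrm : Measurable fun μ : Fin n → ℝ => repulsion j μ := by unfold repulsion; fun_prop
  have hrsm : Measurable fun μ : Fin n → ℝ => repulsionSq j μ := by unfold repulsionSq; fun_prop
  have hrs0 : ∀ μ : Fin n → ℝ, 0 ≤ repulsionSq j μ := fun μ =>
    Finset.sum_nonneg fun _ _ => sq_nonneg _
  have hI : Integrable (fun μ : Fin n → ℝ => 4 * (μ j ^ 2 + 1 + V * repulsionSq j μ +
        m ^ 2 * (2 * repulsion j μ ^ 2 + 2 * repulsionSq j μ))) (rowLaw n) := by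
    have i1 := integrable_coord_sq j
    have i2 := (tame_repulsion_sq j).integrable
    have i3 := (Tame.repulsionSq j).integrable
    exact (((i1.add (integrable_const 1)).add (i3.const_mul V)).add
      (((i2.const_mul 2).add (i3.const_mul 2)).const_mul _)).const_mul 4
  have hg : ∫⁻ d, ENNReal.ofReal (d ^ 2) ∂gaussianReal 0 1 = 1 := by
    have h := ofReal_variance (memLp_id_gaussianReal (μ := 0) (v := 1) 2)
    rw [evariance_eq_lintegral_ofReal, variance_id_gaussianReal] at h
    simpa using h.symm
  have hinner : ∀ μ : Fin n → ℝ,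
      ∫⁻ q, ENNReal.ofReal (gapRest μ q.1 q.2 j k ^ 2) ∂arrowNoise n ≤
        ENNReal.ofReal (4 * (μ j ^ 2 + 1 + V * repulsionSq j μ +
        m ^ 2 * (2 * repulsion j μ ^ 2 + 2 * repulsionSq j μ))) := by
    intro μ
    set c := μ j ^ 2 + m ^ 2 * (2 * repulsion j μ ^ 2 + 2 * repulsionSq j μ) with hc
    have hc0 : 0 ≤ c := by have := hrs0 μ; positivity
    have hm1 : Measurable fun q : (Fin n → ℝ) × ℝ => ENNReal.ofReal (q.2 ^ 2) := by fun_prop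
    have hm2 : Measurable fun q : (Fin n → ℝ) × ℝ =>
      ENNReal.ofReal ((∑ l, a μ l * q.1 l - m * ∑ l, a μ l) ^ 2) := by fun_prop
    calc _ ≤ ∫⁻ q, ENNReal.ofReal 4 * (ENNReal.ofReal c + (ENNReal.ofReal (q.2 ^ 2) +
          ENNReal.ofReal ((∑ l, a μ l * q.1 l - m * ∑ l, a μ l) ^ 2))) ∂arrowNoise n := by
          refine lintegral_mono fun q => ?_
          rw [← ENNReal.ofReal_add (by positivity) (by positivity),
            ← ENNReal.ofReal_add hc0 (by positivity), ← ENNReal.ofReal_mul (by norm_num)]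
          refine ENNReal.ofReal_le_ofReal ((hpt μ q.1 q.2).trans (le_of_eq ?_))
          rw [hc]; ring
      _ = ENNReal.ofReal 4 * (ENNReal.ofReal c + (1 + ENNReal.ofReal (V * ∑ l, a μ l ^ 2))) := by
          rw [lintegral_const_mul _ (by fun_prop), lintegral_add_left measurable_const,
            lintegral_const, measure_univ, mul_one, lintegral_add_left hm1]
          congr 3
          · rw [← hg]
            exact (measurePreserving_snd (μ := Measure.pi fun _ : Fin n => expMeasure 1)
              (ν := gaussianReal 0 1)).lintegral_comp (f := fun d => ENNReal.ofReal (d ^ 2))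
                (by fun_prop)
          · rw [← lintegral_pi_expMeasure_sum_sq]
            exact (measurePreserving_fst (μ := Measure.pi fun _ : Fin n => expMeasure 1)
              (ν := gaussianReal 0 1)).lintegral_comp
                (f := fun w => ENNReal.ofReal ((∑ l, a μ l * w l - m * ∑ l, a μ l) ^ 2))
                (by fun_prop)
      _ ≤ _ := by
          have hq := mul_le_mul_of_nonneg_left (hQ μ) hV0
          have hq0 : 0 ≤ V * ∑ l, a μ l ^ 2 :=
            mul_nonneg hV0 (Finset.sum_nonneg fun _ _ => sq_nonneg _)
          rw [← ENNReal.ofReal_one, ← ENNReal.ofReal_add zero_le_one hq0,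
            ← ENNReal.ofReal_add hc0 (by positivity), ← ENNReal.ofReal_mul (by norm_num)]
          refine ENNReal.ofReal_le_ofReal ?_
          rw [hc]; linarith
  have hmr : Measurable fun p : (Fin n → ℝ) × (Fin n → ℝ) × ℝ =>
      ENNReal.ofReal (gapRest p.1 p.2.1 p.2.2 j k ^ 2) :=
    ((measurable_gapRest j k).pow_const 2).ennreal_ofReal
  rw [lintegral_prod _ hmr.aemeasurable]
  refine (lintegral_mono hinner).trans ?_
  rw [← ofReal_integral_eq_lintegral_ofReal hI (Filter.Eventually.of_forall fun μ => by
    have := hrs0 μ; positivity)]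
  refine ENNReal.ofReal_le_ofReal ?_
  have i1 := integrable_coord_sq j
  have i2 := (tame_repulsion_sq j).integrable
  have i3 := (Tame.repulsionSq j).integrable
  have i4 : Integrable (fun μ : Fin n → ℝ =>
      m ^ 2 * (2 * repulsion j μ ^ 2 + 2 * repulsionSq j μ)) (rowLaw n) :=
    ((i2.const_mul 2).add (i3.const_mul 2)).const_mul _
  rw [integral_const_mul, integral_add (f := fun μ : Fin n → ℝ => μ j ^ 2 + 1 + V * repulsionSq j μ)
      ((i1.add (integrable_const 1)).add (i3.const_mul V)) i4,
    integral_add (f := fun μ : Fin n → ℝ => μ j ^ 2 + 1) (i1.add (integrable_const 1))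
      (i3.const_mul V), integral_add i1 (integrable_const 1), integral_const_mul,
    integral_const_mul, integral_add (i2.const_mul 2) (i3.const_mul 2), integral_const_mul,
    integral_const_mul]
  have e1 := integral_coord_sq_le j
  have e2 := integral_repulsion_sq_le j
  have e3 := integral_repulsionSq_le j
  have e4 := mul_le_mul_of_nonneg_left e3 hV0
  have e5 := mul_le_mul_of_nonneg_left (add_le_add (mul_le_mul_of_nonneg_left e2 zero_le_two)
    (mul_le_mul_of_nonneg_left e3 zero_le_two)) (sq_nonneg m)
  simp only [integral_const, probReal_univ, smul_eq_mul, one_mul]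
  nlinarith

theorem expMeasure_one_Iic {t : ℝ} (ht : 0 ≤ t) :
    expMeasure 1 (Set.Iic t) = ENNReal.ofReal (1 - Real.exp (-t)) := by
  rw [← ofReal_cdf, cdf_expMeasure_eq one_pos, if_pos ht, one_mul]

theorem expMeasure_one_Ioi {t : ℝ} (ht : 0 ≤ t) :
    expMeasure 1 (Set.Ioi t) = ENNReal.ofReal (Real.exp (-t)) := by
  have h : Real.exp (-t) ≤ 1 := Real.exp_le_one_iff.2 (by linarith)
  rw [← Set.compl_Iic, prob_compl_eq_one_sub measurableSet_Iic, expMeasure_one_Iic ht,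
    ← ENNReal.ofReal_one, ← ENNReal.ofReal_sub _ (by linarith)]
  congr 1; ring

theorem measure_weight_inter {n : ℕ} (j : Fin n) {s : Set ℝ}
    {E : Set ((Fin n → ℝ) × (Fin n → ℝ) × ℝ)} (hs : MeasurableSet s) (hE : MeasurableSet E)
    (hupd : ∀ μ w d t, (μ, Function.update w j t, d) ∈ E ↔ (μ, w, d) ∈ E) :
    (rowLaw n).prod (arrowNoise n) ({p | p.2.1 j ∈ s} ∩ E) =
      expMeasure 1 s * (rowLaw n).prod (arrowNoise n) E := by
  have hw : Measurable fun p : (Fin n → ℝ) × (Fin n → ℝ) × ℝ => p.2.1 j := by fun_prop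
  have hA : MeasurableSet {p : (Fin n → ℝ) × (Fin n → ℝ) × ℝ | p.2.1 j ∈ s} := hw hs
  rw [← lintegral_indicator_one hE, ← lintegral_indicator_one hs,
    ← lintegral_indicator_one (hA.inter hE), ← lintegral_weight_mul j (measurable_one.indicator hs)
      (measurable_one.indicator hE)]
  · refine lintegral_congr fun p => ?_
    rw [Set.inter_indicator_one]
    rfl
  · intro μ w d t
    by_cases h : (μ, w, d) ∈ E
    · rw [Set.indicator_of_mem h, Set.indicator_of_mem ((hupd μ w d t).2 h)]; rfl
    · rw [Set.indicator_of_notMem h, Set.indicator_of_notMem (mt (hupd μ w d t).1 h)]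

theorem ae_strictAnti_fst (n : ℕ) :
    ∀ᵐ p ∂(rowLaw n).prod (arrowNoise n), StrictAnti p.1 :=
  Measure.quasiMeasurePreserving_fst.ae (ae_strictAnti_rowLaw n)

theorem exists_le_measure_gapDrive {α : ℝ} (hα : 0 < α) :
    ∃ q : ℝ, 0 < q ∧ ∀ (n : ℕ) (j k : Fin n), (j : ℕ) = k + 1 → 32 ≤ α * n → α * n ≤ k →
      α * n ≤ n - 1 - (j : ℝ) →
      ENNReal.ofReal q ≤ (rowLaw n).prod (arrowNoise n)
        {p | √n ≤ gapDrive p.1 p.2.1 p.2.2 j} := by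
  obtain ⟨K, hK, hrest⟩ := exists_lintegral_gapRest_sq_le
  obtain ⟨C, hC, hgap⟩ := exists_lintegral_bulk_gap_pow_le hα 1
  set T := 8 * C * (√(8 * K) + 1) with hT
  have hT0 : 0 ≤ T := by positivity
  refine ⟨Real.exp (-T) * (3 / 4), by positivity, fun n j k hjk h1 h2 h3 => ?_⟩
  have hkj : k ≠ j := fun h => by rw [h] at hjk; omega
  have hlt : k < j := Fin.lt_def.2 (by omega)
  have hn : (0 : ℝ) < n := by exact_mod_cast Fin.pos j
  have hsn : 0 < √(n : ℝ) := Real.sqrt_pos.2 hn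
  set ν := (rowLaw n).prod (arrowNoise n) with hν
  set B1 : Set ((Fin n → ℝ) × (Fin n → ℝ) × ℝ) :=
    {p | ENNReal.ofReal (8 * K * n) ≤ ENNReal.ofReal (gapRest p.1 p.2.1 p.2.2 j k ^ 2)} with hB1
  set B2 : Set ((Fin n → ℝ) × (Fin n → ℝ) × ℝ) :=
    {p | ENNReal.ofReal (8 * C * (√n)⁻¹) ≤ ENNReal.ofReal (p.1 k - p.1 j)} with hB2
  have hm1 : Measurable fun p : (Fin n → ℝ) × (Fin n → ℝ) × ℝ =>
    ENNReal.ofReal (gapRest p.1 p.2.1 p.2.2 j k ^ 2) :=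
    ((measurable_gapRest j k).pow_const 2).ennreal_ofReal
  have hm2 : Measurable fun p : (Fin n → ℝ) × (Fin n → ℝ) × ℝ =>
    ENNReal.ofReal (p.1 k - p.1 j) := by fun_prop
  have hmB1 : MeasurableSet B1 := measurableSet_le measurable_const hm1
  have hmB2 : MeasurableSet B2 := measurableSet_le measurable_const hm2
  have hP : ∀ {f : (Fin n → ℝ) × (Fin n → ℝ) × ℝ → ℝ≥0∞} {a : ℝ}, Measurable f → 0 < a →
      ∫⁻ p, f p ∂ν ≤ ENNReal.ofReal a → ν {p | ENNReal.ofReal (8 * a) ≤ f p} ≤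
        ENNReal.ofReal (1 / 8) := by
    intro f a hf ha h
    refine (meas_ge_le_lintegral_div hf.aemeasurable (by simpa using ha)
      ENNReal.ofReal_ne_top).trans ?_
    refine (ENNReal.div_le_div_right h _).trans ?_
    rw [← ENNReal.ofReal_div_of_pos (by positivity)]
    refine ENNReal.ofReal_le_ofReal (le_of_eq ?_)
    field_simp
  have hp1 : ν B1 ≤ ENNReal.ofReal (1 / 8) := by
    have := hP hm1 (mul_pos hK hn) (hrest n j k hkj)
    rwa [← mul_assoc] at this
  have hp2 : ν B2 ≤ ENNReal.ofReal (1 / 8) := by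
    have := hP (a := C * (√n)⁻¹) hm2 (by positivity) (by
      have h := hgap n k j hjk h1 h2 h3
      simp only [pow_one] at h
      rw [← (measurePreserving_fst (μ := rowLaw n) (ν := arrowNoise n)).lintegral_comp
        (f := fun μ => ENNReal.ofReal (μ k - μ j)) (by fun_prop)] at h
      exact h)
    rwa [← mul_assoc] at this
  have hE : ENNReal.ofReal (3 / 4) ≤ ν (B1 ∪ B2)ᶜ := by
    have h : ν (B1 ∪ B2) ≤ ENNReal.ofReal (1 / 4) := by
      refine (measure_union_le _ _).trans ((add_le_add hp1 hp2).trans (le_of_eq ?_))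
      rw [← ENNReal.ofReal_add (by norm_num) (by norm_num)]
      norm_num
    rw [prob_compl_eq_one_sub (hmB1.union hmB2)]
    refine le_trans (le_of_eq ?_) (tsub_le_tsub_left h 1)
    rw [← ENNReal.ofReal_one, ← ENNReal.ofReal_sub _ (by norm_num)]
    norm_num
  have hI := measure_weight_inter k measurableSet_Ioi (hmB1.union hmB2).compl (s := Set.Ioi T)
    (fun μ w d t => by simp only [hB1, hB2, Set.mem_compl_iff, Set.mem_union, Set.mem_ofPred_eq,
      gapRest_update])
  calc ENNReal.ofReal (Real.exp (-T) * (3 / 4))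
      = expMeasure 1 (Set.Ioi T) * ENNReal.ofReal (3 / 4) := by
        rw [ENNReal.ofReal_mul (Real.exp_pos _).le, expMeasure_one_Ioi hT0]
    _ ≤ expMeasure 1 (Set.Ioi T) * ν (B1 ∪ B2)ᶜ := mul_le_mul_right hE _
    _ = _ := hI.symm
    _ ≤ _ := by
        refine measure_mono_ae ?_
        filter_upwards [ae_strictAnti_fst n] with p hp hpE
        have hw : T < p.2.1 k := hpE.1
        have hn1 : p ∉ B1 := fun h => hpE.2 (Or.inl h)
        have hn2 : p ∉ B2 := fun h => hpE.2 (Or.inr h)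
        simp only [hB1, hB2, Set.mem_ofPred_eq, not_le] at hn1 hn2
        have hr : gapRest p.1 p.2.1 p.2.2 j k ^ 2 < 8 * K * n :=
          (ENNReal.ofReal_lt_ofReal_iff (by positivity)).1 hn1
        have hg : p.1 k - p.1 j < 8 * C * (√n)⁻¹ :=
          (ENNReal.ofReal_lt_ofReal_iff (by positivity)).1 hn2
        have hg0 : 0 < p.1 k - p.1 j := sub_pos.2 (hp hlt)
        have hr' : -(√(8 * K) * √n) ≤ gapRest p.1 p.2.1 p.2.2 j k := by
          refine (abs_le.1 (Real.abs_le_sqrt hr.le)).1.trans' (le_of_eq ?_)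
          rw [Real.sqrt_mul (by positivity : 0 ≤ 8 * K)]
        have hd : (√(8 * K) + 1) * √n ≤ p.2.1 k * (p.1 k - p.1 j)⁻¹ := by
          rw [← div_eq_mul_inv, le_div_iff₀ hg0]
          refine le_trans ?_ hw.le
          calc (√(8 * K) + 1) * √n * (p.1 k - p.1 j)
              ≤ (√(8 * K) + 1) * √n * (8 * C * (√n)⁻¹) :=
                mul_le_mul_of_nonneg_left hg.le (by positivity)
            _ = T := by rw [hT]; field_simp
        change √n ≤ gapDrive p.1 p.2.1 p.2.2 j
        rw [gapDrive_eq _ _ _ hkj]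
        linarith

theorem sum_measureReal_le_of_pairwise {Ω ι : Type*} [MeasurableSpace Ω] [DecidableEq ι]
    (ν : Measure Ω) [IsFiniteMeasure ν] {A E : ι → Set Ω} {θ : ℝ} (hE : ∀ i, MeasurableSet (E i))
    (hEA : ∀ i, E i ⊆ A i) (hθ : ∀ i j, i ≠ j → ν.real (A i ∩ A j) ≤ θ) (h0 : 0 ≤ θ)
    (s : Finset ι) :
    ∑ i ∈ s, ν.real (E i) ≤ ν.real (⋃ i ∈ s, E i) + (s.card : ℝ) ^ 2 * θ := by
  induction s using Finset.induction_on with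
  | empty => simp
  | insert a s ha ih =>
    have h1 := measureReal_union_add_inter (μ := ν) (s := ⋃ i ∈ s, E i) (hE a)
      (measure_ne_top _ _)
    have h2 : ν.real ((⋃ i ∈ s, E i) ∩ E a) ≤ s.card * θ := by
      rw [Set.iUnion₂_inter]
      refine (measureReal_biUnion_finset_le _ _).trans ?_
      rw [← nsmul_eq_mul]
      refine Finset.sum_le_card_nsmul _ _ _ fun i hi => ?_
      refine (measureReal_mono (Set.inter_subset_inter (hEA i) (hEA a))).trans
        (hθ i a fun h => ha (h ▸ hi))
    rw [Finset.sum_insert ha, Finset.card_insert_of_notMem ha, Finset.set_biUnion_insert,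
      Set.union_comm]
    push_cast
    nlinarith [mul_nonneg (Nat.cast_nonneg (α := ℝ) s.card) h0]

theorem exists_le_measure_small_step {α : ℝ} (hα : 0 < α) :
    ∃ q : ℝ, 0 < q ∧ q ≤ 1 ∧ ∀ (n : ℕ) (s : Finset (Fin n)), s.Nonempty → 32 ≤ α * n →
      (∀ j ∈ s, α * n ≤ (j : ℝ) - 1 ∧ α * n ≤ n - 1 - (j : ℝ)) →
      ENNReal.ofReal (q ^ 2 / 4) ≤ gueMeasure (n + 1)
        {M | ∃ j ∈ s, pattern M (n + 1) j - pattern M n j ≤ q / (s.card * √n)} := by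
  obtain ⟨q, hq, hdrive⟩ := exists_le_measure_gapDrive hα
  refine ⟨min q 1, lt_min hq one_pos, min_le_right _ _, fun n s hs h1 h2 => ?_⟩
  set r := min q 1 with hr
  have hr0 : 0 < r := lt_min hq one_pos
  have hr1 : r ≤ 1 := min_le_right _ _
  have hb : (1 : ℝ) ≤ s.card := by exact_mod_cast hs.card_pos
  have hn : (0 : ℝ) < n := by exact_mod_cast Fin.pos hs.choose
  have hsn : 0 < √(n : ℝ) := Real.sqrt_pos.2 hn
  set θ := r / (2 * s.card) with hθ
  have hθ0 : 0 < θ := by positivity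
  have hθ1 : θ ≤ 1 / 2 := by
    rw [hθ, div_le_iff₀ (by positivity)]; nlinarith
  set δ := -Real.log (1 - θ) with hδ
  have hδ0 : 0 ≤ δ := by
    have := Real.log_nonpos (by linarith : 0 ≤ 1 - θ) (by linarith)
    rw [hδ]; linarith
  have hδ1 : δ ≤ r / s.card := by
    have h := Real.one_sub_inv_le_log_of_pos (by linarith : 0 < 1 - θ)
    have h' : (1 - θ)⁻¹ ≤ 1 + 2 * θ := by
      rw [inv_le_iff_one_le_mul₀ (by linarith)]; nlinarith
    have h'' : 2 * θ = r / s.card := by rw [hθ]; field_simp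
    rw [hδ]; linarith
  have hexp : expMeasure 1 (Set.Iic δ) = ENNReal.ofReal θ := by
    rw [expMeasure_one_Iic hδ0, hδ, neg_neg, Real.exp_log (by linarith)]
    congr 1; ring
  set ν := (rowLaw n).prod (arrowNoise n) with hν
  set A : Fin n → Set ((Fin n → ℝ) × (Fin n → ℝ) × ℝ) := fun j => {p | p.2.1 j ∈ Set.Iic δ} with hA
  set B : Fin n → Set ((Fin n → ℝ) × (Fin n → ℝ) × ℝ) := fun j =>
    {p | √n ≤ gapDrive p.1 p.2.1 p.2.2 j} with hB
  have hmA : ∀ j, MeasurableSet (A j) := fun j =>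
    (by fun_prop : Measurable fun p : (Fin n → ℝ) × (Fin n → ℝ) × ℝ => p.2.1 j) measurableSet_Iic
  have hmB : ∀ j, MeasurableSet (B j) := fun j =>
    measurableSet_le measurable_const (measurable_gapDrive j)
  have hAB : ∀ j, ν (A j ∩ B j) = ENNReal.ofReal θ * ν (B j) := fun j => by
    rw [hν, ← hexp]
    exact measure_weight_inter j measurableSet_Iic (hmB j)
      fun μ w d t => by simp only [hB, Set.mem_ofPred_eq, gapDrive_update]
  have hAuniv : ∀ j, ν (A j) = ENNReal.ofReal θ := fun j => by
    have := measure_weight_inter j (measurableSet_Iic (a := δ)) MeasurableSet.univ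
      fun μ w d t => by simp
    rw [hexp, measure_univ, mul_one, Set.inter_univ] at this
    exact this
  have hAA : ∀ j k, j ≠ k → ν.real (A j ∩ A k) ≤ θ ^ 2 := fun j k hjk => by
    have : ν (A j ∩ A k) = expMeasure 1 (Set.Iic δ) * ν (A k) :=
      measure_weight_inter j measurableSet_Iic (hmA k)
        fun μ w d t => by simp only [hA, Set.mem_ofPred_eq, Function.update_of_ne hjk.symm]
    rw [Measure.real, this, hexp, hAuniv, ENNReal.toReal_mul, ENNReal.toReal_ofReal hθ0.le, sq]
  have hBr : ∀ j ∈ s, r ≤ ν.real (B j) := fun j hj => by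
    obtain ⟨h3, h4⟩ := h2 j hj
    have hj1 : (1 : ℝ) ≤ (j : ℕ) := by linarith [mul_pos hα hn]
    have hj1' : 1 ≤ (j : ℕ) := by exact_mod_cast hj1
    have := hdrive n j ⟨j - 1, by omega⟩ (by simp; omega) h1 (by
      simp only [Nat.cast_sub hj1']; simpa using h3) h4
    exact (min_le_left _ _).trans ((ENNReal.ofReal_le_iff_le_toReal (measure_ne_top _ _)).1 this)
  have hbonf := sum_measureReal_le_of_pairwise ν (A := A) (E := fun j => A j ∩ B j)
    (fun j => (hmA j).inter (hmB j)) (fun j => Set.inter_subset_left) hAA (sq_nonneg _) s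
  have hsum : (s.card : ℝ) * (θ * r) ≤ ∑ j ∈ s, ν.real (A j ∩ B j) := by
    rw [← nsmul_eq_mul]
    refine Finset.card_nsmul_le_sum _ _ _ fun j hj => ?_
    rw [Measure.real, hAB, ENNReal.toReal_mul, ENNReal.toReal_ofReal hθ0.le]
    exact mul_le_mul_of_nonneg_left (hBr j hj) hθ0.le
  have hU : ENNReal.ofReal (r ^ 2 / 4) ≤ ν (⋃ j ∈ s, A j ∩ B j) := by
    rw [ENNReal.ofReal_le_iff_le_toReal (measure_ne_top _ _)]
    have h3 : (s.card : ℝ) * (θ * r) = r ^ 2 / 2 := by rw [hθ]; field_simp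
    have h4 : (s.card : ℝ) ^ 2 * θ ^ 2 = r ^ 2 / 4 := by rw [hθ]; field_simp; norm_num
    rw [Measure.real] at hbonf
    linarith
  have hmS : MeasurableSet {x : (Fin n → ℝ) × (Fin (n + 1) → ℝ) |
      ∃ j ∈ s, x.2 j.castSucc - x.1 j ≤ r / (s.card * √n)} := by
    have : {x : (Fin n → ℝ) × (Fin (n + 1) → ℝ) |
      ∃ j ∈ s, x.2 j.castSucc - x.1 j ≤ r / (s.card * √n)} =
      ⋃ j ∈ s, {x | x.2 j.castSucc - x.1 j ≤ r / (s.card * √n)} := by ext; simp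
    rw [this]
    exact s.measurableSet_biUnion fun j _ => measurableSet_le (by fun_prop) measurable_const
  have hlaw := lintegral_two_rows (n := n) (measurable_one.indicator hmS (f := fun _ => (1 : ℝ≥0∞)))
  have hmR : Measurable fun M : Matrix (Fin (n + 1)) (Fin (n + 1)) ℂ =>
      (patternRow (pattern M) n, patternRow (pattern M) (n + 1)) :=
    (((measurable_patternRow n).comp (measurable_pattern _)).prodMk
      ((measurable_patternRow (n + 1)).comp (measurable_pattern _)))
  have hmE : Measurable fun p : (Fin n → ℝ) × (Fin n → ℝ) × ℝ =>
      (p.1, arrowEigs p.1 p.2.1 p.2.2) := measurable_fst.prodMk measurable_arrowEigs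
  have hlaw' : gueMeasure (n + 1) ((fun M => (patternRow (pattern M) n,
      patternRow (pattern M) (n + 1))) ⁻¹' {x | ∃ j ∈ s, x.2 j.castSucc - x.1 j ≤
        r / (s.card * √n)}) = ν ((fun p => (p.1, arrowEigs p.1 p.2.1 p.2.2)) ⁻¹'
        {x | ∃ j ∈ s, x.2 j.castSucc - x.1 j ≤ r / (s.card * √n)}) := by
    rw [← lintegral_indicator_one (hmR hmS), ← lintegral_indicator_one (hmE hmS)]
    exact hlaw
  refine hU.trans (le_trans ?_ (hlaw'.symm.le.trans (le_of_eq rfl)))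
  have hwpos : ∀ᵐ p ∂ν, ∀ l, 0 < p.2.1 l := by
    rw [ae_all_iff]
    intro l
    have : ν {p | p.2.1 l ∈ Set.Iic 0} = 0 := by
      have := measure_weight_inter l (measurableSet_Iic (a := (0 : ℝ))) MeasurableSet.univ
        fun μ w d t => by simp
      rw [expMeasure_one_Iic le_rfl] at this
      simpa using this
    rw [ae_iff]
    simpa using this
  refine measure_mono_ae ?_
  filter_upwards [ae_strictAnti_fst n, hwpos] with p hp hw hpE
  obtain ⟨j, hj, hjA, hjB⟩ := Set.mem_iUnion₂.1 hpE
  have hG := gapDrive_mul_le hp hw p.2.2 j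
  have hG0 := (interlaces_arrowEigs hp hw p.2.2 j).2
  refine ⟨j, hj, ?_⟩
  change arrowEigs p.1 p.2.1 p.2.2 j.castSucc - p.1 j ≤ _
  have h3 : √n * (arrowEigs p.1 p.2.1 p.2.2 j.castSucc - p.1 j) ≤ r / s.card :=
    (mul_le_mul_of_nonneg_right hjB (sub_nonneg.2 hG0.le)).trans (hG.trans (le_trans hjA hδ1))
  rw [← div_div, le_div_iff₀ hsn]
  linarith

theorem GTPattern.step_pos {n : ℕ} {x : ℕ → ℕ → ℝ} (hx : GTPattern n x) {i j : ℕ} (hi : i < n)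
    (hj : j < i) : 0 < x (i + 1) j - x i j :=
  sub_pos.2 (hx i hi ⟨j, hj⟩).2

theorem exists_measure_large_step_le {α : ℝ} (hα : 0 < α) :
    ∃ q : ℝ, 0 < q ∧ q < 1 ∧ ∀ (n N i : ℕ) (s : Finset (Fin n)), s.Nonempty → 32 ≤ α * n →
      (∀ j ∈ s, α * n ≤ (j : ℝ) - 1 ∧ α * n ≤ n - 1 - (j : ℝ)) → n < N →
      gueMeasure N {M | ∀ j ∈ s, 2 ^ i / (s.card * √n) < pattern M (n + 1) j - pattern M n j} ≤
        ENNReal.ofReal (q ^ 2 ^ i) := by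
  obtain ⟨q, hq, hq1, h⟩ := exists_le_measure_small_step hα
  refine ⟨1 - q ^ 2 / 4, by nlinarith, by nlinarith [sq_pos_of_pos hq],
    fun n N i s hs h1 h2 hN => ?_⟩
  set A : ℝ → Set (ℕ → ℕ → ℝ) := fun t => {x | ∀ j ∈ s, t < x (n + 1) j - x n j} with hA
  have hmA : ∀ t, MeasurableSet (A t) := fun t => by
    have : A t = ⋂ j ∈ s, {x | t < x (n + 1) j - x n j} := by ext; simp [hA]
    rw [this]
    exact s.measurableSet_biInter fun j _ => measurableSet_lt measurable_const (by fun_prop)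
  have hπ : ∀ t, ∫⁻ M, (A t).indicator 1 (pattern M) ∂gueMeasure (n + 1) =
      gueMeasure (n + 1) (pattern ⁻¹' A t) := fun t => by
    rw [← lintegral_indicator_one (measurable_pattern _ (hmA t))]
    rfl
  have hdouble : ∀ t, gueMeasure (n + 1) (pattern ⁻¹' A (2 * t)) ≤
      gueMeasure (n + 1) (pattern ⁻¹' A t) ^ 2 := fun t => by
    have := prekopaLeindler_pattern (n := n + 1) (f := (A (2 * t)).indicator 1) (g := fun _ => 1)
      (h := (A t).indicator 1) (measurable_one.indicator (hmA _)) measurable_const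
      (measurable_one.indicator (hmA _)) (fun x y hx hy => ?_)
    · simpa only [hπ, lintegral_one, measure_univ, mul_one] using this
    by_cases hxA : x ∈ A (2 * t)
    · have hmid : (1 / 2 : ℝ) • (x + y) ∈ A t := fun j hj => by
        have h3 := hxA j hj
        have h4 := hy.step_pos (Nat.lt_succ_self n) j.2
        simp only [Pi.smul_apply, Pi.add_apply, smul_eq_mul]
        linarith
      rw [Set.indicator_of_mem hmid, Set.indicator_of_mem hxA]; simp
    · rw [Set.indicator_of_notMem hxA]; simp
  have hbase : gueMeasure (n + 1) (pattern ⁻¹' A (q / (s.card * √n))) ≤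
      ENNReal.ofReal (1 - q ^ 2 / 4) := by
    have hc : pattern ⁻¹' A (q / (s.card * √n)) = {M : Matrix (Fin (n + 1)) (Fin (n + 1)) ℂ |
        ∃ j ∈ s, pattern M (n + 1) j - pattern M n j ≤ q / (s.card * √n)}ᶜ := by
      ext M
      simp only [hA, Set.mem_preimage, Set.mem_ofPred_eq, Set.mem_compl_iff, not_exists, not_and,
        not_le]
    have hmS : MeasurableSet {M : Matrix (Fin (n + 1)) (Fin (n + 1)) ℂ |
        ∃ j ∈ s, pattern M (n + 1) j - pattern M n j ≤ q / (s.card * √n)} := by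
      rw [← compl_compl {M : Matrix (Fin (n + 1)) (Fin (n + 1)) ℂ |
        ∃ j ∈ s, pattern M (n + 1) j - pattern M n j ≤ q / (s.card * √n)}, ← hc]
      exact (measurable_pattern _ (hmA _)).compl
    rw [hc, prob_compl_eq_one_sub hmS, ENNReal.ofReal_sub _ (by positivity), ENNReal.ofReal_one]
    exact tsub_le_tsub_left (h n s hs h1 h2) 1
  have hpow : gueMeasure (n + 1) (pattern ⁻¹' A (2 ^ i * (q / (s.card * √n)))) ≤
      ENNReal.ofReal ((1 - q ^ 2 / 4) ^ 2 ^ i) := by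
    induction i with
    | zero => simpa using hbase
    | succ i ih =>
      rw [pow_succ' 2 i, mul_assoc]
      refine (hdouble _).trans ((pow_le_pow_left' ih 2).trans (le_of_eq ?_))
      rw [← ENNReal.ofReal_pow (pow_nonneg (by nlinarith) _), ← pow_mul, ← pow_succ]
  rw [← (measurePreserving_topMinor hN).measure_preimage
    (measurable_pattern _ (hmA _)).nullMeasurableSet] at hpow
  refine le_trans (measure_mono ?_) hpow
  intro M hM j hj
  rw [pattern_topMinor M hN le_rfl, pattern_topMinor M hN (Nat.le_succ n)]
  refine lt_of_le_of_lt ?_ (hM j hj)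
  rw [← mul_div_assoc]
  have hb : (0 : ℝ) ≤ s.card * √n := by positivity
  refine div_le_div_of_nonneg_right ?_ hb
  nlinarith [pow_pos (two_pos : (0 : ℝ) < 2) i]

theorem exists_lintegral_exp_centred_le {α : Type*} [MeasurableSpace α] {μ : Measure α} {F : α → ℝ}
    (hF : Measurable F) {s K : ℝ}
    (h : (∫⁻ a, ENNReal.ofReal (Real.exp (s * F a)) ∂μ) *
      (∫⁻ a, ENNReal.ofReal (Real.exp (-(s * F a))) ∂μ) ≤ ENNReal.ofReal K) (hs : s ≠ 0) :
    ∃ c : ℝ, ∫⁻ a, ENNReal.ofReal (Real.exp (s * (F a - c))) ∂μ ≤ 1 ∧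
      ∫⁻ a, ENNReal.ofReal (Real.exp (-(s * (F a - c)))) ∂μ ≤ ENNReal.ofReal K := by
  have hm1 : Measurable fun a => ENNReal.ofReal (Real.exp (s * F a)) :=
    (hF.const_mul s).exp.ennreal_ofReal
  have hm2 : Measurable fun a => ENNReal.ofReal (Real.exp (-(s * F a))) :=
    (hF.const_mul s).neg.exp.ennreal_ofReal
  rcases eq_or_ne μ 0 with rfl | hμ
  · exact ⟨0, by simp⟩
  have hpos : ∀ {G : α → ℝ}, (Measurable fun a => ENNReal.ofReal (Real.exp (G a))) →
      ∫⁻ a, ENNReal.ofReal (Real.exp (G a)) ∂μ ≠ 0 := fun hG h0 => by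
    rw [lintegral_eq_zero_iff hG] at h0
    refine hμ (ae_eq_bot.1 (Filter.eventually_false_iff_eq_bot.1 ?_))
    filter_upwards [h0] with a ha
    simp [not_le.2 (Real.exp_pos _)] at ha
  have hP0 := hpos hm1
  have hQ0 := hpos hm2
  have hlt := h.trans_lt ENNReal.ofReal_lt_top
  set P := ∫⁻ a, ENNReal.ofReal (Real.exp (s * F a)) ∂μ with hP
  set Q := ∫⁻ a, ENNReal.ofReal (Real.exp (-(s * F a))) ∂μ with hQ
  have hPt : P ≠ ∞ := fun ht => by rw [ht, ENNReal.top_mul hQ0] at hlt; exact lt_irrefl _ hlt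
  have hp : 0 < P.toReal := ENNReal.toReal_pos hP0 hPt
  have hsc : s * (Real.log P.toReal / s) = Real.log P.toReal := by field_simp
  refine ⟨Real.log P.toReal / s, le_of_eq ?_, le_of_eq_of_le ?_ h⟩
  · have h1 : ∀ a, ENNReal.ofReal (Real.exp (s * (F a - Real.log P.toReal / s))) =
        P⁻¹ * ENNReal.ofReal (Real.exp (s * F a)) := fun a => by
      rw [mul_sub, hsc, sub_eq_neg_add, Real.exp_add, Real.exp_neg, Real.exp_log hp,
        ENNReal.ofReal_mul (inv_nonneg.2 hp.le), ENNReal.ofReal_inv_of_pos hp,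
        ENNReal.ofReal_toReal hPt]
    rw [lintegral_congr h1, lintegral_const_mul _ hm1, ENNReal.inv_mul_cancel hP0 hPt]
  · have h1 : ∀ a, ENNReal.ofReal (Real.exp (-(s * (F a - Real.log P.toReal / s)))) =
        P * ENNReal.ofReal (Real.exp (-(s * F a))) := fun a => by
      rw [mul_sub, hsc, neg_sub, sub_eq_add_neg, Real.exp_add, Real.exp_log hp,
        ENNReal.ofReal_mul hp.le, ENNReal.ofReal_toReal hPt]
    rw [lintegral_congr h1, lintegral_const_mul _ hm2]

theorem exp_sub_sq_le {a b s ℓ : ℝ} (ha : 0 < a) (hb : 0 < b) (ha' : a ≤ ℓ) (hb' : b ≤ ℓ)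
    (hs : 0 ≤ s) :
    Real.exp (s * (a ^ 2 - b ^ 2)) ≤
      (((a + b) / 2) ^ 2 / (a * b)) ^ 2 * Real.exp (4 * s ^ 2 * ℓ ^ 4) := by
  have hℓ : 0 < ℓ := ha.trans_le ha'
  set v := (a - b) ^ 2 / (4 * ℓ ^ 2) with hv
  have hv0 : 0 ≤ v := by positivity
  have hv1 : v ≤ 1 := by
    rw [hv, div_le_one (by positivity)]; nlinarith
  have h1 : Real.exp (v / 2) ≤ 1 + v := by
    have h := Real.one_sub_le_exp_neg (v / 2)
    have h2 : Real.exp (v / 2) * Real.exp (-(v / 2)) = 1 := by rw [← Real.exp_add]; simp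
    have h3 := Real.exp_pos (v / 2)
    nlinarith [mul_le_mul_of_nonneg_left h h3.le]
  have h2 : 1 + v ≤ ((a + b) / 2) ^ 2 / (a * b) := by
    rw [le_div_iff₀ (by positivity), hv]
    have : a * b ≤ ℓ ^ 2 := by nlinarith
    have h4 : (a - b) ^ 2 / (4 * ℓ ^ 2) * (a * b) ≤ (a - b) ^ 2 / 4 := by
      rw [div_mul_eq_mul_div, div_le_div_iff₀ (by positivity) (by norm_num)]
      nlinarith [mul_le_mul_of_nonneg_left this (sq_nonneg (a - b))]
    nlinarith
  have h3 : Real.exp v ≤ (((a + b) / 2) ^ 2 / (a * b)) ^ 2 := by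
    calc Real.exp v = Real.exp (v / 2) ^ 2 := by rw [← Real.exp_nat_mul]; congr 1; push_cast; ring
      _ ≤ _ := pow_le_pow_left₀ (Real.exp_pos _).le (h1.trans h2) 2
  have h4 : s * (a ^ 2 - b ^ 2) ≤ v + 4 * s ^ 2 * ℓ ^ 4 := by
    have h5 : s * (a ^ 2 - b ^ 2) ≤ 2 * s * ℓ * |a - b| := by
      have : a ^ 2 - b ^ 2 ≤ 2 * ℓ * |a - b| := by
        nlinarith [le_abs_self (a - b), abs_nonneg (a - b)]
      nlinarith
    have h6 : v = (|a - b| / (2 * ℓ)) ^ 2 := by rw [hv, div_pow, sq_abs]; ring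
    have h7 : 2 * s * ℓ * |a - b| = 2 * (|a - b| / (2 * ℓ)) * (2 * s * ℓ ^ 2) := by
      field_simp
    nlinarith [sq_nonneg (|a - b| / (2 * ℓ) - 2 * s * ℓ ^ 2)]
  calc Real.exp (s * (a ^ 2 - b ^ 2)) ≤ Real.exp (v + 4 * s ^ 2 * ℓ ^ 4) := Real.exp_le_exp.2 h4
    _ = Real.exp v * Real.exp (4 * s ^ 2 * ℓ ^ 4) := Real.exp_add _ _
    _ ≤ _ := mul_le_mul_of_nonneg_right h3 (Real.exp_pos _).le

theorem lintegral_exp_row_energy_mul_le {n : ℕ} (W : Finset (Fin n × Fin n))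
    (hW : ∀ p ∈ W, p.1 < p.2) (hne : W.Nonempty) {ℓ : ℝ} (hℓ : 0 < ℓ) {s : ℝ}
    (hs : s = (2 * ℓ ^ 2 * √W.card)⁻¹) :
    (∫⁻ x, ENNReal.ofReal (Real.exp (s * ∑ p ∈ W, (x p.1 - x p.2) ^ 2))
        ∂(rowLaw n).restrict {x | ∀ p ∈ W, x p.1 - x p.2 ≤ ℓ}) *
      (∫⁻ x, ENNReal.ofReal (Real.exp (-(s * ∑ p ∈ W, (x p.1 - x p.2) ^ 2)))
        ∂(rowLaw n).restrict {x | ∀ p ∈ W, x p.1 - x p.2 ≤ ℓ}) ≤ ENNReal.ofReal (Real.exp 1) := by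
  set A : Set (Fin n → ℝ) := {x | ∀ p ∈ W, x p.1 - x p.2 ≤ ℓ} with hA
  have hmA : MeasurableSet A := by
    have : A = ⋂ p ∈ W, {x | x p.1 - x p.2 ≤ ℓ} := by ext; simp [hA]
    rw [this]
    exact W.measurableSet_biInter fun p _ => measurableSet_le (by fun_prop) measurable_const
  have hc : (0 : ℝ) < W.card := by exact_mod_cast hne.card_pos
  have hs0 : 0 ≤ s := by rw [hs]; positivity
  have hsW : 4 * s ^ 2 * ℓ ^ 4 * W.card = 1 := by
    have : √(W.card : ℝ) ^ 2 = W.card := Real.sq_sqrt hc.le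
    have h2 : √(W.card : ℝ) ≠ 0 := (Real.sqrt_pos.2 hc).ne'
    rw [hs]; field_simp; rw [this]; field_simp; norm_num
  have hm1 : Measurable fun x : Fin n → ℝ =>
      ENNReal.ofReal (Real.exp (s * ∑ p ∈ W, (x p.1 - x p.2) ^ 2)) := by fun_prop
  have hm2 : Measurable fun x : Fin n → ℝ =>
      ENNReal.ofReal (Real.exp (-(s * ∑ p ∈ W, (x p.1 - x p.2) ^ 2))) := by fun_prop
  rw [← lintegral_indicator hmA, ← lintegral_indicator hmA]
  have hh : Measurable (A.indicator fun _ : Fin n → ℝ => ENNReal.ofReal (Real.exp (1 / 2))) :=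
    measurable_const.indicator hmA
  refine (prekopaLeindler_rowLaw (hm1.indicator hmA) (hm2.indicator hmA) hh _
    (fun x y hx hy => rowDensity_mul_le hx hy W hW) fun x y hx hy => ?_).trans ?_
  · by_cases hxA : x ∈ A
    swap; · simp [Set.indicator_of_notMem hxA]
    by_cases hyA : y ∈ A
    swap; · simp [Set.indicator_of_notMem hyA]
    have hmid : (1 / 2 : ℝ) • (x + y) ∈ A := fun p hp => by
      have h1 := hxA p hp
      have h2 := hyA p hp
      simp only [Pi.smul_apply, Pi.add_apply, smul_eq_mul]
      linarith
    rw [Set.indicator_of_mem hxA, Set.indicator_of_mem hyA, Set.indicator_of_mem hmid,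
      ← ENNReal.ofReal_mul (Real.exp_pos _).le, ← ENNReal.ofReal_pow (Real.exp_pos _).le,
      ← ENNReal.ofReal_mul (by positivity)]
    refine ENNReal.ofReal_le_ofReal ?_
    rw [← Real.exp_add, ← Real.exp_nat_mul, ← sub_eq_add_neg, ← mul_sub, ← Finset.sum_sub_distrib,
      Finset.mul_sum, Real.exp_sum]
    calc ∏ p ∈ W, Real.exp (s * ((x p.1 - x p.2) ^ 2 - (y p.1 - y p.2) ^ 2))
        ≤ ∏ p ∈ W, ((((x p.1 - x p.2 + (y p.1 - y p.2)) / 2) ^ 2 /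
            ((x p.1 - x p.2) * (y p.1 - y p.2))) ^ 2 * Real.exp (4 * s ^ 2 * ℓ ^ 4)) :=
          Finset.prod_le_prod (fun _ _ => (Real.exp_pos _).le) fun p hp =>
            exp_sub_sq_le (sub_pos.2 (hx (hW p hp))) (sub_pos.2 (hy (hW p hp))) (hxA p hp)
              (hyA p hp) hs0
      _ = (∏ p ∈ W, ((x p.1 - x p.2 + (y p.1 - y p.2)) / 2) ^ 2 /
            ((x p.1 - x p.2) * (y p.1 - y p.2))) ^ 2 * Real.exp ((2 : ℕ) * (1 / 2)) := by
          rw [Finset.prod_mul_distrib, Finset.prod_pow, Finset.prod_const, ← Real.exp_nat_mul]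
          congr 2; push_cast; linarith
      _ ≤ _ := by
          refine mul_le_mul_of_nonneg_right ?_ (Real.exp_pos _).le
          exact le_mul_of_one_le_right (sq_nonneg _) (Real.one_le_exp
            (Finset.sum_nonneg fun _ _ => by positivity))
  · rw [lintegral_indicator_const hmA]
    calc _ ≤ (ENNReal.ofReal (Real.exp (1 / 2)) * 1) ^ 2 :=
          pow_le_pow_left' (mul_le_mul_right prob_le_one _) 2
      _ = _ := by
          rw [mul_one, ← ENNReal.ofReal_pow (Real.exp_pos _).le, ← Real.exp_nat_mul]
          norm_num

theorem measurePreserving_patternRow {n i : ℕ} (h : i ≤ n) :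
    MeasurePreserving (fun M : Matrix (Fin n) (Fin n) ℂ => patternRow (pattern M) i)
      (gueMeasure n) (rowLaw i) := by
  have h1 : MeasurePreserving (eigsDesc : Matrix (Fin i) (Fin i) ℂ → Fin i → ℝ)
      (gueMeasure i) (rowLaw i) := ⟨measurable_eigsDesc i, rfl⟩
  have h2 := h1.comp (measurePreserving_topMinor h)
  have h3 : (fun M : Matrix (Fin n) (Fin n) ℂ => patternRow (pattern M) i) =
      eigsDesc ∘ fun M => topMinor M h := funext fun M => patternRow_pattern M h
  rw [h3]; exact h2

/-- The gap below the entry `p` within its row. -/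
def rowGap (x : ℕ → ℕ → ℝ) (p : ℕ × ℕ) : ℝ := x p.1 p.2 - x p.1 (p.2 + 1)

/-- The quadratic energy of the row gaps over a finite index set. -/
def gapEnergy (P : Finset (ℕ × ℕ)) (x : ℕ → ℕ → ℝ) : ℝ := ∑ p ∈ P, rowGap x p ^ 2

/-- The arrays whose row gaps over `P` are at most `ℓ`. -/
def gapBox (P : Finset (ℕ × ℕ)) (ℓ : ℝ) : Set (ℕ → ℕ → ℝ) := {x | ∀ p ∈ P, rowGap x p ≤ ℓ}

theorem measurable_rowGap (p : ℕ × ℕ) : Measurable fun x : ℕ → ℕ → ℝ => rowGap x p := by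
  unfold rowGap; fun_prop

theorem measurable_gapEnergy (P : Finset (ℕ × ℕ)) : Measurable (gapEnergy P) :=
  Finset.measurable_sum _ fun p _ => (measurable_rowGap p).pow_const 2

theorem measurableSet_gapBox (P : Finset (ℕ × ℕ)) (ℓ : ℝ) : MeasurableSet (gapBox P ℓ) := by
  have : gapBox P ℓ = ⋂ p ∈ P, {x | rowGap x p ≤ ℓ} := by ext; simp [gapBox]
  rw [this]
  exact P.measurableSet_biInter fun p _ => measurableSet_le (measurable_rowGap p) measurable_const

theorem exists_lintegral_exp_row_energy_le {n i : ℕ} (hi : i ≤ n) {J : Finset ℕ} (hJ : J.Nonempty)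
    (hJi : ∀ k ∈ J, k + 1 < i) {ℓ : ℝ} (hℓ : 0 < ℓ) {s : ℝ} (hs : s = (2 * ℓ ^ 2 * √J.card)⁻¹) :
    ∃ c : ℝ, (∫⁻ M, (gapBox ({i} ×ˢ J) ℓ).indicator
        (fun x => ENNReal.ofReal (Real.exp (s * (gapEnergy ({i} ×ˢ J) x - c)))) (pattern M)
          ∂gueMeasure n ≤ 1) ∧
      ∫⁻ M, (gapBox ({i} ×ˢ J) ℓ).indicator
        (fun x => ENNReal.ofReal (Real.exp (-(s * (gapEnergy ({i} ×ˢ J) x - c))))) (pattern M)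
          ∂gueMeasure n ≤ ENNReal.ofReal (Real.exp 1) := by
  set W : Finset (Fin i × Fin i) :=
    Finset.univ.filter fun p => (p.1 : ℕ) ∈ J ∧ (p.2 : ℕ) = p.1 + 1 with hW
  have hmem : ∀ p, p ∈ W ↔ (p.1 : ℕ) ∈ J ∧ (p.2 : ℕ) = p.1 + 1 := fun p => by simp [hW]
  have hmap : Set.MapsTo (fun p : Fin i × Fin i => (p.1 : ℕ)) W J := fun p hp => ((hmem p).1 hp).1
  have hinj : Set.InjOn (fun p : Fin i × Fin i => (p.1 : ℕ)) W := fun p hp q hq h => by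
    have h1 := ((hmem p).1 hp).2
    have h2 := ((hmem q).1 hq).2
    have h3 : (p.1 : ℕ) = q.1 := h
    exact Prod.ext (Fin.ext h3) (Fin.ext (by omega))
  have hsurj : Set.SurjOn (fun p : Fin i × Fin i => (p.1 : ℕ)) W J := fun k hk =>
    ⟨(⟨k, by have := hJi k hk; omega⟩, ⟨k + 1, hJi k hk⟩), (hmem _).2 ⟨hk, rfl⟩, rfl⟩
  have hcard : W.card = J.card :=
    Finset.card_nbij (fun p : Fin i × Fin i => (p.1 : ℕ)) hmap hinj hsurj
  have hpair : ∀ (x : ℕ → ℕ → ℝ) (p : Fin i × Fin i), p ∈ W →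
      patternRow x i p.1 - patternRow x i p.2 = rowGap x (i, p.1) := fun x p hp => by
    simp only [patternRow, rowGap, ((hmem p).1 hp).2]
  have hE : ∀ x : ℕ → ℕ → ℝ, ∑ p ∈ W, (patternRow x i p.1 - patternRow x i p.2) ^ 2 =
      gapEnergy ({i} ×ˢ J) x := fun x => by
    rw [gapEnergy, Finset.sum_product, Finset.sum_singleton]
    exact Finset.sum_nbij (fun p : Fin i × Fin i => (p.1 : ℕ)) hmap hinj hsurj fun p hp => by
      rw [hpair x p hp]
  set A : Set (Fin i → ℝ) := {x | ∀ p ∈ W, x p.1 - x p.2 ≤ ℓ} with hA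
  have hmA : MeasurableSet A := by
    have : A = ⋂ p ∈ W, {x | x p.1 - x p.2 ≤ ℓ} := by ext; simp [hA]
    rw [this]
    exact W.measurableSet_biInter fun p _ => measurableSet_le (by fun_prop) measurable_const
  have hbox : ∀ x : ℕ → ℕ → ℝ, patternRow x i ∈ A ↔ x ∈ gapBox ({i} ×ˢ J) ℓ := fun x => by
    constructor
    · intro h p hp
      obtain ⟨h1, h2⟩ := Finset.mem_product.1 hp
      obtain ⟨q, hq, hqp⟩ := hsurj h2
      have h3 := h q hq
      rw [hpair x q hq] at h3
      obtain ⟨p1, p2⟩ := p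
      simp only [Finset.mem_singleton] at h1 hqp
      subst h1 hqp
      exact h3
    · intro h p hp
      rw [hpair x p hp]
      exact h _ (Finset.mem_product.2 ⟨Finset.mem_singleton_self i, hmap hp⟩)
  have hmF : Measurable fun x : Fin i → ℝ => ∑ p ∈ W, (x p.1 - x p.2) ^ 2 := by fun_prop
  have hWne : W.Nonempty := Finset.card_pos.1 (hcard ▸ hJ.card_pos)
  obtain ⟨c, h1, h2⟩ := exists_lintegral_exp_centred_le (μ := (rowLaw i).restrict A) hmF
    (lintegral_exp_row_energy_mul_le W (fun p hp => Fin.lt_def.2 (by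
      have := ((hmem p).1 hp).2; omega)) hWne hℓ (s := s) (by rw [hs, hcard])) (by
      have : (0 : ℝ) < J.card := by exact_mod_cast hJ.card_pos
      rw [hs]; positivity)
  have key : ∀ φ : ℝ → ℝ≥0∞, Measurable φ →
      ∫⁻ M, (gapBox ({i} ×ˢ J) ℓ).indicator (fun x => φ (gapEnergy ({i} ×ˢ J) x)) (pattern M)
        ∂gueMeasure n = ∫⁻ x, φ (∑ p ∈ W, (x p.1 - x p.2) ^ 2) ∂(rowLaw i).restrict A := by
    intro φ hφ
    have hm : Measurable fun x : Fin i → ℝ => φ (∑ p ∈ W, (x p.1 - x p.2) ^ 2) := hφ.comp hmF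
    rw [← lintegral_indicator hmA,
      ← (measurePreserving_patternRow hi).lintegral_comp (hm.indicator hmA)]
    refine lintegral_congr fun M => ?_
    by_cases h : pattern M ∈ gapBox ({i} ×ˢ J) ℓ
    · rw [Set.indicator_of_mem h, Set.indicator_of_mem ((hbox _).2 h), hE]
    · rw [Set.indicator_of_notMem h, Set.indicator_of_notMem (mt (hbox _).1 h)]
  refine ⟨c, ?_, ?_⟩
  · rw [key (fun y => ENNReal.ofReal (Real.exp (s * (y - c)))) (by fun_prop)]
    exact h1
  · rw [key (fun y => ENNReal.ofReal (Real.exp (-(s * (y - c))))) (by fun_prop)]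
    exact h2

theorem lintegral_exp_gapEnergy_le {n : ℕ} {I J : Finset ℕ} (hI : I.Nonempty) (ℓ r : ℝ)
    (c : ℕ → ℝ) {K : ℝ≥0∞} (h : ∀ i ∈ I, ∫⁻ M, (gapBox ({i} ×ˢ J) ℓ).indicator
      (fun x => ENNReal.ofReal (Real.exp (r * (gapEnergy ({i} ×ˢ J) x - c i)))) (pattern M)
        ∂gueMeasure n ≤ K) :
    ∫⁻ M, (gapBox (I ×ˢ J) ℓ).indicator (fun x => ENNReal.ofReal
      (Real.exp (r / I.card * (gapEnergy (I ×ˢ J) x - ∑ i ∈ I, c i)))) (pattern M)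
        ∂gueMeasure n ≤ K := by
  have hcard : (0 : ℝ) < I.card := by exact_mod_cast hI.card_pos
  set f : ℕ → (ℕ → ℕ → ℝ) → ℝ≥0∞ := fun i => (gapBox ({i} ×ˢ J) ℓ).indicator
      (fun x => ENNReal.ofReal (Real.exp (r * (gapEnergy ({i} ×ˢ J) x - c i)))) with hf
  have hmf : ∀ i, Measurable (f i) := fun i => by
    have := measurable_gapEnergy ({i} ×ˢ J)
    have h2 : Measurable fun x : ℕ → ℕ → ℝ =>
      ENNReal.ofReal (Real.exp (r * (gapEnergy ({i} ×ˢ J) x - c i))) := by fun_prop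
    exact h2.indicator (measurableSet_gapBox _ _)
  have hE : ∀ x : ℕ → ℕ → ℝ, gapEnergy (I ×ˢ J) x = ∑ i ∈ I, gapEnergy ({i} ×ˢ J) x := fun x => by
    simp only [gapEnergy, Finset.sum_product, Finset.sum_singleton]
  have hpt : ∀ x, (gapBox (I ×ˢ J) ℓ).indicator (fun x => ENNReal.ofReal
      (Real.exp (r / I.card * (gapEnergy (I ×ˢ J) x - ∑ i ∈ I, c i)))) x =
      ∏ i ∈ I, f i x ^ (1 / (I.card : ℝ)) := fun x => by
    by_cases hx : x ∈ gapBox (I ×ˢ J) ℓ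
    · rw [Set.indicator_of_mem hx]
      have h1 : ∀ i ∈ I, f i x ^ (1 / (I.card : ℝ)) = ENNReal.ofReal
          (Real.exp (r / I.card * (gapEnergy ({i} ×ˢ J) x - c i))) := fun i hi => by
        have : x ∈ gapBox ({i} ×ˢ J) ℓ := fun p hp => hx p (by
          obtain ⟨h1, h2⟩ := Finset.mem_product.1 hp
          exact Finset.mem_product.2 ⟨by rw [Finset.mem_singleton.1 h1]; exact hi, h2⟩)
        rw [hf]
        simp only
        rw [Set.indicator_of_mem this, ENNReal.ofReal_rpow_of_pos (Real.exp_pos _), ← Real.exp_mul]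
        congr 2; ring
      rw [Finset.prod_congr rfl h1, ← ENNReal.ofReal_prod_of_nonneg fun _ _ => (Real.exp_pos _).le,
        ← Real.exp_sum, ← Finset.mul_sum, Finset.sum_sub_distrib, hE]
    · rw [Set.indicator_of_notMem hx]
      simp only [gapBox, Set.mem_ofPred_eq] at hx
      push Not at hx
      obtain ⟨p, hp, hlt⟩ := hx
      obtain ⟨h1, h2⟩ := Finset.mem_product.1 hp
      refine (Finset.prod_eq_zero h1 ?_).symm
      have : x ∉ gapBox ({p.1} ×ˢ J) ℓ := fun hmem => absurd (hmem p (Finset.mem_product.2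
        ⟨Finset.mem_singleton_self _, h2⟩)) (not_le.2 hlt)
      rw [hf]
      simp only
      rw [Set.indicator_of_notMem this, ENNReal.zero_rpow_of_pos (by positivity)]
  simp_rw [hpt]
  have h1 : ∑ _i ∈ I, 1 / (I.card : ℝ) = 1 := by
    rw [Finset.sum_const, nsmul_eq_mul]; field_simp
  calc _ ≤ ∏ i ∈ I, (∫⁻ M, f i (pattern M) ∂gueMeasure n) ^ (1 / (I.card : ℝ)) :=
        ENNReal.lintegral_prod_norm_pow_le I (f := fun i M => f i (pattern M))
          (fun i _ => ((hmf i).comp (measurable_pattern n)).aemeasurable) h1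
          fun _ _ => by positivity
    _ ≤ ∏ _i ∈ I, K ^ (1 / (I.card : ℝ)) :=
        Finset.prod_le_prod' fun i hi => ENNReal.rpow_le_rpow (h i hi) (by positivity)
    _ = K := by
        rw [Finset.prod_const, ← ENNReal.rpow_natCast, ← ENNReal.rpow_mul, one_div_mul_cancel
          hcard.ne', ENNReal.rpow_one]

theorem exists_lintegral_exp_gapEnergy_le {n : ℕ} {I J : Finset ℕ} (hI : I.Nonempty)
    (hJ : J.Nonempty) (hIn : ∀ i ∈ I, i ≤ n) (hJI : ∀ i ∈ I, ∀ k ∈ J, k + 1 < i) {ℓ : ℝ}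
    (hℓ : 0 < ℓ) {τ : ℝ} (hτ : τ = (2 * ℓ ^ 2 * √J.card * I.card)⁻¹) :
    ∃ c : ℝ, (∫⁻ M, (gapBox (I ×ˢ J) ℓ).indicator
        (fun x => ENNReal.ofReal (Real.exp (τ * (gapEnergy (I ×ˢ J) x - c)))) (pattern M)
          ∂gueMeasure n ≤ 1) ∧
      ∫⁻ M, (gapBox (I ×ˢ J) ℓ).indicator
        (fun x => ENNReal.ofReal (Real.exp (-(τ * (gapEnergy (I ×ˢ J) x - c))))) (pattern M)
          ∂gueMeasure n ≤ ENNReal.ofReal (Real.exp 1) := by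
  have h : ∀ i, ∃ c : ℝ, i ∈ I → _ ∧ _ := fun i => by
    by_cases hi : i ∈ I
    · obtain ⟨c, hc⟩ := exists_lintegral_exp_row_energy_le (hIn i hi) hJ (hJI i hi) hℓ rfl
      exact ⟨c, fun _ => hc⟩
    · exact ⟨0, fun h => absurd h hi⟩
  choose c hc using h
  refine ⟨∑ i ∈ I, c i, ?_, ?_⟩
  · have := lintegral_exp_gapEnergy_le hI ℓ _ c fun i hi => (hc i hi).1
    rw [hτ, mul_inv, ← div_eq_mul_inv]
    exact this
  · simp_rw [← neg_mul] at hc ⊢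
    have := lintegral_exp_gapEnergy_le hI ℓ _ c fun i hi => (hc i hi).2
    rw [hτ, mul_inv, ← div_eq_mul_inv, ← neg_div]
    exact this

theorem exists_gapEnergy_concentration {n : ℕ} {I J : Finset ℕ} (hI : I.Nonempty)
    (hJ : J.Nonempty) (hIn : ∀ i ∈ I, i ≤ n) (hJI : ∀ i ∈ I, ∀ k ∈ J, k + 1 < i) {ℓ : ℝ}
    (hℓ : 0 < ℓ) {k t : ℝ} (hk : 1 ≤ k) (ht : t = (2 * ℓ ^ 2 * √J.card * I.card * k)⁻¹) :
    ∃ c : ℝ, gueMeasure n {M | pattern M ∈ gapBox (I ×ˢ J) ℓ ∧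
        c + 1 / t < gapEnergy (I ×ˢ J) (pattern M)} ≤ ENNReal.ofReal (Real.exp (-k)) ∧
      ∫⁻ M, (gapBox (I ×ˢ J) ℓ).indicator
        (fun x => ENNReal.ofReal (Real.exp (-(t * (gapEnergy (I ×ˢ J) x - c))))) (pattern M)
          ∂gueMeasure n ≤ ENNReal.ofReal (1 + Real.exp 1) := by
  have hI0 : (0 : ℝ) < I.card := by exact_mod_cast hI.card_pos
  have hJ0 : 0 < √(J.card : ℝ) := Real.sqrt_pos.2 (by exact_mod_cast hJ.card_pos)
  set τ : ℝ := (2 * ℓ ^ 2 * √J.card * I.card)⁻¹ with hτ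
  have hτ0 : 0 < τ := by positivity
  have hk0 : 0 < k := by linarith
  have htτ : t * k = τ := by rw [ht, hτ]; field_simp
  have ht0 : 0 < t := by rw [ht]; positivity
  obtain ⟨c, h1, h2⟩ := exists_lintegral_exp_gapEnergy_le hI hJ hIn hJI hℓ hτ
  have hmE := measurable_gapEnergy (I ×ˢ J)
  have hmB := measurableSet_gapBox (I ×ˢ J) ℓ
  refine ⟨c, ?_, ?_⟩
  · have hmf : Measurable ((gapBox (I ×ˢ J) ℓ).indicator (fun x => ENNReal.ofReal
        (Real.exp (τ * (gapEnergy (I ×ˢ J) x - c))))) :=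
      Measurable.indicator (by fun_prop) hmB
    have h3 := meas_ge_le_lintegral_div (μ := gueMeasure n)
      (hmf.comp (measurable_pattern n)).aemeasurable
      (ε := ENNReal.ofReal (Real.exp k)) (by simp [Real.exp_pos]) ENNReal.ofReal_ne_top
    calc _ ≤ _ := measure_mono ?_
      _ ≤ _ := h3
      _ ≤ 1 / ENNReal.ofReal (Real.exp k) := ENNReal.div_le_div_right h1 _
      _ = _ := by rw [Real.exp_neg, ENNReal.ofReal_inv_of_pos (Real.exp_pos _), one_div]
    rintro M ⟨hM, hlt⟩
    simp only [Set.mem_ofPred_eq, Function.comp]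
    rw [Set.indicator_of_mem hM]
    refine ENNReal.ofReal_le_ofReal (Real.exp_le_exp.2 ?_)
    have : 1 / t < gapEnergy (I ×ˢ J) (pattern M) - c := by linarith
    rw [div_lt_iff₀ ht0] at this
    nlinarith
  · have hmf : Measurable ((gapBox (I ×ˢ J) ℓ).indicator (fun x => ENNReal.ofReal
        (Real.exp (-(τ * (gapEnergy (I ×ˢ J) x - c)))))) :=
      Measurable.indicator (by fun_prop) hmB
    calc _ ≤ ∫⁻ M, 1 + (gapBox (I ×ˢ J) ℓ).indicator (fun x => ENNReal.ofReal
          (Real.exp (-(τ * (gapEnergy (I ×ˢ J) x - c))))) (pattern M) ∂gueMeasure n := by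
          refine lintegral_mono fun M => ?_
          by_cases hM : pattern M ∈ gapBox (I ×ˢ J) ℓ
          · rw [Set.indicator_of_mem hM, Set.indicator_of_mem hM, ← ENNReal.ofReal_one,
              ← ENNReal.ofReal_add zero_le_one (Real.exp_pos _).le]
            refine ENNReal.ofReal_le_ofReal ?_
            set z := gapEnergy (I ×ˢ J) (pattern M) - c
            rcases le_total 0 z with hz | hz
            · have : Real.exp (-(t * z)) ≤ 1 := Real.exp_le_one_iff.2 (by nlinarith)
              linarith [Real.exp_pos (-(τ * z))]
            · have : Real.exp (-(t * z)) ≤ Real.exp (-(τ * z)) :=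
                Real.exp_le_exp.2 (by nlinarith [mul_nonneg ht0.le (neg_nonneg.2 hz)])
              linarith
          · rw [Set.indicator_of_notMem hM]; exact zero_le
      _ = 1 + _ := by
          rw [lintegral_add_left measurable_const, lintegral_one, measure_univ]
      _ ≤ 1 + ENNReal.ofReal (Real.exp 1) := by gcongr
      _ = _ := by rw [ENNReal.ofReal_add zero_le_one (Real.exp_pos _).le, ENNReal.ofReal_one]

theorem gapEnergy_add_eq (P : Finset (ℕ × ℕ)) (x y : ℕ → ℕ → ℝ) :
    gapEnergy P x + gapEnergy P y = 2 * gapEnergy P ((1 / 2 : ℝ) • (x + y)) +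
      1 / 2 * ∑ p ∈ P, (rowGap x p - rowGap y p) ^ 2 := by
  simp only [gapEnergy, Finset.mul_sum, ← Finset.sum_add_distrib]
  refine Finset.sum_congr rfl fun p _ => ?_
  simp only [rowGap, Pi.smul_apply, Pi.add_apply, smul_eq_mul]
  ring

theorem gapBox_midpoint {P : Finset (ℕ × ℕ)} {ℓ : ℝ} {x y : ℕ → ℕ → ℝ} (hx : x ∈ gapBox P ℓ)
    (hy : y ∈ gapBox P ℓ) : (1 / 2 : ℝ) • (x + y) ∈ gapBox P ℓ := fun p hp => by
  have h1 := hx p hp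
  have h2 := hy p hp
  simp only [rowGap, Pi.smul_apply, Pi.add_apply, smul_eq_mul] at h1 h2 ⊢
  linarith

theorem exists_setLIntegral_sub_sq_le {n : ℕ} {P : Finset (ℕ × ℕ)} {ℓ c t b D K R : ℝ}
    {F : (ℕ → ℕ → ℝ) → ℝ} (hF : Measurable F) {A : Set (ℕ → ℕ → ℝ)} (hA : MeasurableSet A)
    (ht : 0 < t) (hK : 0 ≤ K) (hR : 0 < R) (hDR : D ≤ R)
    (hbR : 2 * b ^ 2 * P.card / t ≤ R ^ 2)
    (hAbox : A ⊆ gapBox P ℓ) (hAE : ∀ x ∈ A, gapEnergy P x ≤ c + 1 / t)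
    (hlip : ∀ x ∈ A, ∀ y ∈ A, GTPattern n x → GTPattern n y →
      F x - F y ≤ D + 2 * b * ∑ p ∈ P, |rowGap x p - rowGap y p|)
    (hKt : ∫⁻ M, (gapBox P ℓ).indicator
        (fun x => ENNReal.ofReal (Real.exp (-(t * (gapEnergy P x - c))))) (pattern M)
          ∂gueMeasure n ≤ ENNReal.ofReal K) :
    ∃ c' : ℝ, ∫⁻ M, A.indicator (fun x => ENNReal.ofReal ((F x - c') ^ 2)) (pattern M)
      ∂gueMeasure n ≤ ENNReal.ofReal (4 * Real.exp 1 ^ 2 * K * R ^ 2) := by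
  have hmE := measurable_gapEnergy P
  have hmB := measurableSet_gapBox P ℓ
  have hmp := measurable_pattern n
  set w : (ℕ → ℕ → ℝ) → ℝ≥0∞ := A.indicator fun x =>
    ENNReal.ofReal (Real.exp (-(t * (gapEnergy P x - c)))) with hw
  have hmw : Measurable w := Measurable.indicator (by fun_prop) hA
  set ν : Measure (ℕ → ℕ → ℝ) := ((gueMeasure n).map pattern).withDensity w with hν
  have hint : ∀ φ : (ℕ → ℕ → ℝ) → ℝ≥0∞, Measurable φ →
      ∫⁻ x, φ x ∂ν = ∫⁻ M, w (pattern M) * φ (pattern M) ∂gueMeasure n := fun φ hφ => by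
    rw [hν, lintegral_withDensity_eq_lintegral_mul _ hmw hφ, lintegral_map (hmw.mul hφ) hmp]
    rfl
  have hs : 0 < 1 / R := by positivity
  have key : (∫⁻ x, ENNReal.ofReal (Real.exp (1 / R * F x)) ∂ν) *
      (∫⁻ x, ENNReal.ofReal (Real.exp (-(1 / R * F x))) ∂ν) ≤
      ENNReal.ofReal ((Real.exp 1 * K) ^ 2) := by
    rw [hint _ (by fun_prop), hint _ (by fun_prop)]
    have hm1 : Measurable fun x => w x * ENNReal.ofReal (Real.exp (1 / R * F x)) :=
      hmw.mul (by fun_prop)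
    have hm2 : Measurable fun x => w x * ENNReal.ofReal (Real.exp (-(1 / R * F x))) :=
      hmw.mul (by fun_prop)
    have hm3' : Measurable ((gapBox P ℓ).indicator
        (fun x => ENNReal.ofReal (Real.exp (-(t * (gapEnergy P x - c)))))) :=
      Measurable.indicator (by fun_prop) hmB
    have hm3 : Measurable fun x => ENNReal.ofReal (Real.exp 1) * (gapBox P ℓ).indicator
        (fun x => ENNReal.ofReal (Real.exp (-(t * (gapEnergy P x - c))))) x :=
      hm3'.const_mul _
    refine (prekopaLeindler_pattern hm1 hm2 hm3 fun x y hx hy => ?_).trans ?_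
    · by_cases hxA : x ∈ A
      swap; · simp [hw, Set.indicator_of_notMem hxA]
      by_cases hyA : y ∈ A
      swap; · simp [hw, Set.indicator_of_notMem hyA]
      rw [hw, Set.indicator_of_mem hxA, Set.indicator_of_mem hyA,
        Set.indicator_of_mem (gapBox_midpoint (hAbox hxA) (hAbox hyA)),
        ← ENNReal.ofReal_mul (Real.exp_pos _).le, ← ENNReal.ofReal_mul (Real.exp_pos _).le,
        ← ENNReal.ofReal_mul (Real.exp_pos _).le,
        ← ENNReal.ofReal_mul (by positivity), ← ENNReal.ofReal_pow (by positivity),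
        ← Real.exp_add, ← Real.exp_add, ← Real.exp_add, ← Real.exp_add, ← Real.exp_nat_mul]
      refine ENNReal.ofReal_le_ofReal (Real.exp_le_exp.2 ?_)
      have h1 := gapEnergy_add_eq P x y
      have h2 := hlip x hxA y hyA hx hy
      have h3 : 1 / R * (2 * b * ∑ p ∈ P, |rowGap x p - rowGap y p|) ≤
          t * (1 / 2 * ∑ p ∈ P, (rowGap x p - rowGap y p) ^ 2) + 1 := by
        have h4 : ∑ p ∈ P, 1 / R * (2 * b * |rowGap x p - rowGap y p|) ≤
            ∑ p ∈ P, (t * (1 / 2 * (rowGap x p - rowGap y p) ^ 2) + 2 * b ^ 2 / t / R ^ 2) := by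
          refine Finset.sum_le_sum fun p _ => ?_
          set d := |rowGap x p - rowGap y p| with hd
          rw [← sq_abs (rowGap x p - rowGap y p), ← hd]
          have h5 : t * (1 / 2 * d ^ 2) + 2 * b ^ 2 / t / R ^ 2 - 1 / R * (2 * b * d) =
              1 / (2 * t) * (t * d - 2 * b / R) ^ 2 := by
            field_simp; ring
          have : 0 ≤ 1 / (2 * t) * (t * d - 2 * b / R) ^ 2 := by positivity
          linarith
        rw [Finset.sum_add_distrib, Finset.sum_const, nsmul_eq_mul] at h4
        simp only [← Finset.mul_sum] at h4
        have h5 : P.card * (2 * b ^ 2 / t / R ^ 2) ≤ 1 := by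
          have : P.card * (2 * b ^ 2 / t / R ^ 2) = 2 * b ^ 2 * P.card / t / R ^ 2 := by ring
          rw [this, div_le_one (by positivity)]
          exact hbR
        linarith
      have h6 : 1 / R * D ≤ 1 := by rw [one_div, inv_mul_le_iff₀ hR]; linarith
      have h7 := mul_le_mul_of_nonneg_left h2 hs.le
      have h8 : t * (gapEnergy P x + gapEnergy P y) =
          t * (2 * gapEnergy P ((1 / 2 : ℝ) • (x + y)) +
            1 / 2 * ∑ p ∈ P, (rowGap x p - rowGap y p) ^ 2) := by rw [h1]
      push_cast
      linarith
    · have hm4 : Measurable fun M : Matrix (Fin n) (Fin n) ℂ => (gapBox P ℓ).indicator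
          (fun x => ENNReal.ofReal (Real.exp (-(t * (gapEnergy P x - c))))) (pattern M) :=
        hm3'.comp hmp
      rw [lintegral_const_mul _ hm4, ENNReal.ofReal_pow (by positivity),
        ENNReal.ofReal_mul (Real.exp_pos _).le]
      exact pow_le_pow_left' (mul_le_mul_right hKt _) 2
  obtain ⟨c', hc'⟩ := exists_lintegral_sub_sq_le hF hs (by positivity) key
  refine ⟨c', ?_⟩
  rw [hint _ (by fun_prop)] at hc'
  calc _ ≤ ∫⁻ M, ENNReal.ofReal (Real.exp 1) *
        (w (pattern M) * ENNReal.ofReal ((F (pattern M) - c') ^ 2)) ∂gueMeasure n := by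
        refine lintegral_mono fun M => ?_
        by_cases hM : pattern M ∈ A
        swap; · simp [Set.indicator_of_notMem hM]
        rw [hw, Set.indicator_of_mem hM, Set.indicator_of_mem hM, ← mul_assoc,
          ← ENNReal.ofReal_mul (Real.exp_pos _).le, ← Real.exp_add]
        refine le_mul_of_one_le_left zero_le ?_
        rw [← ENNReal.ofReal_one]
        refine ENNReal.ofReal_le_ofReal (Real.one_le_exp ?_)
        have h1 := mul_le_mul_of_nonneg_left (hAE _ hM) ht.le
        have h2 : t * (1 / t) = 1 := by field_simp
        nlinarith
    _ = ENNReal.ofReal (Real.exp 1) * _ := by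
        have hm : Measurable fun x => w x * ENNReal.ofReal ((F x - c') ^ 2) :=
          hmw.mul (by fun_prop)
        exact lintegral_const_mul _ (hm.comp hmp)
    _ ≤ ENNReal.ofReal (Real.exp 1) * _ := mul_le_mul_right hc' _
    _ = _ := by
        rw [← ENNReal.ofReal_mul (Real.exp_pos _).le]
        congr 1
        field_simp

/-- The gap between an entry and the entry of the same column in the previous row. -/
def stepGap (x : ℕ → ℕ → ℝ) (p : ℕ × ℕ) : ℝ := x p.1 p.2 - x (p.1 - 1) p.2

theorem measurable_stepGap (p : ℕ × ℕ) : Measurable fun x : ℕ → ℕ → ℝ => stepGap x p := by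
  unfold stepGap; fun_prop

theorem GTPattern.stepGap_pos {n : ℕ} {x : ℕ → ℕ → ℝ} (hx : GTPattern n x) {i q : ℕ} (hi : i ≤ n)
    (hq : q + 1 < i) : 0 < stepGap x (i, q) := by
  obtain ⟨i, rfl⟩ : ∃ i', i = i' + 1 := ⟨i - 1, by omega⟩
  exact hx.step_pos (by omega) (by omega)

theorem GTPattern.stepGap_le_rowGap {n : ℕ} {x : ℕ → ℕ → ℝ} (hx : GTPattern n x) {i q : ℕ}
    (hi : i ≤ n) (hq : q + 1 < i) : stepGap x (i, q) ≤ rowGap x (i, q) := by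
  obtain ⟨i, rfl⟩ : ∃ i', i = i' + 1 := ⟨i - 1, by omega⟩
  have h := (hx i (by omega) ⟨q, by omega⟩).1
  simp only [patternRow, Fin.val_succ] at h
  simp only [stepGap, rowGap, Nat.add_sub_cancel]
  linarith

theorem stepGap_sub_le {n b : ℕ} {x y : ℕ → ℕ → ℝ} (hy : GTPattern n y) {i q : ℕ} (hi : i ≤ n)
    (hq : q + b < i) {ε : ℝ} (hx : ∃ k ∈ Finset.Ico q (q + b), stepGap x (i, k) ≤ ε) :
    stepGap x (i, q) - stepGap y (i, q) ≤ ε + ∑ r ∈ Finset.range b,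
      (|rowGap x (i, q + r) - rowGap y (i, q + r)| +
        |rowGap x (i - 1, q + r) - rowGap y (i - 1, q + r)|) := by
  obtain ⟨k, hk, hkε⟩ := hx
  obtain ⟨hqk, hkb⟩ := Finset.mem_Ico.1 hk
  obtain ⟨d, rfl⟩ := Nat.exists_eq_add_of_le hqk
  have htel : ∀ d : ℕ, stepGap x (i, q) - stepGap y (i, q) =
      (stepGap x (i, q + d) - stepGap y (i, q + d)) + ∑ r ∈ Finset.range d,
        ((rowGap x (i, q + r) - rowGap y (i, q + r)) -
          (rowGap x (i - 1, q + r) - rowGap y (i - 1, q + r))) := fun d => by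
    induction d with
    | zero => simp
    | succ d ih =>
      rw [ih, Finset.sum_range_succ]
      simp only [stepGap, rowGap, ← add_assoc]
      ring
  have hpos := hy.stepGap_pos (q := q + d) hi (by omega)
  have h1 : ∑ r ∈ Finset.range d, ((rowGap x (i, q + r) - rowGap y (i, q + r)) -
          (rowGap x (i - 1, q + r) - rowGap y (i - 1, q + r))) ≤ ∑ r ∈ Finset.range b,
      (|rowGap x (i, q + r) - rowGap y (i, q + r)| +
        |rowGap x (i - 1, q + r) - rowGap y (i - 1, q + r)|) :=
    (Finset.sum_le_sum fun r _ => (le_abs_self _).trans (abs_sub _ _)).trans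
      (Finset.sum_le_sum_of_subset_of_nonneg (Finset.range_mono (by omega))
        fun _ _ _ => by positivity)
  rw [htel d]
  linarith

theorem sum_sum_range_shift_le {ι : Type*} [Fintype ι] {b : ℕ} {P : Finset (ℕ × ℕ)}
    (f : ι → ℕ × ℕ) (hf : Function.Injective f) (hP : ∀ p, ∀ r < b, ((f p).1, (f p).2 + r) ∈ P)
    {δ : ℕ × ℕ → ℝ} (hδ : ∀ p, 0 ≤ δ p) :
    ∑ p, ∑ r ∈ Finset.range b, δ ((f p).1, (f p).2 + r) ≤ b * ∑ p ∈ P, δ p := by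
  classical
  rw [Finset.sum_comm]
  calc _ ≤ ∑ _r ∈ Finset.range b, ∑ p ∈ P, δ p := by
        refine Finset.sum_le_sum fun r hr => ?_
        have hinj : Function.Injective fun p : ι => ((f p).1, (f p).2 + r) := fun p q h => by
          simp only [Prod.mk.injEq, Nat.add_right_cancel_iff] at h
          exact hf (Prod.ext h.1 h.2)
        rw [← Finset.sum_image (f := δ) (s := Finset.univ)
          (g := fun p : ι => ((f p).1, (f p).2 + r)) fun p _ q _ h => hinj h]
        refine Finset.sum_le_sum_of_subset_of_nonneg (fun z hz => ?_) fun _ _ _ => hδ _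
        obtain ⟨p, -, rfl⟩ := Finset.mem_image.1 hz
        exact hP p r (Finset.mem_range.1 hr)
    _ = _ := by rw [Finset.sum_const, Finset.card_range, nsmul_eq_mul]

/-- The largest of a finite family of linear functionals of the step gaps. -/
def maxStep {ι : Type*} [Fintype ι] (𝒜 : Finset (ι → ℝ)) (h𝒜 : 𝒜.Nonempty) (f : ι → ℕ × ℕ)
    (x : ℕ → ℕ → ℝ) : ℝ := 𝒜.sup' h𝒜 fun a => ∑ p, a p * stepGap x (f p)

theorem measurable_maxStep {ι : Type*} [Fintype ι] (𝒜 : Finset (ι → ℝ)) (h𝒜 : 𝒜.Nonempty)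
    (f : ι → ℕ × ℕ) : Measurable (maxStep 𝒜 h𝒜 f) := by
  have h : maxStep 𝒜 h𝒜 f = 𝒜.sup' h𝒜 fun a x => ∑ p, a p * stepGap x (f p) := by
    ext x; simp [maxStep, Finset.sup'_apply]
  rw [h]
  refine Finset.measurable_sup' h𝒜 fun a _ => ?_
  exact Finset.measurable_sum _ fun p _ => (measurable_stepGap (f p)).const_mul _

theorem maxStep_sub_le {ι : Type*} [Fintype ι] {𝒜 : Finset (ι → ℝ)} {h𝒜 : 𝒜.Nonempty}
    (ha : ∀ a ∈ 𝒜, ∀ p, |a p| ≤ 1) (f : ι → ℕ × ℕ) (x y : ℕ → ℕ → ℝ) :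
    maxStep 𝒜 h𝒜 f x - maxStep 𝒜 h𝒜 f y ≤ ∑ p, |stepGap x (f p) - stepGap y (f p)| := by
  rw [sub_le_iff_le_add', maxStep, Finset.sup'_le_iff]
  intro a hmem
  have h1 : ∑ p, a p * stepGap y (f p) ≤ maxStep 𝒜 h𝒜 f y :=
    Finset.le_sup' (fun a : ι → ℝ => ∑ p, a p * stepGap y (f p)) hmem
  have h2 : ∑ p, a p * stepGap x (f p) - ∑ p, a p * stepGap y (f p) ≤
      ∑ p, |stepGap x (f p) - stepGap y (f p)| := by
    rw [← Finset.sum_sub_distrib]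
    refine Finset.sum_le_sum fun p _ => ?_
    rw [← mul_sub]
    refine (le_abs_self _).trans ?_
    rw [abs_mul]
    exact mul_le_of_le_one_left (abs_nonneg _) (ha a hmem p)
  linarith

theorem abs_maxStep_le {ι : Type*} [Fintype ι] {𝒜 : Finset (ι → ℝ)} {h𝒜 : 𝒜.Nonempty}
    (ha : ∀ a ∈ 𝒜, ∀ p, |a p| ≤ 1) (f : ι → ℕ × ℕ) (x : ℕ → ℕ → ℝ) :
    |maxStep 𝒜 h𝒜 f x| ≤ ∑ p, |stepGap x (f p)| := by
  have h0 : ∀ p, stepGap 0 (f p) = 0 := fun p => by simp [stepGap]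
  have h00 : maxStep 𝒜 h𝒜 f 0 = 0 := by simp [maxStep, h0]
  have h1 := maxStep_sub_le (h𝒜 := h𝒜) ha f x 0
  have h2 := maxStep_sub_le (h𝒜 := h𝒜) ha f 0 x
  simp only [h0, h00, sub_zero, zero_sub, abs_neg] at h1 h2
  exact abs_le.2 ⟨by linarith, h1⟩

theorem maxStep_sub_le_rowGap {ι : Type*} [Fintype ι] {𝒜 : Finset (ι → ℝ)} {h𝒜 : 𝒜.Nonempty}
    (ha : ∀ a ∈ 𝒜, ∀ p, |a p| ≤ 1) {f : ι → ℕ × ℕ} (hf : Function.Injective f) {n b : ℕ}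
    (hfn : ∀ p, (f p).1 ≤ n ∧ (f p).2 + b < (f p).1) {P : Finset (ℕ × ℕ)}
    (hP : ∀ p, ∀ r < b, ((f p).1, (f p).2 + r) ∈ P ∧ ((f p).1 - 1, (f p).2 + r) ∈ P) {ε : ℝ}
    {x y : ℕ → ℕ → ℝ} (hx : GTPattern n x) (hy : GTPattern n y)
    (hxε : ∀ p, ∃ k ∈ Finset.Ico (f p).2 ((f p).2 + b), stepGap x ((f p).1, k) ≤ ε)
    (hyε : ∀ p, ∃ k ∈ Finset.Ico (f p).2 ((f p).2 + b), stepGap y ((f p).1, k) ≤ ε) :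
    maxStep 𝒜 h𝒜 f x - maxStep 𝒜 h𝒜 f y ≤
      Fintype.card ι * ε + 2 * b * ∑ p ∈ P, |rowGap x p - rowGap y p| := by
  refine (maxStep_sub_le ha f x y).trans ?_
  have hinj : Function.Injective fun p : ι => ((f p).1 - 1, (f p).2) := fun p q h => by
    have h1 := (hfn p).2
    have h2 := (hfn q).2
    simp only [Prod.mk.injEq] at h
    exact hf (Prod.ext (by omega) h.2)
  have h1 := sum_sum_range_shift_le f hf (fun p r hr => (hP p r hr).1)
    (δ := fun p => |rowGap x p - rowGap y p|) fun _ => abs_nonneg _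
  have h2 := sum_sum_range_shift_le (fun p : ι => ((f p).1 - 1, (f p).2)) hinj
    (fun p r hr => (hP p r hr).2) (δ := fun p => |rowGap x p - rowGap y p|) fun _ => abs_nonneg _
  calc _ ≤ ∑ p, (ε + ∑ r ∈ Finset.range b,
      (|rowGap x ((f p).1, (f p).2 + r) - rowGap y ((f p).1, (f p).2 + r)| +
        |rowGap x ((f p).1 - 1, (f p).2 + r) - rowGap y ((f p).1 - 1, (f p).2 + r)|)) := by
        refine Finset.sum_le_sum fun p _ => abs_le.2 ⟨?_, ?_⟩
        · have := stepGap_sub_le hx (hfn p).1 (hfn p).2 (hyε p)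
          simp_rw [abs_sub_comm (rowGap x _)]
          linarith
        · exact stepGap_sub_le hy (hfn p).1 (hfn p).2 (hxε p)
    _ ≤ _ := by
        simp only [Finset.sum_add_distrib, Finset.sum_const, nsmul_eq_mul, Finset.card_univ]
        linarith

theorem variance_le_of_setLIntegral {Ω : Type*} [MeasurableSpace Ω] {μ : Measure Ω}
    [IsProbabilityMeasure μ] {F : Ω → ℝ} (hF : Measurable F) {A : Set Ω} (hA : MeasurableSet A)
    {c V B δ : ℝ} (hV : 0 ≤ V) (hB : 0 ≤ B) (hδ : 0 ≤ δ) (hδ2 : δ ≤ 1 / 2)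
    (hVA : ∫⁻ ω in A, ENNReal.ofReal ((F ω - c) ^ 2) ∂μ ≤ ENNReal.ofReal V)
    (hB4 : ∫⁻ ω, ENNReal.ofReal (F ω ^ 4) ∂μ ≤ ENNReal.ofReal (B ^ 2))
    (hAδ : μ Aᶜ ≤ ENNReal.ofReal δ) : variance F μ ≤ 5 * V + 10 * B * √δ := by
  have hint4 : Integrable (fun ω => F ω ^ 4) μ :=
    ⟨(hF.pow_const 4).aestronglyMeasurable, by
      rw [hasFiniteIntegral_iff_ofReal (ae_of_all _ fun ω => by positivity)]
      exact hB4.trans_lt ENNReal.ofReal_lt_top⟩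
  have hI4 : ∫ ω, F ω ^ 4 ∂μ ≤ B ^ 2 := by
    rw [integral_eq_lintegral_of_nonneg_ae (ae_of_all _ fun ω => by positivity)
      (hF.pow_const 4).aestronglyMeasurable]
    exact ENNReal.toReal_le_of_le_ofReal (sq_nonneg _) hB4
  have hint2 : Integrable (fun ω => F ω ^ 2) μ :=
    (hint4.add (integrable_const 1)).mono' (hF.pow_const 2).aestronglyMeasurable
      (ae_of_all _ fun ω => by
        rw [Real.norm_eq_abs, abs_of_nonneg (sq_nonneg _)]
        simp only [Pi.add_apply]
        nlinarith [sq_nonneg (F ω ^ 2 - 1)])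
  have hintc : Integrable (fun ω => (F ω - c) ^ 2) μ :=
    ((hint2.const_mul 2).add (integrable_const (2 * c ^ 2))).mono'
      ((hF.sub_const c).pow_const 2).aestronglyMeasurable (ae_of_all _ fun ω => by
        rw [Real.norm_eq_abs, abs_of_nonneg (sq_nonneg _)]
        simp only [Pi.add_apply]
        nlinarith [sq_nonneg (F ω + c)])
  have hIV : ∫ ω in A, (F ω - c) ^ 2 ∂μ ≤ V := by
    rw [integral_eq_lintegral_of_nonneg_ae (ae_of_all _ fun ω => by positivity)
      hintc.aestronglyMeasurable.restrict]
    exact ENNReal.toReal_le_of_le_ofReal hV hVA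
  have hPc : μ.real Aᶜ ≤ δ := ENNReal.toReal_le_of_le_ofReal hδ hAδ
  have hPA : 1 / 2 ≤ μ.real A := by
    have := probReal_compl_eq_one_sub (μ := μ) hA
    linarith
  have hsq : ∀ S : Set Ω, MeasurableSet S → ∀ d : ℝ, 0 ≤ d → μ.real S ≤ d →
      ∫ ω in S, F ω ^ 2 ∂μ ≤ B * √d := by
    intro S hS d hd hSd
    by_contra! hlt
    have h1 : ∀ r : ℝ, 0 < r → ∫ ω in S, F ω ^ 2 ∂μ ≤ 1 / 2 * (r * B ^ 2 + d / r) := fun r hr => by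
      calc ∫ ω in S, F ω ^ 2 ∂μ ≤ ∫ ω in S, (r / 2 * F ω ^ 4 + 1 / (2 * r)) ∂μ := by
            refine integral_mono hint2.restrict
              ((hint4.const_mul _).restrict.add (integrable_const _)) fun ω => ?_
            have : r / 2 * F ω ^ 4 + 1 / (2 * r) - F ω ^ 2 =
                1 / (2 * r) * (r * F ω ^ 2 - 1) ^ 2 := by field_simp; ring
            have h0 : 0 ≤ 1 / (2 * r) * (r * F ω ^ 2 - 1) ^ 2 := by positivity
            simp only
            linarith
        _ = r / 2 * ∫ ω in S, F ω ^ 4 ∂μ + μ.real S * (1 / (2 * r)) := by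
            rw [integral_add (hint4.const_mul _).restrict (integrable_const _),
              integral_const_mul, setIntegral_const, smul_eq_mul]
        _ ≤ r / 2 * B ^ 2 + d * (1 / (2 * r)) := by
            have h2 : ∫ ω in S, F ω ^ 4 ∂μ ≤ B ^ 2 :=
              (setIntegral_le_integral hint4 (ae_of_all _ fun ω => by positivity)).trans hI4
            gcongr
        _ = _ := by field_simp
    set X := ∫ ω in S, F ω ^ 2 ∂μ
    have hX : 0 < X := lt_of_le_of_lt (by positivity) hlt
    have hd2 : √d ^ 2 = d := Real.sq_sqrt hd
    rcases hB.eq_or_lt with hB0 | hB0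
    · rcases hd.eq_or_lt with hd0 | hd0
      · have := h1 1 one_pos
        rw [← hB0, ← hd0] at this
        norm_num at this
        linarith
      · have := h1 (d / X) (by positivity)
        rw [← hB0, div_div_eq_mul_div, mul_div_cancel_left₀ _ hd0.ne'] at this
        norm_num at this
        linarith
    · rcases hd.eq_or_lt with hd0 | hd0
      · have := h1 (X / B ^ 2) (by positivity)
        rw [← hd0, div_mul_cancel₀ _ (by positivity)] at this
        norm_num at this
        linarith
      · have hd' : 0 < √d := Real.sqrt_pos.2 hd0
        have := h1 (√d / B) (by positivity)
        have h3 : √d / B * B ^ 2 + d / (√d / B) = 2 * (B * √d) := by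
          have h4 : d / (√d / B) = √d * B := by
            rw [div_div_eq_mul_div, div_eq_iff hd'.ne']
            linear_combination -B * hd2
          rw [h4]; field_simp; ring
        rw [h3] at this
        linarith
  have hF2 : ∫ ω, F ω ^ 2 ∂μ ≤ B := by
    have := hsq Set.univ MeasurableSet.univ 1 zero_le_one (by simp)
    simpa using this
  have hF2c : ∫ ω in Aᶜ, F ω ^ 2 ∂μ ≤ B * √δ := hsq _ hA.compl δ hδ hPc
  have hc : c ^ 2 ≤ 4 * V + 4 * B := by
    have h1 : μ.real A * c ^ 2 ≤ 2 * V + 2 * B := by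
      calc μ.real A * c ^ 2 = ∫ _ω in A, c ^ 2 ∂μ := by rw [setIntegral_const, smul_eq_mul]
        _ ≤ ∫ ω in A, (2 * (F ω - c) ^ 2 + 2 * F ω ^ 2) ∂μ := by
            refine integral_mono (integrable_const _)
              ((hintc.const_mul 2).restrict.add (hint2.const_mul 2).restrict) fun ω => ?_
            simp only
            nlinarith [sq_nonneg (F ω - c + F ω)]
        _ = 2 * ∫ ω in A, (F ω - c) ^ 2 ∂μ + 2 * ∫ ω in A, F ω ^ 2 ∂μ := by
            rw [integral_add (hintc.const_mul 2).restrict (hint2.const_mul 2).restrict,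
              integral_const_mul, integral_const_mul]
        _ ≤ _ := by
            have := (setIntegral_le_integral (s := A) hint2
              (ae_of_all _ fun ω => sq_nonneg _)).trans hF2
            linarith
    nlinarith [mul_le_mul_of_nonneg_right hPA (sq_nonneg c)]
  have hAc : ∫ ω in Aᶜ, (F ω - c) ^ 2 ∂μ ≤ 2 * (B * √δ) + δ * (2 * c ^ 2) := by
    calc ∫ ω in Aᶜ, (F ω - c) ^ 2 ∂μ ≤ ∫ ω in Aᶜ, (2 * F ω ^ 2 + 2 * c ^ 2) ∂μ := by
          refine integral_mono hintc.restrict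
            ((hint2.const_mul 2).restrict.add (integrable_const _)) fun ω => ?_
          simp only
          nlinarith [sq_nonneg (F ω + c)]
      _ = 2 * ∫ ω in Aᶜ, F ω ^ 2 ∂μ + μ.real Aᶜ * (2 * c ^ 2) := by
          rw [integral_add (hint2.const_mul 2).restrict (integrable_const _),
            integral_const_mul, setIntegral_const, smul_eq_mul]
      _ ≤ _ := by gcongr
  have hvar : variance F μ ≤ ∫ ω, (F ω - c) ^ 2 ∂μ := by
    rw [← variance_sub_const hF.aestronglyMeasurable c]
    exact variance_le_expectation_sq (hF.sub_const c).aestronglyMeasurable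
  rw [← integral_add_compl hA hintc] at hvar
  have hδs : δ ≤ √δ := by
    refine Real.le_sqrt_of_sq_le ?_
    nlinarith
  have hBδ : B * δ ≤ B * √δ := mul_le_mul_of_nonneg_left hδs hB
  nlinarith [mul_le_mul_of_nonneg_left hc hδ, mul_le_mul_of_nonneg_right hδ2 hV]

theorem exists_lintegral_rowGap_pow_le {β : ℝ} (hβ : 0 < β) (p : ℕ) : ∃ C : ℝ, 0 < C ∧
    ∀ n i q : ℕ, i ≤ n → 32 ≤ β ^ 2 * n → β * n ≤ i → β * n ≤ q → β * n + q + 2 ≤ i →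
      ∫⁻ M, ENNReal.ofReal (|rowGap (pattern M) (i, q)| ^ p) ∂gueMeasure n ≤
        ENNReal.ofReal (C * (√n)⁻¹ ^ p) := by
  obtain ⟨C, hC, h⟩ := exists_lintegral_bulk_gap_pow_le hβ p
  refine ⟨C * (√β)⁻¹ ^ p, by positivity, fun n i q hin hn hi hq hqi => ?_⟩
  have hn0 : (0 : ℝ) ≤ n := n.cast_nonneg
  have hqi' : q + 1 < i := by
    have h1 : (q : ℝ) + 2 ≤ i := by nlinarith
    have h2 : q + 2 ≤ i := by exact_mod_cast h1
    omega
  have hin' : (i : ℝ) ≤ n := by exact_mod_cast hin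
  have hβi : β * i ≤ β * n := mul_le_mul_of_nonneg_left hin' hβ.le
  have h1 := h i ⟨q, by omega⟩ ⟨q + 1, hqi'⟩ rfl (by nlinarith) (by simp only; linarith)
    (by push_cast; linarith)
  have hmp := measurePreserving_patternRow hin
  have hm : Measurable fun x : Fin i → ℝ =>
      ENNReal.ofReal ((x ⟨q, by omega⟩ - x ⟨q + 1, hqi'⟩) ^ p) := by fun_prop
  rw [← hmp.lintegral_comp hm] at h1
  calc _ = ∫⁻ M : Matrix (Fin n) (Fin n) ℂ, ENNReal.ofReal
        ((patternRow (pattern M) i ⟨q, by omega⟩ - patternRow (pattern M) i ⟨q + 1, hqi'⟩) ^ p)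
          ∂gueMeasure n := by
        have hanti := hmp.quasiMeasurePreserving.ae (ae_strictAnti_rowLaw i)
        refine lintegral_congr_ae ?_
        filter_upwards [hanti] with M hM
        have h2 : patternRow (pattern M) i ⟨q + 1, hqi'⟩ < patternRow (pattern M) i ⟨q, by omega⟩ :=
          hM (Fin.mk_lt_mk.2 (Nat.lt_succ_self q))
        have h3 : rowGap (pattern M) (i, q) = patternRow (pattern M) i ⟨q, by omega⟩ -
          patternRow (pattern M) i ⟨q + 1, hqi'⟩ := rfl
        rw [h3, abs_of_pos (sub_pos.2 h2)]
    _ ≤ _ := h1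
    _ ≤ _ := by
        refine ENNReal.ofReal_le_ofReal ?_
        rw [mul_assoc, ← mul_pow, ← mul_inv, ← Real.sqrt_mul hβ.le]
        have hpos : 0 < √(β * n) := Real.sqrt_pos.2 (by nlinarith)
        gcongr

theorem exists_measure_stepGap_large_le {β : ℝ} (hβ : 0 < β) : ∃ q₀ : ℝ, 0 < q₀ ∧ q₀ < 1 ∧
    ∀ n i q b e : ℕ, 0 < b → i ≤ n → 32 ≤ β ^ 2 * n → β * n + 1 ≤ i → β * n + 1 ≤ q →
      β * n + q + b + 1 ≤ i → ∀ ε : ℝ, 2 ^ e / (b * √(β * n)) ≤ ε →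
      gueMeasure n {M | ∀ k ∈ Finset.Ico q (q + b), ε < stepGap (pattern M) (i, k)} ≤
        ENNReal.ofReal (q₀ ^ 2 ^ e) := by
  obtain ⟨q₀, h0, h1, h⟩ := exists_measure_large_step_le hβ
  refine ⟨q₀, h0, h1, fun n i q b e hb hin hn hi hq hqi ε hε => ?_⟩
  have hn0 : (0 : ℝ) ≤ n := n.cast_nonneg
  have hβn : 0 < β * n := by nlinarith
  obtain ⟨i, rfl⟩ : ∃ i', i = i' + 1 := ⟨i - 1, by
    have : 0 < (i : ℝ) := by linarith
    have : 0 < i := by exact_mod_cast this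
    omega⟩
  push_cast at hi hqi
  have hqi' : q + b ≤ i := by
    have : (q : ℝ) + b ≤ i := by linarith
    exact_mod_cast this
  have hin' : (i : ℝ) + 1 ≤ n := by exact_mod_cast hin
  have hβi : β * i ≤ β * n := mul_le_mul_of_nonneg_left (by linarith) hβ.le
  set s : Finset (Fin i) := Finset.univ.filter fun j => (j : ℕ) ∈ Finset.Ico q (q + b) with hs
  have hmem : ∀ j, j ∈ s ↔ q ≤ (j : ℕ) ∧ (j : ℕ) < q + b := fun j => by simp [hs]
  have hcard : s.card = b := by
    have : s.card = (Finset.Ico q (q + b)).card := by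
      refine Finset.card_bij (fun j _ => (j : ℕ)) (fun j hj => Finset.mem_Ico.2 ((hmem j).1 hj))
        (fun _ _ _ _ h => Fin.ext h) fun k hk => ?_
      have := Finset.mem_Ico.1 hk
      exact ⟨⟨k, by omega⟩, (hmem _).2 this, rfl⟩
    rw [this, Nat.card_Ico]; omega
  refine (measure_mono ?_).trans (h i n e s (Finset.card_pos.1 (by omega)) (by nlinarith)
    (fun j hj => ?_) (by omega))
  · intro M hM j hj
    have h2 := hM j (Finset.mem_Ico.2 ((hmem j).1 hj))
    simp only [stepGap, Nat.add_sub_cancel] at h2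
    refine lt_of_le_of_lt (le_trans ?_ hε) h2
    rw [hcard]
    have : √(β * n) ≤ √(i : ℝ) := Real.sqrt_le_sqrt (by linarith)
    have hpos : 0 < √(β * n) := Real.sqrt_pos.2 hβn
    have hb' : (0 : ℝ) < b := by exact_mod_cast hb
    gcongr
  · obtain ⟨h3, h4⟩ := (hmem j).1 hj
    have h3' : (q : ℝ) ≤ j := by exact_mod_cast h3
    have h4' : (j : ℝ) + 1 ≤ q + b := by exact_mod_cast h4
    constructor <;> linarith

theorem measure_compl_gapBox_le {n : ℕ} {P : Finset (ℕ × ℕ)} {ℓ C : ℝ} (hℓ : 0 < ℓ) (p : ℕ)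
    (h : ∀ z ∈ P, ∫⁻ M, ENNReal.ofReal (|rowGap (pattern M) z| ^ p) ∂gueMeasure n ≤
      ENNReal.ofReal C) :
    gueMeasure n {M | pattern M ∉ gapBox P ℓ} ≤ ENNReal.ofReal (P.card * (C / ℓ ^ p)) := by
  calc _ ≤ gueMeasure n (⋃ z ∈ P, {M | ℓ < rowGap (pattern M) z}) := by
        refine measure_mono ?_
        intro M hM
        simp only [gapBox, Set.mem_ofPred_eq] at hM
        push Not at hM
        simpa using hM
    _ ≤ ∑ z ∈ P, gueMeasure n {M | ℓ < rowGap (pattern M) z} := measure_biUnion_finset_le _ _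
    _ ≤ ∑ _z ∈ P, ENNReal.ofReal (C / ℓ ^ p) := by
        refine Finset.sum_le_sum fun z hz => ?_
        have hm : Measurable fun x : ℕ → ℕ → ℝ => ENNReal.ofReal (|rowGap x z| ^ p) := by
          have := measurable_rowGap z
          have h2 : Measurable fun x : ℕ → ℕ → ℝ => |rowGap x z| := this.abs
          fun_prop
        have h3 := meas_ge_le_lintegral_div (μ := gueMeasure n)
          (hm.comp (measurable_pattern n)).aemeasurable
          (ε := ENNReal.ofReal (ℓ ^ p)) (by simp [pow_pos hℓ]) ENNReal.ofReal_ne_top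
        calc _ ≤ _ := measure_mono ?_
          _ ≤ _ := h3
          _ ≤ ENNReal.ofReal C / ENNReal.ofReal (ℓ ^ p) := ENNReal.div_le_div_right (h z hz) _
          _ = _ := (ENNReal.ofReal_div_of_pos (pow_pos hℓ p)).symm
        intro M hM
        have hM' : ℓ < rowGap (pattern M) z := hM
        exact ENNReal.ofReal_le_ofReal (pow_le_pow_left₀ hℓ.le (hM'.le.trans (le_abs_self _)) p)
    _ = _ := by
        rw [Finset.sum_const, nsmul_eq_mul, ENNReal.ofReal_mul P.card.cast_nonneg,
          ENNReal.ofReal_natCast]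

theorem lintegral_maxStep_pow_four_le {ι : Type*} [Fintype ι] {𝒜 : Finset (ι → ℝ)}
    {h𝒜 : 𝒜.Nonempty} (ha : ∀ a ∈ 𝒜, ∀ p, |a p| ≤ 1) {f : ι → ℕ × ℕ} {n : ℕ}
    (hfn : ∀ p, (f p).1 ≤ n ∧ (f p).2 + 1 < (f p).1) {C : ℝ}
    (h : ∀ p, ∫⁻ M, ENNReal.ofReal (|rowGap (pattern M) (f p)| ^ 4) ∂gueMeasure n ≤
      ENNReal.ofReal C) :
    ∫⁻ M, ENNReal.ofReal (maxStep 𝒜 h𝒜 f (pattern M) ^ 4) ∂gueMeasure n ≤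
      ENNReal.ofReal (Fintype.card ι ^ 4 * C) := by
  have hm : ∀ p, Measurable fun M : Matrix (Fin n) (Fin n) ℂ =>
      ENNReal.ofReal (|rowGap (pattern M) (f p)| ^ 4) := fun p => by
    have h1 : Measurable fun M : Matrix (Fin n) (Fin n) ℂ => rowGap (pattern M) (f p) :=
      (measurable_rowGap (f p)).comp (measurable_pattern n)
    have h2 : Measurable fun M : Matrix (Fin n) (Fin n) ℂ => |rowGap (pattern M) (f p)| := h1.abs
    fun_prop
  have hN : (0 : ℝ) ≤ Fintype.card ι ^ 3 := by positivity
  calc _ ≤ ∫⁻ M, ENNReal.ofReal (Fintype.card ι ^ 3) *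
        ∑ p, ENNReal.ofReal (|rowGap (pattern M) (f p)| ^ 4) ∂gueMeasure n := by
        refine lintegral_mono_ae ?_
        filter_upwards [ae_gtPattern n] with M hM
        rw [← ENNReal.ofReal_sum_of_nonneg fun _ _ => by positivity, ← ENNReal.ofReal_mul hN]
        refine ENNReal.ofReal_le_ofReal ?_
        have h1 : |maxStep 𝒜 h𝒜 f (pattern M)| ≤ ∑ p, |rowGap (pattern M) (f p)| := by
          refine (abs_maxStep_le ha f _).trans (Finset.sum_le_sum fun p _ => ?_)
          have h2 := hM.stepGap_pos (hfn p).1 (hfn p).2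
          have h3 := hM.stepGap_le_rowGap (hfn p).1 (hfn p).2
          rw [abs_of_pos h2]
          exact h3.trans (le_abs_self _)
        calc maxStep 𝒜 h𝒜 f (pattern M) ^ 4 = |maxStep 𝒜 h𝒜 f (pattern M)| ^ 4 :=
              ((by decide : Even 4).pow_abs _).symm
          _ ≤ (∑ p, |rowGap (pattern M) (f p)|) ^ 4 := pow_le_pow_left₀ (abs_nonneg _) h1 4
          _ ≤ _ := by
            have := pow_sum_le_card_mul_sum_pow (s := Finset.univ)
              (f := fun p => |rowGap (pattern M) (f p)|) (fun _ _ => abs_nonneg _) 3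
            rwa [Finset.card_univ] at this
    _ = ENNReal.ofReal (Fintype.card ι ^ 3) *
        ∑ p, ∫⁻ M, ENNReal.ofReal (|rowGap (pattern M) (f p)| ^ 4) ∂gueMeasure n := by
        rw [lintegral_const_mul _ (Finset.measurable_sum _ fun p _ => hm p),
          lintegral_finsetSum _ fun p _ => hm p]
    _ ≤ ENNReal.ofReal (Fintype.card ι ^ 3) * ∑ _p : ι, ENNReal.ofReal C :=
        mul_le_mul_right (Finset.sum_le_sum fun p _ => h p) _
    _ = _ := by
        rw [Finset.sum_const, nsmul_eq_mul, Finset.card_univ, ← ENNReal.ofReal_natCast,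
          ← ENNReal.ofReal_mul (Nat.cast_nonneg _), ← ENNReal.ofReal_mul hN]
        congr 1; ring

theorem exists_two_pow_near_sqrt {k : ℕ} (hk : 1 ≤ k) : ∃ e : ℕ, (2 ^ e) ^ 2 ≤ k ∧
    k ≤ 4 * (2 ^ e) ^ 2 := by
  have hs : 0 < Nat.sqrt k := Nat.sqrt_pos.2 hk
  have h1 : 2 ^ Nat.log 2 (Nat.sqrt k) ≤ Nat.sqrt k := Nat.pow_log_le_self 2 hs.ne'
  have h2 : Nat.sqrt k < 2 ^ (Nat.log 2 (Nat.sqrt k) + 1) := Nat.lt_pow_succ_log_self one_lt_two _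
  have h3 := Nat.sqrt_le' k
  have h4 := Nat.lt_succ_sqrt' k
  refine ⟨Nat.log 2 (Nat.sqrt k), ?_, ?_⟩
  · exact (Nat.pow_le_pow_left h1 2).trans h3
  · rw [pow_succ] at h2
    have h5 : Nat.sqrt k + 1 ≤ 2 ^ Nat.log 2 (Nat.sqrt k) * 2 := h2
    have h6 := Nat.pow_le_pow_left h5 2
    simp only [Nat.succ_eq_add_one] at h4
    nlinarith

theorem exists_exceptional_bound {q₀ C : ℝ} (hq0 : 0 < q₀) (hq1 : q₀ < 1) (hC : 0 ≤ C) :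
    ∃ K : ℝ, 0 < K ∧ ∀ k m e : ℕ, 1 ≤ k → m ≤ (2 * k) ^ 20 → k ≤ 4 * (2 ^ e) ^ 2 →
      12 * (m : ℝ) ^ 2 * (C / k ^ 42) + Real.exp (-k) + 9 * (m : ℝ) ^ 2 * q₀ ^ 2 ^ e ≤
        K / k ^ 2 := by
  have htend := tendsto_pow_const_mul_const_pow_of_abs_lt_one 84
    (r := q₀) (by rw [abs_of_pos hq0]; exact hq1)
  obtain ⟨T, hT⟩ := htend.bddAbove_range
  have hT' : ∀ x : ℕ, (x : ℝ) ^ 84 * q₀ ^ x ≤ T := fun x => hT ⟨x, rfl⟩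
  have hT0 : 0 ≤ T := le_trans (by positivity) (hT' 1)
  refine ⟨12 * 2 ^ 40 * C + 2 + 9 * 2 ^ 40 * (4 ^ 42 * T), by positivity,
    fun k m e hk hm hke => ?_⟩
  have hk0 : (0 : ℝ) < k := by exact_mod_cast hk
  have hm' : (m : ℝ) ^ 2 ≤ 2 ^ 40 * (k : ℝ) ^ 40 := by
    have h1 : (m : ℝ) ≤ (2 * k) ^ 20 := by exact_mod_cast hm
    calc (m : ℝ) ^ 2 ≤ ((2 * (k : ℝ)) ^ 20) ^ 2 := pow_le_pow_left₀ m.cast_nonneg h1 2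
      _ = _ := by rw [← pow_mul, mul_pow]
  rw [le_div_iff₀ (by positivity), add_mul, add_mul]
  refine add_le_add (add_le_add ?_ ?_) ?_
  · calc 12 * (m : ℝ) ^ 2 * (C / k ^ 42) * k ^ 2
        ≤ 12 * (2 ^ 40 * (k : ℝ) ^ 40) * (C / k ^ 42) * k ^ 2 := by gcongr
      _ = _ := by field_simp
  · have h1 := Real.quadratic_le_exp_of_nonneg hk0.le
    rw [Real.exp_neg, inv_mul_le_iff₀ (Real.exp_pos _)]
    nlinarith
  · have h1 : (k : ℝ) ≤ 4 * ((2 ^ e : ℕ) : ℝ) ^ 2 := by exact_mod_cast hke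
    have h2 := hT' (2 ^ e)
    calc 9 * (m : ℝ) ^ 2 * q₀ ^ 2 ^ e * k ^ 2
        ≤ 9 * (2 ^ 40 * (k : ℝ) ^ 40) * q₀ ^ 2 ^ e * k ^ 2 := by gcongr
      _ = 9 * 2 ^ 40 * ((k : ℝ) ^ 42 * q₀ ^ 2 ^ e) := by ring
      _ ≤ 9 * 2 ^ 40 * ((4 * ((2 ^ e : ℕ) : ℝ) ^ 2) ^ 42 * q₀ ^ 2 ^ e) := by gcongr
      _ = 9 * 2 ^ 40 * (4 ^ 42 * (((2 ^ e : ℕ) : ℝ) ^ 84 * q₀ ^ 2 ^ e)) := by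
          rw [mul_pow, ← pow_mul]; ring
      _ ≤ _ := by gcongr

theorem sq_card_mul_step_le {n m k e : ℕ} {β : ℝ} (hβ : 0 < β) (hn : 0 < n) (hm : 1 ≤ m)
    (hk : 1 ≤ k) (he : (2 ^ e) ^ 2 ≤ k) :
    ((2 * (m : ℝ) + 1) ^ 2 * (2 ^ e / (k * √(β * n)))) ^ 2 ≤ 400 * m ^ 4 / (β * n * k) := by
  have hk0 : (0 : ℝ) < k := by exact_mod_cast hk
  have hn0 : (0 : ℝ) < n := by exact_mod_cast hn
  have hm1 : (1 : ℝ) ≤ m := by exact_mod_cast hm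
  have he' : ((2 : ℝ) ^ e) ^ 2 ≤ k := by exact_mod_cast he
  have hs : √(β * n) ^ 2 = β * n := Real.sq_sqrt (by positivity)
  rw [mul_pow, div_pow, mul_pow, hs, ← pow_mul]
  have h1 : (2 * (m : ℝ) + 1) ^ (2 * 2) ≤ (3 * m) ^ (2 * 2) :=
    pow_le_pow_left₀ (by positivity) (by linarith) _
  calc (2 * (m : ℝ) + 1) ^ (2 * 2) * ((2 ^ e) ^ 2 / (k ^ 2 * (β * n)))
      ≤ (3 * m) ^ (2 * 2) * (k / (k ^ 2 * (β * n))) := by gcongr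
    _ = 81 * m ^ 4 / (β * n * k) := by field_simp; ring
    _ ≤ _ := by gcongr; norm_num

theorem energy_scale_le {n m k : ℕ} {β : ℝ} (hβ : 0 < β) (hβ1 : β ≤ 1) (hn : 0 < n) (hm : 1 ≤ m)
    (hk : 1 ≤ k) (hkm : k ^ 12 ≤ m) {a j : ℝ} (ha0 : 0 ≤ a) (hj0 : 0 ≤ j) (ha : a ≤ 4 * m)
    (hj : j ≤ 3 * m) :
    2 * (k : ℝ) ^ 2 * (a * j) * (2 * (k * (√n)⁻¹) ^ 2 * √j * a * k) ≤
      400 * m ^ 4 / (β * n * k) := by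
  have hk0 : (0 : ℝ) < k := by exact_mod_cast hk
  have hn0 : (0 : ℝ) < n := by exact_mod_cast hn
  have hm0 : (0 : ℝ) < m := by exact_mod_cast hm
  have hs : (√(n : ℝ))⁻¹ ^ 2 = (n : ℝ)⁻¹ := by rw [inv_pow, Real.sq_sqrt hn0.le]
  have hsj : √j ≤ 2 * √(m : ℝ) := by
    rw [show (2 : ℝ) = √4 by rw [show (4 : ℝ) = 2 ^ 2 by norm_num]; simp,
      ← Real.sqrt_mul (by norm_num)]
    exact Real.sqrt_le_sqrt (by linarith)
  have hk6 : (k : ℝ) ^ 6 ≤ √(m : ℝ) := by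
    refine Real.le_sqrt_of_sq_le ?_
    rw [← pow_mul]
    exact_mod_cast hkm
  have hsm : √(m : ℝ) ^ 2 = m := Real.sq_sqrt hm0.le
  rw [mul_pow, hs]
  calc 2 * (k : ℝ) ^ 2 * (a * j) * (2 * (k ^ 2 * (n : ℝ)⁻¹) * √j * a * k)
      ≤ 2 * (k : ℝ) ^ 2 * ((4 * m) * (3 * m)) *
          (2 * (k ^ 2 * (n : ℝ)⁻¹) * (2 * √m) * (4 * m) * k) := by gcongr
    _ = 384 * m ^ 3 * (√m * k ^ 6) / (n * k) := by field_simp; ring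
    _ ≤ 384 * m ^ 3 * (√m * √m) / (n * k) := by gcongr
    _ = 384 * m ^ 4 / (1 * n * k) := by rw [← sq, hsm]; ring
    _ ≤ _ := by gcongr; norm_num

/-- The patch of array positions with lower corner `(i, q)`. -/
def patchAt (i q : ℕ) {m : ℕ} (p : Fin (2 * m + 1) × Fin (2 * m + 1)) : ℕ × ℕ :=
  (i + p.1, q + p.2)

theorem patchAt_injective (i q m : ℕ) :
    Function.Injective (patchAt i q (m := m)) := fun p p' h => by
  simp only [patchAt, Prod.mk.injEq] at h
  exact Prod.ext (Fin.ext (by omega)) (Fin.ext (by omega))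

theorem exists_measure_exceptional_le {β : ℝ} (hβ : 0 < β) : ∃ K : ℝ, 0 < K ∧
    ∀ n m k e i q : ℕ, 1 ≤ k → k ≤ m → m ≤ (2 * k) ^ 20 → k ≤ 4 * (2 ^ e) ^ 2 →
      32 ≤ β ^ 2 * n → i + 2 * m ≤ n → β * n + 2 ≤ i → β * n + 1 ≤ q →
      β * n + q + 2 * m + k + 3 ≤ i → ∀ c T : ℝ,
      gueMeasure n {M | pattern M ∈
        gapBox (Finset.Icc (i - 1) (i + 2 * m) ×ˢ Finset.Ico q (q + 2 * m + k)) (k * (√n)⁻¹) ∧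
        c + T < gapEnergy (Finset.Icc (i - 1) (i + 2 * m) ×ˢ Finset.Ico q (q + 2 * m + k))
          (pattern M)} ≤ ENNReal.ofReal (Real.exp (-k)) →
      gueMeasure n {M | pattern M ∈
          gapBox (Finset.Icc (i - 1) (i + 2 * m) ×ˢ Finset.Ico q (q + 2 * m + k)) (k * (√n)⁻¹) ∧
        gapEnergy (Finset.Icc (i - 1) (i + 2 * m) ×ˢ Finset.Ico q (q + 2 * m + k))
          (pattern M) ≤ c + T ∧
        ∀ p : Fin (2 * m + 1) × Fin (2 * m + 1),
          ∃ l ∈ Finset.Ico (patchAt i q p).2 ((patchAt i q p).2 + k),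
            stepGap (pattern M) ((patchAt i q p).1, l) ≤ 2 ^ e / (k * √(β * n))}ᶜ ≤
        ENNReal.ofReal (K / k ^ 2) := by
  obtain ⟨C, hC, hgap⟩ := exists_lintegral_rowGap_pow_le hβ 42
  obtain ⟨q₀, hq0, hq1, hstep⟩ := exists_measure_stepGap_large_le hβ
  obtain ⟨K, hK, hKle⟩ := exists_exceptional_bound hq0 hq1 hC.le
  refine ⟨K, hK, fun n m k e i q hk hkm hmk hke hn hin hi hq hqi c T hE => ?_⟩
  have hk0 : (0 : ℝ) < k := by exact_mod_cast hk
  have hn0 : (0 : ℝ) < n := by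
    by_contra! h
    nlinarith [sq_nonneg β]
  have hm1 : (1 : ℝ) ≤ m := by exact_mod_cast hk.trans hkm
  have hkm' : (k : ℝ) ≤ m := by exact_mod_cast hkm
  have hi2 : 2 ≤ i := by
    have h1 : (2 : ℝ) ≤ i := by nlinarith
    exact_mod_cast h1
  have hsn : 0 < (√(n : ℝ))⁻¹ := inv_pos.2 (Real.sqrt_pos.2 hn0)
  set P := Finset.Icc (i - 1) (i + 2 * m) ×ˢ Finset.Ico q (q + 2 * m + k) with hP
  set ε : ℝ := 2 ^ e / (k * √(β * n)) with hε
  have hPcard : (P.card : ℝ) ≤ 12 * m ^ 2 := by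
    have h1 : P.card = (2 * m + 2) * (2 * m + k) := by
      rw [hP, Finset.card_product, Nat.card_Icc, Nat.card_Ico]
      congr 1 <;> omega
    rw [h1]
    push_cast
    nlinarith
  have hbox := measure_compl_gapBox_le (n := n) (P := P) (ℓ := k * (√n)⁻¹)
    (C := C * (√n)⁻¹ ^ 42) (by positivity) 42 fun z hz => by
      obtain ⟨h1, h2⟩ := Finset.mem_product.1 hz
      obtain ⟨h3, h4⟩ := Finset.mem_Icc.1 h1
      obtain ⟨h5, h6⟩ := Finset.mem_Ico.1 h2
      have h3' : (i : ℝ) ≤ z.1 + 1 := by exact_mod_cast (by omega : i ≤ z.1 + 1)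
      have h5' : (q : ℝ) ≤ z.2 := by exact_mod_cast h5
      have h6' : (z.2 : ℝ) + 1 ≤ q + 2 * m + k := by exact_mod_cast h6
      exact hgap n z.1 z.2 (by omega) hn (by linarith) (by linarith) (by linarith)
  have hst : ∀ p : Fin (2 * m + 1) × Fin (2 * m + 1), gueMeasure n
      {M | ∀ l ∈ Finset.Ico (patchAt i q p).2 ((patchAt i q p).2 + k),
        ε < stepGap (pattern M) ((patchAt i q p).1, l)} ≤ ENNReal.ofReal (q₀ ^ 2 ^ e) := fun p => by
    have h1 : ((p.2 : ℕ) : ℝ) ≤ 2 * m := by exact_mod_cast (by omega : (p.2 : ℕ) ≤ 2 * m)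
    have h2 : (0 : ℝ) ≤ ((p.1 : ℕ) : ℝ) := Nat.cast_nonneg _
    have h3 : (0 : ℝ) ≤ ((p.2 : ℕ) : ℝ) := Nat.cast_nonneg _
    exact hstep n (patchAt i q p).1 (patchAt i q p).2 k e hk (by simp only [patchAt]; omega) hn
      (by simp only [patchAt]; push_cast; linarith) (by simp only [patchAt]; push_cast; linarith)
      (by simp only [patchAt]; push_cast; linarith) ε le_rfl
  calc _ ≤ gueMeasure n ({M | pattern M ∉ gapBox P (k * (√n)⁻¹)} ∪
        {M | pattern M ∈ gapBox P (k * (√n)⁻¹) ∧ c + T < gapEnergy P (pattern M)} ∪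
        ⋃ p : Fin (2 * m + 1) × Fin (2 * m + 1),
          {M | ∀ l ∈ Finset.Ico (patchAt i q p).2 ((patchAt i q p).2 + k),
            ε < stepGap (pattern M) ((patchAt i q p).1, l)}) := by
        refine measure_mono ?_
        intro M hM
        by_cases h1 : pattern M ∈ gapBox P (k * (√n)⁻¹)
        swap; · exact Or.inl (Or.inl h1)
        by_cases h2 : gapEnergy P (pattern M) ≤ c + T
        swap; · exact Or.inl (Or.inr ⟨h1, not_le.1 h2⟩)
        refine Or.inr (Set.mem_iUnion.2 ?_)
        by_contra h3
        refine hM ⟨h1, h2, fun p => ?_⟩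
        by_contra h4
        push Not at h4
        exact h3 ⟨p, h4⟩
    _ ≤ ENNReal.ofReal (P.card * (C * (√n)⁻¹ ^ 42 / (k * (√n)⁻¹) ^ 42)) +
        ENNReal.ofReal (Real.exp (-k)) +
        ∑ _p : Fin (2 * m + 1) × Fin (2 * m + 1), ENNReal.ofReal (q₀ ^ 2 ^ e) := by
        refine (measure_union_le _ _).trans (add_le_add ((measure_union_le _ _).trans
          (add_le_add hbox hE)) ?_)
        refine (measure_iUnion_le _).trans ?_
        rw [tsum_fintype]
        exact Finset.sum_le_sum fun p _ => hst p
    _ = ENNReal.ofReal (P.card * (C / k ^ 42) + Real.exp (-k) +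
        (2 * m + 1) * (2 * m + 1) * q₀ ^ 2 ^ e) := by
        have h1 : C * (√(n : ℝ))⁻¹ ^ 42 / (k * (√n)⁻¹) ^ 42 = C / k ^ 42 := by
          rw [mul_pow, mul_div_mul_right _ _ (pow_pos hsn 42).ne']
        rw [h1, Finset.sum_const, nsmul_eq_mul, Finset.card_univ, Fintype.card_prod,
          Fintype.card_fin, ← ENNReal.ofReal_natCast, ← ENNReal.ofReal_mul (Nat.cast_nonneg _),
          ← ENNReal.ofReal_add (by positivity) (by positivity),
          ← ENNReal.ofReal_add (by positivity) (by positivity)]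
        push_cast
        rfl
    _ ≤ _ := by
        refine ENNReal.ofReal_le_ofReal (le_trans ?_ (hKle k m e hk hmk hke))
        have h1 : (2 * (m : ℝ) + 1) * (2 * m + 1) ≤ 9 * m ^ 2 := by nlinarith
        gcongr

theorem exists_variance_maxStep_le {β : ℝ} (hβ : 0 < β) (hβ1 : β ≤ 1) : ∃ K : ℝ, 0 < K ∧
    ∃ k₀ : ℕ, ∀ n m k i q : ℕ, k₀ ≤ k → 1 ≤ k → k ^ 20 ≤ m → m ≤ (2 * k) ^ 20 →
      32 ≤ β ^ 2 * n → i + 2 * m ≤ n → β * n + 2 ≤ i → β * n + 1 ≤ q →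
      β * n + q + 2 * m + k + 3 ≤ i →
      ∀ (𝒜 : Finset (Fin (2 * m + 1) × Fin (2 * m + 1) → ℝ)) (h𝒜 : 𝒜.Nonempty),
        (∀ a ∈ 𝒜, ∀ p, |a p| ≤ 1) →
        variance (fun M => maxStep 𝒜 h𝒜 (patchAt i q) (pattern M)) (gueMeasure n) ≤
          K * m ^ 4 / (n * k) := by
  obtain ⟨K₁, hK₁, hexc⟩ := exists_measure_exceptional_le hβ
  obtain ⟨C₄, hC₄, hgap⟩ := exists_lintegral_rowGap_pow_le hβ 4
  refine ⟨5 * (4 * Real.exp 1 ^ 2 * (1 + Real.exp 1) * 400 / β) + 10 * (81 * √C₄) * √K₁,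
    by positivity, ⌈2 * K₁⌉₊, fun n m k i q hk₀ hk hkm hmk hn hin hi hq hqi 𝒜 h𝒜 ha => ?_⟩
  have hk0 : (0 : ℝ) < k := by exact_mod_cast hk
  have hk1 : (1 : ℝ) ≤ k := by exact_mod_cast hk
  have hn0 : (0 : ℝ) < n := by
    by_contra! h
    nlinarith [sq_nonneg β]
  have hnpos : 0 < n := by exact_mod_cast hn0
  have hkm1 : k ≤ m := (Nat.le_self_pow (by norm_num) k).trans hkm
  have hkm12 : k ^ 12 ≤ m := (Nat.pow_le_pow_right hk (by norm_num)).trans hkm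
  have hm1 : 1 ≤ m := hk.trans hkm1
  have hm1' : (1 : ℝ) ≤ m := by exact_mod_cast hm1
  have hkm' : (k : ℝ) ≤ m := by exact_mod_cast hkm1
  have hqi' : q + 2 * m + k + 3 ≤ i := by
    have h1 : (q : ℝ) + 2 * m + k + 3 ≤ i := by nlinarith
    exact_mod_cast h1
  obtain ⟨e, he1, he2⟩ := exists_two_pow_near_sqrt hk
  have hsn : 0 < (√(n : ℝ))⁻¹ := inv_pos.2 (Real.sqrt_pos.2 hn0)
  set I := Finset.Icc (i - 1) (i + 2 * m) with hI
  set J := Finset.Ico q (q + 2 * m + k) with hJ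
  have hIcard : (I.card : ℝ) ≤ 4 * m := by
    have h1 : I.card = 2 * m + 2 := by rw [hI, Nat.card_Icc]; omega
    rw [h1]; push_cast; linarith
  have hJcard : (J.card : ℝ) ≤ 3 * m := by
    have h1 : J.card = 2 * m + k := by rw [hJ, Nat.card_Ico]; omega
    rw [h1]; push_cast; linarith
  have hIne : I.Nonempty := ⟨i, Finset.mem_Icc.2 (by omega)⟩
  have hJne : J.Nonempty := ⟨q, Finset.mem_Ico.2 (by omega)⟩
  have hI0 : (0 : ℝ) < I.card := by exact_mod_cast hIne.card_pos
  have hJ0 : (0 : ℝ) < J.card := by exact_mod_cast hJne.card_pos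
  set ℓ : ℝ := k * (√n)⁻¹ with hℓ
  have hℓ0 : 0 < ℓ := by positivity
  set t : ℝ := (2 * ℓ ^ 2 * √J.card * I.card * k)⁻¹ with ht
  have ht0 : 0 < t := by
    have := Real.sqrt_pos.2 hJ0
    positivity
  obtain ⟨c, hc1, hc2⟩ := exists_gapEnergy_concentration (n := n) hIne hJne
    (fun z hz => by have := Finset.mem_Icc.1 hz; omega)
    (fun z hz l hl => by
      have := Finset.mem_Icc.1 hz
      have := Finset.mem_Ico.1 hl
      omega) hℓ0 hk1 ht
  set ε : ℝ := 2 ^ e / (k * √(β * n)) with hε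
  set A : Set (ℕ → ℕ → ℝ) := {x | x ∈ gapBox (I ×ˢ J) ℓ ∧ gapEnergy (I ×ˢ J) x ≤ c + 1 / t ∧
    ∀ p : Fin (2 * m + 1) × Fin (2 * m + 1),
      ∃ l ∈ Finset.Ico (patchAt i q p).2 ((patchAt i q p).2 + k),
        stepGap x ((patchAt i q p).1, l) ≤ ε} with hA
  have hmA : MeasurableSet A := by
    refine (measurableSet_gapBox _ _).inter ((measurableSet_le (measurable_gapEnergy _)
      measurable_const).inter ?_)
    have h1 : {x : ℕ → ℕ → ℝ | ∀ p : Fin (2 * m + 1) × Fin (2 * m + 1),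
        ∃ l ∈ Finset.Ico (patchAt i q p).2 ((patchAt i q p).2 + k),
          stepGap x ((patchAt i q p).1, l) ≤ ε} = ⋂ p : Fin (2 * m + 1) × Fin (2 * m + 1),
        ⋃ l ∈ Finset.Ico (patchAt i q p).2 ((patchAt i q p).2 + k),
          {x | stepGap x ((patchAt i q p).1, l) ≤ ε} := by
      ext x; simp only [Set.mem_iInter, Set.mem_iUnion, Set.mem_ofPred_eq, exists_prop]
    have h2 : MeasurableSet {x : ℕ → ℕ → ℝ | ∀ p : Fin (2 * m + 1) × Fin (2 * m + 1),
        ∃ l ∈ Finset.Ico (patchAt i q p).2 ((patchAt i q p).2 + k),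
          stepGap x ((patchAt i q p).1, l) ≤ ε} := by
      rw [h1]
      exact MeasurableSet.iInter fun p => Finset.measurableSet_biUnion _ fun l _ =>
        measurableSet_le (measurable_stepGap _) measurable_const
    exact h2
  set R : ℝ := √(400 * m ^ 4 / (β * n * k)) with hR
  have hR2 : R ^ 2 = 400 * m ^ 4 / (β * n * k) := Real.sq_sqrt (by positivity)
  have hR0 : 0 < R := Real.sqrt_pos.2 (by positivity)
  have hcard : (Fintype.card (Fin (2 * m + 1) × Fin (2 * m + 1)) : ℝ) = (2 * m + 1) ^ 2 := by
    rw [Fintype.card_prod, Fintype.card_fin]; push_cast; ring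
  have hmem : ∀ p : Fin (2 * m + 1) × Fin (2 * m + 1), ∀ r < k,
      ((patchAt i q p).1, (patchAt i q p).2 + r) ∈ I ×ˢ J ∧
        ((patchAt i q p).1 - 1, (patchAt i q p).2 + r) ∈ I ×ˢ J := fun p r hr => by
    simp only [patchAt, hI, hJ, Finset.mem_product, Finset.mem_Icc, Finset.mem_Ico]
    omega
  have hfn : ∀ p : Fin (2 * m + 1) × Fin (2 * m + 1),
      (patchAt i q p).1 ≤ n ∧ (patchAt i q p).2 + k < (patchAt i q p).1 := fun p => by
    simp only [patchAt]; omega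
  have hmF := measurable_maxStep 𝒜 h𝒜 (patchAt i q)
  obtain ⟨c', hc'⟩ := exists_setLIntegral_sub_sq_le (n := n) (P := I ×ˢ J) (ℓ := ℓ) (c := c)
    (t := t) (b := k) (D := (2 * (m : ℝ) + 1) ^ 2 * ε) (K := 1 + Real.exp 1) (R := R) hmF hmA ht0
    (by positivity) hR0 (Real.le_sqrt_of_sq_le (sq_card_mul_step_le hβ hnpos hm1 hk he1))
    (by
      have h1 := energy_scale_le hβ hβ1 hnpos hm1 hk hkm12 hI0.le hJ0.le hIcard hJcard
      rw [hR2, Finset.card_product, ht, div_inv_eq_mul]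
      push_cast
      exact h1)
    (fun x hx => hx.1) (fun x hx => hx.2.1)
    (fun x hx y hy hgx hgy => by
      rw [← hcard]
      exact maxStep_sub_le_rowGap ha (patchAt_injective i q m) hfn hmem hgx hgy hx.2.2 hy.2.2) hc2
  have hexc' := hexc n m k e i q hk hkm1 hmk he2 hn hin hi hq hqi c (1 / t) hc1
  have hmp := measurable_pattern n
  have hfour : ∫⁻ M, ENNReal.ofReal (maxStep 𝒜 h𝒜 (patchAt i q) (pattern M) ^ 4) ∂gueMeasure n ≤
      ENNReal.ofReal ((81 * m ^ 4 * √C₄ / n) ^ 2) := by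
    refine (lintegral_maxStep_pow_four_le ha (C := C₄ * (√n)⁻¹ ^ 4)
      (fun p => ⟨(hfn p).1, by have := (hfn p).2; omega⟩) fun p => ?_).trans
      (ENNReal.ofReal_le_ofReal ?_)
    · have h1 : ((p.2 : ℕ) : ℝ) ≤ 2 * m := by exact_mod_cast (by omega : (p.2 : ℕ) ≤ 2 * m)
      have h2 : (0 : ℝ) ≤ ((p.1 : ℕ) : ℝ) := Nat.cast_nonneg _
      have h3 : (0 : ℝ) ≤ ((p.2 : ℕ) : ℝ) := Nat.cast_nonneg _
      exact hgap n (patchAt i q p).1 (patchAt i q p).2 (hfn p).1 hn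
        (by simp only [patchAt]; push_cast; linarith) (by simp only [patchAt]; push_cast; linarith)
        (by simp only [patchAt]; push_cast; linarith)
    · have h1 : (√(n : ℝ))⁻¹ ^ 4 = ((n : ℝ) ^ 2)⁻¹ := by
        rw [inv_pow, show (4 : ℕ) = 2 * 2 by norm_num, pow_mul, Real.sq_sqrt hn0.le]
      have h2 : √C₄ ^ 2 = C₄ := Real.sq_sqrt hC₄.le
      rw [hcard, h1, div_pow, mul_pow, h2, ← div_eq_mul_inv, ← mul_div_assoc]
      have h3 : (2 * (m : ℝ) + 1) ^ 2 ≤ 9 * m ^ 2 := by nlinarith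
      have h4 : ((2 * (m : ℝ) + 1) ^ 2) ^ 4 ≤ (81 * m ^ 4) ^ 2 := by
        calc _ ≤ (9 * (m : ℝ) ^ 2) ^ 4 := pow_le_pow_left₀ (sq_nonneg _) h3 4
          _ = _ := by ring
      gcongr
  have hvar := variance_le_of_setLIntegral (μ := gueMeasure n) (hmF.comp hmp) (hmp hmA) (c := c')
    (V := 4 * Real.exp 1 ^ 2 * (1 + Real.exp 1) * R ^ 2) (B := 81 * m ^ 4 * √C₄ / n)
    (δ := K₁ / k ^ 2) (by positivity) (by positivity) (by positivity)
    (by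
      have h1 : 2 * K₁ ≤ k := (Nat.le_ceil _).trans (by exact_mod_cast hk₀)
      rw [div_le_div_iff₀ (by positivity) (by norm_num)]
      nlinarith)
    (by
      rw [← lintegral_indicator (hmp hmA)]
      exact hc') hfour hexc'
  refine hvar.trans (le_of_eq ?_)
  rw [hR2, Real.sqrt_div hK₁.le, Real.sqrt_sq hk0.le]
  field_simp

theorem minorEig_eq_pattern {n : ℕ} (σ : ℝ) (M : Matrix (Fin n) (Fin n) ℂ) (i : ℕ) {j : ℕ}
    (hj : 1 ≤ j) : minorEig σ M i j = √(σ ^ 2 * n) * pattern M i (j - 1) := by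
  by_cases h : j ≤ i ∧ i ≤ n
  · have h1 : j - 1 < i ∧ i ≤ n := by omega
    rw [minorEig, dif_pos ⟨hj, h.1, h.2⟩, pattern, dif_pos h1]
    rfl
  · have h1 : ¬ (j - 1 < i ∧ i ≤ n) := by omega
    have h2 : ¬ (1 ≤ j ∧ j ≤ i ∧ i ≤ n) := by omega
    rw [minorEig, dif_neg h2, pattern, dif_neg h1, mul_zero]

theorem patchGap_eq_stepGap {n m i q : ℕ} {σ i0 j0 : ℝ} (hi : ⌈i0 * n⌉ = i + m)
    (hq : ⌈j0 * n⌉ = q + 1 + m) (p : Fin (2 * m + 1) × Fin (2 * m + 1))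
    (M : Matrix (Fin n) (Fin n) ℂ) :
    patchGap σ i0 j0 m p M = √(σ ^ 2 * n) * stepGap (pattern M) (patchAt i q p) := by
  have h1 : (patchIdx i0 j0 n m p).1 = i + p.1 := by simp only [patchIdx]; omega
  have h2 : (patchIdx i0 j0 n m p).2 = q + p.2 + 1 := by simp only [patchIdx]; omega
  rw [patchGap, minorEig_eq_pattern _ _ _ (by omega), minorEig_eq_pattern _ _ _ (by omega), h1, h2,
    ← mul_sub]
  rfl

theorem variance_sup_patchGap {n m i q : ℕ} {σ i0 j0 : ℝ} (hi : ⌈i0 * n⌉ = i + m)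
    (hq : ⌈j0 * n⌉ = q + 1 + m) (𝒜 : Finset (Fin (2 * m + 1) × Fin (2 * m + 1) → ℝ))
    (h𝒜 : 𝒜.Nonempty) :
    variance (fun M => 𝒜.sup' h𝒜 (fun a => ∑ p, a p * patchGap σ i0 j0 m p M)) (gueMeasure n) =
      σ ^ 2 * n * variance (fun M => maxStep 𝒜 h𝒜 (patchAt i q) (pattern M)) (gueMeasure n) := by
  have h : (fun M => 𝒜.sup' h𝒜 (fun a => ∑ p, a p * patchGap σ i0 j0 m p M)) =
      fun M : Matrix (Fin n) (Fin n) ℂ =>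
        √(σ ^ 2 * n) * maxStep 𝒜 h𝒜 (patchAt i q) (pattern M) := by
    ext M
    have hmono : ∀ x y : ℝ, √(σ ^ 2 * n) * (x ⊔ y) = √(σ ^ 2 * n) * x ⊔ √(σ ^ 2 * n) * y :=
      fun x y => mul_max_of_nonneg _ _ (Real.sqrt_nonneg _)
    rw [maxStep, Finset.apply_sup'_eq_sup'_comp h𝒜 (fun x : ℝ => √(σ ^ 2 * n) * x) hmono]
    congr 1
    ext a
    simp only [Function.comp, patchGap_eq_stepGap hi hq, Finset.mul_sum]
    exact Finset.sum_congr rfl fun p _ => by ring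
  rw [h, variance_const_mul, Real.sq_sqrt (by positivity)]

theorem eventually_exists_root_scale (C : ℝ) (k₀ : ℕ) : ∀ᶠ m : ℕ in Filter.atTop, ∃ k : ℕ,
    k₀ ≤ k ∧ 1 ≤ k ∧ k ^ 20 ≤ m ∧ m ≤ (2 * k) ^ 20 ∧ 0 < Real.log m ^ C ∧
      Real.log m ^ C ≤ 2 * k := by
  have h1 : ∀ᶠ x : ℝ in Filter.atTop, Real.log x ^ C ≤ x ^ (1 / 20 : ℝ) := by
    have := (isLittleO_log_rpow_rpow_atTop C (by norm_num : (0 : ℝ) < 1 / 20)).bound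
      (zero_lt_one' ℝ)
    filter_upwards [this, Filter.eventually_ge_atTop 0] with x hx hx0
    rw [one_mul, Real.norm_of_nonneg (Real.rpow_nonneg hx0 _)] at hx
    exact (le_abs_self _).trans hx
  have h2 : Filter.Tendsto (fun x : ℝ => x ^ (1 / 20 : ℝ)) Filter.atTop Filter.atTop :=
    tendsto_rpow_atTop (by norm_num)
  have hcast := tendsto_natCast_atTop_atTop (R := ℝ)
  filter_upwards [hcast.eventually h1, hcast.eventually (h2.eventually_ge_atTop (k₀ + 1)),
    Filter.eventually_ge_atTop 2] with m hm1 hm2 hm3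
  have hm0 : (0 : ℝ) ≤ m := m.cast_nonneg
  set r : ℝ := (m : ℝ) ^ (1 / 20 : ℝ) with hr
  have hr20 : r ^ 20 = m := by
    rw [hr, ← Real.rpow_natCast, ← Real.rpow_mul hm0]; norm_num
  have hr0 : 0 ≤ r := Real.rpow_nonneg hm0 _
  have hk0 : k₀ + 1 ≤ ⌊r⌋₊ := Nat.le_floor (by exact_mod_cast hm2)
  have hk1 : (1 : ℝ) ≤ ⌊r⌋₊ := by exact_mod_cast (by omega : 1 ≤ ⌊r⌋₊)
  have hlt := Nat.lt_floor_add_one r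
  have hle := Nat.floor_le hr0
  refine ⟨⌊r⌋₊, by omega, by omega, ?_, ?_, ?_, by linarith⟩
  · have : ((⌊r⌋₊ : ℝ)) ^ 20 ≤ m := by rw [← hr20]; exact pow_le_pow_left₀ (by positivity) hle 20
    exact_mod_cast this
  · have : (m : ℝ) ≤ (2 * (⌊r⌋₊ : ℝ)) ^ 20 := by
      rw [← hr20]; exact pow_le_pow_left₀ hr0 (by linarith) 20
    exact_mod_cast this
  · exact Real.rpow_pos_of_pos (Real.log_pos (by exact_mod_cast (by omega : 1 < m))) C

/-- Fix `σ > 0`, `0 < j₀ < i₀ < 1`, `C > 0` and a sequence `m(n) → ∞` with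
`m(n)/n → 0`.  Then there are `C'' > 0` and `n₀`, not depending on the family `𝒜`, such that
for all `n > n₀` and every finite nonempty family `𝒜` of vectors `a` with `‖a‖_∞ ≤ 1`,
`Var( max_{a ∈ 𝒜} ∑_{(i,j) ∈ P_n} a_{ij} (λ_{i,j} − λ_{i−1,j}) ) ≤ C'' m⁴ / (log m)^C`. -/
theorem variance_max_gap_functionals (σ i0 j0 : ℝ) (hσ : 0 < σ)
    (hj0 : 0 < j0) (hij : j0 < i0) (hi0 : i0 < 1)
    (C : ℝ) (hC : 0 < C)
    (m : ℕ → ℕ) (hm : Filter.Tendsto m Filter.atTop Filter.atTop)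
    (hmn : Filter.Tendsto (fun n => (m n : ℝ) / n) Filter.atTop (nhds 0)) :
    ∃ (C'' : ℝ) (n0 : ℕ), 0 < C'' ∧ ∀ n : ℕ, n0 < n →
      ∀ (𝒜 : Finset ((Fin (2 * m n + 1) × Fin (2 * m n + 1)) → ℝ)) (h𝒜 : 𝒜.Nonempty),
        (∀ a ∈ 𝒜, ∀ p, |a p| ≤ 1) →
        variance
            (fun M => 𝒜.sup' h𝒜 (fun a => ∑ p, a p * patchGap σ i0 j0 (m n) p M))
            (gueMeasure n)
          ≤ C'' * (m n : ℝ) ^ 4 / Real.log (m n) ^ C := by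
  obtain ⟨β, hβ, hβj, hβij, hβi⟩ : ∃ β : ℝ, 0 < β ∧ 8 * β ≤ j0 ∧ 8 * β ≤ i0 - j0 ∧
      8 * β ≤ 1 - i0 := by
    refine ⟨min j0 (min (i0 - j0) (1 - i0)) / 8, ?_, ?_, ?_, ?_⟩
    · have h1 : 0 < i0 - j0 := by linarith
      have h2 : 0 < 1 - i0 := by linarith
      positivity
    · linarith [min_le_left j0 (min (i0 - j0) (1 - i0))]
    · linarith [min_le_right j0 (min (i0 - j0) (1 - i0)), min_le_left (i0 - j0) (1 - i0)]
    · linarith [min_le_right j0 (min (i0 - j0) (1 - i0)), min_le_right (i0 - j0) (1 - i0)]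
  have hβ1 : β ≤ 1 := by linarith
  obtain ⟨K, hK, k₀, hmain⟩ := exists_variance_maxStep_le hβ hβ1
  have hev : ∀ᶠ n : ℕ in Filter.atTop, 32 ≤ β ^ 2 * n ∧ (m n : ℝ) ≤ β * n ∧ ∃ k : ℕ,
      k₀ ≤ k ∧ 1 ≤ k ∧ k ^ 20 ≤ m n ∧ m n ≤ (2 * k) ^ 20 ∧ 0 < Real.log (m n) ^ C ∧
        Real.log (m n) ^ C ≤ 2 * k := by
    have h1 : Filter.Tendsto (fun n : ℕ => β ^ 2 * (n : ℝ)) Filter.atTop Filter.atTop :=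
      tendsto_natCast_atTop_atTop.const_mul_atTop (by positivity)
    filter_upwards [h1.eventually_ge_atTop 32, hmn.eventually (gt_mem_nhds hβ),
      Filter.eventually_gt_atTop 0, hm.eventually (eventually_exists_root_scale C k₀)]
      with n hn hmn' hn0 hk
    refine ⟨hn, ?_, hk⟩
    rw [div_lt_iff₀ (by exact_mod_cast hn0)] at hmn'
    exact hmn'.le
  obtain ⟨n0, hn0⟩ := Filter.eventually_atTop.1 hev
  refine ⟨2 * (σ ^ 2 * K), n0, by positivity, fun n hn 𝒜 h𝒜 ha => ?_⟩
  obtain ⟨hnβ, hmβ, k, hk₀, hk1, hkm, hmk, hlog0, hlogk⟩ := hn0 n hn.le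
  have hnpos : (0 : ℝ) < n := by
    by_contra! h
    nlinarith [sq_nonneg β]
  have hβn : 32 ≤ β * n := by nlinarith
  have hkm1 : (k : ℝ) ≤ m n := by
    exact_mod_cast (Nat.le_self_pow (by norm_num) k).trans hkm
  have hk0 : (0 : ℝ) < k := by exact_mod_cast hk1
  have hi1 := Int.le_ceil (i0 * n)
  have hi2 := Int.ceil_lt_add_one (i0 * n)
  have hj1 := Int.le_ceil (j0 * n)
  have hj2 := Int.ceil_lt_add_one (j0 * n)
  have hjn : 8 * (β * n) ≤ j0 * n := by nlinarith
  have hijn : 8 * (β * n) + j0 * n ≤ i0 * n := by nlinarith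
  have hin : 8 * (β * n) + i0 * n ≤ n := by nlinarith
  obtain ⟨i, hi⟩ : ∃ i : ℕ, ⌈i0 * n⌉ = i + m n := by
    have h1 : (m n : ℝ) ≤ (⌈i0 * n⌉ : ℝ) := by linarith
    have h2 : (m n : ℤ) ≤ ⌈i0 * n⌉ := by exact_mod_cast h1
    exact ⟨(⌈i0 * n⌉ - m n).toNat, by omega⟩
  obtain ⟨q, hq⟩ : ∃ q : ℕ, ⌈j0 * n⌉ = q + 1 + m n := by
    have h1 : (m n : ℝ) + 1 ≤ (⌈j0 * n⌉ : ℝ) := by linarith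
    have h2 : (m n : ℤ) + 1 ≤ ⌈j0 * n⌉ := by exact_mod_cast h1
    exact ⟨(⌈j0 * n⌉ - m n - 1).toNat, by omega⟩
  rw [hi] at hi1 hi2
  rw [hq] at hj1 hj2
  push_cast at hi1 hi2 hj1 hj2
  have hin' : i + 2 * m n ≤ n := by
    have h1 : (i : ℝ) + 2 * m n ≤ n := by linarith
    exact_mod_cast h1
  have hvar := hmain n (m n) k i q hk₀ hk1 hkm hmk hnβ hin' (by linarith) (by linarith)
    (by linarith) 𝒜 h𝒜 ha
  rw [variance_sup_patchGap hi hq]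
  calc σ ^ 2 * n * variance (fun M => maxStep 𝒜 h𝒜 (patchAt i q) (pattern M)) (gueMeasure n)
      ≤ σ ^ 2 * n * (K * m n ^ 4 / (n * k)) := by gcongr
    _ = 2 * (σ ^ 2 * K) * m n ^ 4 / (2 * k) := by field_simp
    _ ≤ _ := by gcongr
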